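/- Let 2 < c < 37/18 and set δ = c/2 − 1 + η. Then for every real x with τ ≤ |x| ≤ K one has S(x) ≪ X^{1−δ}, where the implied constant depends only on c and η. -/

import Mathlib

open MeasureTheory

noncomputable def e (t : ℝ) : ℂ := Complex.exp (2 * Real.pi * Complex.I * t)

/-- The exponential sum `S(x) = Σ_{X/2 < p ≤ X} (log p) e(p^c x)` over primes. -/
noncomputable def S (X c : ℝ) (x : ℝ) : ℂ :=
  ∑ p ∈ (Finset.range (⌈X⌉₊ + 1)).filter
      (fun p : ℕ => p.Prime ∧ X / 2 < (p : ℝ) ∧ (p : ℝ) ≤ X),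
    (Real.log p : ℂ) * e ((p : ℝ) ^ c * x)

lemma e_add (a b : ℝ) : e (a + b) = e a * e b := by
  unfold e; rw [← Complex.exp_add]; push_cast; ring_nf

lemma e_zero : e 0 = 1 := by simp [e]

lemma e_norm (a : ℝ) : ‖e a‖ = 1 := by
  unfold e
  have : (2 * Real.pi * Complex.I * a : ℂ) = ((2 * Real.pi * a : ℝ) : ℂ) * Complex.I := by
    push_cast; ring
  rw [this, Complex.norm_exp_ofReal_mul_I]

lemma e_neg (a : ℝ) : e (-a) = (starRingEnd ℂ) (e a) := by
  unfold e
  rw [← Complex.exp_conj]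
  congr 1
  simp only [map_mul, Complex.conj_ofReal, Complex.conj_I, map_ofNat]
  push_cast; ring

lemma e_sub (a b : ℝ) : e (a - b) = e a * (starRingEnd ℂ) (e b) := by
  rw [sub_eq_add_neg, e_add, e_neg]

lemma e_int (k : ℤ) : e k = 1 := by
  unfold e
  rw [Complex.exp_eq_one_iff]
  exact ⟨k, by push_cast; ring⟩

lemma e_sub_int (a : ℝ) (k : ℤ) : e (a - k) = e a := by
  rw [e_sub, e_int]; simp

lemma e_nat (k : ℕ) : e k = 1 := by simpa using e_int k

/-- `1/(e(g)-1) = -1/2 - (i/2) cot (π g)` -/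
lemma inv_e_sub_one (g : ℝ) (hs : Real.sin (Real.pi * g) ≠ 0) :
    (-1/2 - Complex.I / 2 * ((Real.cos (Real.pi * g) / Real.sin (Real.pi * g) : ℝ) : ℂ)) * (e g - 1) = 1 := by
  have h1 : e g = Complex.exp (((Real.pi * g : ℝ) : ℂ) * Complex.I) ^ 2 := by
    unfold e; rw [← Complex.exp_nat_mul]; congr 1; push_cast; ring
  have hs' : (Real.sin (Real.pi * g) : ℂ) ≠ 0 := by exact_mod_cast hs
  rw [h1, Complex.exp_mul_I, ← Complex.ofReal_cos, ← Complex.ofReal_sin]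
  have h3 : ((Real.sin (Real.pi * g) : ℝ) : ℂ) ^ 2 + ((Real.cos (Real.pi * g) : ℝ) : ℂ) ^ 2 = 1 := by
    exact_mod_cast Real.sin_sq_add_cos_sq (Real.pi * g)
  set s := ((Real.sin (Real.pi * g) : ℝ) : ℂ)
  set k := ((Real.cos (Real.pi * g) : ℝ) : ℂ)
  rw [Complex.ofReal_div]
  change (-1/2 - Complex.I / 2 * (k / s)) * ((k + s * Complex.I) ^ 2 - 1) = 1
  field_simp
  have hI : Complex.I ^ 2 = -1 := Complex.I_sq
  have hI3 : Complex.I ^ 3 = -Complex.I := by rw [pow_succ, hI]; ring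
  ring_nf
  rw [hI, hI3]
  linear_combination (s - Complex.I * k) * h3

lemma cot_bound {θ g : ℝ} (h0 : 0 < θ) (h1 : θ ≤ g) (h2 : g ≤ 1 - θ) :
    0 < Real.sin (Real.pi * g) ∧ |Real.cos (Real.pi * g) / Real.sin (Real.pi * g)| ≤ 1 / (2 * θ) := by
  have hpi := Real.pi_pos
  have key : 2 * θ ≤ Real.sin (Real.pi * g) := by
    rcases le_total g (1/2) with h | h
    · have := Real.mul_le_sin (x := Real.pi * g) (by nlinarith) (by nlinarith)
      have h3 : 2 / Real.pi * (Real.pi * g) = 2 * g := by field_simp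
      linarith
    · have := Real.mul_le_sin (x := Real.pi * (1 - g)) (by nlinarith) (by nlinarith)
      have h3 : 2 / Real.pi * (Real.pi * (1-g)) = 2 * (1-g) := by field_simp
      have h4 : Real.sin (Real.pi * (1-g)) = Real.sin (Real.pi * g) := by
        rw [mul_sub, mul_one, Real.sin_pi_sub]
      linarith
  have hpos : 0 < Real.sin (Real.pi * g) := by linarith
  refine ⟨hpos, ?_⟩
  rw [abs_div, abs_of_pos hpos]
  exact div_le_div₀ (by norm_num) (Real.abs_cos_le_one _) (by linarith) key

lemma cot_anti {g g' : ℝ} (h0 : 0 < g) (h1 : g ≤ g') (h2 : g' < 1) :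
    Real.cos (Real.pi * g') / Real.sin (Real.pi * g') ≤ Real.cos (Real.pi * g) / Real.sin (Real.pi * g) := by
  have hpi := Real.pi_pos
  have s1 : 0 < Real.sin (Real.pi * g) := Real.sin_pos_of_pos_of_lt_pi (by positivity) (by nlinarith)
  have s2 : 0 < Real.sin (Real.pi * g') := Real.sin_pos_of_pos_of_lt_pi (by nlinarith) (by nlinarith)
  rw [div_le_div_iff₀ s2 s1]
  have : 0 ≤ Real.sin (Real.pi * g' - Real.pi * g) :=
    Real.sin_nonneg_of_nonneg_of_le_pi (by nlinarith) (by nlinarith)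
  rw [Real.sin_sub] at this
  linarith

/-- Kusmin–Landau (discrete). -/
lemma kusmin_landau0 (f : ℕ → ℝ) (a b : ℕ) (θ : ℝ) (h0 : 0 < θ)
    (hm : ∀ n, a ≤ n → n + 1 < b → f (n+1) - f n ≤ f (n+2) - f (n+1))
    (hl : ∀ n, a ≤ n → n < b → θ ≤ f (n+1) - f n ∧ f (n+1) - f n ≤ 1 - θ) :
    ‖∑ n ∈ Finset.Ico a b, e (f n)‖ ≤ 3 / θ := by
  rcases le_or_gt b a with hab | hab
  · rw [Finset.Ico_eq_empty (by omega)]; simp; positivity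
  set ct : ℕ → ℝ := fun n => Real.cos (Real.pi * (f (n+1) - f n)) / Real.sin (Real.pi * (f (n+1) - f n)) with hct
  set w : ℕ → ℂ := fun n => (-1/2 - Complex.I / 2 * ((ct n : ℝ) : ℂ)) with hw
  have hcb : ∀ n, a ≤ n → n < b → |ct n| ≤ 1 / (2*θ) := fun n h1 h2 =>
    (cot_bound h0 (hl n h1 h2).1 (hl n h1 h2).2).2
  have hθ : θ ≤ 1/2 := by have := hl a le_rfl hab; linarith
  have hwb : ∀ n, a ≤ n → n < b → ‖w n‖ ≤ 3/4 / θ := by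
    intro n h1 h2
    have := hcb n h1 h2
    calc ‖w n‖ ≤ ‖(-1/2:ℂ)‖ + ‖Complex.I / 2 * ((ct n : ℝ) : ℂ)‖ := norm_sub_le _ _
      _ = 1/2 + 1/2 * |ct n| := by
        simp
      _ ≤ 1/2 + 1/2 * (1/(2*θ)) := by gcongr
      _ ≤ 3/4/θ := by
        have : (1:ℝ)/2 ≤ 1/2 * (1/(2*θ))*2 := by
          rw [show (1:ℝ)/2 * (1/(2*θ))*2 = (1/2)/θ by field_simp]
          rw [le_div_iff₀ h0]; linarith
        have e2 : (3:ℝ)/4/θ = 1/2 * (1/(2*θ))*2 + 1/2 * (1/(2*θ)) := by field_simp; norm_num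
        linarith
  have hterm : ∀ n, a ≤ n → n < b → e (f n) = w n * (e (f (n+1)) - e (f n)) := by
    intro n h1 h2
    have hs := (cot_bound h0 (hl n h1 h2).1 (hl n h1 h2).2).1
    have := inv_e_sub_one (f (n+1) - f n) hs.ne'
    have h3 : e (f (n+1)) = e (f (n+1) - f n) * e (f n) := by rw [← e_add]; ring_nf
    rw [h3]
    calc e (f n) = 1 * e (f n) := by ring
      _ = _ := by rw [← this]; simp only [hw, hct]; ring
  -- induction claim
  have claim : ∀ k, a + k < b →
      ‖∑ n ∈ Finset.Ico a (a+k+1), e (f n) - w (a+k) * e (f (a+k+1))‖ ≤ 3/4/θ + (ct a - ct (a+k)) / 2 := by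
    intro k
    induction k with
    | zero =>
      intro hk
      simp only [add_zero, sub_self, zero_div]
      rw [Nat.Ico_succ_singleton, Finset.sum_singleton]
      have := hterm a le_rfl hab
      have h4 : e (f a) - w a * e (f (a+1)) = - (w a * e (f a)) := by
        nth_rewrite 1 [this]; ring
      rw [h4, norm_neg, norm_mul, e_norm, mul_one]
      exact hwb a le_rfl hab
    | succ k ih =>
      intro hk
      have ih := ih (by omega)
      rw [show a + (k+1) + 1 = (a + k + 1) + 1 by ring, Finset.sum_Ico_succ_top (by omega)]
      have h5 := hterm (a+k+1) (by omega) (by omega)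
      have h6 : ∑ n ∈ Finset.Ico a (a+k+1), e (f n) + e (f (a+k+1)) - w (a+(k+1)) * e (f (a+k+1+1))
         = (∑ n ∈ Finset.Ico a (a+k+1), e (f n) - w (a+k) * e (f (a+k+1))) + (w (a+k) - w (a+k+1)) * e (f (a+k+1)) := by
        rw [show a + (k+1) = a + k + 1 by ring]
        linear_combination h5
      rw [h6]
      refine (norm_add_le _ _).trans ?_
      have h7 : w (a+k) - w (a+k+1) = Complex.I/2 * ((ct (a+k+1) - ct (a+k) : ℝ) : ℂ) := by
        simp only [hw]; push_cast; ring
      have hanti : ct (a+k+1) ≤ ct (a+k) := by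
        have b1 := hl (a+k) (by omega) (by omega)
        have b2 := hl (a+k+1) (by omega) (by omega)
        exact cot_anti (by linarith) (hm (a+k) (by omega) (by omega)) (by linarith)
      rw [h7, norm_mul, e_norm, mul_one, norm_mul, Complex.norm_real, Real.norm_eq_abs, abs_of_nonpos (by linarith)]
      have : ‖Complex.I/2‖ = 1/2 := by simp
      rw [this, show a + (k+1) = a+k+1 by ring]
      linarith
  have hfin := claim (b - 1 - a) (by omega)
  have e1 : a + (b-1-a) + 1 = b := by omega
  have e2 : a + (b-1-a) = b - 1 := by omega
  rw [e1, e2] at hfin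
  have c1 := abs_le.mp (hcb a le_rfl hab)
  have c2 := abs_le.mp (hcb (b-1) (by omega) (by omega))
  have h8 : ‖w (b-1) * e (f b)‖ ≤ 3/4/θ := by
    rw [norm_mul, e_norm, mul_one]; exact hwb _ (by omega) (by omega)
  have h9 := norm_sub_norm_le (∑ n ∈ Finset.Ico a b, e (f n)) (w (b-1) * e (f b))
  have h10 : (1:ℝ)/(2*θ) = 1/2/θ := by field_simp
  have h11 : (3:ℝ)/θ = 3/4/θ + 3/4/θ + 3 * (1/2/θ) := by field_simp; norm_num
  have : 0 < 1/2/θ := by positivity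
  linarith

lemma kusmin_landau (f : ℕ → ℝ) (a b : ℕ) (θ : ℝ) (k : ℤ) (h0 : 0 < θ)
    (hm : ∀ n, a ≤ n → n + 1 < b → f (n+1) - f n ≤ f (n+2) - f (n+1))
    (hl : ∀ n, a ≤ n → n < b → k + θ ≤ f (n+1) - f n ∧ f (n+1) - f n ≤ k + 1 - θ) :
    ‖∑ n ∈ Finset.Ico a b, e (f n)‖ ≤ 3 / θ := by
  have := kusmin_landau0 (fun n => f n - k * n) a b θ h0
    (fun n h1 h2 => by have := hm n h1 h2; push_cast; linarith)
    (fun n h1 h2 => by have := hl n h1 h2; push_cast; constructor <;> linarith)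
  convert this using 3 with n hn
  have := e_sub_int (f n) (k * n)
  push_cast at this
  exact this.symm

lemma ordc_Ico (s : Finset ℕ) (hs : ∀ x ∈ s, ∀ y ∈ s, ∀ z, x ≤ z → z ≤ y → z ∈ s) :
    ∃ a b, s = Finset.Ico a b := by
  rcases s.eq_empty_or_nonempty with h | h
  · exact ⟨0, 0, by simp [h]⟩
  · refine ⟨s.min' h, s.max' h + 1, ?_⟩
    ext z
    rw [Finset.mem_Ico]
    constructor
    · intro hz
      exact ⟨s.min'_le z hz, Nat.lt_succ_of_le (s.le_max' z hz)⟩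
    · rintro ⟨h1, h2⟩
      exact hs _ (s.min'_mem h) _ (s.max'_mem h) z h1 (by omega)

lemma sdt_pos (f : ℕ → ℝ) (a b : ℕ) (l h : ℝ) (hl0 : 0 < l) (hh : 1 ≤ h)
    (hl : ∀ n, a ≤ n → n + 1 < b → l ≤ f (n+2) - 2 * f (n+1) + f n ∧ f (n+2) - 2 * f (n+1) + f n ≤ h * l) :
    ‖∑ n ∈ Finset.Ico a b, e (f n)‖ ≤ 12 * h * (((b - a : ℕ) : ℝ) * √l + 1 / √l) := by
  set N := b - a with hN
  have hsl : 0 < √l := Real.sqrt_pos.mpr hl0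
  have hsq : √l * √l = l := Real.mul_self_sqrt hl0.le
  have triv : ‖∑ n ∈ Finset.Ico a b, e (f n)‖ ≤ N := by
    refine (norm_sum_le _ _).trans ?_
    simp [e_norm, hN]
  rcases le_or_gt b a with hab | hab
  · rw [Finset.Ico_eq_empty (by omega)]; simp; positivity
  rcases le_or_gt (1/2) √l with hbig | hsmall
  · refine triv.trans ?_
    have h1 : 0 < 1 / √l := by positivity
    have h2 : (N:ℝ) ≤ 2 * (N * √l) := by nlinarith only [Nat.cast_nonneg (α := ℝ) N, hbig]
    have h3 : 0 ≤ N * √l + 1/√l := by positivity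
    nlinarith only [hh, h1, h2]
  set g : ℕ → ℝ := fun n => f (n+1) - f n with hg
  have hstep : ∀ j n, a ≤ n → n + j < b → g n + j * l ≤ g (n+j) ∧ g (n+j) ≤ g n + j * (h * l) := by
    intro j
    induction j with
    | zero => intro n _ _; simp
    | succ j ih =>
      intro n h1 h2
      have h3 := ih n h1 (by omega)
      have h4 := hl (n+j) (by omega) (by omega)
      have h5 : g (n+(j+1)) = g (n+j) + (f (n+j+2) - 2 * f (n+j+1) + f (n+j)) := by
        simp only [hg]; rw [show n + (j+1) = n+j+1 by ring]; ring_nf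
      rw [h5]; push_cast; constructor <;> linarith only [h3.1, h3.2, h4.1, h4.2, h3, h4]
  have hmono : ∀ m n, a ≤ m → m ≤ n → n < b → g m ≤ g n := by
    intro m n h1 h2 h3
    have := (hstep (n-m) m h1 (by omega)).1
    rw [show m + (n-m) = n by omega] at this
    have : 0 ≤ ((n-m:ℕ):ℝ) * l := by positivity
    linarith
  -- card bound
  have hcard : ∀ (u v : ℝ) (p : ℕ → Prop) [DecidablePred p], (∀ n, p n → u ≤ g n ∧ g n ≤ v) →
      (∀ x y z, a ≤ x → x ≤ z → z ≤ y → y < b → p x → p y → p z) → u ≤ v →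
      (((Finset.Ico a b).filter p).card : ℝ) ≤ (v - u) / l + 1 := by
    intro u v p _ hp hoc huv
    obtain ⟨a', b', hs⟩ := ordc_Ico ((Finset.Ico a b).filter p) (by
      intro x hx y hy z h1 h2
      simp only [Finset.mem_filter, Finset.mem_Ico] at *
      exact ⟨⟨by omega, by omega⟩, hoc x y z hx.1.1 h1 h2 hy.1.2 hx.2 hy.2⟩)
    rw [hs]
    rcases le_or_gt b' a' with h1 | h1
    · rw [Finset.Ico_eq_empty (by omega)]
      have : 0 ≤ (v-u)/l := div_nonneg (by linarith) hl0.le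
      simp; linarith
    · have m1 : a' ∈ (Finset.Ico a b).filter p := by rw [hs]; simp [h1]
      have m2 : b' - 1 ∈ (Finset.Ico a b).filter p := by rw [hs]; simp; omega
      simp only [Finset.mem_filter, Finset.mem_Ico] at m1 m2
      have h2 := (hstep (b'-1-a') a' m1.1.1 (by omega)).1
      rw [show a' + (b'-1-a') = b'-1 by omega] at h2
      have h3 := hp _ m1.2
      have h4 := hp _ m2.2
      have h5 : ((b'-1-a' : ℕ):ℝ) ≤ (v-u)/l := by
        rw [le_div_iff₀ hl0]; linarith only [h2, h3, h4]
      have h6 : (Finset.Ico a' b').card = (b'-1-a') + 1 := by simp; omega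
      rw [h6]; push_cast; linarith only [h5]
  set t := √l with ht
  have hfib : ∀ k : ℤ, ‖∑ n ∈ (Finset.Ico a b).filter (fun n => ⌊g n⌋ = k), e (f n)‖ ≤ 6 / t := by
    intro k
    classical
    set s := (Finset.Ico a b).filter (fun n => ⌊g n⌋ = k) with hs
    have hpart : ∑ n ∈ s, e (f n) = ∑ n ∈ (Finset.Ico a b).filter (fun n => ⌊g n⌋ = k ∧ g n < k + t), e (f n)
       + (∑ n ∈ (Finset.Ico a b).filter (fun n => ⌊g n⌋ = k ∧ (k + t ≤ g n ∧ g n ≤ k + 1 - t)), e (f n)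
       + ∑ n ∈ (Finset.Ico a b).filter (fun n => ⌊g n⌋ = k ∧ (k + t ≤ g n ∧ k + 1 - t < g n)), e (f n)) := by
      rw [hs, ← Finset.sum_filter_add_sum_filter_not _ (fun n => g n < k + t), Finset.filter_filter, Finset.filter_filter]
      congr 1
      rw [← Finset.sum_filter_add_sum_filter_not _ (fun n => g n ≤ k + 1 - t), Finset.filter_filter, Finset.filter_filter]
      simp only [not_lt, not_le, and_assoc]
    have fl : ∀ n, ⌊g n⌋ = k → (k:ℝ) ≤ g n ∧ g n ≤ k + 1 := by
      intro n h; rw [← h]; exact ⟨Int.floor_le _, (Int.lt_floor_add_one _).le⟩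
    have flc : ∀ x y z, a ≤ x → x ≤ z → z ≤ y → y < b → ⌊g x⌋ = k → ⌊g y⌋ = k → ⌊g z⌋ = k := by
      intro x y z h1 h2 h3 h4 h5 h6
      have := Int.floor_mono (hmono x z h1 h2 (by omega))
      have := Int.floor_mono (hmono z y (by omega) h3 h4)
      omega
    have nb : ∀ s : Finset ℕ, ‖∑ n ∈ s, e (f n)‖ ≤ s.card := by
      intro s; refine (norm_sum_le _ _).trans ?_; simp [e_norm]
    have c1 := hcard k (k+t) (fun n => ⌊g n⌋ = k ∧ g n < k + t)
      (fun n hn => ⟨(fl n hn.1).1, hn.2.le⟩)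
      (fun x y z h1 h2 h3 h4 h5 h6 => ⟨flc x y z h1 h2 h3 h4 h5.1 h6.1,
        lt_of_le_of_lt (hmono z y (by omega) h3 h4) h6.2⟩) (by linarith)
    have c3 := hcard (k+1-t) (k+1) (fun n => ⌊g n⌋ = k ∧ (k + t ≤ g n ∧ k + 1 - t < g n))
      (fun n hn => ⟨hn.2.2.le, (fl n hn.1).2⟩)
      (fun x y z h1 h2 h3 h4 h5 h6 => ⟨flc x y z h1 h2 h3 h4 h5.1 h6.1,
        h5.2.1.trans (hmono x z h1 h2 (by omega)), lt_of_lt_of_le h5.2.2 (hmono x z h1 h2 (by omega))⟩) (by linarith)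
    have c2 : ‖∑ n ∈ (Finset.Ico a b).filter (fun n => ⌊g n⌋ = k ∧ (k + t ≤ g n ∧ g n ≤ k + 1 - t)), e (f n)‖ ≤ 3 / t := by
      obtain ⟨a', b', hs⟩ := ordc_Ico ((Finset.Ico a b).filter (fun n => ⌊g n⌋ = k ∧ (k + t ≤ g n ∧ g n ≤ k + 1 - t))) (by
        intro x hx y hy z h1 h2
        simp only [Finset.mem_filter, Finset.mem_Ico] at *
        exact ⟨⟨by omega, by omega⟩, flc x y z hx.1.1 h1 h2 hy.1.2 hx.2.1 hy.2.1,
          hx.2.2.1.trans (hmono x z hx.1.1 h1 (by omega)), (hmono z y (by omega) h2 hy.1.2).trans hy.2.2.2⟩)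
      have mem : ∀ n, a' ≤ n → n < b' → a ≤ n ∧ n < b ∧ (k + t ≤ g n ∧ g n ≤ k + 1 - t) := by
        intro n h1 h2
        have : n ∈ (Finset.Ico a b).filter (fun n => ⌊g n⌋ = k ∧ (k + t ≤ g n ∧ g n ≤ k + 1 - t)) := by
          rw [hs]; simp [h1, h2]
        simp only [Finset.mem_filter, Finset.mem_Ico] at this
        exact ⟨this.1.1, this.1.2, this.2.2⟩
      rw [hs]
      refine kusmin_landau f a' b' t k hsl ?_ ?_
      · intro n h1 h2
        have m1 := mem n h1 (by omega)
        have m2 := mem (n+1) (by omega) h2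
        exact hmono n (n+1) m1.1 (by omega) m2.2.1
      · intro n h1 h2
        exact (mem n h1 h2).2.2
    rw [hpart]
    refine (norm_add_le _ _).trans ?_
    have h1 := nb ((Finset.Ico a b).filter (fun n => ⌊g n⌋ = k ∧ g n < k + t))
    have h3 := nb ((Finset.Ico a b).filter (fun n => ⌊g n⌋ = k ∧ (k + t ≤ g n ∧ k + 1 - t < g n)))
    have h4 := norm_add_le (∑ n ∈ (Finset.Ico a b).filter (fun n => ⌊g n⌋ = k ∧ (k + t ≤ g n ∧ g n ≤ k + 1 - t)), e (f n))
       (∑ n ∈ (Finset.Ico a b).filter (fun n => ⌊g n⌋ = k ∧ (k + t ≤ g n ∧ k + 1 - t < g n)), e (f n))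
    have e1 : ((k:ℝ) + t - k) / l = 1 / t := by
      rw [← hsq]; field_simp; ring
    have e2 : ((k:ℝ) + 1 - (k + 1 - t)) / l = 1 / t := by
      rw [← hsq]; field_simp; ring
    rw [e1] at c1
    rw [e2] at c3
    have e3 : (2:ℝ) ≤ 1 / t := by rw [le_div_iff₀ hsl]; linarith only [hsmall]
    have e4 : (6:ℝ)/t = 6 * (1/t) := by ring
    have e5 : (3:ℝ)/t = 3 * (1/t) := by ring
    rw [e4]; rw [e5] at c2
    linarith only [c1, c3, c2, h1, h3, h4, e3]
  have hmaps : ∀ n ∈ Finset.Ico a b, ⌊g n⌋ ∈ Finset.Icc ⌊g a⌋ ⌊g (b-1)⌋ := by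
    intro n hn
    rw [Finset.mem_Ico] at hn
    rw [Finset.mem_Icc]
    exact ⟨Int.floor_mono (hmono a n le_rfl hn.1 hn.2), Int.floor_mono (hmono n (b-1) hn.1 (by omega) (by omega))⟩
  rw [← Finset.sum_fiberwise_of_maps_to hmaps]
  refine (norm_sum_le _ _).trans ?_
  refine (Finset.sum_le_card_nsmul _ _ _ (fun k _ => hfib k)).trans ?_
  rw [nsmul_eq_mul, Int.card_Icc]
  have h7 := (hstep (b-1-a) a le_rfl (by omega)).2
  rw [show a + (b-1-a) = b-1 by omega] at h7
  have h8 : ((b-1-a:ℕ):ℝ) ≤ N := by exact_mod_cast (by omega)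
  have h9 : ((⌊g (b-1)⌋ + 1 - ⌊g a⌋).toNat : ℝ) ≤ N * (h*l) + 2 := by
    have p1 : 0 ≤ ⌊g (b-1)⌋ + 1 - ⌊g a⌋ := by
      have := Int.floor_mono (hmono a (b-1) le_rfl (by omega) (by omega)); omega
    have p2 : ((⌊g (b-1)⌋ + 1 - ⌊g a⌋).toNat : ℝ) = ((⌊g (b-1)⌋ + 1 - ⌊g a⌋ : ℤ) : ℝ) := by
      rw [← Int.cast_natCast, Int.toNat_of_nonneg p1]
    rw [p2]; push_cast
    have := Int.floor_le (g (b-1))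
    have := Int.lt_floor_add_one (g a)
    have : ((b-1-a:ℕ):ℝ) * (h*l) ≤ N * (h*l) := by gcongr
    linarith
  calc _ ≤ (N * (h*l) + 2) * (6/t) := by gcongr
    _ = 6 * h * (N * t) + 12 * (1/t) := by
      rw [← hsq]; field_simp; ring
    _ ≤ 12 * h * (N * t + 1/t) := by
      have : 0 ≤ N * t := by positivity
      have : 0 ≤ 1/t := by positivity
      have q1 : 12 * (1/t) ≤ 12 * h * (1/t) := by gcongr; linarith
      have q2 : 6 * h * (N*t) ≤ 12 * h * (N * t) := by gcongr; norm_num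
      linarith only [q1, q2]

lemma norm_sum_e_neg {ι : Type*} (s : Finset ι) (f : ι → ℝ) :
    ‖∑ n ∈ s, e (-f n)‖ = ‖∑ n ∈ s, e (f n)‖ := by
  simp only [e_neg]
  rw [← map_sum, RCLike.norm_conj]

/-- discrete second derivative test -/
lemma sdt (f : ℕ → ℝ) (a b : ℕ) (l h : ℝ) (hl0 : 0 < l) (hh : 1 ≤ h)
    (hl : (∀ n, a ≤ n → n + 1 < b → l ≤ f (n+2) - 2 * f (n+1) + f n ∧ f (n+2) - 2 * f (n+1) + f n ≤ h * l) ∨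
      (∀ n, a ≤ n → n + 1 < b → l ≤ -(f (n+2) - 2 * f (n+1) + f n) ∧ -(f (n+2) - 2 * f (n+1) + f n) ≤ h * l)) :
    ‖∑ n ∈ Finset.Ico a b, e (f n)‖ ≤ 12 * h * (((b - a : ℕ) : ℝ) * √l + 1 / √l) := by
  rcases hl with hl | hl
  · exact sdt_pos f a b l h hl0 hh hl
  · rw [← norm_sum_e_neg]
    refine sdt_pos (fun n => - f n) a b l h hl0 hh ?_
    intro n h1 h2
    have := hl n h1 h2
    constructor <;> linarith

lemma shift_sum (f : ℕ → ℂ) (A N Q q : ℕ) (hA : Q ≤ A) (hq : q ≤ Q)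
    (hf : ∀ n, f n ≠ 0 → A ≤ n ∧ n < A + N) :
    ∑ k ∈ Finset.Ico (A - Q) (A + N), f (k + q) = ∑ k ∈ Finset.Ico A (A + N), f k := by
  rw [Finset.sum_Ico_add']
  symm
  apply Finset.sum_subset
  · intro x hx; rw [Finset.mem_Ico] at *; omega
  · intro x _ hx
    by_contra h
    exact hx (by rw [Finset.mem_Ico]; exact hf x h)

/-- van der Corput inequality, family version -/
lemma vdc {ι : Type*} (Y : Finset ι) (z : ι → ℕ → ℂ) (A N Q : ℕ) (hQ : 1 ≤ Q) (hA : Q ≤ A) (hN : Q ≤ N)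
    (hz : ∀ y n, z y n ≠ 0 → A ≤ n ∧ n < A + N) :
    ∑ y ∈ Y, ‖∑ n ∈ Finset.Ico A (A + N), z y n‖ ^ 2 ≤
      (2 * N / Q : ℝ) * (∑ y ∈ Y, ∑ n ∈ Finset.Ico A (A + N), ‖z y n‖ ^ 2 +
        2 * ∑ q ∈ Finset.Ico 1 Q, ‖∑ y ∈ Y, ∑ n ∈ Finset.Ico A (A + N), z y (n + q) * (starRingEnd ℂ) (z y n)‖) := by
  set T := Finset.Ico (A - Q) (A + N) with hT
  set rho : ℕ → ℝ := fun q => ‖∑ y ∈ Y, ∑ n ∈ Finset.Ico A (A + N), z y (n + q) * (starRingEnd ℂ) (z y n)‖ with hrho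
  have hQ0 : (0:ℝ) < Q := by exact_mod_cast hQ
  have hTc : (T.card : ℝ) ≤ 2 * N := by
    have : T.card ≤ 2 * N := by rw [hT, Nat.card_Ico]; omega
    exact_mod_cast this
  -- step 1
  have h1 : ∀ y, (Q:ℝ)^2 * ‖∑ n ∈ Finset.Ico A (A + N), z y n‖ ^ 2 ≤
      2 * N * ∑ k ∈ T, ‖∑ q ∈ Finset.range Q, z y (k + q)‖ ^ 2 := by
    intro y
    have e1 : (Q:ℂ) * ∑ n ∈ Finset.Ico A (A + N), z y n = ∑ k ∈ T, ∑ q ∈ Finset.range Q, z y (k + q) := by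
      rw [Finset.sum_comm]
      rw [Finset.sum_congr rfl (fun q hq => shift_sum (z y) A N Q q hA (Finset.mem_range.mp hq).le (hz y))]
      simp
    have e2 : (Q:ℝ) * ‖∑ n ∈ Finset.Ico A (A + N), z y n‖ ≤ ∑ k ∈ T, ‖∑ q ∈ Finset.range Q, z y (k + q)‖ := by
      have := congrArg norm e1
      rw [norm_mul, Complex.norm_natCast] at this
      rw [this]; exact norm_sum_le _ _
    calc (Q:ℝ)^2 * ‖∑ n ∈ Finset.Ico A (A + N), z y n‖ ^ 2 = ((Q:ℝ) * ‖∑ n ∈ Finset.Ico A (A + N), z y n‖)^2 := by ring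
      _ ≤ (∑ k ∈ T, ‖∑ q ∈ Finset.range Q, z y (k + q)‖)^2 := by gcongr
      _ ≤ T.card * ∑ k ∈ T, ‖∑ q ∈ Finset.range Q, z y (k + q)‖ ^ 2 := sq_sum_le_card_mul_sum_sq
      _ ≤ _ := by
        refine mul_le_mul_of_nonneg_right hTc ?_
        positivity
  -- step 2
  set R : ℕ → ℕ → ℂ := fun q q' => ∑ y ∈ Y, ∑ k ∈ T, z y (k + q) * (starRingEnd ℂ) (z y (k + q')) with hR
  have hRle : ∀ q q', q' ≤ q → q < Q → ‖R q q'‖ = rho (q - q') := by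
    intro q q' h h'
    simp only [hR, hrho]
    congr 2
    ext y
    rw [← shift_sum (fun n => z y (n + (q - q')) * (starRingEnd ℂ) (z y n)) A N Q q' hA (by omega)]
    · apply Finset.sum_congr rfl
      intro k _
      rw [show k + q' + (q - q') = k + q by omega]
    · intro n hn
      apply hz y
      intro h0; apply hn; simp [h0]
  have hRsymm : ∀ q q', ‖R q q'‖ = ‖R q' q‖ := by
    intro q q'
    rw [← RCLike.norm_conj (R q' q)]
    simp only [hR, map_sum, map_mul, Complex.conj_conj]
    congr 1
    refine Finset.sum_congr rfl (fun y _ => Finset.sum_congr rfl (fun k _ => ?_))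
    ring
  have h2 : ∑ y ∈ Y, ∑ k ∈ T, ‖∑ q ∈ Finset.range Q, z y (k + q)‖ ^ 2 ≤
      ∑ q ∈ Finset.range Q, ∑ q' ∈ Finset.range Q, ‖R q q'‖ := by
    have e1 : ((∑ y ∈ Y, ∑ k ∈ T, ‖∑ q ∈ Finset.range Q, z y (k + q)‖ ^ 2 : ℝ) : ℂ) =
        ∑ q ∈ Finset.range Q, ∑ q' ∈ Finset.range Q, R q q' := by
      push_cast
      have : ∀ y k, ((‖∑ q ∈ Finset.range Q, z y (k + q)‖ : ℂ)) ^ 2 = ∑ q ∈ Finset.range Q, ∑ q' ∈ Finset.range Q,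
          z y (k + q) * (starRingEnd ℂ) (z y (k + q')) := by
        intro y k
        rw [← Complex.mul_conj', map_sum, Finset.sum_mul_sum]
      simp only [this, hR]
      rw [Finset.sum_congr rfl (fun y _ => Finset.sum_comm)]
      rw [Finset.sum_comm]
      refine Finset.sum_congr rfl (fun q _ => ?_)
      rw [Finset.sum_congr rfl (fun y _ => Finset.sum_comm)]
      rw [Finset.sum_comm]
    have e2 := congrArg norm e1
    rw [Complex.norm_real, Real.norm_eq_abs, abs_of_nonneg (by positivity)] at e2
    rw [e2]
    exact (norm_sum_le _ _).trans (Finset.sum_le_sum (fun q _ => norm_sum_le _ _))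
  have h3 : ∀ q ∈ Finset.range Q, ∑ q' ∈ Finset.range Q, ‖R q q'‖ ≤ rho 0 + 2 * ∑ d ∈ Finset.Ico 1 Q, rho d := by
    intro q hq
    rw [Finset.mem_range] at hq
    have hrn : ∀ d, 0 ≤ rho d := fun d => norm_nonneg _
    rw [← Finset.sum_range_add_sum_Ico _ (show q + 1 ≤ Q by omega)]
    have p1 : ∑ q' ∈ Finset.range (q+1), ‖R q q'‖ ≤ rho 0 + ∑ d ∈ Finset.Ico 1 Q, rho d := by
      have : ∑ q' ∈ Finset.range (q+1), ‖R q q'‖ = ∑ d ∈ Finset.range (q+1), rho d := by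
        rw [← Finset.sum_range_reflect]
        refine Finset.sum_congr rfl (fun d hd => ?_)
        rw [Finset.mem_range] at hd
        rw [hRle q _ (by omega) hq]; congr 1; omega
      rw [this, Finset.range_eq_Ico, Finset.sum_eq_sum_Ico_succ_bot (by omega)]
      gcongr
      omega
    have p2 : ∑ q' ∈ Finset.Ico (q+1) Q, ‖R q q'‖ ≤ ∑ d ∈ Finset.Ico 1 Q, rho d := by
      have : ∑ q' ∈ Finset.Ico (q+1) Q, ‖R q q'‖ = ∑ d ∈ Finset.Ico 1 (Q - q), rho d := by
        have := Finset.sum_Ico_add' (fun q' => ‖R q q'‖) 1 (Q - q) q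
        rw [show 1 + q = q + 1 by ring, show Q - q + q = Q by omega] at this
        rw [← this]
        refine Finset.sum_congr rfl (fun d hd => ?_)
        rw [Finset.mem_Ico] at hd
        rw [hRsymm, hRle _ _ (by omega) (by omega)]; congr 1; omega
      rw [this]
      apply Finset.sum_le_sum_of_subset_of_nonneg
      · intro x hx; rw [Finset.mem_Ico] at *; omega
      · intro _ _ _; exact hrn _
    linarith
  have h4 : rho 0 ≤ ∑ y ∈ Y, ∑ n ∈ Finset.Ico A (A + N), ‖z y n‖ ^ 2 := by
    simp only [hrho]
    refine (norm_sum_le _ _).trans (Finset.sum_le_sum (fun y _ => (norm_sum_le _ _).trans (Finset.sum_le_sum (fun n _ => ?_))))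
    rw [norm_mul, RCLike.norm_conj, add_zero, sq]
  have h5 : (Q:ℝ)^2 * ∑ y ∈ Y, ‖∑ n ∈ Finset.Ico A (A + N), z y n‖ ^ 2 ≤ 2 * N * (Q * (rho 0 + 2 * ∑ d ∈ Finset.Ico 1 Q, rho d)) := by
    rw [Finset.mul_sum]
    refine (Finset.sum_le_sum (fun y _ => h1 y)).trans ?_
    rw [← Finset.mul_sum]
    refine mul_le_mul_of_nonneg_left ?_ (by positivity)
    refine h2.trans ((Finset.sum_le_sum h3).trans ?_)
    rw [Finset.sum_const, Finset.card_range, nsmul_eq_mul]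
  rw [show (2 * N / Q : ℝ) = 2 * N * Q / Q ^ 2 by field_simp, div_mul_eq_mul_div, le_div_iff₀ (by positivity)]
  calc _ = (Q:ℝ)^2 * ∑ y ∈ Y, ‖∑ n ∈ Finset.Ico A (A + N), z y n‖ ^ 2 := by ring
    _ ≤ _ := h5
    _ = 2 * N * Q * (rho 0 + 2 * ∑ d ∈ Finset.Ico 1 Q, rho d) := by ring
    _ ≤ _ := by gcongr

/-- iterated differences -/
def Dl : List ℝ → (ℝ → ℝ) → ℝ → ℝ
  | [], f, t => f t
  | h :: l, f, t => Dl l f (t + h) - Dl l f t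

noncomputable def cf : ℕ → ℝ → ℝ
  | 0, _ => 1
  | k + 1, s => s * cf k (s - 1)

lemma Dl_deriv (l : List ℝ) (hl : ∀ h ∈ l, 0 ≤ h) (s t : ℝ) (ht : 0 < t) :
    HasDerivAt (Dl l (fun u => u ^ s)) (s * Dl l (fun u => u ^ (s - 1)) t) t := by
  induction l generalizing t with
  | nil =>
    simp only [Dl]
    exact Real.hasDerivAt_rpow_const (Or.inl ht.ne')
  | cons h l ih =>
    have hh : 0 ≤ h := hl h (by simp)
    have ih' := ih (fun x hx => hl x (by simp [hx]))
    have h1 := (ih' (t + h) (by linarith)).comp_add_const t h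
    have h2 := ih' t ht
    have := h1.sub h2
    simp only [Dl]
    rw [mul_sub]
    exact this

lemma Dl_mvt (l : List ℝ) (hl : ∀ h ∈ l, 0 < h) (s t : ℝ) (ht : 0 < t) :
    ∃ ξ, t ≤ ξ ∧ ξ ≤ t + l.sum ∧ Dl l (fun u => u ^ s) t = l.prod * cf l.length s * ξ ^ (s - l.length) := by
  induction l generalizing t s with
  | nil => exact ⟨t, le_rfl, by simp, by simp [Dl, cf]⟩
  | cons h l ih =>
    have hh : 0 < h := hl h (by simp)
    have hl' : ∀ x ∈ l, 0 < x := fun x hx => hl x (by simp [hx])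
    obtain ⟨u, hu, hu2⟩ := exists_hasDerivAt_eq_slope (Dl l (fun u => u ^ s))
      (fun t => s * Dl l (fun u => u ^ (s - 1)) t) (show t < t + h by linarith)
      (fun x hx => (Dl_deriv l (fun x hx => (hl' x hx).le) s x (by linarith [hx.1])).continuousAt.continuousWithinAt)
      (fun x hx => Dl_deriv l (fun x hx => (hl' x hx).le) s x (by linarith [hx.1]))
    obtain ⟨ξ, h1, h2, h3⟩ := ih hl' (s-1) u (by linarith [hu.1])
    refine ⟨ξ, by linarith [hu.1], ?_, ?_⟩
    · simp only [List.sum_cons]; linarith [hu.2]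
    · simp only [Dl, List.prod_cons, List.length_cons, cf]
      have : Dl l (fun u => u ^ s) (t + h) - Dl l (fun u => u ^ s) t = h * (s * Dl l (fun u => u ^ (s - 1)) u) := by
        rw [hu2, show t + h - t = h by ring]; field_simp
      rw [this, h3]
      push_cast
      rw [show s - ((l.length:ℝ) + 1) = s - 1 - l.length by ring]
      ring

lemma rpow_between {p N t : ℝ} (hN : 0 < N) (h1 : N ≤ t) (h2 : t ≤ 4 * N) :
    4 ^ (-|p|) * N ^ p ≤ t ^ p ∧ t ^ p ≤ 4 ^ |p| * N ^ p := by
  have ht : 0 < t := by linarith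
  have e : t = (t / N) * N := by field_simp
  have r1 : 1 ≤ t / N := by rw [le_div_iff₀ hN]; linarith
  have r2 : t / N ≤ 4 := by rw [div_le_iff₀ hN]; linarith
  rw [e, Real.mul_rpow (by positivity) hN.le]
  have hp : 0 < N ^ p := by positivity
  constructor
  · gcongr
    rcases le_total 0 p with h | h
    · calc (4:ℝ) ^ (-|p|) ≤ 1 := Real.rpow_le_one_of_one_le_of_nonpos (by norm_num) (by simp)
        _ ≤ _ := Real.one_le_rpow r1 h
    · rw [abs_of_nonpos h, neg_neg]
      exact Real.rpow_le_rpow_of_nonpos (by positivity) r2 h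
  · gcongr
    rcases le_total 0 p with h | h
    · rw [abs_of_nonneg h]; exact Real.rpow_le_rpow (by positivity) r2 h
    · calc _ ≤ (1:ℝ) := Real.rpow_le_one_of_one_le_of_nonpos r1 h
        _ ≤ _ := Real.one_le_rpow (by norm_num) (by simp)

/-- two sided bound for the iterated differences; sign is that of `cf`. -/
lemma Dl_bound (l : List ℝ) (hl : ∀ h ∈ l, 0 < h) (s N t : ℝ) (hN : 0 < N) (h1 : N ≤ t) (h2 : t + l.sum ≤ 4 * N) :
    ∃ v, 4 ^ (-|s - l.length|) * (l.prod * N ^ (s - l.length)) ≤ v ∧ v ≤ 4 ^ |s - l.length| * (l.prod * N ^ (s - l.length)) ∧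
      Dl l (fun u => u ^ s) t = cf l.length s * v := by
  obtain ⟨ξ, a1, a2, a3⟩ := Dl_mvt l hl s t (by linarith)
  obtain ⟨b1, b2⟩ := rpow_between (p := s - l.length) hN (h1.trans a1) (a2.trans h2)
  have hp : 0 < l.prod := List.prod_pos hl
  refine ⟨l.prod * ξ ^ (s - l.length), ?_, ?_, ?_⟩
  · calc _ = l.prod * (4 ^ (-|s - l.length|) * N ^ (s - l.length)) := by ring
      _ ≤ _ := by gcongr
  · calc _ ≤ l.prod * (4 ^ (|s - l.length|) * N ^ (s - l.length)) := by gcongr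
      _ = _ := by ring
  · rw [a3]; ring

/-- second derivative test for `y * Dl l (m^c)` -/
lemma sdtD (c : ℝ) (k : ℕ) (hcf : cf (k+2) c ≠ 0) : ∃ C > 0, ∀ (l : List ℝ) (y : ℝ) (M a b : ℕ), l.length = k →
    (∀ h ∈ l, 0 < h) → y ≠ 0 → 1 ≤ M → M ≤ a → b ≤ 2 * M → (b:ℝ) + 1 + l.sum ≤ 4 * M →
    ‖∑ m ∈ Finset.Ico a b, e (y * Dl l (fun u => u ^ c) m)‖ ≤
      C * (M * √(|y| * l.prod * (M:ℝ) ^ (c - k - 2)) + 1 / √(|y| * l.prod * (M:ℝ) ^ (c - k - 2))) := by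
  set E : ℝ := 4 ^ |c - (k+2 : ℕ)| with hE
  have hE1 : 1 ≤ E := Real.one_le_rpow (by norm_num) (abs_nonneg _)
  set κ := |cf (k+2) c| with hκ
  have hκ0 : 0 < κ := abs_pos.mpr hcf
  set μ := κ * E⁻¹ with hμ
  have hμ0 : 0 < μ := by positivity
  refine ⟨12 * E^2 * (√μ + 1/√μ), by positivity, ?_⟩
  intro l y M a b hlen hl hy hM ha hb hsum
  have hM0 : (0:ℝ) < M := by exact_mod_cast hM
  set lam := |y| * l.prod * (M:ℝ) ^ (c - k - 2) with hlam
  have hlp : 0 < l.prod := List.prod_pos hl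
  have hlam0 : 0 < lam := by have := abs_pos.mpr hy; positivity
  have key : ∀ n, a ≤ n → n + 1 < b → ∃ v, E⁻¹ * lam ≤ v ∧ v ≤ E * lam ∧
     (y * Dl l (fun u => u ^ c) ((n+2:ℕ):ℝ) - 2 * (y * Dl l (fun u => u ^ c) ((n+1:ℕ):ℝ)) + y * Dl l (fun u => u ^ c) n) =
     (SignType.sign y : ℝ) * cf (k+2) c * v := by
    intro n h1 h2
    have hn1 : (M:ℝ) ≤ n := by exact_mod_cast ha.trans h1
    have hn2 : (n:ℝ) + 1 + 1 ≤ b := by exact_mod_cast h2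
    obtain ⟨v, v1, v2, v3⟩ := Dl_bound (1 :: 1 :: l) (by
      intro h hh; simp at hh; rcases hh with rfl | hh
      · norm_num
      · exact hl h hh) c M n hM0 hn1 (by simp only [List.sum_cons]; linarith)
    simp only [List.length_cons, hlen, List.prod_cons, one_mul] at v1 v2 v3
    rw [show k + 1 + 1 = k + 2 by ring] at *
    refine ⟨|y| * v, ?_, ?_, ?_⟩
    · calc _ = |y| * (E⁻¹ * (l.prod * (M:ℝ) ^ (c - (k+2:ℕ)))) := by
            rw [hlam]; push_cast; rw [show c - ((k:ℝ)+2) = c - k - 2 by ring]; ring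
        _ ≤ _ := by
            rw [hE, ← Real.rpow_neg (by norm_num)]; gcongr
    · calc _ ≤ |y| * (E * (l.prod * (M:ℝ) ^ (c - (k+2:ℕ)))) := by gcongr
        _ = _ := by
            rw [hlam]; push_cast; rw [show c - ((k:ℝ)+2) = c - k - 2 by ring]; ring
    · simp only [Dl] at v3
      push_cast
      have e1 : (n:ℝ) + 1 + 1 = n + 2 := by ring
      rw [e1] at v3
      have : (SignType.sign y : ℝ) * |y| = y := sign_mul_abs y
      calc _ = y * (Dl l (fun u => u ^ c) ((n:ℝ) + 2) - Dl l (fun u => u ^ c) ((n:ℝ) + 1) -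
                 (Dl l (fun u => u ^ c) ((n:ℝ) + 1) - Dl l (fun u => u ^ c) n)) := by ring
        _ = _ := by rw [v3]; linear_combination (-cf (k+2) c * v) * this
  have hcs : (∀ n, a ≤ n → n + 1 < b → ∃ v, E⁻¹ * lam ≤ v ∧ v ≤ E * lam ∧
     (y * Dl l (fun u => u ^ c) ((n+2:ℕ):ℝ) - 2 * (y * Dl l (fun u => u ^ c) ((n+1:ℕ):ℝ)) + y * Dl l (fun u => u ^ c) n) = κ * v) ∨
     (∀ n, a ≤ n → n + 1 < b → ∃ v, E⁻¹ * lam ≤ v ∧ v ≤ E * lam ∧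
     (y * Dl l (fun u => u ^ c) ((n+2:ℕ):ℝ) - 2 * (y * Dl l (fun u => u ^ c) ((n+1:ℕ):ℝ)) + y * Dl l (fun u => u ^ c) n) = -(κ * v)) := by
    rcases hy.lt_or_gt with hy | hy <;> rcases hcf.lt_or_gt with hc | hc
    · left; intro n h1 h2; obtain ⟨v, v1, v2, v3⟩ := key n h1 h2
      exact ⟨v, v1, v2, by rw [v3, hκ, abs_of_neg hc, sign_neg hy]; simp⟩
    · right; intro n h1 h2; obtain ⟨v, v1, v2, v3⟩ := key n h1 h2
      exact ⟨v, v1, v2, by rw [v3, hκ, abs_of_pos hc, sign_neg hy]; simp⟩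
    · right; intro n h1 h2; obtain ⟨v, v1, v2, v3⟩ := key n h1 h2
      exact ⟨v, v1, v2, by rw [v3, hκ, abs_of_neg hc, sign_pos hy]; simp⟩
    · left; intro n h1 h2; obtain ⟨v, v1, v2, v3⟩ := key n h1 h2
      exact ⟨v, v1, v2, by rw [v3, hκ, abs_of_pos hc, sign_pos hy]; simp⟩
  have hll : 0 < μ * lam := by positivity
  have fin := sdt (fun n : ℕ => y * Dl l (fun u => u ^ c) n) a b (μ * lam) (E^2) hll (by nlinarith only [hE1]) (by
    have c1 : ∀ v, E⁻¹ * lam ≤ v → μ * lam ≤ κ * v := by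
      intro v hv
      calc μ * lam = κ * (E⁻¹ * lam) := by rw [hμ]; ring
        _ ≤ _ := by gcongr
    have c2 : ∀ v, v ≤ E * lam → κ * v ≤ E^2 * (μ * lam) := by
      intro v hv
      calc κ * v ≤ κ * (E * lam) := by gcongr
        _ = E^2 * (μ * lam) := by rw [hμ]; field_simp
    rcases hcs with hcs | hcs
    · left
      intro n h1 h2
      obtain ⟨v, v1, v2, v3⟩ := hcs n h1 h2
      rw [v3]; exact ⟨c1 v v1, c2 v v2⟩
    · right
      intro n h1 h2
      obtain ⟨v, v1, v2, v3⟩ := hcs n h1 h2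
      rw [v3, neg_neg]; exact ⟨c1 v v1, c2 v v2⟩)
  refine fin.trans ?_
  have hba : ((b - a : ℕ):ℝ) ≤ M := by exact_mod_cast (by omega)
  rw [Real.sqrt_mul hμ0.le]
  have s1 : 0 < √μ := Real.sqrt_pos.mpr hμ0
  have s2 : 0 < √lam := Real.sqrt_pos.mpr hlam0
  have : ((b - a : ℕ):ℝ) * (√μ * √lam) + 1 / (√μ * √lam) ≤ (√μ + 1/√μ) * (M * √lam + 1/√lam) := by
    have q1 : ((b - a : ℕ):ℝ) * (√μ * √lam) ≤ √μ * (M * √lam) := by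
      calc _ ≤ (M:ℝ) * (√μ * √lam) := by gcongr
        _ = _ := by ring
    have q2 : 1 / (√μ * √lam) = 1/√μ * (1/√lam) := by field_simp
    have q3 : 0 ≤ √μ * (1/√lam) := by positivity
    have q4 : 0 ≤ 1/√μ * (M * √lam) := by positivity
    rw [q2]; nlinarith only [q1, q3, q4]
  calc _ ≤ 12 * E^2 * ((√μ + 1/√μ) * (M * √lam + 1/√lam)) := by gcongr
    _ = _ := by ring

/-- vdC with a single smooth sum -/
lemma vdc1 (f : ℕ → ℝ) (M a b R : ℕ) (hR : 1 ≤ R) (hRM : R ≤ M) (ha : M ≤ a) (hb : b ≤ 2 * M) :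
    ‖∑ n ∈ Finset.Ico a b, e (f n)‖ ^ 2 ≤ 2 * (M:ℝ)^2 / R +
      4 * M / R * ∑ r ∈ Finset.Ico 1 R, ‖∑ n ∈ Finset.Ico a (b - r), e (f (n + r) - f n)‖ := by
  classical
  set z : Unit → ℕ → ℂ := fun _ n => if a ≤ n ∧ n < b then e (f n) else 0 with hz
  have key := vdc {()} z M M R hR hRM hRM (by
    intro y n h
    simp only [hz] at h
    split_ifs at h with h1
    · omega
    · exact absurd rfl h)
  simp only [Finset.sum_singleton] at key
  have e1 : ∑ n ∈ Finset.Ico M (M + M), z () n = ∑ n ∈ Finset.Ico a b, e (f n) := by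
    simp only [hz]
    rw [← Finset.sum_filter]
    congr 1
    ext n; simp only [Finset.mem_filter, Finset.mem_Ico]; omega
  have e2 : ∀ q, ∑ n ∈ Finset.Ico M (M + M), z () (n + q) * (starRingEnd ℂ) (z () n) =
      ∑ n ∈ Finset.Ico a (b - q), e (f (n + q) - f n) := by
    intro q
    rw [Finset.sum_congr rfl (g := fun n => if a ≤ n ∧ n < b - q then e (f (n + q) - f n) else 0)]
    · rw [← Finset.sum_filter]
      congr 1
      ext n; simp only [Finset.mem_filter, Finset.mem_Ico]; omega
    · intro n _
      simp only [hz]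
      by_cases h : a ≤ n ∧ n < b - q
      · rw [if_pos (by omega), if_pos (by omega), if_pos h, e_sub]
      · rw [if_neg h]
        by_cases h2 : a ≤ n ∧ n < b
        · rw [if_neg (show ¬ (a ≤ n + q ∧ n + q < b) by omega), zero_mul]
        · rw [if_neg h2]; simp
  rw [e1] at key
  simp only [e2] at key
  have e3 : ∑ n ∈ Finset.Ico M (M + M), ‖z () n‖ ^ 2 ≤ M := by
    calc _ ≤ ∑ n ∈ Finset.Ico M (M + M), (1:ℝ) := by
          refine Finset.sum_le_sum (fun n _ => ?_)
          simp only [hz]; split_ifs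
          · simp [e_norm]
          · simp
      _ = M := by simp
  refine key.trans ?_
  calc _ ≤ (2 * M / R : ℝ) * (M + 2 * ∑ q ∈ Finset.Ico 1 R, ‖∑ n ∈ Finset.Ico a (b - q), e (f (n + q) - f n)‖) := by gcongr
    _ = _ := by ring

lemma vdcD (c y : ℝ) (l : List ℝ) (M a b R : ℕ) (hR : 1 ≤ R) (hRM : R ≤ M) (ha : M ≤ a) (hb : b ≤ 2 * M) :
    ‖∑ n ∈ Finset.Ico a b, e (y * Dl l (fun u => u ^ c) n)‖ ^ 2 ≤ 2 * (M:ℝ)^2 / R +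
      4 * M / R * ∑ r ∈ Finset.Ico 1 R, ‖∑ n ∈ Finset.Ico a (b - r), e (y * Dl ((r:ℝ) :: l) (fun u => u ^ c) n)‖ := by
  have := vdc1 (fun n : ℕ => y * Dl l (fun u => u ^ c) n) M a b R hR hRM ha hb
  simpa only [Dl, mul_sub, Nat.cast_add] using this

lemma sum_inv_sqrt (R : ℕ) : ∑ r ∈ Finset.Ico 1 R, 1 / √(r:ℝ) ≤ 2 * √(R:ℝ) := by
  rcases R with _ | n
  · simp
  have : ∑ r ∈ Finset.Ico 1 (n+1), 1 / √(r:ℝ) ≤ 2 * √(n:ℝ) := by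
    induction n with
    | zero => simp
    | succ n ih =>
      rw [Finset.sum_Ico_succ_top (by omega)]
      have a0 : 0 ≤ √(n:ℝ) := Real.sqrt_nonneg _
      have a1 : 0 < √((n+1:ℕ):ℝ) := Real.sqrt_pos.mpr (by positivity)
      have b0 : √(n:ℝ) ^ 2 = n := Real.sq_sqrt (by positivity)
      have b1 : √((n+1:ℕ):ℝ) ^ 2 = n + 1 := by rw [Real.sq_sqrt (by positivity)]; push_cast; ring
      have : 1 / √((n+1:ℕ):ℝ) ≤ 2 * √((n+1:ℕ):ℝ) - 2 * √(n:ℝ) := by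
        rw [div_le_iff₀ a1]; nlinarith only [sq_nonneg (√((n+1:ℕ):ℝ) - √(n:ℝ)), b0, b1]
      linarith
  refine this.trans ?_
  gcongr; simp

lemma thirdD (c : ℝ) (k : ℕ) (hcf : cf (k+3) c ≠ 0) : ∃ C > 0, ∀ (l : List ℝ) (y : ℝ) (M a b R : ℕ), l.length = k →
    (∀ h ∈ l, 0 < h) → y ≠ 0 → 1 ≤ R → R ≤ M → M ≤ a → b ≤ 2 * M → (b:ℝ) + 1 + l.sum + R ≤ 4 * M →
    ‖∑ m ∈ Finset.Ico a b, e (y * Dl l (fun u => u ^ c) m)‖ ^ 2 ≤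
      C * ((M:ℝ)^2 / R + (M:ℝ)^2 * √(R * (|y| * l.prod * (M:ℝ) ^ (c - k - 3))) +
        M / √(R * (|y| * l.prod * (M:ℝ) ^ (c - k - 3)))) := by
  obtain ⟨C, hC, hC2⟩ := sdtD c (k+1) (by simpa using hcf)
  refine ⟨2 + 8 * C, by positivity, ?_⟩
  intro l y M a b R hlen hl hy hR hRM ha hb hsum
  have hM0 : (0:ℝ) < M := by exact_mod_cast (by omega : 0 < M)
  have hR0 : (0:ℝ) < R := by exact_mod_cast hR
  have hlp : 0 < l.prod := List.prod_pos hl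
  have hy0 := abs_pos.mpr hy
  set lam := |y| * l.prod * (M:ℝ) ^ (c - k - 3) with hlam
  have hlam0 : 0 < lam := by positivity
  have h1 := vdcD c y l M a b R hR hRM ha hb
  have h2 : ∀ r ∈ Finset.Ico 1 R, ‖∑ n ∈ Finset.Ico a (b - r), e (y * Dl ((r:ℝ) :: l) (fun u => u ^ c) n)‖ ≤
      C * (M * √(R * lam) + 1 / √lam * (1 / √(r:ℝ))) := by
    intro r hr
    rw [Finset.mem_Ico] at hr
    have hr0 : (0:ℝ) < r := by exact_mod_cast hr.1
    have hrR : (r:ℝ) ≤ R := by exact_mod_cast hr.2.le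
    have hbr : ((b - r : ℕ):ℝ) ≤ b := by exact_mod_cast Nat.sub_le _ _
    have := hC2 ((r:ℝ) :: l) y M a (b - r) (by simp [hlen]) (by
      intro h hh; rw [List.mem_cons] at hh; rcases hh with rfl | hh
      · exact hr0
      · exact hl h hh) hy (by omega) ha (by omega) (by rw [List.sum_cons]; linarith)
    refine this.trans ?_
    have e1 : |y| * ((r:ℝ) :: l).prod * (M:ℝ) ^ (c - (k+1:ℕ) - 2) = r * lam := by
      rw [hlam, List.prod_cons]; push_cast
      rw [show c - ((k:ℝ)+1) - 2 = c - k - 3 by ring]; ring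
    rw [e1]
    have e2 : √((r:ℝ) * lam) = √(r:ℝ) * √lam := Real.sqrt_mul hr0.le _
    have e3 : 1 / √((r:ℝ) * lam) = 1 / √lam * (1 / √(r:ℝ)) := by rw [e2]; field_simp
    rw [e3]; gcongr
  have h3 : ∑ r ∈ Finset.Ico 1 R, ‖∑ n ∈ Finset.Ico a (b - r), e (y * Dl ((r:ℝ) :: l) (fun u => u ^ c) n)‖ ≤
      C * (R * (M * √(R * lam)) + 1 / √lam * (2 * √(R:ℝ))) := by
    refine (Finset.sum_le_sum h2).trans ?_
    rw [← Finset.mul_sum, Finset.sum_add_distrib, ← Finset.mul_sum (f := fun r : ℕ => 1 / √(r:ℝ)),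
      Finset.sum_const, nsmul_eq_mul]
    have hcd : ((Finset.Ico 1 R).card : ℝ) ≤ R := by
      rw [Nat.card_Ico]; exact_mod_cast Nat.sub_le _ _
    gcongr
    exact sum_inv_sqrt R
  have e4 : 1 / √lam * (2 * √(R:ℝ)) = 2 * R * (1 / √(R * lam)) := by
    rw [Real.sqrt_mul hR0.le]
    have := Real.mul_self_sqrt hR0.le
    have s1 : 0 < √(R:ℝ) := Real.sqrt_pos.mpr hR0
    have s2 : 0 < √lam := Real.sqrt_pos.mpr hlam0
    field_simp; rw [sq, this]
  rw [e4] at h3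
  set s := √(R * lam) with hs
  have hs0 : 0 < s := Real.sqrt_pos.mpr (by positivity)
  calc _ ≤ 2 * (M:ℝ)^2 / R + 4 * M / R * (C * (R * (M * s) + 2 * R * (1 / s))) := h1.trans (by gcongr)
    _ = 2 * ((M:ℝ)^2 / R) + 4 * C * (M^2 * s) + 8 * C * (M / s) := by field_simp; ring
    _ ≤ _ := by
      have p1 : 0 ≤ (M:ℝ)^2 / R := by positivity
      have p2 : 0 ≤ (M:ℝ)^2 * s := by positivity
      have p3 : 0 ≤ M / s := by positivity
      nlinarith only [mul_nonneg hC.le p1, mul_nonneg hC.le p2, mul_nonneg hC.le p3, hC, p1, p2, p3]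

lemma fourthD (c : ℝ) (hcf : cf 4 c ≠ 0) : ∃ C > 0, ∀ (y : ℝ) (M a b R Sn : ℕ),
    y ≠ 0 → 1 ≤ R → R ≤ M → 1 ≤ Sn → Sn ≤ M → M ≤ a → b ≤ 2 * M → (b:ℝ) + 1 + R + Sn ≤ 4 * M →
    ‖∑ m ∈ Finset.Ico a b, e (y * (m:ℝ) ^ c)‖ ^ 2 ≤
      C * ((M:ℝ)^2 / R + M * √((M:ℝ)^2 / Sn + (M:ℝ)^2 * √(Sn * R * (|y| * (M:ℝ) ^ (c - 4))) +
        M / √(Sn * R * (|y| * (M:ℝ) ^ (c - 4))))) := by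
  obtain ⟨C, hC, hC2⟩ := thirdD c 1 (by simpa using hcf)
  refine ⟨2 + 4 * √(2 * C), by positivity, ?_⟩
  intro y M a b R Sn hy hR hRM hS hSM ha hb hsum
  have hM0 : (0:ℝ) < M := by exact_mod_cast (by omega : 0 < M)
  have hR0 : (0:ℝ) < R := by exact_mod_cast hR
  have hS0 : (0:ℝ) < Sn := by exact_mod_cast hS
  have hy0 := abs_pos.mpr hy
  set lam := |y| * (M:ℝ) ^ (c - 4) with hlam
  have hlam0 : 0 < lam := by positivity
  have h1 := vdcD c y [] M a b R hR hRM ha hb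
  rw [show Dl [] (fun u : ℝ => u ^ c) = (fun u : ℝ => u ^ c) from rfl] at h1
  set W : ℕ → ℝ := fun r => ‖∑ n ∈ Finset.Ico a (b - r), e (y * Dl [(r:ℝ)] (fun u => u ^ c) n)‖ with hW
  have h2 : ∀ r ∈ Finset.Ico 1 R, W r ^ 2 ≤
      C * (((M:ℝ)^2 / Sn + (M:ℝ)^2 * √(Sn * R * lam)) + M / √(Sn * lam) * (1 / √(r:ℝ))) := by
    intro r hr
    rw [Finset.mem_Ico] at hr
    have hr0 : (0:ℝ) < r := by exact_mod_cast hr.1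
    have hrR : (r:ℝ) ≤ R := by exact_mod_cast hr.2.le
    have hbr : ((b - r : ℕ):ℝ) ≤ b := by exact_mod_cast Nat.sub_le _ _
    have := hC2 [(r:ℝ)] y M a (b - r) Sn (by simp) (by
      intro h hh; rw [List.mem_singleton] at hh; rw [hh]; exact hr0) hy hS hSM ha (by omega) (by
        simp only [List.sum_singleton]; linarith)
    refine this.trans ?_
    have e1 : (Sn:ℝ) * (|y| * [(r:ℝ)].prod * (M:ℝ) ^ (c - (1:ℕ) - 3)) = Sn * r * lam := by
      rw [hlam, List.prod_singleton]; push_cast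
      rw [show c - 1 - 3 = c - 4 by ring]; ring
    rw [e1]
    have e3 : M / √((Sn:ℝ) * r * lam) = M / √(Sn * lam) * (1 / √(r:ℝ)) := by
      rw [show (Sn:ℝ) * r * lam = (Sn * lam) * r by ring, Real.sqrt_mul (by positivity)]
      have : 0 < √((Sn:ℝ) * lam) := Real.sqrt_pos.mpr (by positivity)
      have : 0 < √(r:ℝ) := Real.sqrt_pos.mpr hr0
      field_simp
    rw [e3]; gcongr
  set P := (M:ℝ)^2 / Sn + (M:ℝ)^2 * √(Sn * R * lam) with hP
  have h3 : (∑ r ∈ Finset.Ico 1 R, W r) ^ 2 ≤ R * (C * (R * P + M / √(Sn * lam) * (2 * √(R:ℝ)))) := by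
    refine (sq_sum_le_card_mul_sum_sq (s := Finset.Ico 1 R)).trans ?_
    have hcd : ((Finset.Ico 1 R).card : ℝ) ≤ R := by
      rw [Nat.card_Ico]; exact_mod_cast Nat.sub_le _ _
    have : ∑ r ∈ Finset.Ico 1 R, W r ^ 2 ≤ C * (R * P + M / √(Sn * lam) * (2 * √(R:ℝ))) := by
      refine (Finset.sum_le_sum h2).trans ?_
      rw [← Finset.mul_sum, Finset.sum_add_distrib, ← Finset.mul_sum, Finset.sum_const, nsmul_eq_mul]
      gcongr
      exact sum_inv_sqrt R
    gcongr
  set s := √((Sn:ℝ) * R * lam) with hs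
  have hs0 : 0 < s := Real.sqrt_pos.mpr (by positivity)
  have e4 : M / √((Sn:ℝ) * lam) * (2 * √(R:ℝ)) = 2 * R * (M / s) := by
    have hss : s = √((Sn:ℝ) * lam) * √(R:ℝ) := by
      rw [hs, show (Sn:ℝ) * R * lam = (Sn * lam) * R by ring, Real.sqrt_mul (by positivity)]
    rw [hss]
    have := Real.mul_self_sqrt hR0.le
    have s1 : 0 < √(R:ℝ) := Real.sqrt_pos.mpr hR0
    have s2 : 0 < √((Sn:ℝ) * lam) := Real.sqrt_pos.mpr (by positivity)
    generalize √((Sn:ℝ) * lam) = w at s2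
    field_simp; rw [sq, this]
  rw [e4] at h3
  have hP0 : 0 ≤ P := by positivity
  have hMs : 0 ≤ M / s := by positivity
  have h4 : ∑ r ∈ Finset.Ico 1 R, W r ≤ R * √(2 * C) * √(P + M / s) := by
    refine abs_le_of_sq_le_sq' ?_ (by positivity) |>.2
    rw [mul_pow, mul_pow, Real.sq_sqrt (by positivity), Real.sq_sqrt (by positivity)]
    refine h3.trans ?_
    have : 0 ≤ R^2 * C * P := by positivity
    nlinarith only [this]
  calc _ ≤ 2 * (M:ℝ)^2 / R + 4 * M / R * (R * √(2 * C) * √(P + M / s)) := h1.trans (by gcongr)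
    _ = 2 * ((M:ℝ)^2 / R) + 4 * √(2*C) * (M * √(P + M / s)) := by field_simp
    _ ≤ _ := by
      have p1 : 0 ≤ (M:ℝ)^2 / R := by positivity
      have p2 : 0 ≤ M * √(P + M / s) := by positivity
      have p3 : 0 ≤ √(2*C) := Real.sqrt_nonneg _
      nlinarith only [mul_nonneg p3 p1, p1, p2, p3]

lemma e_int_mul_pow (t : ℝ) (n : ℕ) : e (t * n) = e t ^ n := by
  unfold e; rw [← Complex.exp_nat_mul]; congr 1; push_cast; ring

lemma e_eq_one {t : ℝ} (h : e t = 1) : ∃ n : ℤ, t = n := by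
  unfold e at h
  rw [Complex.exp_eq_one_iff] at h
  obtain ⟨n, hn⟩ := h
  refine ⟨n, ?_⟩
  have h2 : (2 * Real.pi * Complex.I : ℂ) ≠ 0 := by
    simp [Real.pi_ne_zero, Complex.I_ne_zero]
  have : (2 * Real.pi * Complex.I : ℂ) * t = (2 * Real.pi * Complex.I : ℂ) * n := by rw [hn]; ring
  have := mul_left_cancel₀ h2 this
  exact_mod_cast this

lemma orth (P : ℕ) (hP : 1 ≤ P) (k : ℤ) :
    ∑ s ∈ Finset.range P, e ((k:ℝ) / P * s) = if (P:ℤ) ∣ k then (P:ℂ) else 0 := by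
  have hP0 : (P:ℝ) ≠ 0 := by positivity
  simp only [e_int_mul_pow]
  split_ifs with h
  · obtain ⟨j, rfl⟩ := h
    have : e ((((P:ℤ) * j : ℤ) : ℝ) / P) = 1 := by
      rw [show (((P:ℤ) * j : ℤ) : ℝ) / P = (j:ℤ) by push_cast; field_simp]; exact e_int j
    rw [this]; simp
  · have hne : e ((k:ℝ)/P) ≠ 1 := by
      intro h1
      obtain ⟨n, hn⟩ := e_eq_one h1
      apply h
      refine ⟨n, ?_⟩
      rw [div_eq_iff hP0] at hn
      have : (k:ℝ) = ((P * n : ℤ):ℝ) := by push_cast; rw [hn]; ring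
      exact_mod_cast this
    rw [geom_sum_eq hne, ← e_int_mul_pow, div_mul_cancel₀ _ hP0, e_int]; simp

lemma parseval_form {I J : Type*} (s : Finset I) (t : Finset J) (k : I → ℤ) (l : J → ℤ) (P : ℕ) (hP : 1 ≤ P)
    (α : I → ℂ) (β : J → ℂ) (hα : ∀ i, ‖α i‖ ≤ 1) (hβ : ∀ j, ‖β j‖ ≤ 1) :
    ‖∑ i ∈ s, ∑ j ∈ t, α i * β j * e ((k i : ℝ) * l j / P)‖ ^ 2 ≤
      P * ((s ×ˢ s).filter (fun p => (P:ℤ) ∣ k p.1 - k p.2)).card *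
        ((t ×ˢ t).filter (fun p => (P:ℤ) ∣ l p.1 - l p.2)).card := by
  classical
  have hP0 : (P:ℝ) ≠ 0 := by positivity
  have hPz : (0:ℤ) < P := by exact_mod_cast hP
  set F : ℕ → ℂ := fun r => ∑ i ∈ s, α i * e ((k i : ℝ) / P * r) with hF
  set g : J → ℕ := fun j => (l j % P).toNat with hg
  have hgc : ∀ j, ((g j : ℕ) : ℤ) = l j % P := fun j => Int.toNat_of_nonneg (Int.emod_nonneg _ (by omega))
  have hgm : ∀ j ∈ t, g j ∈ Finset.range P := by
    intro j _
    rw [Finset.mem_range]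
    have := Int.emod_lt_of_pos (l j) hPz
    have := hgc j
    omega
  set B : ℕ → ℂ := fun r => ∑ j ∈ t.filter (fun j => g j = r), β j with hB
  have e1 : ∑ i ∈ s, ∑ j ∈ t, α i * β j * e ((k i : ℝ) * l j / P) = ∑ r ∈ Finset.range P, B r * F r := by
    rw [Finset.sum_comm, ← Finset.sum_fiberwise_of_maps_to hgm]
    refine Finset.sum_congr rfl (fun r _ => ?_)
    rw [hB, Finset.sum_mul]
    refine Finset.sum_congr rfl (fun j hj => ?_)
    rw [Finset.mem_filter] at hj
    rw [hF, Finset.mul_sum]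
    refine Finset.sum_congr rfl (fun i _ => ?_)
    have h1 : (k i : ℝ) * l j / P = (k i : ℝ) / P * r + ((k i * (l j / P) : ℤ) : ℝ) := by
      have h2 : (l j : ℝ) = P * ((l j / P : ℤ) : ℝ) + r := by
        have h3 := Int.emod_add_mul_ediv (l j) P
        rw [← hgc j, hj.2] at h3
        have : (l j : ℝ) = (((r:ℤ) + P * (l j / P) : ℤ) : ℝ) := by rw [h3]
        rw [this]; push_cast; ring
      rw [h2]; push_cast; field_simp; ring
    rw [h1, e_add, e_int]; ring
  have hBsq : ∑ r ∈ Finset.range P, ‖B r‖ ^ 2 ≤ ((t ×ˢ t).filter (fun p => (P:ℤ) ∣ l p.1 - l p.2)).card := by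
    have h1 : ∀ r, ‖B r‖ ^ 2 ≤ ((t.filter (fun j => g j = r)) ×ˢ (t.filter (fun j => g j = r))).card := by
      intro r
      rw [Finset.card_product]; push_cast; rw [← sq]
      gcongr
      refine (norm_sum_le _ _).trans ((Finset.sum_le_sum (fun j _ => hβ j)).trans ?_)
      simp
    refine (Finset.sum_le_sum (fun r _ => h1 r)).trans ?_
    rw [← Nat.cast_sum]
    norm_cast
    rw [Finset.card_eq_sum_card_fiberwise (f := fun p : J × J => g p.1) (t := Finset.range P)]
    · refine Finset.sum_le_sum (fun r _ => Finset.card_le_card ?_)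
      intro p hp
      simp only [Finset.mem_product, Finset.mem_filter] at *
      refine ⟨⟨⟨hp.1.1, hp.2.1⟩, ?_⟩, hp.1.2⟩
      have h3 := hgc p.1
      have h4 := hgc p.2
      rw [hp.1.2] at h3
      rw [hp.2.2] at h4
      exact Int.ModEq.dvd (show l p.2 % P = l p.1 % P by rw [← h3, ← h4])
    · intro p hp
      simp only [Finset.coe_filter, Set.mem_ofPred_eq, Finset.mem_product] at hp
      exact hgm _ hp.1.1
  have hFsq : ∑ r ∈ Finset.range P, ‖F r‖ ^ 2 ≤ P * ((s ×ˢ s).filter (fun p => (P:ℤ) ∣ k p.1 - k p.2)).card := by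
    have h1 : ((∑ r ∈ Finset.range P, ‖F r‖ ^ 2 : ℝ) : ℂ) =
        ∑ p ∈ s ×ˢ s, α p.1 * (starRingEnd ℂ) (α p.2) * (if (P:ℤ) ∣ k p.1 - k p.2 then (P:ℂ) else 0) := by
      push_cast
      have h2 : ∀ r, (‖F r‖ : ℂ) ^ 2 = ∑ p ∈ s ×ˢ s, α p.1 * (starRingEnd ℂ) (α p.2) * e (((k p.1 - k p.2 : ℤ) : ℝ) / P * r) := by
        intro r
        rw [← Complex.mul_conj', hF, map_sum, Finset.sum_mul_sum, Finset.sum_product]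
        refine Finset.sum_congr rfl (fun i _ => Finset.sum_congr rfl (fun i' _ => ?_))
        rw [map_mul, show ((k i - k i' : ℤ) : ℝ) / P * r = (k i:ℝ)/P * r - (k i':ℝ) / P * r by push_cast; ring, e_sub]
        ring
      rw [Finset.sum_congr rfl (fun r _ => h2 r), Finset.sum_comm]
      refine Finset.sum_congr rfl (fun p _ => ?_)
      rw [← Finset.mul_sum, orth P hP]
    have h2 := congrArg norm h1
    rw [Complex.norm_real, Real.norm_eq_abs, abs_of_nonneg (by positivity)] at h2
    rw [h2]
    refine (norm_sum_le _ _).trans ?_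
    calc _ ≤ ∑ p ∈ s ×ˢ s, (if (P:ℤ) ∣ k p.1 - k p.2 then (P:ℝ) else 0) := by
          refine Finset.sum_le_sum (fun p _ => ?_)
          rw [norm_mul, norm_mul, RCLike.norm_conj]
          have : ‖(if (P:ℤ) ∣ k p.1 - k p.2 then (P:ℂ) else 0)‖ = (if (P:ℤ) ∣ k p.1 - k p.2 then (P:ℝ) else 0) := by
            split_ifs <;> simp
          rw [this]
          have h5 : ‖α p.1‖ * ‖α p.2‖ ≤ 1 := mul_le_one₀ (hα _) (norm_nonneg _) (hα _)
          have h6 : 0 ≤ (if (P:ℤ) ∣ k p.1 - k p.2 then (P:ℝ) else 0) := by split_ifs <;> positivity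
          nlinarith only [h5, h6]
      _ = _ := by
          rw [← Finset.sum_filter, Finset.sum_const, nsmul_eq_mul]; ring
  rw [e1]
  calc _ ≤ (∑ r ∈ Finset.range P, ‖B r‖ * ‖F r‖) ^ 2 := by
        gcongr
        refine (norm_sum_le _ _).trans (Finset.sum_le_sum (fun r _ => by rw [norm_mul]))
    _ ≤ (∑ r ∈ Finset.range P, ‖B r‖ ^ 2) * (∑ r ∈ Finset.range P, ‖F r‖ ^ 2) := Finset.sum_mul_sq_le_sq_mul_sq _ _ _
    _ ≤ _ := by
        rw [mul_comm (P * _ : ℝ)]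
        gcongr

lemma taylor_form {I J : Type*} (s : Finset I) (t : Finset J) (Kn : I → J → ℂ) (T : ℝ)
    (hT : ∀ α : I → ℂ, ∀ β : J → ℂ, (∀ i, ‖α i‖ ≤ 1) → (∀ j, ‖β j‖ ≤ 1) → ‖∑ i ∈ s, ∑ j ∈ t, α i * β j * Kn i j‖ ≤ T)
    (w : ℂ) (x : I → ℝ) (y : J → ℝ) (hx : ∀ i, |x i| ≤ 1) (hy : ∀ j, |y j| ≤ 1)
    (α : I → ℂ) (β : J → ℂ) (hα : ∀ i, ‖α i‖ ≤ 1) (hβ : ∀ j, ‖β j‖ ≤ 1) :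
    ‖∑ i ∈ s, ∑ j ∈ t, α i * β j * (Kn i j * Complex.exp (w * (x i * y j)))‖ ≤ T * Real.exp ‖w‖ := by
  have hs : ∀ z : ℂ, HasSum (fun n : ℕ => z ^ n / (n.factorial : ℂ)) (Complex.exp z) := by
    intro z; rw [Complex.exp_eq_exp_ℂ]; exact NormedSpace.expSeries_div_hasSum_exp z
  have h1 : HasSum (fun n : ℕ => w ^ n / (n.factorial : ℂ) * ∑ i ∈ s, ∑ j ∈ t, (α i * x i ^ n) * (β j * y j ^ n) * Kn i j)
      (∑ i ∈ s, ∑ j ∈ t, α i * β j * (Kn i j * Complex.exp (w * (x i * y j)))) := by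
    have h2 : HasSum (fun n : ℕ => ∑ i ∈ s, ∑ j ∈ t, α i * β j * (Kn i j * ((w * (x i * y j)) ^ n / (n.factorial : ℂ))))
      (∑ i ∈ s, ∑ j ∈ t, α i * β j * (Kn i j * Complex.exp (w * (x i * y j)))) :=
      hasSum_sum (fun i _ => hasSum_sum (fun j _ => ((hs _).mul_left _).mul_left _))
    convert h2 using 2 with n
    rw [Finset.mul_sum]
    refine Finset.sum_congr rfl (fun i _ => ?_)
    rw [Finset.mul_sum]
    refine Finset.sum_congr rfl (fun j _ => ?_)
    rw [mul_pow, mul_pow]; ring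
  have hexp : HasSum (fun n : ℕ => ‖w‖ ^ n / (n.factorial : ℝ) * T) (Real.exp ‖w‖ * T) := by
    have : HasSum (fun n : ℕ => ‖w‖ ^ n / (n.factorial : ℝ)) (Real.exp ‖w‖) := by
      rw [Real.exp_eq_exp_ℝ]; exact NormedSpace.expSeries_div_hasSum_exp ‖w‖
    exact this.mul_right T
  rw [mul_comm, ← h1.tsum_eq]
  refine tsum_of_norm_bounded hexp (fun n => ?_)
  rw [norm_mul, norm_div, norm_pow, Complex.norm_natCast]
  gcongr
  apply hT
  · intro i
    rw [norm_mul, norm_pow, Complex.norm_real, Real.norm_eq_abs]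
    exact mul_le_one₀ (hα i) (by positivity) (pow_le_one₀ (abs_nonneg _) (hx i))
  · intro j
    rw [norm_mul, norm_pow, Complex.norm_real, Real.norm_eq_abs]
    exact mul_le_one₀ (hβ j) (by positivity) (pow_le_one₀ (abs_nonneg _) (hy j))

lemma taylor_e {I J : Type*} (s : Finset I) (t : Finset J) (Kn : I → J → ℂ) (T : ℝ)
    (hT : ∀ α : I → ℂ, ∀ β : J → ℂ, (∀ i, ‖α i‖ ≤ 1) → (∀ j, ‖β j‖ ≤ 1) → ‖∑ i ∈ s, ∑ j ∈ t, α i * β j * Kn i j‖ ≤ T)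
    (a b : ℝ) (ha : 0 < a) (hb : 0 < b) (hab : a * b ≤ 1) (x : I → ℝ) (y : J → ℝ) (hx : ∀ i, |x i| ≤ a) (hy : ∀ j, |y j| ≤ b)
    (α : I → ℂ) (β : J → ℂ) (hα : ∀ i, ‖α i‖ ≤ 1) (hβ : ∀ j, ‖β j‖ ≤ 1) :
    ‖∑ i ∈ s, ∑ j ∈ t, α i * β j * (Kn i j * e (x i * y j))‖ ≤ T * Real.exp (2 * Real.pi) := by
  have hT0 : 0 ≤ T := (norm_nonneg _).trans (hT α β hα hβ)
  have := taylor_form s t Kn T hT (2 * Real.pi * Complex.I * (a * b : ℝ)) (fun i => x i / a) (fun j => y j / b)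
    (fun i => by rw [abs_div, abs_of_pos ha, div_le_one ha]; exact hx i)
    (fun j => by rw [abs_div, abs_of_pos hb, div_le_one hb]; exact hy j) α β hα hβ
  have h2 : ∀ i j, Complex.exp (2 * Real.pi * Complex.I * (a * b : ℝ) * (((x i / a : ℝ):ℂ) * ((y j / b : ℝ) : ℂ))) = e (x i * y j) := by
    intro i j
    unfold e; congr 1; push_cast
    have : (a:ℂ) ≠ 0 := by exact_mod_cast ha.ne'
    have : (b:ℂ) ≠ 0 := by exact_mod_cast hb.ne'
    field_simp
  simp only [h2] at this
  refine this.trans ?_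
  gcongr
  rw [norm_mul, norm_mul, norm_mul, Complex.norm_I, Complex.norm_real, Complex.norm_real, Complex.norm_ofNat, Real.norm_eq_abs, Real.norm_eq_abs,
    abs_of_pos Real.pi_pos, abs_of_pos (by positivity : 0 < a * b)]
  nlinarith [Real.pi_pos]

/-- double large sieve -/
lemma dls {I J : Type*} (s : Finset I) (t : Finset J) (u : I → ℝ) (v : J → ℝ) (A B : ℝ) (hA : 0 < A) (hB : 0 < B)
    (hu : ∀ i, |u i| ≤ A) (hv : ∀ j, |v j| ≤ B)
    (α : I → ℂ) (β : J → ℂ) (hα : ∀ i, ‖α i‖ ≤ 1) (hβ : ∀ j, ‖β j‖ ≤ 1) :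
    ‖∑ i ∈ s, ∑ j ∈ t, α i * β j * e (u i * v j)‖ ^ 2 ≤ Real.exp (8 * Real.pi) * (8 * (A * B) + 3) *
      ((s ×ˢ s).filter (fun p => |u p.1 - u p.2| ≤ 1 / B)).card *
      ((t ×ˢ t).filter (fun p => |v p.1 - v p.2| ≤ 1 / A)).card := by
  classical
  set P : ℕ := ⌈8 * (A * B)⌉₊ + 2 with hP
  have hAB : 0 < A * B := by positivity
  have hP1 : 8 * (A * B) + 2 ≤ P := by
    rw [hP]; push_cast; linarith [Nat.le_ceil (8 * (A * B))]
  have hP2 : (P:ℝ) ≤ 8 * (A * B) + 3 := by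
    rw [hP]; push_cast; linarith [Nat.ceil_lt_add_one (show 0 ≤ 8 * (A * B) by positivity)]
  have hP0 : (0:ℝ) < P := by linarith
  set η := 1 / (4 * B) with hη
  set ζ := 4 * B / P with hζ
  have hη0 : 0 < η := by positivity
  have hζ0 : 0 < ζ := by positivity
  have hηζ : η * ζ = 1 / P := by rw [hη, hζ]; field_simp
  have hζA : ζ * A ≤ 1 / 2 := by
    rw [hζ, div_mul_eq_mul_div, div_le_iff₀ hP0]; nlinarith only [hP1]
  set k : I → ℤ := fun i => ⌊u i / η⌋ with hk
  set l : J → ℤ := fun j => ⌊v j / ζ⌋ with hl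
  have hk1 : ∀ i, 0 ≤ u i - k i * η ∧ u i - k i * η ≤ η := by
    intro i
    have h1 := Int.floor_le (u i / η)
    have h2 := (Int.lt_floor_add_one (u i / η)).le
    rw [le_div_iff₀ hη0] at h1
    rw [div_le_iff₀ hη0] at h2
    constructor <;> simp only [hk] <;> linarith only [h1, h2]
  have hl1 : ∀ j, 0 ≤ v j - l j * ζ ∧ v j - l j * ζ ≤ ζ := by
    intro j
    have h1 := Int.floor_le (v j / ζ)
    have h2 := (Int.lt_floor_add_one (v j / ζ)).le
    rw [le_div_iff₀ hζ0] at h1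
    rw [div_le_iff₀ hζ0] at h2
    constructor <;> simp only [hl] <;> linarith only [h1, h2]
  have hsplit : ∀ i j, e (u i * v j) = e ((k i : ℝ) * l j / P) * e ((u i - k i * η) * v j) * e ((k i * η) * (v j - l j * ζ)) := by
    intro i j
    rw [← e_add, ← e_add]
    congr 1
    have : (k i : ℝ) * l j / P = k i * l j * (η * ζ) := by rw [hηζ]; ring
    rw [this]; ring
  set T := √(P * ((s ×ˢ s).filter (fun p => (P:ℤ) ∣ k p.1 - k p.2)).card *
        ((t ×ˢ t).filter (fun p => (P:ℤ) ∣ l p.1 - l p.2)).card) with hT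
  have st1 : ∀ α : I → ℂ, ∀ β : J → ℂ, (∀ i, ‖α i‖ ≤ 1) → (∀ j, ‖β j‖ ≤ 1) →
      ‖∑ i ∈ s, ∑ j ∈ t, α i * β j * e ((k i : ℝ) * l j / P)‖ ≤ T := by
    intro α β hα hβ
    exact Real.le_sqrt_of_sq_le (parseval_form s t k l P (by omega) α β hα hβ)
  have st2 := taylor_e s t _ T st1 η B hη0 hB (by rw [hη]; field_simp; norm_num) (fun i => u i - k i * η) v
    (fun i => by rw [abs_of_nonneg (hk1 i).1]; exact (hk1 i).2) hv
  have st3 := taylor_e s t _ (T * Real.exp (2 * Real.pi)) st2 (A + η) ζ (by positivity) hζ0 (by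
      have : η * ζ ≤ 1/2 := by
        rw [hηζ]; exact one_div_le_one_div_of_le (by norm_num) (by linarith)
      linarith) (fun i => k i * η) (fun j => v j - l j * ζ)
    (fun i => by
      have h1 := abs_le.mp (hu i)
      have h2 := hk1 i
      rw [abs_le]; constructor <;> linarith only [h1, h2, hη0])
    (fun j => by rw [abs_of_nonneg (hl1 j).1]; exact (hl1 j).2) α β hα hβ
  have st4 : ‖∑ i ∈ s, ∑ j ∈ t, α i * β j * e (u i * v j)‖ ≤ T * Real.exp (2 * Real.pi) * Real.exp (2 * Real.pi) := by
    refine le_trans (le_of_eq ?_) st3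
    congr 1
    refine Finset.sum_congr rfl (fun i _ => Finset.sum_congr rfl (fun j _ => ?_))
    rw [hsplit]
  have hdv : ∀ z : ℤ, (P:ℤ) ∣ z → |z| < P → z = 0 := fun z h1 h2 => Int.eq_zero_of_abs_lt_dvd h1 h2
  have kinj : ∀ i i', (P:ℤ) ∣ k i - k i' → |u i - u i'| ≤ 1 / B := by
    intro i i' h
    have h0 : k i - k i' = 0 := by
      apply hdv _ h
      have : |((k i - k i' : ℤ):ℝ)| < P := by
        have h1 := hk1 i; have h2 := hk1 i'
        have h3 := abs_le.mp (hu i); have h4 := abs_le.mp (hu i')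
        have h5 : |((k i - k i' : ℤ):ℝ)| * η ≤ 2 * A + η := by
          rw [← abs_of_pos hη0, ← abs_mul, abs_of_pos hη0]
          push_cast
          rw [abs_le]; constructor <;> nlinarith only [h1, h2, h3, h4]
        have h6 : 2 * A + η < P * η := by
          have : 2 * A = 8 * (A * B) * η := by rw [hη]; field_simp; norm_num
          rw [this]; nlinarith only [hA, hAB, hP1, hη0, this]
        exact lt_of_mul_lt_mul_right (h5.trans_lt h6) hη0.le
      exact_mod_cast this
    have h1 := hk1 i; have h2 := hk1 i'
    have h3 : (k i : ℝ) = k i' := by exact_mod_cast (sub_eq_zero.mp h0)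
    rw [h3] at h1
    have : η ≤ 1 / B := by rw [hη]; exact one_div_le_one_div_of_le hB (by linarith only [hB])
    rw [abs_le]; constructor <;> linarith only [h1, h2, this]
  have linj : ∀ j j', (P:ℤ) ∣ l j - l j' → |v j - v j'| ≤ 1 / A := by
    intro j j' h
    have h0 : l j - l j' = 0 := by
      apply hdv _ h
      have : |((l j - l j' : ℤ):ℝ)| < P := by
        have h1 := hl1 j; have h2 := hl1 j'
        have h3 := abs_le.mp (hv j); have h4 := abs_le.mp (hv j')
        have h5 : |((l j - l j' : ℤ):ℝ)| * ζ ≤ 2 * B + ζ := by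
          rw [← abs_of_pos hζ0, ← abs_mul, abs_of_pos hζ0]
          push_cast
          rw [abs_le]; constructor <;> nlinarith only [h1, h2, h3, h4]
        have h6 : 2 * B + ζ < P * ζ := by
          have h7 : P * ζ = 4 * B := by rw [hζ]; field_simp
          have h8 : ζ < 2 * B := by rw [hζ, div_lt_iff₀ hP0]; nlinarith only [hB, hAB, hP1]
          linarith
        exact lt_of_mul_lt_mul_right (h5.trans_lt h6) hζ0.le
      exact_mod_cast this
    have h1 := hl1 j; have h2 := hl1 j'
    have h3 : (l j : ℝ) = l j' := by exact_mod_cast (sub_eq_zero.mp h0)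
    rw [h3] at h1
    have : ζ ≤ 1 / A := by rw [le_div_iff₀ hA]; linarith
    rw [abs_le]; constructor <;> linarith only [h1, h2, this]
  have hT2 : T ^ 2 ≤ (8 * (A * B) + 3) *
      ((s ×ˢ s).filter (fun p => |u p.1 - u p.2| ≤ 1 / B)).card *
      ((t ×ˢ t).filter (fun p => |v p.1 - v p.2| ≤ 1 / A)).card := by
    rw [hT, Real.sq_sqrt (by positivity)]
    have q1 := Finset.card_le_card (Finset.monotone_filter_right (s ×ˢ s) (fun (p : I × I) (_ : p ∈ s ×ˢ s) hp => kinj p.1 p.2 hp))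
    have q2 := Finset.card_le_card (Finset.monotone_filter_right (t ×ˢ t) (fun (p : J × J) (_ : p ∈ t ×ˢ t) hp => linj p.1 p.2 hp))
    gcongr
  calc _ ≤ (T * Real.exp (2 * Real.pi) * Real.exp (2 * Real.pi)) ^ 2 := by gcongr
    _ = Real.exp (8 * Real.pi) * T ^ 2 := by
      rw [mul_assoc, ← Real.exp_add, mul_pow, ← Real.exp_nat_mul, mul_comm]; congr 2; push_cast; ring
    _ ≤ _ := by
      rw [mul_assoc, mul_assoc, ← mul_assoc (8 * (A*B) + 3)]; gcongr

lemma dls' {I J : Type*} (s : Finset I) (t : Finset J) (u : I → ℝ) (v : J → ℝ) (A B : ℝ) (hA : 0 < A) (hB : 0 < B)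
    (hu : ∀ i ∈ s, |u i| ≤ A) (hv : ∀ j ∈ t, |v j| ≤ B)
    (α : I → ℂ) (β : J → ℂ) (hα : ∀ i ∈ s, ‖α i‖ ≤ 1) (hβ : ∀ j ∈ t, ‖β j‖ ≤ 1) :
    ‖∑ i ∈ s, ∑ j ∈ t, α i * β j * e (u i * v j)‖ ^ 2 ≤ Real.exp (8 * Real.pi) * (8 * (A * B) + 3) *
      ((s ×ˢ s).filter (fun p => |u p.1 - u p.2| ≤ 1 / B)).card *
      ((t ×ˢ t).filter (fun p => |v p.1 - v p.2| ≤ 1 / A)).card := by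
  classical
  have := dls s t (fun i => if i ∈ s then u i else 0) (fun j => if j ∈ t then v j else 0) A B hA hB
    (fun i => by split_ifs with h; exacts [hu i h, by simp [hA.le]])
    (fun i => by split_ifs with h; exacts [hv i h, by simp [hB.le]])
    (fun i => if i ∈ s then α i else 0) (fun j => if j ∈ t then β j else 0)
    (fun i => by split_ifs with h; exacts [hα i h, by simp])
    (fun i => by split_ifs with h; exacts [hβ i h, by simp])
  convert this using 3
  · refine Finset.sum_congr rfl (fun i hi => Finset.sum_congr rfl (fun j hj => ?_))
    simp [hi, hj]
  · congr 2
    refine Finset.filter_congr (fun p hp => ?_)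
    rw [Finset.mem_product] at hp
    simp [hp.1, hp.2]
  · congr 1
    refine Finset.filter_congr (fun p hp => ?_)
    rw [Finset.mem_product] at hp
    simp [hp.1, hp.2]

/-- spaced points in an interval -/
lemma spaced_count {I : Type*} (T : Finset I) (φ : I → ℝ) (z σ ε : ℝ) (hσ : 0 < σ) (hε : 0 ≤ ε)
    (hsp : ∀ x ∈ T, ∀ y ∈ T, x ≠ y → σ ≤ |φ x - φ y|) (hin : ∀ x ∈ T, |φ x - z| ≤ ε) :
    (T.card : ℝ) ≤ 1 + 2 * ε / σ := by
  have h1 : T.card ≤ (Finset.range (⌊2 * ε / σ⌋₊ + 1)).card := by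
    refine Finset.card_le_card_of_injOn (fun x => ⌊(φ x - (z - ε)) / σ⌋₊) ?_ ?_
    · intro x hx
      have := abs_le.mp (hin x hx)
      simp only [Finset.coe_range, Set.mem_Iio]
      apply Nat.lt_succ_of_le
      apply Nat.floor_le_floor
      gcongr; linarith
    · intro x hx y hy hxy
      by_contra hne
      have h2 := hsp x hx y hy hne
      have hx2 := abs_le.mp (hin x hx)
      have hy2 := abs_le.mp (hin y hy)
      simp only at hxy
      have a1 := Nat.floor_le (show 0 ≤ (φ x - (z - ε)) / σ from div_nonneg (by linarith) hσ.le)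
      have a2 := Nat.lt_floor_add_one ((φ x - (z - ε)) / σ)
      have b1 := Nat.floor_le (show 0 ≤ (φ y - (z - ε)) / σ from div_nonneg (by linarith) hσ.le)
      have b2 := Nat.lt_floor_add_one ((φ y - (z - ε)) / σ)
      rw [hxy] at a1 a2
      have h3 : |(φ x - φ y) / σ| < 1 := by
        have : (φ x - φ y) / σ = (φ x - (z - ε)) / σ - (φ y - (z - ε)) / σ := by ring
        rw [this, abs_lt]; constructor <;> linarith only [a1, b2, a2, b1]
      rw [abs_div, abs_of_pos hσ, div_lt_one hσ] at h3
      linarith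
  rw [Finset.card_range] at h1
  have h2 : (T.card : ℝ) ≤ (⌊2 * ε / σ⌋₊ : ℝ) + 1 := by exact_mod_cast h1
  have := Nat.floor_le (show 0 ≤ 2 * ε / σ by positivity)
  linarith

lemma pairs_gcd (T : Finset (ℕ × ℕ)) (g : ℕ) (hg : 1 ≤ g) (U : ℝ) (hU : 0 ≤ U)
    (hT : ∀ p ∈ T, Nat.gcd p.1 p.2 = g ∧ (p.1:ℝ) ≤ U ∧ (p.2:ℝ) ≤ U ∧ 1 ≤ p.1 ∧ 1 ≤ p.2) : (T.card : ℝ) ≤ (U / g) ^ 2 := by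
  have hg0 : (0:ℝ) < g := by exact_mod_cast hg
  have h1 : T.card ≤ ((Finset.Icc 1 ⌊U / g⌋₊) ×ˢ (Finset.Icc 1 ⌊U / g⌋₊)).card := by
    refine Finset.card_le_card_of_injOn (fun p => (p.1 / g, p.2 / g)) ?_ ?_
    · intro p hp
      obtain ⟨h1, h2, h3, h4, h5⟩ := hT p hp
      have d1 : g ∣ p.1 := h1 ▸ Nat.gcd_dvd_left _ _
      have d2 : g ∣ p.2 := h1 ▸ Nat.gcd_dvd_right _ _
      simp only [Finset.coe_product, Set.mem_prod, Finset.coe_Icc, Set.mem_Icc]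
      refine ⟨⟨Nat.div_pos (Nat.le_of_dvd h4 d1) hg, Nat.le_floor ?_⟩, ⟨Nat.div_pos (Nat.le_of_dvd h5 d2) hg, Nat.le_floor ?_⟩⟩
      · rw [Nat.cast_div d1 hg0.ne']; gcongr
      · rw [Nat.cast_div d2 hg0.ne']; gcongr
    · intro p hp q hq hpq
      obtain ⟨h1, -⟩ := hT p hp
      obtain ⟨h1', -⟩ := hT q hq
      simp only [Prod.mk.injEq] at hpq
      have d1 : g ∣ p.1 := h1 ▸ Nat.gcd_dvd_left _ _
      have d2 : g ∣ p.2 := h1 ▸ Nat.gcd_dvd_right _ _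
      have d1' : g ∣ q.1 := h1' ▸ Nat.gcd_dvd_left _ _
      have d2' : g ∣ q.2 := h1' ▸ Nat.gcd_dvd_right _ _
      exact Prod.ext (Nat.div_left_inj d1 d1' |>.mp hpq.1) (Nat.div_left_inj d2 d2' |>.mp hpq.2)
  rw [Finset.card_product, Nat.card_Icc, Nat.add_sub_cancel] at h1
  have h2 : (T.card : ℝ) ≤ (⌊U / g⌋₊ : ℝ) * ⌊U / g⌋₊ := by exact_mod_cast h1
  have h3 := Nat.floor_le (show 0 ≤ U / g by positivity)
  have h4 : (0:ℝ) ≤ (⌊U / g⌋₊ : ℝ) := by positivity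
  nlinarith only [h2, h3]

lemma frac_spacing (g : ℕ) (hg : 1 ≤ g) (U : ℝ) (p q : ℕ × ℕ) (hp : Nat.gcd p.1 p.2 = g) (hq : Nat.gcd q.1 q.2 = g)
    (hp2 : 1 ≤ p.2) (hq2 : 1 ≤ q.2) (hpU : (p.2:ℝ) ≤ U) (hqU : (q.2:ℝ) ≤ U) (hne : p ≠ q) :
    ((g:ℝ) / U) ^ 2 ≤ |(p.1:ℝ) / p.2 - q.1 / q.2| := by
  have hg0 : (0:ℝ) < g := by exact_mod_cast hg
  have hP : (0:ℝ) < p.2 := by exact_mod_cast hp2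
  have hQ : (0:ℝ) < q.2 := by exact_mod_cast hq2
  have hU : 0 < U := by linarith
  -- integer difference
  have hdiff : (p.1:ℤ) * q.2 - q.1 * p.2 ≠ 0 := by
    intro h
    apply hne
    have h1 : p.1 * q.2 = q.1 * p.2 := by zify; linarith
    obtain ⟨a, b, hab, ha, hb⟩ : ∃ a b, Nat.Coprime a b ∧ p.1 = a * g ∧ p.2 = b * g := by
      have := Nat.exists_coprime p.1 p.2
      rw [hp] at this
      obtain ⟨a, b, h1, h2, h3⟩ := this
      exact ⟨a, b, h1, h2, h3⟩
    obtain ⟨a', b', hab', ha', hb'⟩ : ∃ a b, Nat.Coprime a b ∧ q.1 = a * g ∧ q.2 = b * g := by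
      have := Nat.exists_coprime q.1 q.2
      rw [hq] at this
      obtain ⟨a, b, h1, h2, h3⟩ := this
      exact ⟨a, b, h1, h2, h3⟩
    have h2 : a * b' = a' * b := by
      rw [ha, hb, ha', hb'] at h1
      have h3 : (a * b') * (g * g) = (a' * b) * (g * g) := by linarith only [h1]
      exact Nat.eq_of_mul_eq_mul_right (by positivity) h3
    have d1 : b ∣ b' := (hab.symm).dvd_of_dvd_mul_left (Dvd.intro_left a' h2.symm)
    have d2 : b' ∣ b := (hab'.symm).dvd_of_dvd_mul_left (Dvd.intro_left a h2)
    have hbb : b = b' := Nat.dvd_antisymm d1 d2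
    have hb0 : 0 < b := by rw [hb] at hp2; exact Nat.pos_of_mul_pos_right hp2
    have haa : a = a' := by rw [← hbb] at h2; exact Nat.eq_of_mul_eq_mul_right hb0 h2
    exact Prod.ext (by rw [ha, ha', haa]) (by rw [hb, hb', hbb])
  have hdvd : ((g:ℤ)^2) ∣ (p.1:ℤ) * q.2 - q.1 * p.2 := by
    have d1 : (g:ℤ) ∣ p.1 := by exact_mod_cast (hp ▸ Nat.gcd_dvd_left _ _ : g ∣ p.1)
    have d2 : (g:ℤ) ∣ p.2 := by exact_mod_cast (hp ▸ Nat.gcd_dvd_right _ _ : g ∣ p.2)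
    have d3 : (g:ℤ) ∣ q.1 := by exact_mod_cast (hq ▸ Nat.gcd_dvd_left _ _ : g ∣ q.1)
    have d4 : (g:ℤ) ∣ q.2 := by exact_mod_cast (hq ▸ Nat.gcd_dvd_right _ _ : g ∣ q.2)
    rw [sq]
    exact dvd_sub (mul_dvd_mul d1 d4) (mul_dvd_mul d3 d2)
  have hge : (g:ℝ)^2 ≤ |(p.1:ℝ) * q.2 - q.1 * p.2| := by
    have := Int.le_of_dvd (abs_pos.mpr hdiff) ((dvd_abs _ _).mpr hdvd)
    exact_mod_cast this
  rw [div_sub_div _ _ hP.ne' hQ.ne', abs_div, abs_of_pos (mul_pos hP hQ), mul_comm (p.2:ℝ) (q.1:ℝ), div_pow]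
  rw [div_le_div_iff₀ (by positivity) (by positivity)]
  have : (p.2:ℝ) * q.2 ≤ U ^ 2 := by rw [sq]; gcongr
  calc (g:ℝ)^2 * (p.2 * q.2) ≤ |(p.1:ℝ) * q.2 - q.1 * p.2| * U^2 := by gcongr
    _ = _ := by ring

lemma rpow_ge_quarter (p ξ : ℝ) (h1 : 1/4 ≤ ξ) (h2 : ξ ≤ 4) : (4:ℝ) ^ (-|p|) ≤ ξ ^ p := by
  have h0 : 0 < ξ := by linarith
  rw [Real.rpow_def_of_pos h0, Real.rpow_def_of_pos (by norm_num)]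
  apply Real.exp_le_exp.mpr
  have a1 : |Real.log ξ| ≤ Real.log 4 := by
    rw [abs_le]
    constructor
    · rw [← Real.log_inv]; exact Real.log_le_log (by norm_num) (by norm_num; linarith)
    · exact Real.log_le_log h0 h2
  have : |Real.log ξ * p| ≤ Real.log 4 * |p| := by rw [abs_mul]; gcongr
  have := (abs_le.mp this).1
  linarith

lemma rpow_sub_ge (β s s' : ℝ) (hβ : 0 < β) (h1 : 1/4 ≤ s) (h2 : s ≤ 4) (h1' : 1/4 ≤ s') (h2' : s' ≤ 4) :
    β * 4 ^ (-|β - 1|) * |s - s'| ≤ |s ^ β - s' ^ β| := by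
  wlog h : s' ≤ s generalizing s s'
  · rw [abs_sub_comm s, abs_sub_comm (s ^ β)]
    exact this s' s h1' h2' h1 h2 (by linarith)
  rcases h.eq_or_lt with h | h
  · rw [h]; simp
  obtain ⟨ξ, a1, a2, a3⟩ := Dl_mvt [s - s'] (by intro x hx; rw [List.mem_singleton] at hx; linarith) β s' (by linarith)
  simp only [Dl, List.sum_singleton, List.prod_singleton, List.length_singleton, cf, mul_one] at a2 a3
  rw [show s' + (s - s') = s by ring] at a2 a3
  rw [a3, Nat.cast_one]
  have := rpow_ge_quarter (β - 1) ξ (by linarith) (by linarith)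
  have h3 : 0 < s - s' := by linarith
  have h4 : (0:ℝ) < 4 ^ (-|β - 1|) := by positivity
  have hξ : 0 < ξ := by linarith
  have hpos : 0 < (s - s') * β * ξ ^ (β - 1) := by positivity
  have e1 : β * 4 ^ (-|β - 1|) * |s - s'| = β * 4 ^ (-|β - 1|) * (s - s') := by rw [abs_of_pos h3]
  rw [e1]
  refine le_trans ?_ (le_abs_self _)
  calc _ = (s - s') * β * 4 ^ (-|β - 1|) := by ring
    _ ≤ _ := by gcongr

lemma sum_inv_le_log (n : ℕ) : ∑ g ∈ Finset.Icc 1 n, 1 / (g:ℝ) ≤ 1 + Real.log n := by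
  have := harmonic_le_one_add_log n
  rw [harmonic_eq_sum_Icc] at this
  push_cast at this
  simpa only [one_div] using this

/-- Fouvry–Iwaniec type spacing lemma -/
lemma fi (β : ℝ) (hβ : 0 < β) : ∃ C > 0, ∀ (K D ε : ℝ) (Qs : Finset ((ℕ × ℕ) × (ℕ × ℕ))), 1 ≤ K → 1 ≤ D → 0 ≤ ε →
    (∀ p ∈ Qs, (K ≤ p.1.1 ∧ p.1.1 ≤ 4 * K) ∧ (K ≤ p.1.2 ∧ p.1.2 ≤ 4 * K) ∧ (D ≤ p.2.1 ∧ p.2.1 ≤ 4 * D) ∧ (D ≤ p.2.2 ∧ p.2.2 ≤ 4 * D) ∧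
      |(p.1.1:ℝ) * (p.2.1:ℝ) ^ β - p.1.2 * (p.2.2:ℝ) ^ β| ≤ ε * (K * D ^ β)) →
    (Qs.card : ℝ) ≤ C * (K * D + ε * (K * D) ^ 2) * (1 + Real.log (4 * K)) * (1 + Real.log (4 * D)) := by
  set c0 := min 1 (β * 4 ^ (-|β - 1|)) with hc0
  have hc00 : 0 < c0 := lt_min one_pos (by positivity)
  refine ⟨16 + 512 / c0, by positivity, ?_⟩
  intro K D ε Qs hK hD hε hQ
  have hnat : ∀ {x : ℕ} {y : ℝ}, 1 ≤ y → y ≤ x → 1 ≤ x := by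
    intro x y h1 h2
    have : (1:ℝ) ≤ x := by linarith
    exact_mod_cast this
  -- ratio forms
  have hr : ∀ p ∈ Qs, |(p.1.1:ℝ) / p.1.2 - ((p.2.2:ℝ) / p.2.1) ^ β| ≤ ε := by
    intro p hp
    obtain ⟨⟨a1, a2⟩, ⟨b1, b2⟩, ⟨c1, c2⟩, ⟨d1, d2⟩, h⟩ := hQ p hp
    have hk : (0:ℝ) < p.1.2 := by linarith
    have hd : (0:ℝ) < p.2.1 := by linarith
    have hd' : (0:ℝ) < p.2.2 := by linarith
    have hdb : (0:ℝ) < (p.2.1:ℝ) ^ β := by positivity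
    rw [Real.div_rpow hd'.le hd.le, div_sub_div _ _ hk.ne' hdb.ne', abs_div, abs_of_pos (mul_pos hk hdb), div_le_iff₀ (by positivity)]
    refine h.trans ?_
    have : D ^ β ≤ (p.2.1:ℝ) ^ β := Real.rpow_le_rpow (by linarith) c1 hβ.le
    gcongr
  -- fibers
  have hfib : ∀ g ∈ Finset.Icc 1 ⌊4 * K⌋₊, ∀ f ∈ Finset.Icc 1 ⌊4 * D⌋₊,
      ((Qs.filter (fun p => (Nat.gcd p.1.1 p.1.2, Nat.gcd p.2.1 p.2.2) = (g, f))).card : ℝ) ≤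
        (16 + 512 / c0) * (K * D + ε * (K * D)^2) * (1 / g) * (1 / f) := by
    intro g hg f hf
    rw [Finset.mem_Icc] at hg hf
    have hg0 : (1:ℝ) ≤ g := by exact_mod_cast hg.1
    have hf0 : (1:ℝ) ≤ f := by exact_mod_cast hf.1
    set F := Qs.filter (fun p => (Nat.gcd p.1.1 p.1.2, Nat.gcd p.2.1 p.2.2) = (g, f)) with hF
    have hFm : ∀ p ∈ F, p ∈ Qs ∧ Nat.gcd p.1.1 p.1.2 = g ∧ Nat.gcd p.2.1 p.2.2 = f := by
      intro p hp
      rw [hF, Finset.mem_filter, Prod.mk.injEq] at hp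
      exact ⟨hp.1, hp.2.1, hp.2.2⟩
    set x := 4 * K / g with hx
    set y := 4 * D / f with hy
    have hx0 : 0 < x := by positivity
    have hy0 : 0 < y := by positivity
    have B1 : (F.card : ℝ) ≤ y^2 * (1 + 2 * ε * x^2) := by
      have h1 : ((F.image Prod.snd).card : ℝ) ≤ y ^ 2 := by
        refine pairs_gcd _ f hf.1 (4 * D) (by linarith) ?_
        intro q hq
        rw [Finset.mem_image] at hq
        obtain ⟨p, hp, rfl⟩ := hq
        obtain ⟨h1, h2, h3⟩ := hFm p hp
        obtain ⟨_, _, ⟨c1, c2⟩, ⟨d1, d2⟩, _⟩ := hQ p h1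
        exact ⟨h3, c2, d2, hnat hD c1, hnat hD d1⟩
      have h2 := Finset.card_eq_sum_card_image Prod.snd F
      rw [h2]; push_cast
      calc _ ≤ ∑ b ∈ F.image Prod.snd, (1 + 2 * ε * x^2) := by
            refine Finset.sum_le_sum (fun b hb => ?_)
            have := spaced_count (F.filter (fun p => p.2 = b)) (fun p => (p.1.1:ℝ) / p.1.2) (((b.2:ℝ) / b.1) ^ β)
              (((g:ℝ) / (4 * K))^2) ε (by positivity) hε ?_ ?_
            · refine this.trans (le_of_eq ?_)
              rw [hx]; field_simp
            · intro p hp q hq hne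
              rw [Finset.mem_filter] at hp hq
              obtain ⟨h1, h2, h3⟩ := hFm p hp.1
              obtain ⟨h1', h2', h3'⟩ := hFm q hq.1
              obtain ⟨_, ⟨b1, b2⟩, _⟩ := hQ p h1
              obtain ⟨_, ⟨b1', b2'⟩, _⟩ := hQ q h1'
              refine frac_spacing g hg.1 (4 * K) p.1 q.1 h2 h2' (hnat hK b1) (hnat hK b1') b2 b2' ?_
              intro h; exact hne (Prod.ext h (hp.2.trans hq.2.symm))
            · intro p hp
              rw [Finset.mem_filter] at hp
              have := hr p (hFm p hp.1).1
              rw [hp.2] at this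
              exact this
        _ = (F.image Prod.snd).card * (1 + 2 * ε * x^2) := by rw [Finset.sum_const, nsmul_eq_mul]
        _ ≤ _ := by gcongr
    have B2 : (F.card : ℝ) ≤ x^2 * (1 + 2 * ε * y^2 / c0) := by
      have h1 : ((F.image Prod.fst).card : ℝ) ≤ x ^ 2 := by
        refine pairs_gcd _ g hg.1 (4 * K) (by linarith) ?_
        intro q hq
        rw [Finset.mem_image] at hq
        obtain ⟨p, hp, rfl⟩ := hq
        obtain ⟨h1, h2, h3⟩ := hFm p hp
        obtain ⟨⟨c1, c2⟩, ⟨d1, d2⟩, _⟩ := hQ p h1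
        exact ⟨h2, c2, d2, hnat hK c1, hnat hK d1⟩
      have h2 := Finset.card_eq_sum_card_image Prod.fst F
      rw [h2]; push_cast
      calc _ ≤ ∑ b ∈ F.image Prod.fst, (1 + 2 * ε * y^2 / c0) := by
            refine Finset.sum_le_sum (fun b hb => ?_)
            have := spaced_count (F.filter (fun p => p.1 = b)) (fun p => ((p.2.2:ℝ) / p.2.1) ^ β) ((b.1:ℝ) / b.2)
              (c0 * ((f:ℝ) / (4 * D))^2) ε (by positivity) hε ?_ ?_
            · refine this.trans (le_of_eq ?_)
              rw [hy]; field_simp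
            · intro p hp q hq hne
              rw [Finset.mem_filter] at hp hq
              obtain ⟨h1, h2, h3⟩ := hFm p hp.1
              obtain ⟨h1', h2', h3'⟩ := hFm q hq.1
              obtain ⟨_, _, ⟨b1, b2⟩, ⟨a1, a2⟩, _⟩ := hQ p h1
              obtain ⟨_, _, ⟨b1', b2'⟩, ⟨a1', a2'⟩, _⟩ := hQ q h1'
              have hs := frac_spacing f hf.1 (4 * D) p.2.swap q.2.swap (by rw [← h3, Nat.gcd_comm]; rfl)
                (by rw [← h3', Nat.gcd_comm]; rfl) (hnat hD b1) (hnat hD b1') b2 b2' (by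
                  intro h; exact hne (Prod.ext (hp.2.trans hq.2.symm) (Prod.swap_injective h)))
              simp only [Prod.fst_swap, Prod.snd_swap] at hs
              have hq1 : ∀ a b : ℕ, D ≤ a → a ≤ 4 * D → D ≤ b → b ≤ 4 * D → 1/4 ≤ (a:ℝ)/b ∧ (a:ℝ) / b ≤ 4 := by
                intro a b h1 h2 h3 h4
                have : (0:ℝ) < b := by linarith only [hD, h3]
                rw [le_div_iff₀ this, div_le_iff₀ this]
                constructor <;> linarith only [h1, h4, h2, h3]
              have u1 := hq1 _ _ a1 a2 b1 b2
              have u2 := hq1 _ _ a1' a2' b1' b2'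
              have := rpow_sub_ge β _ _ hβ u1.1 u1.2 u2.1 u2.2
              refine le_trans ?_ this
              have : c0 ≤ β * 4 ^ (-|β - 1|) := min_le_right _ _
              gcongr
            · intro p hp
              rw [Finset.mem_filter] at hp
              have := hr p (hFm p hp.1).1
              rw [hp.2, abs_sub_comm] at this
              exact this
        _ = (F.image Prod.fst).card * (1 + 2 * ε * y^2 / c0) := by rw [Finset.sum_const, nsmul_eq_mul]
        _ ≤ _ := by gcongr
    have B3 : (F.card : ℝ) ≤ x * y + 2 / c0 * ε * (x * y)^2 := by
      have hc1 : 1 ≤ 1 / c0 := by rw [le_div_iff₀ hc00, one_mul]; exact min_le_left _ _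
      have hpos : 0 ≤ 2 * ε * (x*y)^2 := by positivity
      rcases le_total x y with h | h
      · refine B2.trans ?_
        have : x^2 ≤ x * y := by nlinarith only [hx0, h]
        calc _ = x^2 + 2 / c0 * ε * (x*y)^2 := by field_simp
          _ ≤ _ := by linarith
      · refine B1.trans ?_
        have : y^2 ≤ x * y := by nlinarith only [hy0, h]
        calc _ = y^2 + 1 * (2 * ε * (x*y)^2) := by ring
          _ ≤ x * y + 1 / c0 * (2 * ε * (x*y)^2) := by gcongr
          _ = _ := by ring
    refine B3.trans ?_
    have e1 : x * y = 16 * (K * D) * (1 / g * (1 / f)) := by rw [hx, hy]; field_simp; norm_num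
    set w := 1 / (g:ℝ) * (1 / f) with hw
    have hw0 : 0 < w := by positivity
    have hw1 : w ≤ 1 := by
      rw [hw]
      exact mul_le_one₀ ((div_le_one (by linarith)).mpr hg0) (by positivity) ((div_le_one (by linarith)).mpr hf0)
    rw [e1]
    have e2 : w^2 ≤ w := by nlinarith only [hw0, hw1]
    have e3 : 0 ≤ ε * (K*D)^2 := by positivity
    have e4 : 0 ≤ K * D := by positivity
    have e5 : 0 < 512 / c0 := by positivity
    calc _ = 16 * (K * D) * w + 512 / c0 * (ε * (K*D)^2) * w^2 := by ring
      _ ≤ 16 * (K * D) * w + 512 / c0 * (ε * (K*D)^2) * w := by gcongr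
      _ ≤ (16 + 512 / c0) * (K * D + ε * (K * D)^2) * w := by
        have : 0 ≤ 512 / c0 * (K * D) := by positivity
        have : 0 ≤ (16 * (ε * (K*D)^2) + 512 / c0 * (K * D)) * w := by positivity
        linarith only [this]
      _ = _ := by rw [hw]; ring
  -- sum up
  have hmaps : ∀ p ∈ Qs, (Nat.gcd p.1.1 p.1.2, Nat.gcd p.2.1 p.2.2) ∈ (Finset.Icc 1 ⌊4 * K⌋₊) ×ˢ (Finset.Icc 1 ⌊4 * D⌋₊) := by
    intro p hp
    obtain ⟨⟨a1, a2⟩, ⟨b1, b2⟩, ⟨c1, c2⟩, ⟨d1, d2⟩, h⟩ := hQ p hp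
    have k1 := hnat hK a1
    have k2 := hnat hD c1
    rw [Finset.mem_product, Finset.mem_Icc, Finset.mem_Icc]
    refine ⟨⟨Nat.gcd_pos_of_pos_left _ k1, Nat.le_floor (le_trans ?_ a2)⟩, ⟨Nat.gcd_pos_of_pos_left _ k2, Nat.le_floor (le_trans ?_ c2)⟩⟩
    · exact_mod_cast Nat.gcd_le_left _ k1
    · exact_mod_cast Nat.gcd_le_left _ k2
  rw [Finset.card_eq_sum_card_fiberwise hmaps, Finset.sum_product]
  push_cast
  set Z := (16 + 512 / c0) * (K * D + ε * (K * D)^2) with hZ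
  have hZ0 : 0 ≤ Z := by positivity
  calc _ ≤ ∑ g ∈ Finset.Icc 1 ⌊4 * K⌋₊, ∑ f ∈ Finset.Icc 1 ⌊4 * D⌋₊, Z * (1 / (g:ℝ)) * (1 / (f:ℝ)) :=
        Finset.sum_le_sum (fun g hg => Finset.sum_le_sum (fun f hf => hfib g hg f hf))
    _ = Z * (∑ g ∈ Finset.Icc 1 ⌊4 * K⌋₊, 1 / (g:ℝ)) * (∑ f ∈ Finset.Icc 1 ⌊4 * D⌋₊, 1 / (f:ℝ)) := by
        rw [mul_assoc, Finset.sum_mul_sum, Finset.mul_sum]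
        refine Finset.sum_congr rfl (fun g _ => ?_)
        rw [Finset.mul_sum]
        refine Finset.sum_congr rfl (fun f _ => ?_)
        ring
    _ ≤ _ := by
        have l1 : ∀ T : ℝ, 1 ≤ T → ∑ g ∈ Finset.Icc 1 ⌊4 * T⌋₊, 1 / (g:ℝ) ≤ 1 + Real.log (4 * T) := by
          intro T hT
          refine (sum_inv_le_log _).trans ?_
          have : (1:ℝ) ≤ (⌊4 * T⌋₊:ℝ) := by
            exact_mod_cast Nat.le_floor (by push_cast; linarith)
          gcongr
          exact Nat.floor_le (by linarith)
        have lk : 0 ≤ Real.log (4 * K) := Real.log_nonneg (by linarith)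
        have := l1 K hK
        have := l1 D hD
        gcongr

lemma divisor_bound (ε : ℝ) (hε : 0 < ε) : ∃ C > 0, ∀ n : ℕ, 1 ≤ n → (n.divisors.card : ℝ) ≤ C * (n:ℝ) ^ ε := by
  set C0 : ℝ := 1 + 1 / (ε * Real.log 2) with hC0
  have hl2 : 0 < Real.log 2 := Real.log_pos (by norm_num)
  have hC1 : 1 ≤ C0 := by rw [hC0]; have : 0 < 1 / (ε * Real.log 2) := by positivity
                          linarith
  set P0 : ℕ := ⌈(2:ℝ) ^ (1 / ε)⌉₊ with hP0
  have key1 : ∀ p v : ℕ, 2 ≤ p → ((v:ℝ) + 1) ≤ C0 * ((p:ℝ) ^ v) ^ ε := by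
    intro p v hp
    have hp' : (2:ℝ) ≤ p := by exact_mod_cast hp
    have e1 : (1:ℝ) + v * (ε * Real.log 2) ≤ ((p:ℝ) ^ v) ^ ε := by
      calc (1:ℝ) + v * (ε * Real.log 2) = (Real.log (((2:ℝ) ^ v) ^ ε)) + 1 := by
            rw [Real.log_rpow (by positivity), Real.log_pow]; ring
        _ ≤ Real.exp (Real.log (((2:ℝ) ^ v) ^ ε)) := Real.add_one_le_exp _
        _ = ((2:ℝ) ^ v) ^ ε := Real.exp_log (by positivity)
        _ ≤ _ := by gcongr
    have hpos : 0 < ε * Real.log 2 := by positivity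
    have : (v:ℝ) + 1 ≤ C0 * (1 + v * (ε * Real.log 2)) := by
      rw [hC0]
      have : (1 / (ε * Real.log 2)) * (v * (ε * Real.log 2)) = v := by field_simp
      have h0 : 0 < 1 / (ε * Real.log 2) := by positivity
      have h1 : 0 ≤ (v:ℝ) * (ε * Real.log 2) := by positivity
      nlinarith
    exact this.trans (by gcongr)
  have key2 : ∀ p v : ℕ, P0 ≤ p → ((v:ℝ) + 1) ≤ ((p:ℝ) ^ v) ^ ε := by
    intro p v hp
    have hp' : (2:ℝ) ^ (1 / ε) ≤ p := (Nat.le_ceil _).trans (by exact_mod_cast hp)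
    have e1 : (2:ℝ) ≤ (p:ℝ) ^ ε := by
      calc (2:ℝ) = ((2:ℝ) ^ (1 / ε)) ^ ε := by rw [← Real.rpow_mul (by norm_num), one_div_mul_cancel hε.ne', Real.rpow_one]
        _ ≤ _ := by gcongr
    rw [← Real.rpow_natCast, ← Real.rpow_mul (by positivity), mul_comm, Real.rpow_mul (by positivity), Real.rpow_natCast]
    calc (v:ℝ) + 1 ≤ 2 ^ v := by exact_mod_cast Nat.lt_two_pow_self
      _ ≤ _ := by gcongr
  refine ⟨C0 ^ P0, by positivity, ?_⟩
  intro n hn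
  have hn0 : n ≠ 0 := by omega
  rw [Nat.card_divisors hn0]
  have hnn : (n:ℝ) ^ ε = ∏ p ∈ n.primeFactors, ((p:ℝ) ^ (n.factorization p)) ^ ε := by
    rw [Real.finsetProd_rpow _ _ (by intros; positivity)]
    congr 1
    have := Nat.prod_factorization_pow_eq_self hn0
    conv_lhs => rw [← this]
    rw [Finsupp.prod, Nat.support_factorization]
    push_cast; rfl
  have h3 : ∏ p ∈ n.primeFactors, (if p < P0 then C0 else 1) ≤ C0 ^ P0 := by
    rw [Finset.prod_ite, Finset.prod_const_one, mul_one, Finset.prod_const]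
    apply pow_le_pow_right₀ hC1
    calc _ ≤ (Finset.range P0).card := by
          apply Finset.card_le_card
          intro p hp
          simp only [Finset.mem_filter] at hp
          exact Finset.mem_range.mpr hp.2
      _ = P0 := Finset.card_range _
  rw [hnn]
  push_cast
  calc ∏ p ∈ n.primeFactors, ((n.factorization p : ℝ) + 1)
      ≤ ∏ p ∈ n.primeFactors, ((if p < P0 then C0 else 1) * ((p:ℝ) ^ (n.factorization p)) ^ ε) := by
        apply Finset.prod_le_prod
        · intros; positivity
        · intro p hp
          have hp2 := (Nat.prime_of_mem_primeFactors hp).two_le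
          split_ifs with h
          · exact key1 _ _ hp2
          · rw [one_mul]; exact key2 _ _ (by omega)
    _ = (∏ p ∈ n.primeFactors, (if p < P0 then C0 else 1)) * _ := Finset.prod_mul_distrib
    _ ≤ _ := by gcongr

/-- close pairs of a union -/
lemma pairs_split {I : Type*} [DecidableEq I] (s : Finset I) (u : I → ℝ) (δ : ℝ) (hδ : 0 < δ) (J : ℕ) (f : I → ℕ) (hf : ∀ i ∈ s, f i < J) :
    (((s ×ˢ s).filter (fun p => |u p.1 - u p.2| ≤ δ)).card : ℝ) ≤
      3 * J * ∑ j ∈ Finset.range J, (((s ×ˢ s).filter (fun p => |u p.1 - u p.2| ≤ δ ∧ f p.1 = j ∧ f p.2 = j)).card : ℝ) := by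
  classical
  set g : I → ℤ := fun i => ⌊u i / δ⌋ with hg
  set cells := s.image g with hcells
  set n : ℤ → ℝ := fun z => ((s.filter (fun i => g i = z)).card : ℝ) with hn
  set nj : ℕ → ℤ → ℝ := fun j z => ((s.filter (fun i => g i = z ∧ f i = j)).card : ℝ) with hnj
  -- first: total pairs ≤ 3 Σ n²
  have hsq : ∀ z, n z ^ 2 ≤ J * ∑ j ∈ Finset.range J, (nj j z) ^ 2 := by
    intro z
    have e1 : n z = ∑ j ∈ Finset.range J, nj j z := by
      simp only [hn, hnj]
      rw [Finset.card_eq_sum_card_fiberwise (f := f) (t := Finset.range J)]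
      · push_cast
        apply Finset.sum_congr rfl
        intro j _
        rw [Finset.filter_filter]
      · intro i hi
        simp only [Finset.coe_filter, Set.mem_ofPred_eq] at hi
        simpa using hf i hi.1
    rw [e1]
    have := sq_sum_le_card_mul_sum_sq (s := Finset.range J) (f := fun j => nj j z)
    simpa using this
  have hone : ∀ k : ℤ, (((s ×ˢ s).filter (fun p => g p.1 = g p.2 + k)).card : ℝ) ≤ ∑ z ∈ cells, n z ^ 2 := by
    intro k
    have e2 : (((s ×ˢ s).filter (fun p => g p.1 = g p.2 + k)).card : ℝ) = ∑ z ∈ cells, n (z + k) * n z := by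
      rw [Finset.card_eq_sum_card_fiberwise (f := fun p : I × I => g p.2) (t := cells)]
      · push_cast
        apply Finset.sum_congr rfl
        intro z _
        simp only [hn]
        rw [← Nat.cast_mul, ← Finset.card_product]
        congr 2
        ext p
        simp only [Finset.mem_filter, Finset.mem_product]
        constructor
        · rintro ⟨⟨⟨a, b⟩, c⟩, d⟩
          exact ⟨⟨a, by rw [c, d]⟩, b, d⟩
        · rintro ⟨⟨a, b⟩, c, d⟩
          exact ⟨⟨⟨a, c⟩, by rw [b, d]⟩, d⟩
      · intro p hp
        simp only [Finset.coe_filter, Set.mem_ofPred_eq, Finset.mem_product] at hp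
        exact Finset.mem_image_of_mem _ hp.1.2
    have e3 : ∑ z ∈ cells, n (z + k) ^ 2 ≤ ∑ z ∈ cells, n z ^ 2 := by
      have : ∑ z ∈ cells, n (z + k) ^ 2 = ∑ z ∈ cells.image (fun z => z + k), n z ^ 2 := by
        refine (Finset.sum_image (s := cells) (g := fun z : ℤ => z + k) (f := fun z => n z ^ 2) ?_).symm
        intro a _ b _ h
        simpa using h
      rw [this]
      rw [← Finset.sum_filter_add_sum_filter_not (cells.image (fun z => z + k)) (fun z => z ∈ cells)]
      have z0 : ∑ z ∈ (cells.image (fun z => z + k)).filter (fun z => ¬ z ∈ cells), n z ^ 2 = 0 := by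
        apply Finset.sum_eq_zero
        intro z hz
        have hz2 := (Finset.mem_filter.mp hz).2
        simp only [hn]
        have : s.filter (fun i => g i = z) = ∅ := by
          rw [Finset.filter_eq_empty_iff]
          intro i hi h
          exact hz2 (h ▸ Finset.mem_image_of_mem _ hi)
        rw [this]; simp
      rw [z0, add_zero]
      apply Finset.sum_le_sum_of_subset_of_nonneg
      · intro z hz; exact (Finset.mem_filter.mp hz).2
      · intros; positivity
    rw [e2]
    calc ∑ z ∈ cells, n (z + k) * n z ≤ ∑ z ∈ cells, (n (z + k) ^ 2 / 2 + n z ^ 2 / 2) := by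
          apply Finset.sum_le_sum; intro z _; nlinarith [sq_nonneg (n (z + k) - n z)]
      _ = (∑ z ∈ cells, n (z + k) ^ 2) / 2 + (∑ z ∈ cells, n z ^ 2) / 2 := by
          rw [Finset.sum_add_distrib, Finset.sum_div, Finset.sum_div]
      _ ≤ _ := by linarith
  have h1 : (((s ×ˢ s).filter (fun p => |u p.1 - u p.2| ≤ δ)).card : ℝ) ≤ 3 * ∑ z ∈ cells, n z ^ 2 := by
    have hsub : (s ×ˢ s).filter (fun p => |u p.1 - u p.2| ≤ δ) ⊆
        ((s ×ˢ s).filter (fun p => g p.1 = g p.2 + 0)) ∪ (((s ×ˢ s).filter (fun p => g p.1 = g p.2 + 1)) ∪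
          ((s ×ˢ s).filter (fun p => g p.1 = g p.2 + (-1)))) := by
      intro p hp
      simp only [Finset.mem_filter, Finset.mem_union] at hp ⊢
      obtain ⟨hp1, hp2⟩ := hp
      have h := abs_le.mp hp2
      have a1 : u p.1 / δ ≤ u p.2 / δ + 1 := by rw [div_add_one hδ.ne']; gcongr; linarith
      have a2 : u p.2 / δ ≤ u p.1 / δ + 1 := by rw [div_add_one hδ.ne']; gcongr; linarith
      have b1 : g p.1 ≤ g p.2 + 1 := by
        simp only [hg]; rw [← Int.floor_add_one]; exact Int.floor_mono a1
      have b2 : g p.2 ≤ g p.1 + 1 := by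
        simp only [hg]; rw [← Int.floor_add_one]; exact Int.floor_mono a2
      simp only [hp1, true_and]
      omega
    have c1 := Finset.card_le_card hsub
    have c2 := c1.trans ((Finset.card_union_le _ _).trans (Nat.add_le_add_left (Finset.card_union_le _ _) _))
    have c3 : (((s ×ˢ s).filter (fun p => |u p.1 - u p.2| ≤ δ)).card : ℝ) ≤ ((s ×ˢ s).filter (fun p => g p.1 = g p.2 + 0)).card + (((s ×ˢ s).filter (fun p => g p.1 = g p.2 + 1)).card +
          ((s ×ˢ s).filter (fun p => g p.1 = g p.2 + (-1))).card) := by exact_mod_cast c2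
    linarith [hone 0, hone 1, hone (-1)]
  have h2 : ∀ j, ∑ z ∈ cells, nj j z ^ 2 ≤ (((s ×ˢ s).filter (fun p => |u p.1 - u p.2| ≤ δ ∧ f p.1 = j ∧ f p.2 = j)).card : ℝ) := by
    intro j
    have e2 : ∑ z ∈ cells, nj j z ^ 2 = (((s ×ˢ s).filter (fun p => g p.1 = g p.2 ∧ f p.1 = j ∧ f p.2 = j)).card : ℝ) := by
      rw [Finset.card_eq_sum_card_fiberwise (f := fun p : I × I => g p.2) (t := cells)]
      · push_cast
        apply Finset.sum_congr rfl
        intro z _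
        simp only [hnj]
        rw [sq, ← Nat.cast_mul, ← Finset.card_product]
        congr 2
        ext p
        simp only [Finset.mem_filter, Finset.mem_product]
        constructor
        · rintro ⟨⟨a, b1, b2⟩, c, d1, d2⟩
          exact ⟨⟨⟨a, c⟩, by rw [b1, d1], b2, d2⟩, d1⟩
        · rintro ⟨⟨⟨a, b⟩, c1, c2, c3⟩, d⟩
          exact ⟨⟨a, by rw [c1, d], c2⟩, b, d, c3⟩
      · intro p hp
        simp only [Finset.coe_filter, Set.mem_ofPred_eq, Finset.mem_product] at hp
        exact Finset.mem_image_of_mem _ hp.1.2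
    rw [e2]
    norm_cast
    apply Finset.card_le_card
    intro p hp
    simp only [Finset.mem_filter] at hp ⊢
    refine ⟨hp.1, ?_, hp.2.2⟩
    have := Int.abs_sub_lt_one_of_floor_eq_floor hp.2.1
    rw [← sub_div, abs_div, abs_of_pos hδ, div_lt_one hδ] at this
    exact this.le
  calc _ ≤ 3 * ∑ z ∈ cells, n z ^ 2 := h1
    _ ≤ 3 * ∑ z ∈ cells, (J * ∑ j ∈ Finset.range J, (nj j z) ^ 2) := by
        gcongr with z _; exact hsq z
    _ = 3 * J * ∑ j ∈ Finset.range J, ∑ z ∈ cells, (nj j z) ^ 2 := by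
        rw [← Finset.mul_sum, Finset.sum_comm]; ring
    _ ≤ _ := by gcongr with j _; exact h2 j

lemma rpow_le_quarter (p ξ : ℝ) (h1 : 1/4 ≤ ξ) (h2 : ξ ≤ 4) : ξ ^ p ≤ (4:ℝ) ^ |p| := by
  have := rpow_ge_quarter (-p) ξ h1 h2
  rw [abs_neg, Real.rpow_neg (by norm_num), Real.rpow_neg (by linarith)] at this
  exact (inv_le_inv₀ (by positivity) (by have : 0 < ξ := by linarith
                                         positivity)).mp this

lemma rpow_cmp (p t ζ : ℝ) (ht : 0 < t) (h1 : t / 4 ≤ ζ) (h2 : ζ ≤ 4 * t) : ζ ^ p ≤ 4 ^ |p| * t ^ p := by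
  have := rpow_le_quarter p (ζ / t) (by rw [le_div_iff₀ ht]; linarith) (by rw [div_le_iff₀ ht]; linarith)
  rw [Real.div_rpow (by linarith) ht.le, div_le_iff₀ (by positivity)] at this
  exact this

lemma symavg (s : ℝ) : ∃ C > 0, ∀ t ξ : ℝ, 0 < t → 0 ≤ ξ → ξ ≤ t / 2 →
    |(t + ξ) ^ s + (t - ξ) ^ s - 2 * t ^ s| ≤ C * ξ ^ 2 * t ^ (s - 2) := by
  refine ⟨(|cf 2 s| + 1) * 4 ^ |s - 2|, by positivity, ?_⟩
  intro t ξ ht hξ hξt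
  rcases hξ.eq_or_lt with h | h
  · rw [← h]; simp [two_mul]
  obtain ⟨ζ, a1, a2, a3⟩ := Dl_mvt [ξ, ξ] (by intro x hx; simp at hx; linarith) s (t - ξ) (by linarith)
  simp only [Dl, List.sum_cons, List.sum_nil, List.prod_cons, List.prod_nil, List.length_cons, List.length_nil] at a2 a3
  rw [show t - ξ + ξ + ξ = t + ξ by ring, show t - ξ + ξ = t by ring] at a3
  rw [show (t + ξ) ^ s + (t - ξ) ^ s - 2 * t ^ s = (t + ξ) ^ s - t ^ s - (t ^ s - (t - ξ) ^ s) by ring, a3]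
  have hζ : 0 < ζ := by linarith
  rw [abs_mul, abs_mul, abs_of_pos (by positivity : 0 < ξ * (ξ * 1)), abs_of_pos (by positivity : 0 < ζ ^ (s - ((0 + 1 + 1 : ℕ):ℝ)))]
  have := rpow_cmp (s - 2) t ζ ht (by linarith) (by linarith)
  norm_num at this ⊢
  have hp : 0 < ζ ^ (s - 2) := by positivity
  calc ξ * ξ * |cf 2 s| * ζ ^ (s - 2) ≤ ξ * ξ * (|cf 2 s| + 1) * (4 ^ |s - 2| * t ^ (s - 2)) := by gcongr; linarith
    _ = _ := by ring

lemma hasDeriv_pow_add (s t a : ℝ) (h : 0 < t + a) : HasDerivAt (fun a : ℝ => (t + a) ^ s) (s * (t + a) ^ (s - 1)) a := by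
  have := ((hasDerivAt_id a).const_add t).rpow_const (p := s) (Or.inl h.ne')
  simpa using this

lemma hasDeriv_pow_sub (s t a : ℝ) (h : 0 < t - a) : HasDerivAt (fun a : ℝ => (t - a) ^ s) (-(s * (t - a) ^ (s - 1))) a := by
  have := ((hasDerivAt_id a).const_sub t).rpow_const (p := s) (Or.inl h.ne')
  simpa using this

lemma sym1 (s : ℝ) : ∃ C > 0, ∀ t a : ℝ, 0 < t → 0 ≤ a → a ≤ t / 2 →
    |(t + a) ^ s - (t - a) ^ s - 2 * a * (s * t ^ (s - 1))| ≤ C * a ^ 3 * t ^ (s - 3) := by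
  obtain ⟨C, hC, h⟩ := symavg (s - 1)
  refine ⟨(|s| + 1) * C, by positivity, ?_⟩
  intro t a ht ha hat
  rcases ha.eq_or_lt with h0 | h0
  · rw [← h0]; simp
  have hd : ∀ x : ℝ, 0 ≤ x → x ≤ a → HasDerivAt (fun a : ℝ => (t + a) ^ s - (t - a) ^ s - 2 * a * (s * t ^ (s - 1)))
      (s * (t + x) ^ (s - 1) - -(s * (t - x) ^ (s - 1)) - 2 * (s * t ^ (s - 1))) x := by
    intro x h1 h2
    apply HasDerivAt.sub
    · exact (hasDeriv_pow_add s t x (by linarith)).sub (hasDeriv_pow_sub s t x (by linarith))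
    · simpa using ((hasDerivAt_id x).const_mul 2).mul_const (s * t ^ (s - 1))
  obtain ⟨ξ, ⟨b1, b2⟩, b3⟩ := exists_hasDerivAt_eq_slope _ _ h0
    (fun x hx => (hd x hx.1 hx.2).continuousAt.continuousWithinAt) (fun x hx => hd x hx.1.le hx.2.le)
  rw [eq_div_iff (by linarith)] at b3
  simp only [add_zero, sub_zero, mul_zero, zero_mul, sub_self] at b3
  rw [← b3, show s * (t + ξ) ^ (s - 1) - -(s * (t - ξ) ^ (s - 1)) - 2 * (s * t ^ (s - 1)) = s * ((t + ξ) ^ (s - 1) + (t - ξ) ^ (s - 1) - 2 * t ^ (s - 1)) by ring,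
    abs_mul, abs_mul, abs_of_pos h0]
  have := h t ξ ht b1.le (by linarith)
  rw [show s - 1 - 2 = s - 3 by ring] at this
  calc _ ≤ (|s| + 1) * (C * a ^ 2 * t ^ (s - 3)) * a := by
        gcongr
        · linarith
        · exact this.trans (by gcongr)
    _ = _ := by ring

lemma sym2 (s : ℝ) : ∃ C > 0, ∀ t A B : ℝ, 0 < t → 0 ≤ B → B < A → A ≤ t / 2 →
    |((t + A) ^ s + (t - A) ^ s) - ((t + B) ^ s + (t - B) ^ s) - s * (s - 1) * t ^ (s - 2) * (A ^ 2 - B ^ 2)| ≤ C * (A ^ 2 - B ^ 2) * A ^ 2 * t ^ (s - 4) := by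
  obtain ⟨C, hC, h⟩ := sym1 (s - 1)
  refine ⟨(|s| + 1) * C, by positivity, ?_⟩
  intro t A B ht hB hBA hA
  set G : ℝ → ℝ := fun a => (t + a) ^ s + (t - a) ^ s - s * (s - 1) * t ^ (s - 2) * a ^ 2 with hG
  have hd : ∀ x : ℝ, B ≤ x → x ≤ A → HasDerivAt G
      (s * (t + x) ^ (s - 1) + -(s * (t - x) ^ (s - 1)) - s * (s - 1) * t ^ (s - 2) * (2 * x)) x := by
    intro x h1 h2
    apply HasDerivAt.sub
    · exact (hasDeriv_pow_add s t x (by linarith)).add (hasDeriv_pow_sub s t x (by linarith))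
    · simpa using (hasDerivAt_pow 2 x).const_mul (s * (s - 1) * t ^ (s - 2))
  have hd2 : ∀ x : ℝ, HasDerivAt (fun x : ℝ => x ^ 2) (2 * x) x := by
    intro x; simpa using hasDerivAt_pow 2 x
  obtain ⟨ξ, ⟨b1, b2⟩, b3⟩ := exists_ratio_hasDerivAt_eq_ratio_slope G _ hBA
    (fun x hx => (hd x hx.1 hx.2).continuousAt.continuousWithinAt) (fun x hx => hd x hx.1.le hx.2.le)
    (fun x : ℝ => x ^ 2) (fun x => 2 * x) (by fun_prop) (fun x _ => hd2 x)
  have hξ : 0 < ξ := by linarith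
  have h1 := h t ξ ht hξ.le (by linarith)
  rw [show s - 1 - 1 = s - 2 by ring, show s - 1 - 3 = s - 4 by ring] at h1
  have hAB : 0 < A ^ 2 - B ^ 2 := by nlinarith only [hB, hBA]
  have e1 : ((t + A) ^ s + (t - A) ^ s) - ((t + B) ^ s + (t - B) ^ s) - s * (s - 1) * t ^ (s - 2) * (A ^ 2 - B ^ 2) = G A - G B := by
    simp only [hG]; ring
  have e2 : (G A - G B) = (A ^ 2 - B ^ 2) * (s * ((t + ξ) ^ (s - 1) - (t - ξ) ^ (s - 1) - 2 * ξ * ((s - 1) * t ^ (s - 2)))) / (2 * ξ) := by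
    rw [eq_div_iff (by positivity), ← b3]; ring
  rw [e1, e2, abs_div, abs_mul, abs_mul, abs_of_pos hAB, abs_of_pos (by positivity : 0 < 2 * ξ), div_le_iff₀ (by positivity)]
  calc _ ≤ (A ^ 2 - B ^ 2) * ((|s| + 1) * (C * ξ ^ 3 * t ^ (s - 4))) := by
        gcongr; linarith
    _ = ((|s| + 1) * C * (A ^ 2 - B ^ 2) * ξ ^ 2 * t ^ (s - 4)) * ξ := by ring
    _ ≤ ((|s| + 1) * C * (A ^ 2 - B ^ 2) * A ^ 2 * t ^ (s - 4)) * (2 * ξ) := by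
        gcongr; linarith

lemma Dl2_approx (c : ℝ) : ∃ C > 0, ∀ q q' n : ℝ, 0 < q → 0 < q' → 0 < n → q + q' ≤ n →
    |Dl [q, q'] (fun x => x ^ c) n - c * (c - 1) * (q * q') * (n + (q + q') / 2) ^ (c - 2)| ≤
      C * (q * q') * (q + q') ^ 2 * (n + (q + q') / 2) ^ (c - 4) := by
  obtain ⟨C, hC, h⟩ := sym2 c
  refine ⟨C, hC, ?_⟩
  intro q q' n hq hq' hn hqn
  wlog hqq : q' ≤ q generalizing q q'
  · have := this q' q hq' hq (by linarith) (by linarith)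
    rw [add_comm q', mul_comm q'] at this
    convert this using 3
    simp only [Dl]; rw [add_right_comm]; ring
  have := h (n + (q + q') / 2) ((q + q') / 2) ((q - q') / 2) (by linarith) (by linarith) (by linarith) (by linarith)
  rw [show ((q + q') / 2) ^ 2 - ((q - q') / 2) ^ 2 = q * q' by ring,
    show n + (q + q') / 2 + (q + q') / 2 = n + q + q' by ring, show n + (q + q') / 2 - (q + q') / 2 = n by ring,
    show n + (q + q') / 2 + (q - q') / 2 = n + q by ring, show n + (q + q') / 2 - (q - q') / 2 = n + q' by ring] at this
  simp only [Dl]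
  calc _ = |(n + q + q') ^ c + n ^ c - ((n + q) ^ c + (n + q') ^ c) - c * (c - 1) * (n + (q + q') / 2) ^ (c - 2) * (q * q')| := by
        congr 1; ring
    _ ≤ _ := this
    _ ≤ _ := by
        have : ((q + q') / 2) ^ 2 ≤ (q + q') ^ 2 := by nlinarith only [mul_pos hq hq']
        gcongr

lemma inj_help (q q' n a b : ℕ) (hq : 1 ≤ q) (h : q * q' = q * a) (h3 : 2 * n + q + q' = 2 * b + q + a) : q' = a ∧ n = b := by
  have := Nat.eq_of_mul_eq_mul_left (by omega) h
  exact ⟨this, by omega⟩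

lemma log_bound (ε : ℝ) (hε : 0 < ε) : ∃ C > 0, ∀ U : ℝ, 1 ≤ U → 1 + Real.log (8 * U) ≤ C * U ^ ε := by
  refine ⟨1 + Real.log 8 + 1 / ε, by have := Real.log_pos (by norm_num : (1:ℝ) < 8); positivity, ?_⟩
  intro U hU
  have h1 : Real.log U ≤ U ^ ε / ε := Real.log_le_rpow_div (by linarith) hε
  have h2 : 1 ≤ U ^ ε := Real.one_le_rpow hU hε.le
  rw [Real.log_mul (by norm_num) (by linarith)]
  have := Real.log_pos (by norm_num : (1:ℝ) < 8)
  have h3 : (1 + Real.log 8) * 1 ≤ (1 + Real.log 8) * U ^ ε := by gcongr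
  have h4 : U ^ ε / ε = 1 / ε * U ^ ε := by ring
  rw [h4] at h1
  linarith [add_mul (1 + Real.log 8) (1 / ε) (U ^ ε)]

lemma natlog_bound (n : ℕ) (U : ℝ) (hn : 1 ≤ n) (h : (n:ℝ) ≤ U) : ((Nat.log 2 n + 1 : ℕ) : ℝ) ≤ 2 * (1 + Real.log (8 * U)) := by
  have h0 : (0:ℝ) < n := by exact_mod_cast hn
  have h1 : ((2:ℝ) ^ (Nat.log 2 n)) ≤ U := by
    have : 2 ^ (Nat.log 2 n) ≤ n := Nat.pow_log_le_self 2 (by omega)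
    exact le_trans (by exact_mod_cast this) h
  have h2 := Real.log_le_log (by positivity) h1
  rw [Real.log_pow] at h2
  have h3 := Real.log_two_gt_d9
  have h4 : Real.log U ≤ Real.log (8 * U) := Real.log_le_log (by linarith) (by linarith)
  push_cast
  have : (0:ℝ) ≤ Nat.log 2 n := by positivity
  nlinarith only [h2, h3, h4]

set_option maxHeartbeats 1000000 in
lemma Nu (c : ℝ) (hc : 2 < c) (ε : ℝ) (hε : 0 < ε) : ∃ C > 0, ∀ (Q Q' N : ℕ) (δ : ℝ), 1 ≤ Q → 1 ≤ Q' → 1 ≤ N → Q + Q' ≤ N → 0 < δ →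
    ∀ s : Finset (ℕ × ℕ × ℕ), s = Finset.Ico 1 Q ×ˢ Finset.Ico 1 Q' ×ˢ Finset.Ico N (2 * N) → ∀ U : ℝ, U = (Q:ℝ) * Q' * N →
    (((s ×ˢ s).filter (fun p => |Dl [(p.1.1:ℝ), (p.1.2.1:ℝ)] (fun x => x ^ c) p.1.2.2 - Dl [(p.2.1:ℝ), (p.2.2.1:ℝ)] (fun x => x ^ c) p.2.2.2|
      ≤ δ * ((Q:ℝ) * Q' * (N:ℝ) ^ (c - 2)))).card : ℝ) ≤ C * U ^ ε * (U + U ^ 2 * (δ + ((Q:ℝ) + Q') ^ 2 / (N:ℝ) ^ 2)) := by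
  classical
  obtain ⟨C1, hC1, h1⟩ := fi (c - 2) (by linarith)
  obtain ⟨C2, hC2, h2⟩ := Dl2_approx c
  obtain ⟨Cd, hCd, hd⟩ := divisor_bound (ε / 6) (by positivity)
  obtain ⟨Cl, hCl, hl⟩ := log_bound (ε / 6) (by positivity)
  set C3 := 2 * C2 * 4 ^ |c - 4| with hC3
  have hC30 : 0 < C3 := by positivity
  refine ⟨3 * (2 * Cl) * (2 * Cl) * (Cd * Cd) * (C1 * (4 * (1 + 2 * C3))) * Cl * Cl, by positivity, ?_⟩
  intro Q Q' N δ hQ hQ' hN hQN hδ s hs U hU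
  have hQr : (1:ℝ) ≤ Q := by exact_mod_cast hQ
  have hQ'r : (1:ℝ) ≤ Q' := by exact_mod_cast hQ'
  have hNr : (1:ℝ) ≤ N := by exact_mod_cast hN
  have hQNr : (Q:ℝ) + Q' ≤ N := by exact_mod_cast hQN
  have hQQU : (Q:ℝ) * Q' ≤ U := by rw [hU]; exact le_mul_of_one_le_right (by positivity) hNr
  have hQQ1 : (1:ℝ) ≤ (Q:ℝ) * Q' := one_le_mul_of_one_le_of_one_le hQr hQ'r
  have hNU : (N:ℝ) ≤ U := by rw [hU]; exact le_mul_of_one_le_left (by positivity) hQQ1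
  have hU1 : 1 ≤ U := hNr.trans hNU
  set ρ := ((Q:ℝ) + Q') ^ 2 / (N:ℝ) ^ 2 with hρ
  have hρ0 : 0 < ρ := by positivity
  set V := U ^ (ε / 6) with hV
  have hV1 : 1 ≤ V := Real.one_le_rpow hU1 (by positivity)
  have hUV : U ^ ε = V ^ 6 := by
    rw [hV, ← Real.rpow_natCast, ← Real.rpow_mul (by linarith)]; congr 1; push_cast; ring
  set J := Nat.log 2 (Q * Q') + 1 with hJ
  have hJV : (J:ℝ) ≤ 2 * Cl * V := by
    have := natlog_bound (Q * Q') U (Nat.mul_pos hQ hQ') (by push_cast; exact hQQU)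
    have := hl U hU1
    linarith
  set u : ℕ × ℕ × ℕ → ℝ := fun i => Dl [(i.1:ℝ), (i.2.1:ℝ)] (fun x => x ^ c) i.2.2 with hu
  have hmem : ∀ i ∈ s, (1 ≤ i.1 ∧ i.1 < Q) ∧ (1 ≤ i.2.1 ∧ i.2.1 < Q') ∧ (N ≤ i.2.2 ∧ i.2.2 < 2 * N) := by
    intro i hi
    rw [hs] at hi
    simpa [Finset.mem_product] using hi
  have hsp := pairs_split s u (δ * ((Q:ℝ) * Q' * (N:ℝ) ^ (c - 2))) (by positivity) J (fun i => Nat.log 2 (i.1 * i.2.1)) (by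
    intro i hi
    obtain ⟨⟨a1, a2⟩, ⟨b1, b2⟩, _⟩ := hmem i hi
    apply Nat.lt_succ_of_le
    exact Nat.log_mono_right (Nat.mul_le_mul a2.le b2.le))
  refine hsp.trans ?_
  -- approx
  have happ : ∀ i ∈ s, ∀ K : ℝ, ((i.1 * i.2.1 : ℕ) : ℝ) ≤ 2 * K → |u i - c * (c - 1) * ((i.1 * i.2.1 : ℕ):ℝ) * (((2 * i.2.2 + i.1 + i.2.1 : ℕ):ℝ) / 2) ^ (c - 2)| ≤ C3 * K * (N:ℝ) ^ (c - 2) * ρ := by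
    intro i hi K hK
    obtain ⟨⟨a1, a2⟩, ⟨b1, b2⟩, d1, d2⟩ := hmem i hi
    have a1r : (1:ℝ) ≤ i.1 := by exact_mod_cast a1
    have b1r : (1:ℝ) ≤ i.2.1 := by exact_mod_cast b1
    have a2r : (i.1:ℝ) ≤ Q := by exact_mod_cast a2.le
    have b2r : (i.2.1:ℝ) ≤ Q' := by exact_mod_cast b2.le
    have d1r : (N:ℝ) ≤ i.2.2 := by exact_mod_cast d1
    have d2r : (i.2.2:ℝ) ≤ 2 * N := by exact_mod_cast d2.le
    have := h2 i.1 i.2.1 i.2.2 (by linarith) (by linarith) (by linarith) (by linarith only [hQNr, a2r, b2r, d1r])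
    have e1 : (((2 * i.2.2 + i.1 + i.2.1 : ℕ):ℝ) / 2) = i.2.2 + ((i.1:ℝ) + i.2.1) / 2 := by push_cast; ring
    rw [e1]
    push_cast at hK ⊢
    refine this.trans ?_
    have r1 := rpow_cmp (c - 4) N (i.2.2 + ((i.1:ℝ) + i.2.1) / 2) (by linarith only [hQr, hQ'r, hQNr]) (by linarith only [hQr, hQ'r, hQNr, a1r, b1r, d1r]) (by linarith only [hQr, hQ'r, hQNr, a2r, b2r, d2r])
    have r2 : (N:ℝ) ^ (c - 4) = (N:ℝ) ^ (c - 2) / (N:ℝ) ^ 2 := by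
      rw [← Real.rpow_natCast, ← Real.rpow_sub (by linarith only [hQr, hQ'r, hQNr])]; congr 1; push_cast; ring
    rw [r2] at r1
    have hK0 : 0 ≤ K := by nlinarith only [hK]
    calc _ ≤ C2 * (2 * K) * ((Q:ℝ) + Q') ^ 2 * (4 ^ |c - 4| * ((N:ℝ) ^ (c - 2) / (N:ℝ) ^ 2)) := by gcongr
      _ = _ := by rw [hC3, hρ]; ring
  have hblock : ∀ j ∈ Finset.range J, (((s ×ˢ s).filter (fun p => |u p.1 - u p.2| ≤ δ * ((Q:ℝ) * Q' * (N:ℝ) ^ (c - 2)) ∧ Nat.log 2 (p.1.1 * p.1.2.1) = j ∧ Nat.log 2 (p.2.1 * p.2.2.1) = j)).card : ℝ)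
      ≤ (Cd * V) * (Cd * V) * (C1 * (4 * (1 + 2 * C3)) * (U + U ^ 2 * (δ + ρ)) * (Cl * V) * (Cl * V)) := by
    intro j hj
    set T := (s ×ˢ s).filter (fun p => |u p.1 - u p.2| ≤ δ * ((Q:ℝ) * Q' * (N:ℝ) ^ (c - 2)) ∧ Nat.log 2 (p.1.1 * p.1.2.1) = j ∧ Nat.log 2 (p.2.1 * p.2.2.1) = j) with hT
    set K : ℝ := 2 ^ j with hK
    have hK1 : 1 ≤ K := one_le_pow₀ (by norm_num)
    have hKQ : K ≤ (Q:ℝ) * Q' := by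
      have h3 : 2 ^ j ≤ Q * Q' := (Nat.pow_le_pow_right (by norm_num) (by have := Finset.mem_range.mp hj; omega : j ≤ Nat.log 2 (Q * Q'))).trans
        (Nat.pow_log_le_self 2 (Nat.mul_pos hQ hQ').ne')
      rw [hK]; exact_mod_cast h3
    set π : (ℕ × ℕ × ℕ) × (ℕ × ℕ × ℕ) → (ℕ × ℕ) × (ℕ × ℕ) := fun p =>
      ((p.1.1 * p.1.2.1, p.2.1 * p.2.2.1), (2 * p.1.2.2 + p.1.1 + p.1.2.1, 2 * p.2.2.2 + p.2.1 + p.2.2.1)) with hπ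
    have hTm : ∀ p ∈ T, p.1 ∈ s ∧ p.2 ∈ s ∧ |u p.1 - u p.2| ≤ δ * ((Q:ℝ) * Q' * (N:ℝ) ^ (c - 2)) ∧ Nat.log 2 (p.1.1 * p.1.2.1) = j ∧ Nat.log 2 (p.2.1 * p.2.2.1) = j := by
      intro p hp
      rw [hT, Finset.mem_filter, Finset.mem_product] at hp
      exact ⟨hp.1.1, hp.1.2, hp.2⟩
    have hkb : ∀ i ∈ s, Nat.log 2 (i.1 * i.2.1) = j → K ≤ ((i.1 * i.2.1 : ℕ):ℝ) ∧ ((i.1 * i.2.1 : ℕ):ℝ) ≤ 2 * K := by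
      intro i hi h
      obtain ⟨⟨a1, a2⟩, ⟨b1, b2⟩, _⟩ := hmem i hi
      have hp : i.1 * i.2.1 ≠ 0 := (Nat.mul_pos a1 b1).ne'
      have x1 : 2 ^ j ≤ i.1 * i.2.1 := h ▸ Nat.pow_log_le_self 2 hp
      have x2 : i.1 * i.2.1 < 2 ^ (j + 1) := h ▸ Nat.lt_pow_succ_log_self (by norm_num) _
      rw [hK]
      refine ⟨by exact_mod_cast x1, ?_⟩
      rw [pow_succ'] at x2
      exact_mod_cast x2.le
    have hdb : ∀ i ∈ s, 2 * (N:ℝ) ≤ ((2 * i.2.2 + i.1 + i.2.1 : ℕ):ℝ) ∧ ((2 * i.2.2 + i.1 + i.2.1 : ℕ):ℝ) ≤ 4 * (2 * N) := by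
      intro i hi
      obtain ⟨⟨a1, a2⟩, ⟨b1, b2⟩, d1, d2⟩ := hmem i hi
      have x1 : 2 * N ≤ 2 * i.2.2 + i.1 + i.2.1 := by omega
      have x2 : 2 * i.2.2 + i.1 + i.2.1 ≤ 4 * (2 * N) := by omega
      exact ⟨by exact_mod_cast x1, by exact_mod_cast x2⟩
    have hc2 : 1 ≤ c * (c - 1) := by nlinarith only [hc]
    have hfi := h1 K (2 * N) ((δ * ((Q:ℝ) * Q') / K + 2 * C3 * ρ) / (c * (c - 1))) (T.image π) hK1 (by linarith) (by positivity) (by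
      intro b hb
      obtain ⟨p, hp, rfl⟩ := Finset.mem_image.mp hb
      obtain ⟨m1, m2, m3, m4, m5⟩ := hTm p hp
      have k1 := hkb _ m1 m4
      have k2 := hkb _ m2 m5
      refine ⟨⟨k1.1, by linarith⟩, ⟨k2.1, by linarith⟩, hdb _ m1, hdb _ m2, ?_⟩
      have y1 := happ _ m1 K k1.2
      have y2 := happ _ m2 K k2.2
      simp only [hπ]
      set k := ((p.1.1 * p.1.2.1 : ℕ):ℝ)
      set k' := ((p.2.1 * p.2.2.1 : ℕ):ℝ)
      set d := ((2 * p.1.2.2 + p.1.1 + p.1.2.1 : ℕ):ℝ) with hd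
      set d' := ((2 * p.2.2.2 + p.2.1 + p.2.2.1 : ℕ):ℝ) with hd'
      have hd0 : 0 ≤ d := Nat.cast_nonneg _
      have hd0' : 0 ≤ d' := Nat.cast_nonneg _
      have z : |c * (c - 1) * (k * (d / 2) ^ (c - 2) - k' * (d' / 2) ^ (c - 2))| ≤ δ * ((Q:ℝ) * Q' * (N:ℝ) ^ (c - 2)) + 2 * (C3 * K * (N:ℝ) ^ (c - 2) * ρ) := by
        rw [abs_le] at y1 y2 m3 ⊢
        constructor <;> linarith only [m3, y1, y2]
      rw [Real.div_rpow hd0 (by norm_num), Real.div_rpow hd0' (by norm_num), abs_mul, abs_of_pos (by linarith only [hc2]),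
        show k * (d ^ (c - 2) / 2 ^ (c - 2)) - k' * (d' ^ (c - 2) / 2 ^ (c - 2)) = (k * d ^ (c - 2) - k' * d' ^ (c - 2)) / 2 ^ (c - 2) by ring,
        abs_div, abs_of_pos (by positivity : (0:ℝ) < 2 ^ (c - 2))] at z
      have z2 : |k * d ^ (c - 2) - k' * d' ^ (c - 2)| ≤ (δ * ((Q:ℝ) * Q' * (N:ℝ) ^ (c - 2)) + 2 * (C3 * K * (N:ℝ) ^ (c - 2) * ρ)) * 2 ^ (c - 2) / (c * (c - 1)) := by
        rw [le_div_iff₀ (by linarith only [hc2])]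
        rw [← mul_div_assoc, div_le_iff₀ (by positivity)] at z
        linarith only [z]
      refine z2.trans (le_of_eq ?_)
      rw [Real.mul_rpow (by norm_num) (by positivity)]
      field_simp)
    have hcard : (T.card : ℝ) ≤ (Cd * V) * (Cd * V) * ((T.image π).card : ℝ) := by
      rw [Finset.card_eq_sum_card_image π T]
      push_cast
      have : ∀ b ∈ T.image π, ((T.filter (fun a => π a = b)).card : ℝ) ≤ (Cd * V) * (Cd * V) := by
        intro b hb
        obtain ⟨p, hp, hpb⟩ := Finset.mem_image.mp hb
        obtain ⟨m1, m2, m3, m4, m5⟩ := hTm p hp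
        have k1 := hkb _ m1 m4
        have k2 := hkb _ m2 m5
        have db : ∀ k : ℕ, K ≤ (k:ℝ) → (k:ℝ) ≤ U → (k.divisors.card : ℝ) ≤ Cd * V := by
          intro k hk hk2
          have hk1 : 1 ≤ k := by
            have : (1:ℝ) ≤ k := by linarith only [hK1, hk]
            exact_mod_cast this
          refine (hd k hk1).trans ?_
          rw [hV]; gcongr
        have hkU : ∀ i ∈ s, ((i.1 * i.2.1 : ℕ):ℝ) ≤ U := by
          intro i hi
          obtain ⟨⟨a1, a2⟩, ⟨b1, b2⟩, _⟩ := hmem i hi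
          refine le_trans ?_ hQQU
          exact_mod_cast Nat.mul_le_mul a2.le b2.le
        have b1 : b.1.1 = p.1.1 * p.1.2.1 := by rw [← hpb]
        have b2 : b.1.2 = p.2.1 * p.2.2.1 := by rw [← hpb]
        have D1 := db b.1.1 (by rw [b1]; exact k1.1) (by rw [b1]; exact hkU _ m1)
        have D2 := db b.1.2 (by rw [b2]; exact k2.1) (by rw [b2]; exact hkU _ m2)
        have hle : (T.filter (fun a => π a = b)).card ≤ (b.1.1.divisors ×ˢ b.1.2.divisors).card := by
          refine Finset.card_le_card_of_injOn (fun p => (p.1.1, p.2.1)) ?_ ?_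
          · intro r hr
            simp only [Finset.coe_filter, Set.mem_ofPred_eq] at hr
            obtain ⟨n1, n2, n3, n4, n5⟩ := hTm r hr.1
            have := hr.2
            simp only [Finset.coe_product, Set.mem_prod, Finset.mem_coe, Nat.mem_divisors]
            have q1 := hmem _ n1
            have q2 := hmem _ n2
            rw [← this]
            exact ⟨⟨Dvd.intro _ rfl, (Nat.mul_pos q1.1.1 q1.2.1.1).ne'⟩, ⟨Dvd.intro _ rfl, (Nat.mul_pos q2.1.1 q2.2.1.1).ne'⟩⟩
          · intro r hr r' hr' h
            simp only [Finset.coe_filter, Set.mem_ofPred_eq] at hr hr'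
            obtain ⟨n1, n2, _⟩ := hTm r hr.1
            have q1 := (hmem _ n1).1.1
            have q2 := (hmem _ n2).1.1
            have e := hr.2.trans hr'.2.symm
            simp only [hπ, Prod.mk.injEq] at e h
            obtain ⟨⟨e1, e2⟩, e3, e4⟩ := e
            obtain ⟨h1, h2⟩ := h
            rw [← h1] at e1 e3
            rw [← h2] at e2 e4
            have f1 := inj_help _ _ _ _ _ q1 e1 e3
            have f2 := inj_help _ _ _ _ _ q2 e2 e4
            exact Prod.ext (Prod.ext h1 (Prod.ext f1.1 f1.2)) (Prod.ext h2 (Prod.ext f2.1 f2.2))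
        rw [Finset.card_product] at hle
        calc ((T.filter (fun a => π a = b)).card : ℝ) ≤ (b.1.1.divisors.card : ℝ) * b.1.2.divisors.card := by rw [← Nat.cast_mul]; exact Nat.cast_le.mpr hle
          _ ≤ _ := mul_le_mul D1 D2 (Nat.cast_nonneg _) (by positivity)
      calc _ ≤ ∑ b ∈ T.image π, (Cd * V) * (Cd * V) := Finset.sum_le_sum this
        _ = _ := by rw [Finset.sum_const, nsmul_eq_mul]; ring
    refine hcard.trans (mul_le_mul_of_nonneg_left (hfi.trans ?_) (by positivity))
    have l1 : 1 + Real.log (4 * K) ≤ Cl * V := by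
      refine le_trans ?_ (hl U hU1)
      gcongr
      · norm_num
      · linarith only [hQQU, hKQ]
    have l2 : 1 + Real.log (4 * (2 * N)) ≤ Cl * V := by
      refine le_trans ?_ (hl U hU1)
      rw [show 4 * (2 * (N:ℝ)) = 8 * N by ring]
      gcongr
    have l10 : 0 ≤ 1 + Real.log (4 * K) := by
      have := Real.log_nonneg (by linarith only [hK1] : 1 ≤ 4 * K); linarith
    have l20 : 0 ≤ 1 + Real.log (4 * (2 * (N:ℝ))) := by
      have := Real.log_nonneg (by linarith : 1 ≤ 4 * (2 * (N:ℝ))); linarith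
    have main : K * (2 * N) + (δ * ((Q:ℝ) * Q') / K + 2 * C3 * ρ) / (c * (c - 1)) * (K * (2 * N)) ^ 2 ≤ 4 * (1 + 2 * C3) * (U + U ^ 2 * (δ + ρ)) := by
      have hKU : K * N ≤ U := by rw [hU]; gcongr
      have g1 : (δ * ((Q:ℝ) * Q') / K + 2 * C3 * ρ) / (c * (c - 1)) ≤ δ * ((Q:ℝ) * Q') / K + 2 * C3 * ρ :=
        div_le_self (by positivity) hc2
      have g2 : (δ * ((Q:ℝ) * Q') / K + 2 * C3 * ρ) * (K * (2 * N)) ^ 2 = 4 * (δ * U * (K * N) + 2 * C3 * ρ * (K * N) ^ 2) := by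
        rw [hU]; field_simp; ring
      calc _ ≤ K * (2 * N) + (δ * ((Q:ℝ) * Q') / K + 2 * C3 * ρ) * (K * (2 * N)) ^ 2 := by gcongr
        _ = 2 * (K * N) + 4 * (δ * U * (K * N) + 2 * C3 * ρ * (K * N) ^ 2) := by rw [g2]; ring
        _ ≤ 2 * U + 4 * (δ * U * U + 2 * C3 * ρ * U ^ 2) := by gcongr
        _ ≤ _ := by
          have t1 : 0 ≤ C3 * U := by positivity
          have t2 : 0 ≤ C3 * U ^ 2 * δ := by positivity
          have t3 : 0 ≤ U ^ 2 * ρ := by positivity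
          nlinarith only [hQr, hQ'r, hQNr, hNU, t1, t2, t3]
    calc _ ≤ C1 * (4 * (1 + 2 * C3) * (U + U ^ 2 * (δ + ρ))) * (Cl * V) * (Cl * V) := by gcongr
      _ = _ := by ring
  calc _ ≤ 3 * (J:ℝ) * ∑ j ∈ Finset.range J, (Cd * V) * (Cd * V) * (C1 * (4 * (1 + 2 * C3)) * (U + U ^ 2 * (δ + ρ)) * (Cl * V) * (Cl * V)) := by
        gcongr with j hj
        exact hblock j hj
    _ = 3 * (J:ℝ) * J * ((Cd * V) * (Cd * V) * (C1 * (4 * (1 + 2 * C3)) * (U + U ^ 2 * (δ + ρ)) * (Cl * V) * (Cl * V))) := by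
        rw [Finset.sum_const, Finset.card_range, nsmul_eq_mul]; ring
    _ ≤ 3 * (2 * Cl * V) * (2 * Cl * V) * ((Cd * V) * (Cd * V) * (C1 * (4 * (1 + 2 * C3)) * (U + U ^ 2 * (δ + ρ)) * (Cl * V) * (Cl * V))) := by
        gcongr
    _ = _ := by rw [hUV]; ring

lemma rpow_lip (p x y : ℝ) (h1 : 1/4 ≤ x) (h2 : x ≤ 4) (h1' : 1/4 ≤ y) (h2' : y ≤ 4) :
    |x ^ p - y ^ p| ≤ |p| * 4 ^ |p - 1| * |x - y| := by
  wlog h : y ≤ x generalizing x y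
  · rw [abs_sub_comm x, abs_sub_comm (x ^ p)]
    exact this y x h1' h2' h1 h2 (by linarith)
  rcases h.eq_or_lt with h | h
  · rw [h]; simp
  obtain ⟨ξ, a1, a2, a3⟩ := Dl_mvt [x - y] (by intro x hx; rw [List.mem_singleton] at hx; linarith) p y (by linarith)
  simp only [Dl, List.sum_singleton, List.prod_singleton, List.length_singleton, cf, mul_one] at a2 a3
  rw [show y + (x - y) = x by ring] at a2 a3
  rw [a3, Nat.cast_one]
  have := rpow_le_quarter (p - 1) ξ (by linarith) (by linarith)
  have hξ : 0 < ξ := by linarith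
  rw [abs_mul, abs_mul, abs_of_pos (by positivity : 0 < ξ ^ (p - 1))]
  calc _ = |p| * ξ ^ (p - 1) * |x - y| := by ring
    _ ≤ _ := by gcongr

lemma rpow_lip_low (p W x y : ℝ) (hp : 0 < p) (hp1 : p ≤ 1) (hW : 0 < W) (h1 : W ≤ x) (h2 : W ≤ y) :
    |x ^ p - y ^ p| ≤ W ^ (p - 1) * |x - y| := by
  wlog h : y ≤ x generalizing x y
  · rw [abs_sub_comm x, abs_sub_comm (x ^ p)]
    exact this y x h2 h1 (by linarith)
  rcases h.eq_or_lt with h | h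
  · rw [h]; simp
  obtain ⟨ξ, a1, a2, a3⟩ := Dl_mvt [x - y] (by intro x hx; rw [List.mem_singleton] at hx; linarith) p y (by linarith)
  simp only [Dl, List.sum_singleton, List.prod_singleton, List.length_singleton, cf, mul_one] at a2 a3
  rw [show y + (x - y) = x by ring] at a2 a3
  rw [a3, Nat.cast_one]
  have hξ : 0 < ξ := by linarith
  have : ξ ^ (p - 1) ≤ W ^ (p - 1) := Real.rpow_le_rpow_of_nonpos hW (by linarith) (by linarith)
  rw [abs_mul, abs_mul, abs_of_pos (by positivity : 0 < ξ ^ (p - 1)), abs_of_pos hp]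
  calc _ = p * ξ ^ (p - 1) * |x - y| := by ring
    _ ≤ 1 * W ^ (p - 1) * |x - y| := by gcongr
    _ = _ := by ring

/-- `ψ_r(m) = (((m+r)^c - m^c)/c)^(1/(c-1))` -/
noncomputable def psi (c r m : ℝ) : ℝ := (((m + r) ^ c - m ^ c) / c) ^ (1 / (c - 1))

lemma phi_mvt (c r m : ℝ) (hc : 2 < c) (hr : 0 < r) (hm : 0 < m) : ∃ ξ, m ≤ ξ ∧ ξ ≤ m + r ∧ ((m + r) ^ c - m ^ c) / c = r * ξ ^ (c - 1) := by
  obtain ⟨ξ, a1, a2, a3⟩ := Dl_mvt [r] (by intro x hx; rw [List.mem_singleton] at hx; linarith) c m hm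
  simp only [Dl, List.sum_singleton, List.prod_singleton, List.length_singleton, cf, mul_one, Nat.cast_one] at a2 a3
  refine ⟨ξ, a1, a2, ?_⟩
  rw [a3]; field_simp

lemma psi_deriv (c : ℝ) (hc : 2 < c) (hc3 : c < 3) : ∃ C > 0, ∀ r m : ℝ, 0 < r → r ≤ m → ∃ D, HasDerivAt (psi c r) D m ∧
    |D - r ^ (1 / (c - 1))| ≤ C * r ^ (1 / (c - 1)) * (r / m) ^ 2 := by
  obtain ⟨C1, hC1, h1⟩ := sym1 c
  obtain ⟨C2, hC2, h2⟩ := sym1 (c - 1)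
  set γ := 1 / (c - 1) with hγ
  refine ⟨(|γ - 1| * 4 ^ |γ - 1 - 1| * C1) * (1 + C2) + C2, by positivity, ?_⟩
  intro r m hr hrm
  have hm : 0 < m := by linarith
  set t := m + r / 2 with ht
  have ht0 : 0 < t := by linarith
  have x1 := h1 t (r / 2) ht0 (by linarith) (by linarith)
  have x2 := h2 t (r / 2) ht0 (by linarith) (by linarith)
  rw [show t + r / 2 = m + r by rw [ht]; ring, show t - r / 2 = m by rw [ht]; ring] at x1 x2
  set a1 := ((m + r) ^ c - m ^ c) / c / (r * t ^ (c - 1)) with ha1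
  set b1 := ((m + r) ^ (c - 1) - m ^ (c - 1)) / ((c - 1) * (r * t ^ (c - 2))) with hb1
  have hrt : 0 < r * t ^ (c - 1) := by positivity
  have hrt2 : 0 < r * t ^ (c - 2) := by positivity
  have hc1 : 0 < c - 1 := by linarith
  have htm : r / t ≤ r / m := by gcongr; linarith
  have hrm1 : r / m ≤ 1 := by rw [div_le_one hm]; exact hrm
  have hrt1 : r / t ≤ 1 := htm.trans hrm1
  have hrt0 : 0 < r / t := by positivity
  have p1 : t ^ (c - 3) = t ^ (c - 1) / t ^ 2 := by
    rw [← Real.rpow_natCast, ← Real.rpow_sub ht0]; congr 1; push_cast; ring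
  have p2 : t ^ (c - 1 - 3) = t ^ (c - 2) / t ^ 2 := by
    rw [← Real.rpow_natCast, ← Real.rpow_sub ht0]; congr 1; push_cast; ring
  have ea : |a1 - 1| ≤ C1 * (r / t) ^ 2 := by
    have : a1 - 1 = ((m + r) ^ c - m ^ c - 2 * (r / 2) * (c * t ^ (c - 1))) / (c * (r * t ^ (c - 1))) := by
      rw [ha1]; field_simp
    rw [this, abs_div, abs_of_pos (by positivity : 0 < c * (r * t ^ (c - 1))), div_le_iff₀ (by positivity)]
    refine x1.trans ?_
    rw [p1]
    calc _ = (C1 * (r / t) ^ 2 * (r * t ^ (c - 1))) * (1 / 8) := by field_simp; ring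
      _ ≤ (C1 * (r / t) ^ 2 * (r * t ^ (c - 1))) * c := by gcongr; linarith only [hc, hc3]
      _ = _ := by ring
  have eb : |b1 - 1| ≤ C2 * (r / t) ^ 2 := by
    have : b1 - 1 = ((m + r) ^ (c - 1) - m ^ (c - 1) - 2 * (r / 2) * ((c - 1) * t ^ (c - 1 - 1))) / ((c - 1) * (r * t ^ (c - 2))) := by
      rw [hb1, show c - 1 - 1 = c - 2 by ring]; field_simp
    rw [this, abs_div, abs_of_pos (by positivity : 0 < (c - 1) * (r * t ^ (c - 2))), div_le_iff₀ (by positivity)]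
    refine x2.trans ?_
    rw [p2]
    calc _ = (C2 * (r / t) ^ 2 * (r * t ^ (c - 2))) * (1 / 8) := by field_simp; ring
      _ ≤ (C2 * (r / t) ^ 2 * (r * t ^ (c - 2))) * (c - 1) := by gcongr; linarith only [hc, hc3]
      _ = _ := by ring
  -- a1 in [1/4,4]
  obtain ⟨ξ, k1, k2, k3⟩ := phi_mvt c r m hc hr hm
  have ha : a1 = (ξ / t) ^ (c - 1) := by
    rw [ha1, k3, Real.div_rpow (by linarith) ht0.le]; field_simp
  have q1 : 1 / 2 ≤ ξ / t := by rw [le_div_iff₀ ht0]; linarith only [hr, hrm, ht, k1]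
  have q2 : ξ / t ≤ 2 := by rw [div_le_iff₀ ht0]; linarith only [hr, hrm, ht, k2]
  have ha4 : 1 / 4 ≤ a1 := by
    rw [ha]
    calc (1:ℝ) / 4 = (1 / 2) ^ (2:ℝ) := by norm_num
      _ ≤ (1 / 2) ^ (c - 1) := Real.rpow_le_rpow_of_exponent_ge (by norm_num) (by norm_num) (by linarith only [hc3])
      _ ≤ _ := by gcongr
  have ha5 : a1 ≤ 4 := by
    rw [ha]
    calc _ ≤ (2:ℝ) ^ (c - 1) := by gcongr
      _ ≤ 2 ^ (2:ℝ) := Real.rpow_le_rpow_of_exponent_le (by norm_num) (by linarith only [hc3])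
      _ = 4 := by norm_num
  have hlip := rpow_lip (γ - 1) a1 1 ha4 ha5 (by norm_num) (by norm_num)
  rw [Real.one_rpow] at hlip
  have hφ : 0 < ((m + r) ^ c - m ^ c) / c := by rw [k3]; have : 0 < ξ := by linarith only [hr, hrm, k1]
                                                positivity
  have hder : HasDerivAt (psi c r) ((((c * (m + r) ^ (c - 1)) - (c * m ^ (c - 1))) / c) * γ * (((m + r) ^ c - m ^ c) / c) ^ (γ - 1)) m := by
    have d1 : HasDerivAt (fun m : ℝ => (m + r) ^ c) (c * (m + r) ^ (c - 1)) m := by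
      have := hasDeriv_pow_add c r m (by linarith only [hr, hrm])
      simpa [add_comm] using this
    have d2 : HasDerivAt (fun m : ℝ => m ^ c) (c * m ^ (c - 1)) m := Real.hasDerivAt_rpow_const (Or.inl hm.ne')
    exact ((d1.sub d2).div_const c).rpow_const (p := γ) (Or.inl hφ.ne')
  refine ⟨_, hder, ?_⟩
  have hD : (((c * (m + r) ^ (c - 1)) - (c * m ^ (c - 1))) / c) * γ * (((m + r) ^ c - m ^ c) / c) ^ (γ - 1) = r ^ γ * (a1 ^ (γ - 1) * b1) := by
    have e1 : ((m + r) ^ c - m ^ c) / c = r * t ^ (c - 1) * a1 := by rw [ha1]; field_simp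
    have e2 : ((c * (m + r) ^ (c - 1)) - (c * m ^ (c - 1))) / c = (c - 1) * (r * t ^ (c - 2)) * b1 := by
      rw [hb1]; field_simp
    rw [e1, e2, Real.mul_rpow hrt.le (by linarith only [hc, hc3, ha4]), Real.mul_rpow hr.le (by positivity), ← Real.rpow_mul ht0.le]
    have e3 : (c - 1) * (γ - 1) = -(c - 2) := by rw [hγ]; field_simp; ring
    have e4 : r ^ γ = r * r ^ (γ - 1) := by
      rw [Real.rpow_sub hr, Real.rpow_one]; field_simp
    have e5 : (c - 1) * γ = 1 := by rw [hγ]; field_simp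
    rw [e3, Real.rpow_neg ht0.le, e4]
    have : t ^ (c - 2) ≠ 0 := by positivity
    calc _ = ((c - 1) * γ) * (t ^ (c - 2) * (t ^ (c - 2))⁻¹) * (r * r ^ (γ - 1) * (a1 ^ (γ - 1) * b1)) := by ring
      _ = _ := by rw [e5, mul_inv_cancel₀ this]; ring
  rw [hD, show r ^ γ * (a1 ^ (γ - 1) * b1) - r ^ γ = r ^ γ * (a1 ^ (γ - 1) * b1 - 1) by ring, abs_mul, abs_of_pos (by positivity : 0 < r ^ γ)]
  have hb2 : |b1| ≤ 1 + C2 := by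
    have t1 : |b1| ≤ |b1 - 1| + |1| := by simpa using abs_add_le (b1 - 1) 1
    rw [abs_one] at t1
    have t2 : (r / t) ^ 2 ≤ 1 := pow_le_one₀ hrt0.le hrt1
    nlinarith only [hc, hc3, hC2, eb, t1, t2]
  have hfin : |a1 ^ (γ - 1) * b1 - 1| ≤ ((|γ - 1| * 4 ^ |γ - 1 - 1| * C1) * (1 + C2) + C2) * (r / t) ^ 2 := by
    calc |a1 ^ (γ - 1) * b1 - 1| = |(a1 ^ (γ - 1) - 1) * b1 + (b1 - 1)| := by ring_nf
      _ ≤ |a1 ^ (γ - 1) - 1| * |b1| + |b1 - 1| := by rw [← abs_mul]; exact abs_add_le _ _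
      _ ≤ (|γ - 1| * 4 ^ |γ - 1 - 1| * (C1 * (r / t) ^ 2)) * (1 + C2) + C2 * (r / t) ^ 2 := by
          gcongr
          exact hlip.trans (by gcongr)
      _ = _ := by ring
  calc _ ≤ r ^ γ * (((|γ - 1| * 4 ^ |γ - 1 - 1| * C1) * (1 + C2) + C2) * (r / m) ^ 2) := by
        gcongr; exact hfin.trans (by gcongr)
    _ = _ := by ring

lemma psi_diff (c : ℝ) (hc : 2 < c) (hc3 : c < 3) : ∃ C > 0, ∀ r M m m' : ℝ, 0 < r → r ≤ M → M ≤ m → M ≤ m' →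
    |psi c r m' - psi c r m - r ^ (1 / (c - 1)) * (m' - m)| ≤ C * r ^ (1 / (c - 1)) * (r / M) ^ 2 * |m' - m| := by
  obtain ⟨C, hC, h⟩ := psi_deriv c hc hc3
  refine ⟨C, hC, ?_⟩
  intro r M m m' hr hrM hm hm'
  have hM : 0 < M := by linarith
  choose! D hD using (fun m (hm : r ≤ m) => h r m hr hm)
  have := Convex.norm_image_sub_le_of_norm_hasDerivWithin_le (f := fun m => psi c r m - r ^ (1 / (c - 1)) * m) (f' := fun m => D m - r ^ (1 / (c - 1)))
    (s := Set.Ici M) (C := C * r ^ (1 / (c - 1)) * (r / M) ^ 2) (x := m) (y := m') (by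
      intro x hx
      have hx' : M ≤ x := hx
      have d1 := (hD x (by linarith)).1
      have d2 : HasDerivAt (fun m : ℝ => r ^ (1 / (c - 1)) * m) (r ^ (1 / (c - 1))) x := by
        simpa using (hasDerivAt_id x).const_mul (r ^ (1 / (c - 1)))
      exact (d1.sub d2).hasDerivWithinAt) (by
      intro x hx
      have hx' : M ≤ x := hx
      have hx0 : 0 < x := by linarith
      rw [Real.norm_eq_abs]
      refine (hD x (by linarith)).2.trans ?_
      gcongr) (convex_Ici M) hm hm'
  simp only [Real.norm_eq_abs] at this
  convert this using 2
  ring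

lemma small_class (κ a b E d d' : ℝ) (hκ : 0 < κ) (hκ1 : κ ≤ 1) (ha1 : 1 ≤ a) (ha2 : a ≤ 2 * (1 - κ)) (hb1 : 1 ≤ b) (hb2 : b ≤ 2 * (1 - κ))
    (hd : 0 ≤ d) (h : |a * d - b * d'| ≤ E) (hno : ¬ (0 < d' ∧ d < 2 * d' ∧ d' < 2 * d)) : |d| ≤ E / κ ∧ |d'| ≤ E / κ := by
  have hE : 0 ≤ E := (abs_nonneg _).trans h
  have hEκ : E ≤ E / κ := by rw [le_div_iff₀ hκ]; nlinarith
  have h' := abs_le.mp h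
  rw [abs_of_nonneg hd]
  by_cases h1 : d' ≤ 0
  · rw [abs_of_nonpos h1]
    constructor <;> nlinarith
  push Not at h1
  rw [abs_of_pos h1]
  by_cases h2 : 2 * d' ≤ d
  · have : κ * d ≤ E := by nlinarith
    have h3 : d ≤ E / κ := by rw [le_div_iff₀ hκ]; linarith
    exact ⟨h3, by linarith⟩
  push Not at h2
  have h3 : 2 * d ≤ d' := by
    by_contra h4
    push Not at h4
    exact hno ⟨h1, h2, h4⟩
  have : κ * d' ≤ E := by nlinarith
  have h4 : d' ≤ E / κ := by rw [le_div_iff₀ hκ]; linarith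
  exact ⟨by linarith, h4⟩

/-- count for the main class -/
lemma Nv_main (γ : ℝ) (hγ : 0 < γ) : ∃ C > 0, ∀ (R' M1 E : ℝ) (W : Finset ((ℕ × ℕ) × (ℕ × ℕ))), 1 ≤ R' → 1 ≤ M1 → 0 ≤ E →
    (∀ p ∈ W, 1 ≤ p.1.1 ∧ (p.1.1:ℝ) ≤ M1 ∧ (p.1.1:ℝ) < 2 * p.1.2 ∧ (p.1.2:ℝ) < 2 * p.1.1 ∧
      (R' ≤ p.2.1 ∧ p.2.1 ≤ 2 * R') ∧ (R' ≤ p.2.2 ∧ p.2.2 ≤ 2 * R') ∧ |(p.1.1:ℝ) * (p.2.1:ℝ) ^ γ - p.1.2 * (p.2.2:ℝ) ^ γ| ≤ E * R' ^ γ) →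
    (W.card : ℝ) ≤ C * (M1 * R' + E * M1 * R' ^ 2) * (1 + Real.log (8 * (M1 * R'))) ^ 3 := by
  classical
  obtain ⟨C1, hC1, h1⟩ := fi γ hγ
  refine ⟨2 * C1, by positivity, ?_⟩
  intro R' M1 E W hR hM hE hW
  set I := Nat.log 2 ⌊M1⌋₊ + 1 with hI
  have hfl : 1 ≤ ⌊M1⌋₊ := Nat.le_floor (by simpa using hM)
  have hMR : M1 ≤ M1 * R' := le_mul_of_one_le_right (by linarith) hR
  have hRM : R' ≤ M1 * R' := le_mul_of_one_le_left (by linarith) hM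
  set Lg := 1 + Real.log (8 * (M1 * R')) with hLg
  have hLg0 : 0 < Lg := by
    have := Real.log_nonneg (by linarith : 1 ≤ 8 * (M1 * R')); linarith
  have hIb : (I:ℝ) ≤ 2 * Lg := natlog_bound _ _ hfl ((Nat.floor_le (by linarith)).trans hMR)
  have hmin : ∀ p ∈ W, 1 ≤ min p.1.1 p.1.2 ∧ min p.1.1 p.1.2 ≤ ⌊M1⌋₊ ∧ p.1.1 < 2 * p.1.2 ∧ p.1.2 < 2 * p.1.1 := by
    intro p hp
    obtain ⟨x1, x2, x3, x4, _⟩ := hW p hp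
    have y3 : p.1.1 < 2 * p.1.2 := by exact_mod_cast x3
    have y4 : p.1.2 < 2 * p.1.1 := by exact_mod_cast x4
    refine ⟨le_min x1 (by omega), (min_le_left _ _).trans (Nat.le_floor x2), y3, y4⟩
  have hcard : (W.card : ℝ) = ∑ i ∈ Finset.range I, ((W.filter (fun p => Nat.log 2 (min p.1.1 p.1.2) = i)).card : ℝ) := by
    rw [Finset.card_eq_sum_card_fiberwise (f := fun p => Nat.log 2 (min p.1.1 p.1.2)) (t := Finset.range I)]
    · push_cast; rfl
    · intro p hp
      have := hmin p hp
      simp only [Finset.coe_range, Set.mem_Iio]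
      exact Nat.lt_succ_of_le (Nat.log_mono_right this.2.1)
  rw [hcard]
  have hb : ∀ i ∈ Finset.range I, ((W.filter (fun p => Nat.log 2 (min p.1.1 p.1.2) = i)).card : ℝ) ≤ C1 * (M1 * R' + E * M1 * R' ^ 2) * Lg * Lg := by
    intro i hi
    set K : ℝ := 2 ^ i with hK
    have hK1 : 1 ≤ K := one_le_pow₀ (by norm_num)
    have hKM : K ≤ M1 := by
      have h3 : 2 ^ i ≤ ⌊M1⌋₊ := (Nat.pow_le_pow_right (by norm_num) (by have := Finset.mem_range.mp hi; omega : i ≤ Nat.log 2 ⌊M1⌋₊)).trans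
        (Nat.pow_log_le_self 2 (by omega))
      refine le_trans ?_ (Nat.floor_le (by linarith : 0 ≤ M1))
      rw [hK]; exact_mod_cast h3
    have := h1 K R' (E / K) (W.filter (fun p => Nat.log 2 (min p.1.1 p.1.2) = i)) hK1 hR (by positivity) (by
      intro p hp
      rw [Finset.mem_filter] at hp
      obtain ⟨hp, hl⟩ := hp
      obtain ⟨m1, m2, m3, m4⟩ := hmin p hp
      obtain ⟨x1, x2, x3, x4, x5, x6, x7⟩ := hW p hp
      have y1 : 2 ^ i ≤ min p.1.1 p.1.2 := hl ▸ Nat.pow_log_le_self 2 (by omega)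
      have y2 : min p.1.1 p.1.2 < 2 ^ (i + 1) := hl ▸ Nat.lt_pow_succ_log_self (by norm_num) _
      rw [pow_succ] at y2
      set k := 2 ^ i with hk
      have hKk : K = (k:ℝ) := by rw [hk, hK]; push_cast; rfl
      rw [hKk]
      have z1 : k ≤ p.1.1 := by omega
      have z2 : k ≤ p.1.2 := by omega
      have z3 : p.1.1 ≤ 4 * k := by omega
      have z4 : p.1.2 ≤ 4 * k := by omega
      refine ⟨⟨by exact_mod_cast z1, by exact_mod_cast z3⟩, ⟨by exact_mod_cast z2, by exact_mod_cast z4⟩, ⟨x5.1, by linarith⟩, ⟨x6.1, by linarith⟩, ?_⟩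
      refine x7.trans (le_of_eq ?_)
      rw [← hKk]; field_simp)
    refine this.trans ?_
    have e1 : K * R' + E / K * (K * R') ^ 2 = K * R' + E * K * R' ^ 2 := by field_simp
    rw [e1]
    have l1 : 1 + Real.log (4 * K) ≤ Lg := by
      rw [hLg]; gcongr
      · norm_num
      · linarith
    have l2 : 1 + Real.log (4 * R') ≤ Lg := by
      rw [hLg]; gcongr
      · norm_num
    have l10 : 0 ≤ 1 + Real.log (4 * K) := by
      have := Real.log_nonneg (by linarith : 1 ≤ 4 * K); linarith
    have l20 : 0 ≤ 1 + Real.log (4 * R') := by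
      have := Real.log_nonneg (by linarith : 1 ≤ 4 * R'); linarith
    gcongr
  calc _ ≤ ∑ i ∈ Finset.range I, C1 * (M1 * R' + E * M1 * R' ^ 2) * Lg * Lg := Finset.sum_le_sum hb
    _ = I * (C1 * (M1 * R' + E * M1 * R' ^ 2) * Lg * Lg) := by rw [Finset.sum_const, Finset.card_range, nsmul_eq_mul]
    _ ≤ (2 * Lg) * (C1 * (M1 * R' + E * M1 * R' ^ 2) * Lg * Lg) := by gcongr
    _ = _ := by ring

set_option maxHeartbeats 1000000 in
lemma Nv_diff (c : ℝ) (hc : 2 < c) (hc3 : c < 3) : ∃ C ≥ 2, ∀ R' R M δ r r' m m' m0 m0' : ℝ, 1 ≤ R' → R' ≤ R → C * R ≤ M → 0 < δ →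
    R' ≤ r → r ≤ 2 * R' → R' ≤ r' → r' ≤ 2 * R' → M ≤ m → M ≤ m' → M ≤ m0 → M ≤ m0' →
    |((m + r) ^ c - m ^ c) - ((m' + r') ^ c - m' ^ c)| ≤ δ * (R * M ^ (c - 1)) →
    |((m0 + r) ^ c - m0 ^ c) - ((m0' + r') ^ c - m0' ^ c)| ≤ δ * (R * M ^ (c - 1)) → |m - m0| ≤ M / R' →
    |r ^ (1 / (c - 1)) * (m - m0) - r' ^ (1 / (c - 1)) * (m' - m0')| ≤ C * (R / R' * M * δ + R' / M) * R' ^ (1 / (c - 1)) := by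
  obtain ⟨C0, hC0, h0⟩ := psi_diff c hc hc3
  refine ⟨24 * C0 + 4, by linarith, ?_⟩
  intro R' R M δ r r' m m' m0 m0' hR' hRR hM hδ hr1 hr2 hr1' hr2' hm hm' hm0 hm0' hs hs0 hd
  set γ := 1 / (c - 1) with hγ
  have hc1 : 0 < c - 1 := by linarith
  have hγ0 : 0 < γ := by positivity
  have hγ1 : γ ≤ 1 := by rw [hγ, div_le_one hc1]; linarith
  have hM1 : 4 * R ≤ M := by nlinarith only [hc, hc3, hC0, hR', hRR, hM]
  have hM0 : 0 < M := by linarith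
  have hR'0 : 0 < R' := by linarith
  have hR0 : 0 < R := by linarith
  set P := R' ^ γ with hP
  have hP0 : 0 < P := by positivity
  set θ2 := R / R' * M * δ with hθ2
  have hθ20 : 0 < θ2 := by positivity
  -- e0
  have he0 : ∀ m m' : ℝ, M ≤ m → M ≤ m' → |((m + r) ^ c - m ^ c) - ((m' + r') ^ c - m' ^ c)| ≤ δ * (R * M ^ (c - 1)) →
      |psi c r m - psi c r' m'| ≤ P * θ2 := by
    intro m m' hm hm' h
    obtain ⟨ξ, k1, k2, k3⟩ := phi_mvt c r m hc (by linarith) (by linarith)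
    obtain ⟨ξ', k1', k2', k3'⟩ := phi_mvt c r' m' hc (by linarith) (by linarith)
    have hW : 0 < R' * M ^ (c - 1) := by positivity
    have := rpow_lip_low γ (R' * M ^ (c - 1)) (((m + r) ^ c - m ^ c) / c) (((m' + r') ^ c - m' ^ c) / c) hγ0 hγ1 hW
      (by rw [k3]; gcongr <;> linarith) (by rw [k3']; gcongr <;> linarith)
    unfold psi
    rw [← hγ]
    refine this.trans ?_
    rw [← sub_div, abs_div, abs_of_pos (by linarith : 0 < c)]
    have e1 : (R' * M ^ (c - 1)) ^ (γ - 1) = P * M / (R' * M ^ (c - 1)) := by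
      rw [Real.rpow_sub hW, Real.rpow_one, Real.mul_rpow (by linarith) (by positivity), ← Real.rpow_mul hM0.le]
      have : (c - 1) * γ = 1 := by rw [hγ]; field_simp
      rw [this, Real.rpow_one]
    rw [e1]
    have hdc := (div_le_self (abs_nonneg _) (by linarith : 1 ≤ c)).trans h
    calc _ ≤ P * M / (R' * M ^ (c - 1)) * (δ * (R * M ^ (c - 1))) := by
          exact mul_le_mul_of_nonneg_left hdc (by positivity)
      _ = _ := by rw [hθ2]; field_simp
  have f1 := he0 m m' hm hm' hs
  have f2 := he0 m0 m0' hm0 hm0' hs0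
  set κ0 := C0 * (2 * R' / M) ^ 2 with hκ0
  have hκ00 : 0 < κ0 := by positivity
  have hκ1 : κ0 ≤ 1 / 4 := by
    have : 2 * R' / M ≤ 2 / (24 * C0 + 4) := by
      rw [div_le_div_iff₀ hM0 (by positivity)]; nlinarith only [hc, hc3, hC0, hRR, hM]
    calc κ0 ≤ C0 * (2 / (24 * C0 + 4)) ^ 2 := by rw [hκ0]; gcongr
      _ ≤ 1 / 4 := by
        rw [div_pow, ← mul_div_assoc, div_le_div_iff₀ (by positivity) (by norm_num)]
        nlinarith only [hc, hc3, hC0]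
  have g : ∀ r, R' ≤ r → r ≤ 2 * R' → P ≤ r ^ γ ∧ r ^ γ ≤ 2 * P ∧ ∀ m m0, M ≤ m → M ≤ m0 → |psi c r m - psi c r m0 - r ^ γ * (m - m0)| ≤ κ0 * (r ^ γ * |m - m0|) := by
    intro r h1 h2
    have hr0 : 0 < r := by linarith
    refine ⟨by rw [hP]; gcongr, ?_, ?_⟩
    · calc r ^ γ ≤ (2 * R') ^ γ := by gcongr
        _ = 2 ^ γ * P := by rw [Real.mul_rpow (by norm_num) (by linarith)]
        _ ≤ 2 ^ (1:ℝ) * P := by gcongr; norm_num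
        _ = _ := by norm_num
    · intro m m0 hm hm0
      refine (h0 r M m0 m hr0 (by linarith) hm0 hm).trans ?_
      rw [hκ0]
      calc C0 * r ^ γ * (r / M) ^ 2 * |m - m0| ≤ C0 * r ^ γ * (2 * R' / M) ^ 2 * |m - m0| := by gcongr
        _ = _ := by ring
  obtain ⟨a1, a2, a3⟩ := g r hr1 hr2
  obtain ⟨b1, b2, b3⟩ := g r' hr1' hr2'
  have a4 := a3 m m0 hm hm0
  have b4 := b3 m' m0' hm' hm0'
  set A := r ^ γ
  set B := r' ^ γ
  set d := m - m0
  set d' := m' - m0'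
  have key1 : |A * d - B * d'| ≤ 2 * (P * θ2) + κ0 * (A * |d|) + κ0 * (B * |d'|) := by
    rw [abs_le] at f1 f2 a4 b4 ⊢
    constructor <;> linarith only [f1, f2, a4, b4]
  have hAd : |A * d| = A * |d| := by rw [abs_mul, abs_of_pos (by linarith)]
  have hBd : |B * d'| = B * |d'| := by rw [abs_mul, abs_of_pos (by linarith)]
  have key2 : B * |d'| ≤ A * |d| + |A * d - B * d'| := by
    rw [← hAd, ← hBd]
    have := abs_sub_abs_le_abs_sub (B * d') (A * d)
    rw [abs_sub_comm] at this; linarith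
  have hA0 : 0 ≤ A * |d| := mul_nonneg (by linarith) (abs_nonneg _)
  have hB0 : 0 ≤ B * |d'| := mul_nonneg (by linarith) (abs_nonneg _)
  have key3 : B * |d'| ≤ 2 * (A * |d|) + 3 * (P * θ2) := by
    have t1 := mul_le_mul_of_nonneg_right hκ1 hA0
    have t2 := mul_le_mul_of_nonneg_right hκ1 hB0
    have t3 : 0 < P * θ2 := by positivity
    linarith only [key1, key2, hA0, t1, t2, t3]
  have hAdM : A * |d| ≤ 2 * P * (M / R') := by gcongr
  have hκM : κ0 * (2 * P * (M / R')) = 8 * C0 * (R' / M) * P := by rw [hκ0]; field_simp; ring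
  have hPθ : 0 < P * θ2 := by positivity
  calc |A * d - B * d'| ≤ 2 * (P * θ2) + κ0 * (A * |d|) + κ0 * (2 * (A * |d|) + 3 * (P * θ2)) := by
        refine key1.trans ?_; gcongr
    _ = 2 * (P * θ2) + 3 * (κ0 * (A * |d|)) + 3 * (κ0 * (P * θ2)) := by ring
    _ ≤ 2 * (P * θ2) + 3 * (κ0 * (2 * P * (M / R'))) + 3 * ((1 / 4) * (P * θ2)) := by gcongr
    _ = 2 * (P * θ2) + 3 * (8 * C0 * (R' / M) * P) + 3 * ((1 / 4) * (P * θ2)) := by rw [hκM]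
    _ ≤ _ := by
      have t1 : 0 < R' / M * P := by positivity
      have t2 : 0 < C0 * (P * θ2) := by positivity
      nlinarith only [hPθ, t1, t2]

set_option maxHeartbeats 1000000 in
lemma Nv_block (c : ℝ) (hc : 2 < c) (hc3 : c < 3) : ∃ C > (0:ℝ), ∀ (j R M : ℕ) (δ : ℝ) (T : Finset ((ℕ × ℕ) × (ℕ × ℕ))), 2 ^ j ≤ R → C * R ≤ M → 0 < δ → δ * M ≤ 1 →
    (∀ p ∈ T, (2 ^ j ≤ p.1.1 ∧ p.1.1 < 2 ^ (j + 1)) ∧ (2 ^ j ≤ p.2.1 ∧ p.2.1 < 2 ^ (j + 1)) ∧ (M ≤ p.1.2 ∧ p.1.2 < 2 * M) ∧ (M ≤ p.2.2 ∧ p.2.2 < 2 * M) ∧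
      |(((p.1.2:ℝ) + p.1.1) ^ c - (p.1.2:ℝ) ^ c) - (((p.2.2:ℝ) + p.2.1) ^ c - (p.2.2:ℝ) ^ c)| ≤ δ * (R * (M:ℝ) ^ (c - 1))) →
    (T.card : ℝ) ≤ C * ((M:ℝ) * R + (R:ℝ) ^ 3 + ((M:ℝ) * R) ^ 2 * δ) * (1 + Real.log (8 * M)) ^ 3 := by
  classical
  obtain ⟨C2, hC2, hdiff⟩ := Nv_diff c hc hc3
  have hC20 : 0 < C2 := by linarith
  set γ := 1 / (c - 1) with hγ
  have hc1 : 0 < c - 1 := by linarith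
  have hγ0 : 0 < γ := by positivity
  have hγ1 : γ < 1 := by rw [hγ, div_lt_one hc1]; linarith
  obtain ⟨Cm, hCm, hmain⟩ := Nv_main γ hγ0
  set κ : ℝ := 1 - 2 ^ (γ - 1) with hκ
  have h2γ : (2:ℝ) ^ (γ - 1) < 1 := Real.rpow_lt_one_of_one_lt_of_neg (by norm_num) (by linarith)
  have h2γ0 : (0:ℝ) < 2 ^ (γ - 1) := by positivity
  have hκ0 : 0 < κ := by linarith
  have hκ1 : κ ≤ 1 := by linarith
  have hκ2 : 2 * (1 - κ) = 2 ^ γ := by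
    rw [hκ, Real.rpow_sub (by norm_num), Real.rpow_one]; ring
  refine ⟨C2 + (32 * C2 ^ 2 / κ ^ 2 + 2) + Cm * (1 + C2), by positivity, ?_⟩
  intro j R M δ T hjR hRM hδ hδM hT
  set R' : ℝ := 2 ^ j with hR'
  have hR'1 : 1 ≤ R' := one_le_pow₀ (by norm_num)
  have hRR : R' ≤ R := by rw [hR']; exact_mod_cast hjR
  have hC2M : C2 * R ≤ M := by
    refine le_trans ?_ hRM
    gcongr
    have : 0 < 32 * C2 ^ 2 / κ ^ 2 := by positivity
    have : 0 < Cm * (1 + C2) := by positivity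
    linarith
  have hM0 : (0:ℝ) < M := by nlinarith only [hc, hc3, hC2, hR'1, hRR, hC2M]
  have hRM1 : (R:ℝ) ≤ M := by nlinarith only [hc, hc3, hC2, hR'1, hRR, hC2M]
  set M1 : ℝ := M / R' with hM1
  have hM11 : 1 ≤ M1 := by rw [hM1, le_div_iff₀ (by linarith)]; linarith
  set θ := R / R' * M * δ + R' / M with hθ
  have hθ0 : 0 < θ := by positivity
  set E := C2 * θ with hE
  have hE0 : 0 < E := by positivity
  set ι : (ℕ × ℕ) × (ℕ × ℕ) → ℕ := fun p => ⌊((p.1.2:ℝ) - M) / M1⌋₊ with hι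
  set key : (ℕ × ℕ) × (ℕ × ℕ) → ℕ × ℕ × ℕ := fun p => (p.1.1, p.2.1, ι p) with hkey
  have hbase : ∀ k : ℕ × ℕ × ℕ, ∃ p0 : (ℕ × ℕ) × (ℕ × ℕ), (∃ p ∈ T, key p = k) → p0 ∈ T ∧ key p0 = k ∧ ∀ p ∈ T, key p = k → p0.1.2 ≤ p.1.2 := by
    intro k
    by_cases h : ∃ p ∈ T, key p = k
    · obtain ⟨p, hp, hk⟩ := h
      obtain ⟨p0, h1, h2⟩ := Finset.exists_min_image (T.filter (fun p => key p = k)) (fun p => p.1.2) ⟨p, Finset.mem_filter.mpr ⟨hp, hk⟩⟩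
      rw [Finset.mem_filter] at h1
      exact ⟨p0, fun _ => ⟨h1.1, h1.2, fun p hp hk => h2 p (Finset.mem_filter.mpr ⟨hp, hk⟩)⟩⟩
    · exact ⟨((0, 0), (0, 0)), fun h' => absurd h' h⟩
  choose base hb using hbase
  set rs := Finset.Ico (2 ^ j) (2 ^ (j + 1)) with hrs
  set b : ℤ := ⌊E / κ⌋ with hbdef
  set W : Finset ((ℕ × ℕ) × (ℕ × ℕ)) := ((Finset.Icc 1 M ×ˢ Finset.Icc 1 M) ×ˢ (rs ×ˢ rs)).filter (fun p => (p.1.1:ℝ) ≤ M1 ∧ (p.1.1:ℝ) < 2 * p.1.2 ∧ (p.1.2:ℝ) < 2 * p.1.1 ∧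
      |(p.1.1:ℝ) * (p.2.1:ℝ) ^ γ - p.1.2 * (p.2.2:ℝ) ^ γ| ≤ E * R' ^ γ) with hW
  set A : Finset ((ℤ × ℤ) × (ℕ × ℕ)) := (Finset.Icc (-b) b ×ˢ Finset.Icc (-b) b) ×ˢ (rs ×ˢ rs) with hA
  set Bm : Finset ((ℤ × ℤ) × (ℕ × ℕ)) := W.image (fun p => (((p.1.1:ℤ), (p.1.2:ℤ)), p.2)) with hBm
  set Φ : (ℕ × ℕ) × (ℕ × ℕ) → ℕ × ((ℤ × ℤ) × (ℕ × ℕ)) := fun p =>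
    (ι p, (((p.1.2:ℤ) - (base (key p)).1.2, (p.2.2:ℤ) - (base (key p)).2.2), (p.1.1, p.2.1))) with hΦ
  have hcast : ∀ r : ℕ, 2 ^ j ≤ r → r < 2 ^ (j + 1) → R' ≤ r ∧ (r:ℝ) ≤ 2 * R' := by
    intro r h1 h2
    rw [hR']
    refine ⟨by exact_mod_cast h1, ?_⟩
    rw [pow_succ'] at h2
    exact_mod_cast h2.le
  have hle : T.card ≤ (Finset.range (2 ^ j) ×ˢ (A ∪ Bm)).card := by
    refine Finset.card_le_card_of_injOn Φ ?_ ?_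
    · intro p hp
      have hp' : p ∈ T := hp
      obtain ⟨t1, t2, t3, t4, t5⟩ := hT p hp'
      obtain ⟨q1, q2, q3⟩ := hb (key p) ⟨p, hp', rfl⟩
      have q4 := q3 p hp' rfl
      set p0 := base (key p) with hp0
      obtain ⟨u1, u2, u3, u4, u5⟩ := hT p0 q1
      simp only [hkey, Prod.mk.injEq] at q2
      obtain ⟨v1, v2, v3⟩ := q2
      rw [v1, v2] at u5
      simp only [Finset.coe_product, Set.mem_prod, Finset.mem_coe, Finset.mem_range, Finset.mem_union]
      have m1 : (M:ℝ) ≤ p.1.2 := by exact_mod_cast t3.1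
      have m2 : (M:ℝ) ≤ p.2.2 := by exact_mod_cast t4.1
      have m3 : (M:ℝ) ≤ p0.1.2 := by exact_mod_cast u3.1
      have m4 : (M:ℝ) ≤ p0.2.2 := by exact_mod_cast u4.1
      have m5 : (p.1.2:ℝ) < 2 * M := by exact_mod_cast t3.2
      have m6 : (p0.1.2:ℝ) ≤ p.1.2 := by exact_mod_cast q4
      constructor
      · simp only [hΦ, hι]
        rw [Nat.floor_lt (by apply div_nonneg <;> linarith only [m1, hc, hc3, hM11]), div_lt_iff₀ (by linarith only [hc, hc3, hM11])]
        push_cast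
        rw [hM1, ← hR', mul_div_cancel₀ _ (by linarith only [hc, hc3, hR'1])]
        linarith only [m5]
      have hdM : |(p.1.2:ℝ) - p0.1.2| ≤ M / R' := by
        rw [← hM1, abs_of_nonneg (by linarith only [m6])]
        have w1 := Nat.lt_floor_add_one (((p.1.2:ℝ) - M) / M1)
        have w2 := Nat.floor_le (a := ((p0.1.2:ℝ) - M) / M1) (by apply div_nonneg <;> linarith only [m3, hc, hc3, hM11])
        simp only [hι] at v3
        rw [v3] at w2
        have w3 : ((p.1.2:ℝ) - M) / M1 < ((p0.1.2:ℝ) - M) / M1 + 1 := by linarith only [w1, w2]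
        rw [div_add_one (by linarith only [hc, hc3, hM11]), div_lt_div_iff_of_pos_right (by linarith only [hc, hc3, hM11])] at w3
        linarith only [w3]
      obtain ⟨c1, c2⟩ := hcast _ t1.1 t1.2
      obtain ⟨c3, c4⟩ := hcast _ t2.1 t2.2
      have hD := hdiff R' R M δ p.1.1 p.2.1 p.1.2 p.2.2 p0.1.2 p0.2.2 hR'1 hRR hC2M hδ c1 c2 c3 c4 m1 m2 m3 m4 t5 u5 hdM
      rw [← hθ, ← hE] at hD
      have hR'γ : 0 < R' ^ γ := by positivity
      have hrsm : p.1.1 ∈ rs ∧ p.2.1 ∈ rs := ⟨Finset.mem_Ico.mpr t1, Finset.mem_Ico.mpr t2⟩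
      by_cases hcl : 0 < ((p.2.2:ℝ) - p0.2.2) ∧ ((p.1.2:ℝ) - p0.1.2) < 2 * ((p.2.2:ℝ) - p0.2.2) ∧ ((p.2.2:ℝ) - p0.2.2) < 2 * ((p.1.2:ℝ) - p0.1.2)
      · right
        obtain ⟨x1, x2, x3⟩ := hcl
        have y1 : p0.2.2 < p.2.2 := by
          have : (p0.2.2:ℝ) < p.2.2 := by linarith only [x1]
          exact_mod_cast this
        have y2 : p0.1.2 < p.1.2 := by
          have : (p0.1.2:ℝ) < p.1.2 := by linarith only [x1, x3]
          exact_mod_cast this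
        rw [hBm, Finset.mem_image]
        have e1 : ((p.1.2 - p0.1.2 : ℕ):ℝ) = (p.1.2:ℝ) - p0.1.2 := Nat.cast_sub y2.le
        have e2 : ((p.2.2 - p0.2.2 : ℕ):ℝ) = (p.2.2:ℝ) - p0.2.2 := Nat.cast_sub y1.le
        refine ⟨((p.1.2 - p0.1.2, p.2.2 - p0.2.2), (p.1.1, p.2.1)), ?_, ?_⟩
        · rw [hW, Finset.mem_filter]
          refine ⟨?_, ?_, ?_, ?_, ?_⟩
          · simp only [Finset.mem_product, Finset.mem_Icc]
            exact ⟨⟨⟨by omega, by omega⟩, ⟨by omega, by omega⟩⟩, hrsm⟩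
          · simp only [e1]
            exact (le_abs_self _).trans hdM
          · simp only [e1, e2]; exact x2
          · simp only [e1, e2]; exact x3
          · simp only [e1, e2]
            rw [mul_comm _ ((p.1.1:ℝ) ^ γ), mul_comm _ ((p.2.1:ℝ) ^ γ)]
            exact hD
        · simp only [hΦ]
          rw [Nat.cast_sub y2.le, Nat.cast_sub y1.le]
      · left
        have hab : ∀ r : ℕ, R' ≤ r → (r:ℝ) ≤ 2 * R' → 1 ≤ (r:ℝ) ^ γ / R' ^ γ ∧ (r:ℝ) ^ γ / R' ^ γ ≤ 2 * (1 - κ) := by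
          intro r h1 h2
          constructor
          · rw [le_div_iff₀ hR'γ, one_mul]; gcongr
          · rw [div_le_iff₀ hR'γ, hκ2, ← Real.mul_rpow (by norm_num) (by linarith only [hc, hc3, hR'1])]; gcongr
        have hs := small_class κ ((p.1.1:ℝ) ^ γ / R' ^ γ) ((p.2.1:ℝ) ^ γ / R' ^ γ) E ((p.1.2:ℝ) - p0.1.2) ((p.2.2:ℝ) - p0.2.2) hκ0 hκ1
          (hab _ c1 c2).1 (hab _ c1 c2).2 (hab _ c3 c4).1 (hab _ c3 c4).2 (by linarith only [m6]) (by
            rw [div_mul_eq_mul_div, div_mul_eq_mul_div, ← sub_div, abs_div, abs_of_pos hR'γ, div_le_iff₀ hR'γ]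
            exact hD) hcl
        have habs : ∀ z : ℤ, |(z:ℝ)| ≤ E / κ → z ∈ Finset.Icc (-b) b := by
          intro z hz
          rw [Finset.mem_Icc, ← abs_le]
          rw [hbdef, Int.le_floor]
          push_cast; exact hz
        simp only [hA, hΦ, Finset.mem_product]
        refine ⟨⟨habs _ ?_, habs _ ?_⟩, hrsm⟩
        · push_cast; exact hs.1
        · push_cast; exact hs.2
    · intro p hp p' hp' h
      simp only [hΦ, Prod.mk.injEq] at h
      obtain ⟨h1, ⟨h2, h3⟩, h4, h5⟩ := h
      have hk : key p = key p' := by simp only [hkey]; rw [h1, h4, h5]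
      rw [hk] at h2 h3
      have f1 : (p.1.2:ℤ) = p'.1.2 := by linarith only [h2]
      have f2 : (p.2.2:ℤ) = p'.2.2 := by linarith only [h3]
      exact Prod.ext (Prod.ext h4 (by exact_mod_cast f1)) (Prod.ext h5 (by exact_mod_cast f2))
  have hcardA : (A.card : ℝ) ≤ (2 * (E / κ) + 1) ^ 2 * R' ^ 2 := by
    rw [hA]
    simp only [Finset.card_product, Int.card_Icc, hrs, Nat.card_Ico]
    have e1 : (2 ^ (j + 1) - 2 ^ j : ℕ) = 2 ^ j := by rw [pow_succ]; omega
    rw [e1]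
    have hb0 : 0 ≤ b := by rw [hbdef, Int.floor_nonneg]; positivity
    have e2 : (((b + 1 - -b).toNat : ℕ) : ℝ) = 2 * (b:ℝ) + 1 := by
      have : (((b + 1 - -b).toNat : ℕ) : ℤ) = 2 * b + 1 := by rw [Int.toNat_of_nonneg (by omega)]; ring
      exact_mod_cast this
    push_cast
    rw [e2, ← hR']
    have : (b:ℝ) ≤ E / κ := Int.floor_le _
    have hb0' : (0:ℝ) ≤ b := by exact_mod_cast hb0
    calc (2 * (b:ℝ) + 1) * (2 * b + 1) * (R' * R') = (2 * (b:ℝ) + 1) ^ 2 * R' ^ 2 := by ring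
      _ ≤ _ := by gcongr
  have hcardW := hmain R' M1 E W hR'1 hM11 hE0.le (by
    intro p hp
    rw [hW, Finset.mem_filter] at hp
    obtain ⟨x0, x1, x2, x3, x4⟩ := hp
    simp only [Finset.mem_product, Finset.mem_Icc, hrs, Finset.mem_Ico] at x0
    exact ⟨x0.1.1.1, x1, x2, x3, hcast _ x0.2.1.1 x0.2.1.2, hcast _ x0.2.2.1 x0.2.2.2, x4⟩)
  have e3 : M1 * R' = M := by rw [hM1]; field_simp
  rw [e3] at hcardW
  set Lg := 1 + Real.log (8 * (M:ℝ)) with hLg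
  have hLg1 : 1 ≤ Lg := by
    have := Real.log_nonneg (by linarith only [hc, hc3, hR'1, hRR, hRM1] : (1:ℝ) ≤ 8 * (M:ℝ)); linarith
  have hcard : (T.card : ℝ) ≤ R' * (A.card + W.card) := by
    rw [Finset.card_product, Finset.card_range] at hle
    have h3 : (A ∪ Bm).card ≤ A.card + W.card := (Finset.card_union_le _ _).trans (Nat.add_le_add_left Finset.card_image_le _)
    have h4 := hle.trans (Nat.mul_le_mul_left _ h3)
    rw [hR']
    exact_mod_cast h4
  have hRr : (1:ℝ) ≤ R := by linarith
  have hθ2 : θ ^ 2 ≤ 4 * (R / R') ^ 2 := by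
    have w1 : R / R' * M * δ ≤ R / R' := by
      rw [mul_assoc]; apply mul_le_of_le_one_right (by positivity); linarith
    have w2 : R' / M ≤ R / R' := by
      calc R' / M ≤ 1 := by rw [div_le_one hM0]; linarith
        _ ≤ _ := by rw [le_div_iff₀ (by linarith)]; linarith only [hRR]
    have : θ ≤ 2 * (R / R') := by linarith only [w1, w2]
    calc θ ^ 2 ≤ (2 * (R / R')) ^ 2 := by gcongr
      _ = _ := by ring
  have hpartA : R' * (A.card:ℝ) ≤ (32 * C2 ^ 2 / κ ^ 2 + 2) * (R:ℝ) ^ 3 := by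
    calc R' * (A.card:ℝ) ≤ R' * ((2 * (E / κ) + 1) ^ 2 * R' ^ 2) := by gcongr
      _ ≤ R' * ((8 * (E / κ) ^ 2 + 2) * R' ^ 2) := by
          gcongr; nlinarith only [sq_nonneg (2 * (E / κ) - 1)]
      _ = (8 * C2 ^ 2 / κ ^ 2 * θ ^ 2) * R' ^ 3 + 2 * R' ^ 3 := by rw [hE]; ring
      _ ≤ (8 * C2 ^ 2 / κ ^ 2 * (4 * (R / R') ^ 2)) * R' ^ 3 + 2 * R' ^ 3 := by gcongr
      _ = 32 * C2 ^ 2 / κ ^ 2 * ((R:ℝ) ^ 2 * R') + 2 * R' ^ 3 := by field_simp; ring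
      _ ≤ 32 * C2 ^ 2 / κ ^ 2 * ((R:ℝ) ^ 2 * R) + 2 * (R:ℝ) ^ 3 := by gcongr
      _ = _ := by ring
  have hpartW : R' * (W.card:ℝ) ≤ Cm * (1 + C2) * ((M:ℝ) * R + (R:ℝ) ^ 3 + ((M:ℝ) * R) ^ 2 * δ) * Lg ^ 3 := by
    calc R' * (W.card:ℝ) ≤ R' * (Cm * (M + E * M1 * R' ^ 2) * Lg ^ 3) := by gcongr
      _ = Cm * (M * R' + C2 * (R * R' * M ^ 2 * δ + R' ^ 3)) * Lg ^ 3 := by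
          rw [hE, hθ, hM1]; field_simp
      _ ≤ Cm * (M * R + C2 * (R * R * M ^ 2 * δ + R ^ 3)) * Lg ^ 3 := by gcongr
      _ ≤ Cm * ((1 + C2) * ((M:ℝ) * R + (R:ℝ) ^ 3 + ((M:ℝ) * R) ^ 2 * δ)) * Lg ^ 3 := by
          gcongr
          have t1 : 0 ≤ (M:ℝ) * R := by positivity
          have t2 : 0 ≤ C2 * ((M:ℝ) * R) := by positivity
          have t3 : 0 ≤ (R:ℝ) ^ 3 := by positivity
          have t4 : 0 ≤ ((M:ℝ) * R) ^ 2 * δ := by positivity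
          nlinarith only [t1, t2, t3, t4]
      _ = _ := by ring
  have hS0 : 0 ≤ (M:ℝ) * R + (R:ℝ) ^ 3 + ((M:ℝ) * R) ^ 2 * δ := by positivity
  have hLg3 : 1 ≤ Lg ^ 3 := one_le_pow₀ hLg1
  have hR3 : (R:ℝ) ^ 3 ≤ ((M:ℝ) * R + (R:ℝ) ^ 3 + ((M:ℝ) * R) ^ 2 * δ) * Lg ^ 3 := by
    have w1 : 0 ≤ (M:ℝ) * R := by positivity
    have w2 : 0 ≤ ((M:ℝ) * R) ^ 2 * δ := by positivity
    calc (R:ℝ) ^ 3 ≤ (M:ℝ) * R + (R:ℝ) ^ 3 + ((M:ℝ) * R) ^ 2 * δ := by linarith only [w1, w2]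
      _ ≤ _ := le_mul_of_one_le_right hS0 hLg3
  calc (T.card : ℝ) ≤ R' * A.card + R' * W.card := by rw [← mul_add]; exact hcard
    _ ≤ (32 * C2 ^ 2 / κ ^ 2 + 2) * (((M:ℝ) * R + (R:ℝ) ^ 3 + ((M:ℝ) * R) ^ 2 * δ) * Lg ^ 3) + Cm * (1 + C2) * ((M:ℝ) * R + (R:ℝ) ^ 3 + ((M:ℝ) * R) ^ 2 * δ) * Lg ^ 3 := by
        refine add_le_add (hpartA.trans ?_) hpartW
        gcongr
    _ ≤ _ := by
        have : 0 ≤ C2 * (((M:ℝ) * R + (R:ℝ) ^ 3 + ((M:ℝ) * R) ^ 2 * δ) * Lg ^ 3) := by positivity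
        linarith only [this]

lemma Nv (c : ℝ) (hc : 2 < c) (hc3 : c < 3) : ∃ C > (0:ℝ), ∀ (R M : ℕ) (δ : ℝ), 1 ≤ R → C * R ≤ M → 0 < δ → δ * M ≤ 1 →
    ∀ s : Finset (ℕ × ℕ), s = Finset.Ico 1 R ×ˢ Finset.Ico M (2 * M) →
    ((((s ×ˢ s).filter (fun p => |(((p.1.2:ℝ) + p.1.1) ^ c - (p.1.2:ℝ) ^ c) - (((p.2.2:ℝ) + p.2.1) ^ c - (p.2.2:ℝ) ^ c)| ≤ δ * (R * (M:ℝ) ^ (c - 1)))).card : ℕ) : ℝ)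
      ≤ C * ((M:ℝ) * R + (R:ℝ) ^ 3 + ((M:ℝ) * R) ^ 2 * δ) * (1 + Real.log (8 * M)) ^ 5 := by
  classical
  obtain ⟨C, hC, h⟩ := Nv_block c hc hc3
  refine ⟨12 * C + 1, by positivity, ?_⟩
  intro R M δ hR hM hδ hδM s hs
  have hR1 : (1:ℝ) ≤ R := by exact_mod_cast hR
  have hRM : (R:ℝ) ≤ M := by nlinarith
  have hM0 : (0:ℝ) < M := by linarith
  set J := Nat.log 2 R + 1 with hJ
  set Lg := 1 + Real.log (8 * (M:ℝ)) with hLg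
  have hLg0 : 1 ≤ Lg := by
    have := Real.log_nonneg (by linarith : (1:ℝ) ≤ 8 * (M:ℝ)); linarith
  have hJb : (J:ℝ) ≤ 2 * Lg := natlog_bound R M hR hRM
  set B := C * ((M:ℝ) * R + (R:ℝ) ^ 3 + ((M:ℝ) * R) ^ 2 * δ) * Lg ^ 3 with hB
  have hB0 : 0 ≤ B := by positivity
  have hps := pairs_split s (fun p => ((p.2:ℝ) + p.1) ^ c - (p.2:ℝ) ^ c) (δ * (R * (M:ℝ) ^ (c - 1))) (by positivity) J (fun p => Nat.log 2 p.1) (by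
    intro i hi
    simp only [hs, Finset.mem_product, Finset.mem_Ico] at hi
    exact Nat.lt_succ_of_le (Nat.log_mono_right hi.1.2.le))
  have hj : ∀ j ∈ Finset.range J, ((((s ×ˢ s).filter (fun p => |(((p.1.2:ℝ) + p.1.1) ^ c - (p.1.2:ℝ) ^ c) - (((p.2.2:ℝ) + p.2.1) ^ c - (p.2.2:ℝ) ^ c)| ≤ δ * (R * (M:ℝ) ^ (c - 1)) ∧
      Nat.log 2 p.1.1 = j ∧ Nat.log 2 p.2.1 = j)).card : ℕ) : ℝ) ≤ B := by
    intro j hj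
    rw [Finset.mem_range, hJ] at hj
    refine h j R M δ _ ((Nat.pow_le_pow_right (by norm_num) (Nat.lt_succ_iff.mp hj)).trans (Nat.pow_log_le_self 2 (by omega))) (by nlinarith) hδ hδM ?_
    intro p hp
    simp only [hs, Finset.mem_filter, Finset.mem_product, Finset.mem_Ico] at hp
    obtain ⟨⟨⟨⟨a1, a2⟩, a3⟩, ⟨b1, b2⟩, b3⟩, k1, k2, k3⟩ := hp
    have hl : ∀ r, 1 ≤ r → Nat.log 2 r = j → 2 ^ j ≤ r ∧ r < 2 ^ (j + 1) := by
      intro r hr h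
      exact (Nat.log_eq_iff (Or.inr ⟨by norm_num, by omega⟩)).mp h
    exact ⟨hl _ a1 k2, hl _ b1 k3, a3, b3, k1⟩
  refine hps.trans ?_
  calc 3 * (J:ℝ) * _ ≤ 3 * (J:ℝ) * ∑ j ∈ Finset.range J, B := by
        gcongr with j hj'; exact hj j hj'
    _ = 3 * (J:ℝ) ^ 2 * B := by rw [Finset.sum_const, Finset.card_range, nsmul_eq_mul]; ring
    _ ≤ 3 * (2 * Lg) ^ 2 * B := by gcongr
    _ = 12 * C * ((M:ℝ) * R + (R:ℝ) ^ 3 + ((M:ℝ) * R) ^ 2 * δ) * Lg ^ 5 := by rw [hB]; ring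
    _ ≤ _ := by gcongr; linarith

lemma floor_half (T : ℝ) (hT : 1 ≤ T) : 1 ≤ ⌊T⌋₊ ∧ (⌊T⌋₊ : ℝ) ≤ T ∧ T ≤ 2 * (⌊T⌋₊ : ℝ) := by
  have h1 : 1 ≤ ⌊T⌋₊ := Nat.le_floor (by simpa using hT)
  have h2 : (1:ℝ) ≤ ⌊T⌋₊ := by exact_mod_cast h1
  exact ⟨h1, Nat.floor_le (by linarith), by linarith [Nat.lt_floor_add_one T]⟩

lemma sqb (l κ T : ℝ) (hT : 0 < T) (h : l * T ^ 2 ≤ κ) : √l ≤ √κ / T := by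
  rw [le_div_iff₀ hT, ← Real.sqrt_sq hT.le, ← Real.sqrt_mul' _ (sq_nonneg T)]
  exact Real.sqrt_le_sqrt h

lemma isqb (l κ T M : ℝ) (hT : 0 < T) (hM : 0 < M) (hκ : 0 < κ) (h : κ * T ^ 2 ≤ l * M ^ 2) : 1 / √l ≤ 1 / √κ * (M / T) := by
  have h1 : √κ * T ≤ √l * M := by
    rw [← Real.sqrt_sq hT.le, ← Real.sqrt_sq hM.le, ← Real.sqrt_mul' _ (sq_nonneg T), ← Real.sqrt_mul' _ (sq_nonneg M)]
    exact Real.sqrt_le_sqrt h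
  have hs : 0 < √κ := Real.sqrt_pos.mpr hκ
  have hl : 0 < √l := by
    by_contra h2
    have : √l ≤ 0 := not_lt.mp h2
    nlinarith [mul_pos hs hT]
  rw [div_mul_div_comm, one_mul, div_le_div_iff₀ hl (by positivity)]
  linarith

lemma cf_ne (c : ℝ) (hc : 2 < c) (hc3 : c < 3) : cf 2 c ≠ 0 ∧ cf 3 c ≠ 0 ∧ cf 4 c ≠ 0 := by
  have h0 : c ≠ 0 := by linarith
  have h1 : c - 1 ≠ 0 := by intro h; linarith
  have h2 : c - 1 - 1 ≠ 0 := by intro h; linarith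
  have h3 : c - 1 - 1 - 1 ≠ 0 := by intro h; linarith
  refine ⟨?_, ?_, ?_⟩ <;> simp only [cf] <;> simp [h0, h1, h2, h3]

/-- second and third derivative estimates in convenient form -/
lemma WW (c : ℝ) (hc : 2 < c) (hc3 : c < 3) : ∃ C > (0:ℝ), ∀ (y Lam : ℝ) (M a b : ℕ), y ≠ 0 → 8 ≤ M → M ≤ a → b ≤ 2 * M → Lam = |y| * (M:ℝ) ^ c →
    (‖∑ m ∈ Finset.Ico a b, e (y * (m:ℝ) ^ c)‖ ≤ C * (M * √(Lam / (M:ℝ) ^ 2) + 1 / √(Lam / (M:ℝ) ^ 2))) ∧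
    (∀ R : ℕ, 1 ≤ R → 4 * R ≤ M → ‖∑ m ∈ Finset.Ico a b, e (y * (m:ℝ) ^ c)‖ ^ 2 ≤ C * ((M:ℝ) ^ 2 / R + (M:ℝ) ^ 2 * √(R * (Lam / (M:ℝ) ^ 3)) + M * (1 / √(R * (Lam / (M:ℝ) ^ 3))))) ∧
    (∀ R Sn : ℕ, 1 ≤ R → 4 * R ≤ M → 1 ≤ Sn → 4 * Sn ≤ M → ‖∑ m ∈ Finset.Ico a b, e (y * (m:ℝ) ^ c)‖ ^ 2 ≤
      C * ((M:ℝ) ^ 2 / R + M * √((M:ℝ) ^ 2 / Sn + (M:ℝ) ^ 2 * √(Sn * R * (Lam / (M:ℝ) ^ 4)) + M * (1 / √(Sn * R * (Lam / (M:ℝ) ^ 4)))))) := by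
  obtain ⟨h2, h3, h4⟩ := cf_ne c hc hc3
  obtain ⟨C1, hC1, k1⟩ := sdtD c 0 h2
  obtain ⟨C2, hC2, k2⟩ := thirdD c 0 h3
  obtain ⟨C3, hC3, k3⟩ := fourthD c h4
  refine ⟨C1 + C2 + C3, by positivity, ?_⟩
  intro y Lam M a b hy hM ha hb hL
  have hM0 : (0:ℝ) < M := by exact_mod_cast (by omega : 0 < M)
  have hM8 : (8:ℝ) ≤ M := by exact_mod_cast hM
  have hb2 : (b:ℝ) ≤ 2 * M := by exact_mod_cast hb
  have e2 : |y| * (M:ℝ) ^ (c - 2) = Lam / (M:ℝ) ^ 2 := by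
    rw [hL, Real.rpow_sub hM0, mul_div_assoc]; norm_cast
  have e3 : |y| * (M:ℝ) ^ (c - 3) = Lam / (M:ℝ) ^ 3 := by
    rw [hL, Real.rpow_sub hM0, mul_div_assoc]; norm_cast
  have e4 : |y| * (M:ℝ) ^ (c - 4) = Lam / (M:ℝ) ^ 4 := by
    rw [hL, Real.rpow_sub hM0, mul_div_assoc]; norm_cast
  refine ⟨?_, ?_, ?_⟩
  · have := k1 [] y M a b rfl (by simp) hy (by omega) ha hb (by simp; linarith)
    simp only [Dl, List.prod_nil, mul_one, Nat.cast_zero, sub_zero, e2] at this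
    refine this.trans ?_
    gcongr; linarith
  · intro R hR hRM
    have hR4 : 4 * (R:ℝ) ≤ M := by exact_mod_cast hRM
    have := k2 [] y M a b R rfl (by simp) hy hR (by omega) ha hb (by simp; linarith)
    simp only [Dl, List.prod_nil, mul_one, Nat.cast_zero, sub_zero, e3] at this
    rw [mul_one_div]
    refine this.trans ?_
    gcongr; linarith
  · intro R Sn hR hRM hS hSM
    have hR4 : 4 * (R:ℝ) ≤ M := by exact_mod_cast hRM
    have hS4 : 4 * (Sn:ℝ) ≤ M := by exact_mod_cast hSM
    have := k3 y M a b R Sn hy hR (by omega) hS (by omega) ha hb (by linarith)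
    simp only [e4] at this
    rw [mul_one_div]
    refine this.trans ?_
    gcongr; linarith

lemma sq_root_bd (w C T : ℝ) (hw : 0 ≤ w) (hT : 0 ≤ T) (h : w ^ 2 ≤ C * T ^ 2) : w ≤ √C * T := by
  rw [← Real.sqrt_sq hw]
  calc √(w ^ 2) ≤ √(C * T ^ 2) := Real.sqrt_le_sqrt h
    _ = _ := by rw [Real.sqrt_mul' _ (sq_nonneg T), Real.sqrt_sq hT]

/-- exponential sums needed in type I sums -/
lemma WI (c : ℝ) (hc : 2 < c) (hc3 : c < 3) (κ1 κ2 : ℝ) (h1 : 0 < κ1) (h2 : 0 < κ2) : ∃ C > (0:ℝ), ∀ (L F y : ℝ) (M a b : ℕ), 2 ≤ L → L ^ 35 ≤ F → F ≤ L ^ 74 →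
    L ^ 32 ≤ 8 * M → M ≤ L ^ 36 → M ≤ a → b ≤ 2 * M → κ1 * F ≤ |y| * (M:ℝ) ^ c → |y| * (M:ℝ) ^ c ≤ κ2 * F →
    ‖∑ m ∈ Finset.Ico a b, e (y * (m:ℝ) ^ c)‖ ≤ C * (M / L) := by
  obtain ⟨C, hC, h⟩ := WW c hc hc3
  set s2 := √(512 * κ2) with hs2
  set s1 := 1 / √κ1 with hs1
  have hs20 : 0 < s2 := by positivity
  have hs10 : 0 < s1 := by positivity
  refine ⟨C * (s2 + s1) + √(C * (2 + s2 + s1)), by positivity, ?_⟩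
  intro L F y M a b hL hF1 hF2 hM1 hM2 ha hb hl hu
  have hL0 : 0 < L := by linarith
  have hL1 : 1 ≤ L := by linarith
  have hF0 : 0 < F := lt_of_lt_of_le (by positivity) hF1
  have hL32 : L ^ 32 = L ^ 30 * L ^ 2 := by ring
  have hL30 : (2:ℝ) ^ 30 ≤ L ^ 30 := by gcongr
  have hMbig : L ^ 2 * 64 ≤ M := by nlinarith only [sq_nonneg L, hM1, hL30]
  have hM0 : (0:ℝ) < M := by nlinarith only [sq_nonneg L, hc, hc3, hL, hMbig]
  have hM8 : 8 ≤ M := by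
    have : (8:ℝ) ≤ M := by nlinarith only [hc, hc3, hL, hMbig]
    exact_mod_cast this
  have hy : y ≠ 0 := by
    intro hy; rw [hy] at hl; simp at hl; nlinarith only [h1, hF0, hl]
  obtain ⟨g1, g2, _⟩ := h y _ M a b hy hM8 ha hb rfl
  set Lam := |y| * (M:ℝ) ^ c with hLam
  have hLam0 : 0 < Lam := lt_of_lt_of_le (by positivity) hl
  by_cases hF : F ≤ L ^ 60
  · have b1 : √(Lam / (M:ℝ) ^ 2) ≤ s2 / L := by
      apply sqb _ _ _ hL0
      rw [div_mul_eq_mul_div, div_le_iff₀ (by positivity)]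
      have : (L ^ 32) ^ 2 ≤ (8 * (M:ℝ)) ^ 2 := by gcongr
      calc Lam * L ^ 2 ≤ κ2 * L ^ 60 * L ^ 2 := by gcongr; exact hu.trans (by gcongr)
        _ = κ2 * L ^ 62 := by ring
        _ ≤ κ2 * L ^ 64 := by gcongr <;> norm_num
        _ = κ2 * (L ^ 32) ^ 2 := by ring
        _ ≤ κ2 * (8 * (M:ℝ)) ^ 2 := by gcongr
        _ ≤ _ := by nlinarith only [mul_pos h2 (pow_pos hM0 2), h2, hM0]
    have b2 : 1 / √(Lam / (M:ℝ) ^ 2) ≤ s1 * (M / L) := by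
      apply isqb _ _ _ _ hL0 hM0 h1
      rw [div_mul_cancel₀ _ (by positivity)]
      calc κ1 * L ^ 2 ≤ κ1 * L ^ 35 := by gcongr <;> norm_num
        _ ≤ κ1 * F := by gcongr
        _ ≤ _ := hl
    calc _ ≤ _ := g1
      _ ≤ C * (M * (s2 / L) + s1 * (M / L)) := by gcongr
      _ = C * (s2 + s1) * (M / L) := by ring
      _ ≤ _ := by gcongr; have := Real.sqrt_nonneg (C * (2 + s2 + s1)); linarith
  push Not at hF
  obtain ⟨r1, r2, r3⟩ := floor_half (L ^ 2) (by nlinarith only [hc, hc3, hL])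
  set R := ⌊L ^ 2⌋₊
  have hR4 : 4 * R ≤ M := by
    have : 4 * (R:ℝ) ≤ M := by linarith
    exact_mod_cast this
  have hR1 : (1:ℝ) ≤ R := by exact_mod_cast r1
  have g := g2 R r1 hR4
  have b1 : √(R * (Lam / (M:ℝ) ^ 3)) ≤ s2 / L ^ 2 := by
    apply sqb _ _ _ (by positivity)
    rw [← mul_div_assoc, div_mul_eq_mul_div, div_le_iff₀ (by positivity)]
    have : (L ^ 32) ^ 3 ≤ (8 * (M:ℝ)) ^ 3 := by gcongr
    calc R * Lam * (L ^ 2) ^ 2 ≤ L ^ 2 * (κ2 * L ^ 74) * (L ^ 2) ^ 2 := by gcongr; exact hu.trans (by gcongr)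
      _ = κ2 * L ^ 80 := by ring
      _ ≤ κ2 * L ^ 96 := by gcongr <;> norm_num
      _ = κ2 * (L ^ 32) ^ 3 := by ring
      _ ≤ κ2 * (8 * (M:ℝ)) ^ 3 := by gcongr
      _ = _ := by ring
  have b2 : 1 / √(R * (Lam / (M:ℝ) ^ 3)) ≤ s1 * (M / L ^ 2) := by
    apply isqb _ _ _ _ (by positivity) hM0 h1
    have e1 : R * (Lam / (M:ℝ) ^ 3) * (M:ℝ) ^ 2 = R * Lam / M := by field_simp
    rw [e1, le_div_iff₀ hM0]
    calc κ1 * (L ^ 2) ^ 2 * M ≤ κ1 * (L ^ 2) ^ 2 * L ^ 36 := by gcongr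
      _ = κ1 * L ^ 40 := by ring
      _ ≤ κ1 * L ^ 60 := by gcongr <;> norm_num
      _ ≤ κ1 * F := by gcongr
      _ ≤ 1 * Lam := by rw [one_mul]; exact hl
      _ ≤ _ := by gcongr
  have b3 : 1 / (R:ℝ) ≤ 2 / L ^ 2 := by rw [div_le_div_iff₀ (by linarith only [hc, hc3, hR1]) (by positivity)]; linarith only [r3]
  have : ‖∑ m ∈ Finset.Ico a b, e (y * (m:ℝ) ^ c)‖ ≤ √(C * (2 + s2 + s1)) * (M / L) := by
    apply sq_root_bd _ _ _ (norm_nonneg _) (by positivity)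
    calc _ ≤ _ := g
      _ = C * ((M:ℝ) ^ 2 * (1 / R) + (M:ℝ) ^ 2 * √(R * (Lam / (M:ℝ) ^ 3)) + M * (1 / √(R * (Lam / (M:ℝ) ^ 3)))) := by ring
      _ ≤ C * ((M:ℝ) ^ 2 * (2 / L ^ 2) + (M:ℝ) ^ 2 * (s2 / L ^ 2) + M * (s1 * (M / L ^ 2))) := by gcongr
      _ = _ := by ring
  refine this.trans ?_
  gcongr
  have : 0 < C * (s2 + s1) := by positivity
  linarith only [this]

/-- exponential sums needed in case A of the type II estimate -/
lemma WA (c : ℝ) (hc : 2 < c) (hc3 : c < 3) (κ1 κ2 : ℝ) (h1 : 0 < κ1) (h2 : 0 < κ2) : ∃ C > (0:ℝ), ∀ (L F y : ℝ) (M : ℕ), 2 ≤ L → L ^ 35 ≤ F → F ≤ L ^ 6 * M ^ 3 →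
    L ^ 18 ≤ 3 * M → κ1 * F * M ≤ |y| * (M:ℝ) ^ c * L ^ 36 → |y| * (M:ℝ) ^ c * L ^ 36 ≤ κ2 * F * L ^ 2 * M →
    ‖∑ m ∈ Finset.Ico M (2 * M), e (y * (m:ℝ) ^ c)‖ ≤ C * (M / L ^ 2) := by
  obtain ⟨C, hC, h⟩ := WW c hc hc3
  set s2 := √κ2 with hs2
  set s1 := 1 / √(κ1 / 12) with hs1
  have hs20 : 0 < s2 := by positivity
  have hs10 : 0 < s1 := by positivity
  refine ⟨C * (s2 + s1) + √(C * (2 + s2 + s1)) + √(C * (2 + √(2 + s2 + s1))), by positivity, ?_⟩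
  intro L F y M hL hF1 hF2 hM1 hl hu
  have hL0 : 0 < L := by linarith
  have hL1 : 1 ≤ L := by linarith
  have hF0 : 0 < F := lt_of_lt_of_le (by positivity) hF1
  have hL10 : (2:ℝ) ^ 10 ≤ L ^ 10 := by gcongr
  have hL8 : 1 ≤ L ^ 8 := one_le_pow₀ hL1
  have hL48 : L ^ 4 ≤ L ^ 8 := by gcongr <;> norm_num
  have hMbig : L ^ 8 * 64 ≤ M := by
    have : L ^ 18 = L ^ 10 * L ^ 8 := by ring
    nlinarith only [hc, hc3, hM1, hL10]
  have hM0 : (0:ℝ) < M := by linarith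
  have hM8 : 8 ≤ M := by
    have : (8:ℝ) ≤ M := by linarith
    exact_mod_cast this
  have hy : y ≠ 0 := by
    intro hy; rw [hy] at hl; simp at hl; nlinarith only [mul_pos (mul_pos h1 hF0) hM0, h1, hF0, hM0, hl]
  obtain ⟨g1, g2, g3⟩ := h y _ M M (2 * M) hy hM8 le_rfl le_rfl rfl
  set Lam := |y| * (M:ℝ) ^ c with hLam
  have hLam0 : 0 < Lam := by
    by_contra h'
    push Not at h'
    have : Lam * L ^ 36 ≤ 0 := mul_nonpos_of_nonpos_of_nonneg h' (by positivity)
    have : 0 < κ1 * F * M := by positivity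
    linarith
  have q1 : 0 ≤ √(C * (2 + s2 + s1)) := Real.sqrt_nonneg _
  have q2 : 0 ≤ √(C * (2 + √(2 + s2 + s1))) := Real.sqrt_nonneg _
  have q3 : 0 < C * (s2 + s1) := by positivity
  obtain ⟨r1, r2, r3⟩ := floor_half (L ^ 4) (one_le_pow₀ hL1)
  set R := ⌊L ^ 4⌋₊
  have hR4 : 4 * R ≤ M := by
    have : 4 * (R:ℝ) ≤ M := by linarith
    exact_mod_cast this
  have hR1 : (1:ℝ) ≤ R := by exact_mod_cast r1
  have b3 : 1 / (R:ℝ) ≤ 2 / L ^ 4 := by rw [div_le_div_iff₀ (by linarith) (by positivity)]; linarith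
  by_cases hF : F ≤ L ^ 30 * M
  · have b1 : √(Lam / (M:ℝ) ^ 2) ≤ s2 / L ^ 2 := by
      apply sqb _ _ _ (by positivity)
      rw [div_mul_eq_mul_div, div_le_iff₀ (by positivity)]
      refine le_of_mul_le_mul_right (a := L ^ 32) ?_ (by positivity)
      calc Lam * (L ^ 2) ^ 2 * L ^ 32 = Lam * L ^ 36 := by ring
        _ ≤ κ2 * F * L ^ 2 * M := hu
        _ ≤ κ2 * (L ^ 30 * M) * L ^ 2 * M := by gcongr
        _ = _ := by ring
    have b2 : 1 / √(Lam / (M:ℝ) ^ 2) ≤ s1 * (M / L ^ 2) := by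
      apply isqb _ _ _ _ (by positivity) hM0 (by positivity)
      rw [div_mul_cancel₀ _ (by positivity)]
      refine le_of_mul_le_mul_right (a := L ^ 36) ?_ (by positivity)
      calc κ1 / 12 * (L ^ 2) ^ 2 * L ^ 36 = κ1 * (L ^ 35 * L ^ 5) / 12 := by ring
        _ ≤ κ1 * (F * L ^ 18) / 12 := by gcongr <;> norm_num
        _ ≤ κ1 * (F * (3 * M)) / 12 := by gcongr
        _ ≤ κ1 * F * M := by nlinarith only [mul_pos (mul_pos h1 hF0) hM0, h1, hF0, hM0]
        _ ≤ _ := hl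
    calc _ ≤ _ := g1
      _ ≤ C * (M * (s2 / L ^ 2) + s1 * (M / L ^ 2)) := by gcongr
      _ = C * (s2 + s1) * (M / L ^ 2) := by ring
      _ ≤ _ := by gcongr; linarith
  push Not at hF
  by_cases hF' : F ≤ L ^ 22 * M ^ 2
  · have g := g2 R r1 hR4
    have b1 : √(R * (Lam / (M:ℝ) ^ 3)) ≤ s2 / L ^ 4 := by
      apply sqb _ _ _ (by positivity)
      rw [← mul_div_assoc, div_mul_eq_mul_div, div_le_iff₀ (by positivity)]
      refine le_of_mul_le_mul_right (a := L ^ 24) ?_ (by positivity)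
      calc R * Lam * (L ^ 4) ^ 2 * L ^ 24 ≤ L ^ 4 * Lam * (L ^ 4) ^ 2 * L ^ 24 := by gcongr
        _ = Lam * L ^ 36 := by ring
        _ ≤ κ2 * F * L ^ 2 * M := hu
        _ ≤ κ2 * (L ^ 22 * M ^ 2) * L ^ 2 * M := by gcongr
        _ = _ := by ring
    have b2 : 1 / √(R * (Lam / (M:ℝ) ^ 3)) ≤ s1 * (M / L ^ 4) := by
      apply isqb _ _ _ _ (by positivity) hM0 (by positivity)
      have e1 : R * (Lam / (M:ℝ) ^ 3) * (M:ℝ) ^ 2 = R * Lam / M := by field_simp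
      rw [e1, le_div_iff₀ hM0]
      refine le_of_mul_le_mul_right (a := L ^ 36) ?_ (by positivity)
      calc κ1 / 12 * (L ^ 4) ^ 2 * M * L ^ 36 = κ1 * (L ^ 30 * L ^ 14 * M) / 12 := by ring
        _ ≤ κ1 * (L ^ 30 * L ^ 18 * M) / 12 := by gcongr <;> norm_num
        _ ≤ κ1 * (L ^ 30 * (3 * M) * M) / 12 := by gcongr
        _ ≤ κ1 * (L ^ 30 * M) * M := by
          have : 0 < κ1 * (L ^ 30 * M) * M := by positivity
          linarith only [this]
        _ ≤ κ1 * F * M := by gcongr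
        _ ≤ 1 * (Lam * L ^ 36) := by rw [one_mul]; exact hl
        _ ≤ R * (Lam * L ^ 36) := by gcongr
        _ = _ := by ring
    have : ‖∑ m ∈ Finset.Ico M (2 * M), e (y * (m:ℝ) ^ c)‖ ≤ √(C * (2 + s2 + s1)) * (M / L ^ 2) := by
      apply sq_root_bd _ _ _ (norm_nonneg _) (by positivity)
      calc _ ≤ _ := g
        _ = C * ((M:ℝ) ^ 2 * (1 / R) + (M:ℝ) ^ 2 * √(R * (Lam / (M:ℝ) ^ 3)) + M * (1 / √(R * (Lam / (M:ℝ) ^ 3)))) := by ring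
        _ ≤ C * ((M:ℝ) ^ 2 * (2 / L ^ 4) + (M:ℝ) ^ 2 * (s2 / L ^ 4) + M * (s1 * (M / L ^ 4))) := by gcongr
        _ = _ := by ring
    refine this.trans ?_
    gcongr
    linarith only [q2, q3]
  push Not at hF'
  obtain ⟨t1, t2, t3⟩ := floor_half (L ^ 8) hL8
  set Sn := ⌊L ^ 8⌋₊
  have hS4 : 4 * Sn ≤ M := by
    have : 4 * (Sn:ℝ) ≤ M := by linarith only [hc, hc3, hL8, hMbig, t2]
    exact_mod_cast this
  have hS1 : (1:ℝ) ≤ Sn := by exact_mod_cast t1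
  have g := g3 R Sn r1 hR4 t1 hS4
  have b4 : 1 / (Sn:ℝ) ≤ 2 / L ^ 8 := by rw [div_le_div_iff₀ (by linarith only [hc, hc3, hL8, t3]) (by positivity)]; linarith only [t3]
  have b1 : √(Sn * R * (Lam / (M:ℝ) ^ 4)) ≤ s2 / L ^ 8 := by
    apply sqb _ _ _ (by positivity)
    rw [← mul_div_assoc, div_mul_eq_mul_div, div_le_iff₀ (by positivity)]
    refine le_of_mul_le_mul_right (a := L ^ 8) ?_ (by positivity)
    calc Sn * R * Lam * (L ^ 8) ^ 2 * L ^ 8 ≤ L ^ 8 * L ^ 4 * Lam * (L ^ 8) ^ 2 * L ^ 8 := by gcongr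
      _ = Lam * L ^ 36 := by ring
      _ ≤ κ2 * F * L ^ 2 * M := hu
      _ ≤ κ2 * (L ^ 6 * M ^ 3) * L ^ 2 * M := by gcongr
      _ = _ := by ring
  have b2 : 1 / √(Sn * R * (Lam / (M:ℝ) ^ 4)) ≤ s1 * (M / L ^ 8) := by
    apply isqb _ _ _ _ (by positivity) hM0 (by positivity)
    have e1 : Sn * R * (Lam / (M:ℝ) ^ 4) * (M:ℝ) ^ 2 = Sn * R * Lam / M ^ 2 := by field_simp
    rw [e1, le_div_iff₀ (by positivity)]
    refine le_of_mul_le_mul_right (a := L ^ 36) ?_ (by positivity)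
    calc κ1 / 12 * (L ^ 8) ^ 2 * M ^ 2 * L ^ 36 = κ1 * (L ^ 34 * L ^ 18 * M ^ 2) / 12 := by ring
      _ ≤ κ1 * (L ^ 34 * (3 * M) * M ^ 2) / 12 := by gcongr
      _ = κ1 * (L ^ 22 * M ^ 2) * M * (L ^ 8 / 2 * (L ^ 4 / 2)) := by ring
      _ ≤ κ1 * F * M * (Sn * R) := by gcongr <;> linarith only [t3, r3]
      _ ≤ (Lam * L ^ 36) * (Sn * R) := by gcongr
      _ = _ := by ring
  have hin : √((M:ℝ) ^ 2 / Sn + (M:ℝ) ^ 2 * √(Sn * R * (Lam / (M:ℝ) ^ 4)) + M * (1 / √(Sn * R * (Lam / (M:ℝ) ^ 4)))) ≤ √(2 + s2 + s1) * (M / L ^ 4) := by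
    apply sq_root_bd _ _ _ (Real.sqrt_nonneg _) (by positivity)
    rw [Real.sq_sqrt (by positivity)]
    calc _ = ((M:ℝ) ^ 2 * (1 / Sn) + (M:ℝ) ^ 2 * √(Sn * R * (Lam / (M:ℝ) ^ 4)) + M * (1 / √(Sn * R * (Lam / (M:ℝ) ^ 4)))) := by ring
      _ ≤ ((M:ℝ) ^ 2 * (2 / L ^ 8) + (M:ℝ) ^ 2 * (s2 / L ^ 8) + M * (s1 * (M / L ^ 8))) := by gcongr
      _ = _ := by ring
  have : ‖∑ m ∈ Finset.Ico M (2 * M), e (y * (m:ℝ) ^ c)‖ ≤ √(C * (2 + √(2 + s2 + s1))) * (M / L ^ 2) := by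
    apply sq_root_bd _ _ _ (norm_nonneg _) (by positivity)
    refine g.trans ?_
    calc _ ≤ C * ((M:ℝ) ^ 2 / R + M * (√(2 + s2 + s1) * (M / L ^ 4))) := by gcongr
      _ = C * ((M:ℝ) ^ 2 * (1 / R) + M * (√(2 + s2 + s1) * (M / L ^ 4))) := by ring
      _ ≤ C * ((M:ℝ) ^ 2 * (2 / L ^ 4) + M * (√(2 + s2 + s1) * (M / L ^ 4))) := by gcongr
      _ = _ := by ring
  refine this.trans ?_
  gcongr
  linarith only [q1, q3]

lemma cs_card {ι : Type*} (Y : Finset ι) (a w : ι → ℂ) (ha : ∀ i ∈ Y, ‖a i‖ ≤ 1) :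
    ‖∑ i ∈ Y, a i * w i‖ ^ 2 ≤ Y.card * ∑ i ∈ Y, ‖w i‖ ^ 2 := by
  have h : ‖∑ i ∈ Y, a i * w i‖ ≤ ∑ i ∈ Y, ‖w i‖ := by
    refine (norm_sum_le _ _).trans (Finset.sum_le_sum fun i hi => ?_)
    rw [norm_mul]
    exact mul_le_of_le_one_left (norm_nonneg _) (ha i hi)
  calc _ ≤ (∑ i ∈ Y, ‖w i‖) ^ 2 := by gcongr
    _ ≤ _ := sq_sum_le_card_mul_sum_sq

lemma vdcP {ι : Type*} (Y : Finset ι) (φ : ι → ℝ) (ψ : ℕ → ℝ) (b : ℕ → ℂ) (N Q : ℕ) (hQ : 1 ≤ Q) (hQN : Q ≤ N)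
    (hb : ∀ n, ‖b n‖ ≤ 1) (hb0 : ∀ n, b n ≠ 0 → N ≤ n ∧ n < 2 * N) :
    ∑ y ∈ Y, ‖∑ n ∈ Finset.Ico N (2 * N), b n * e (φ y * ψ n)‖ ^ 2 ≤
      (2 * N / Q : ℝ) * (Y.card * N + 2 * ∑ q ∈ Finset.Ico 1 Q, ‖∑ y ∈ Y, ∑ n ∈ Finset.Ico N (2 * N),
        (b (n + q) * (starRingEnd ℂ) (b n)) * e (φ y * (ψ (n + q) - ψ n))‖) := by
  have h := vdc Y (fun y n => b n * e (φ y * ψ n)) N N Q hQ hQN hQN (by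
    intro y n h
    have := hb0 n (left_ne_zero_of_mul h)
    omega)
  have e1 : N + N = 2 * N := by ring
  rw [e1] at h
  refine h.trans ?_
  gcongr with q hq
  · calc _ ≤ ∑ y ∈ Y, ∑ n ∈ Finset.Ico N (2 * N), (1:ℝ) := by
          gcongr with y _ n _
          rw [norm_mul, e_norm, mul_one]
          exact pow_le_one₀ (norm_nonneg _) (hb n)
      _ = _ := by
        simp only [Finset.sum_const, Nat.card_Ico, nsmul_eq_mul, mul_one]
        congr 2; omega
  · apply le_of_eq
    congr 1
    refine Finset.sum_congr rfl fun y _ => Finset.sum_congr rfl fun n _ => ?_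
    rw [mul_sub, e_sub, map_mul]; ring

lemma b_shift (b : ℕ → ℂ) (N : ℕ) (hb : ∀ n, ‖b n‖ ≤ 1) (hb0 : ∀ n, b n ≠ 0 → N ≤ n ∧ n < 2 * N) (q : ℕ) :
    (∀ n, ‖b (n + q) * (starRingEnd ℂ) (b n)‖ ≤ 1) ∧ (∀ n, b (n + q) * (starRingEnd ℂ) (b n) ≠ 0 → N ≤ n ∧ n < 2 * N) := by
  constructor
  · intro n
    rw [norm_mul, RCLike.norm_conj]
    exact mul_le_one₀ (hb _) (norm_nonneg _) (hb _)
  · intro n h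
    exact hb0 n (by intro h'; rw [h'] at h; simp at h)

lemma scale_id (c x X M N : ℝ) (hM : 0 < M) (hN : 0 < N) : |x| * N ^ (c - 1) * M ^ c = |x| * (M * N) ^ c / N := by
  rw [Real.rpow_sub hN, Real.rpow_one, Real.mul_rpow hM.le hN.le]; ring

lemma caseA (c : ℝ) (hc : 2 < c) (hc3 : c < 3) : ∃ C > (0:ℝ), ∀ (L X x : ℝ) (M N : ℕ) (a b : ℕ → ℂ), 2 ≤ L → X = L ^ 36 →
    L ^ 35 ≤ |x| * X ^ c → |x| * X ^ c ≤ L ^ 6 * M ^ 3 → L ^ 18 ≤ 3 * M → L ^ 2 ≤ N → (M:ℝ) * N ≤ X → X ≤ 8 * ((M:ℝ) * N) →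
    (∀ n, ‖a n‖ ≤ 1) → (∀ n, ‖b n‖ ≤ 1) → (∀ n, b n ≠ 0 → N ≤ n ∧ n < 2 * N) →
    ‖∑ m ∈ Finset.Ico M (2 * M), a m * ∑ n ∈ Finset.Ico N (2 * N), b n * e (x * (m:ℝ) ^ c * (n:ℝ) ^ c)‖ ≤ C * L ^ 35 := by
  obtain ⟨C, hC, h⟩ := WA c hc hc3 (1 / 8 ^ c) 216 (by positivity) (by norm_num)
  refine ⟨√(4 + 4 * C), by positivity, ?_⟩
  intro L X x M N a b hL hX hF1 hF2 hM hN hMN hMN' ha hb hb0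
  have hL0 : 0 < L := by linarith
  have hX0 : 0 < X := by rw [hX]; positivity
  obtain ⟨r1, r2, r3⟩ := floor_half (L ^ 2) (one_le_pow₀ (by linarith))
  set Q := ⌊L ^ 2⌋₊
  have hQ0 : (0:ℝ) < Q := by exact_mod_cast r1
  have hN0 : (0:ℝ) < N := lt_of_lt_of_le (by positivity) hN
  have hM0 : (0:ℝ) < M := by have : 0 < L ^ 18 := by positivity
                             linarith
  have hQN : Q ≤ N := by exact_mod_cast r2.trans hN
  have hq : ∀ q ∈ Finset.Ico 1 Q, ‖∑ y ∈ Finset.Ico M (2 * M), ∑ n ∈ Finset.Ico N (2 * N),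
        (b (n + q) * (starRingEnd ℂ) (b n)) * e ((x * (y:ℝ) ^ c) * (((n + q : ℕ):ℝ) ^ c - (n:ℝ) ^ c))‖ ≤ N * (C * (M / L ^ 2)) := by
    intro q hq
    rw [Finset.mem_Ico] at hq
    have hq1 : (1:ℝ) ≤ q := by exact_mod_cast hq.1
    have hqL : (q:ℝ) ≤ L ^ 2 := (by exact_mod_cast hq.2.le : (q:ℝ) ≤ Q).trans r2
    rw [Finset.sum_comm]
    have hn : ∀ n ∈ Finset.Ico N (2 * N), ‖∑ y ∈ Finset.Ico M (2 * M),
        (b (n + q) * (starRingEnd ℂ) (b n)) * e ((x * (y:ℝ) ^ c) * (((n + q : ℕ):ℝ) ^ c - (n:ℝ) ^ c))‖ ≤ C * (M / L ^ 2) := by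
      intro n hn
      rw [Finset.mem_Ico] at hn
      have hn1 : (N:ℝ) ≤ n := by exact_mod_cast hn.1
      have hn2 : (n:ℝ) ≤ 2 * N := by exact_mod_cast hn.2.le
      rw [← Finset.mul_sum, norm_mul]
      refine (mul_le_of_le_one_left (norm_nonneg _) ((b_shift b N hb hb0 q).1 n)).trans ?_
      obtain ⟨ξ, k1, k2, k3⟩ := phi_mvt c q n hc (by linarith) (by linarith)
      have hξ3 : ξ ≤ 3 * N := by linarith
      have hξ0 : 0 < ξ := by linarith
      have hD : ((n + q : ℕ):ℝ) ^ c - (n:ℝ) ^ c = c * (q * ξ ^ (c - 1)) := by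
        rw [← k3]; push_cast; field_simp
      have hy := h L (|x| * X ^ c) (x * (c * (q * ξ ^ (c - 1)))) M hL hF1 hF2 hM
      have hya : |x * (c * (q * ξ ^ (c - 1)))| = |x| * (c * (q * ξ ^ (c - 1))) := by
        rw [abs_mul, abs_of_pos (by positivity : 0 < c * (q * ξ ^ (c - 1)))]
      rw [hya] at hy
      have hup : ξ ^ (c - 1) ≤ 9 * (N:ℝ) ^ (c - 1) := by
        calc ξ ^ (c - 1) ≤ (3 * N) ^ (c - 1) := by gcongr; linarith
          _ = 3 ^ (c - 1) * (N:ℝ) ^ (c - 1) := by rw [Real.mul_rpow (by norm_num) hN0.le]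
          _ ≤ 3 ^ (2:ℝ) * (N:ℝ) ^ (c - 1) := by gcongr <;> linarith only [hc, hc3]
          _ = _ := by norm_num
      have hlo : (N:ℝ) ^ (c - 1) ≤ ξ ^ (c - 1) := by
        apply Real.rpow_le_rpow hN0.le <;> linarith only [hn1, k1, hc, hc3]
      have hsum : ∑ y ∈ Finset.Ico M (2 * M), e ((x * (y:ℝ) ^ c) * (((n + q : ℕ):ℝ) ^ c - (n:ℝ) ^ c)) =
          ∑ m ∈ Finset.Ico M (2 * M), e (x * (c * (q * ξ ^ (c - 1))) * (m:ℝ) ^ c) := by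
        refine Finset.sum_congr rfl fun y _ => ?_
        rw [hD]; congr 1; ring
      rw [hsum]
      apply hy
      · rw [← hX]
        have hcq : (1:ℝ) ≤ c * q := by nlinarith only [hc, hc3, hq1]
        calc 1 / 8 ^ c * (|x| * X ^ c) * M = |x| * (X / 8) ^ c * M := by
              rw [Real.div_rpow hX0.le (by norm_num)]; ring
          _ ≤ |x| * ((M:ℝ) * N) ^ c * (X / N) := by
              gcongr
              · linarith
              · rw [le_div_iff₀ hN0]; exact hMN
          _ = 1 * (|x| * (N:ℝ) ^ (c - 1) * M ^ c) * X := by rw [scale_id c x X M N hM0 hN0]; ring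
          _ ≤ (c * q) * (|x| * ξ ^ (c - 1) * M ^ c) * X := by gcongr
          _ = _ := by ring
      · rw [← hX]
        calc |x| * (c * (q * ξ ^ (c - 1))) * (M:ℝ) ^ c * X ≤ |x| * (3 * (L ^ 2 * (9 * (N:ℝ) ^ (c - 1)))) * (M:ℝ) ^ c * X := by
              gcongr
          _ = 27 * L ^ 2 * (|x| * (N:ℝ) ^ (c - 1) * M ^ c) * X := by ring
          _ = 27 * L ^ 2 * |x| * ((M:ℝ) * N) ^ c * (X / N) := by rw [scale_id c x X M N hM0 hN0]; ring
          _ ≤ 27 * L ^ 2 * |x| * X ^ c * (8 * M) := by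
              gcongr
              rw [div_le_iff₀ hN0]; linarith
          _ = _ := by ring
    refine (norm_sum_le _ _).trans ((Finset.sum_le_sum hn).trans ?_)
    rw [Finset.sum_const, Nat.card_Ico, nsmul_eq_mul, show 2 * N - N = N by omega]
  have hv := vdcP (Finset.Ico M (2 * M)) (fun m => x * (m:ℝ) ^ c) (fun n => (n:ℝ) ^ c) b N Q r1 hQN hb hb0
  have hcs := cs_card (Finset.Ico M (2 * M)) a (fun m => ∑ n ∈ Finset.Ico N (2 * N), b n * e (x * (m:ℝ) ^ c * (n:ℝ) ^ c)) (fun i _ => ha i)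
  rw [Nat.card_Ico, show 2 * M - M = M by omega] at hv hcs
  apply sq_root_bd _ _ _ (norm_nonneg _) (by positivity)
  have b3 : 1 / (Q:ℝ) ≤ 2 / L ^ 2 := by rw [div_le_div_iff₀ (by linarith) (by positivity)]; linarith
  have hs : ∑ q ∈ Finset.Ico 1 Q, ‖∑ y ∈ Finset.Ico M (2 * M), ∑ n ∈ Finset.Ico N (2 * N),
        (b (n + q) * (starRingEnd ℂ) (b n)) * e ((x * (y:ℝ) ^ c) * (((n + q : ℕ):ℝ) ^ c - (n:ℝ) ^ c))‖ ≤ Q * (N * (C * (M / L ^ 2))) := by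
    refine (Finset.sum_le_sum hq).trans ?_
    rw [Finset.sum_const, Nat.card_Ico, nsmul_eq_mul]
    gcongr
    omega
  have h35 : (M:ℝ) * N / L ≤ L ^ 35 := by
    rw [div_le_iff₀ hL0]; refine hMN.trans (le_of_eq ?_); rw [hX]; ring
  calc _ ≤ _ := hcs
    _ ≤ (M:ℝ) * ((2 * N / Q : ℝ) * (M * N + 2 * (Q * (N * (C * (M / L ^ 2)))))) := by
        gcongr; refine hv.trans ?_; gcongr
    _ = 2 * (M * N) ^ 2 * (1 / Q) + 4 * C * (M * N) ^ 2 / L ^ 2 := by field_simp; ring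
    _ ≤ 2 * (M * N) ^ 2 * (2 / L ^ 2) + 4 * C * (M * N) ^ 2 / L ^ 2 := by gcongr
    _ = (4 + 4 * C) * (M * N / L) ^ 2 := by ring
    _ ≤ _ := by gcongr

lemma B_num (L H N M P R U : ℝ) (hL : 1 ≤ L) (hN0 : 0 < N) (hM0 : 0 < M) (hH0 : 0 < H)
    (hP1 : L ^ 6 ≤ 4 * P) (hR1 : L ^ 8 ≤ 2 * R) (hR2 : R ≤ L ^ 8) (hU : U = P * N)
    (h1 : H * N ≤ 8 * L ^ 52) (h3 : L ^ 20 ≤ 36864 * H) (hN : L ^ 18 ≤ 3 * N) (hM : L ^ 12 ≤ M) (hMN : L ^ 36 ≤ 8 * (M * N)) :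
    H * (13 * U + U ^ 2 / H) * (M * R + R ^ 3 + (M * R) ^ 2 / H) ≤ 100000 * (U * M * R / L ^ 8) ^ 2 := by
  have hL0 : 0 < L := by linarith
  have hR0 : 0 < R := by have : 0 < L ^ 8 := by positivity
                         linarith
  have hP0 : 0 < P := by have : 0 < L ^ 6 := by positivity
                         linarith
  have hU0 : 0 < U := by rw [hU]; positivity
  have k1 : H * L ^ 16 ≤ 1536 * (U * M * R) := by
    refine le_of_mul_le_mul_right (a := N) ?_ hN0
    calc H * L ^ 16 * N = (H * N) * L ^ 16 := by ring
      _ ≤ (8 * L ^ 52) * L ^ 16 := by gcongr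
      _ = 8 * (L ^ 6 * L ^ 8 * L ^ 36) * L ^ 18 := by ring
      _ ≤ 8 * ((4 * P) * (2 * R) * (8 * (M * N))) * (3 * N) := by gcongr
      _ = _ := by rw [hU]; ring
  have k2 : H * R * L ^ 16 ≤ 2048 * (U * M ^ 2) := by
    refine le_of_mul_le_mul_right (a := N) ?_ hN0
    calc H * R * L ^ 16 * N = (H * N) * R * L ^ 16 := by ring
      _ ≤ (8 * L ^ 52) * L ^ 8 * L ^ 16 := by gcongr
      _ = 8 * L ^ 76 := by ring
      _ ≤ 8 * L ^ 78 := by gcongr; norm_num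
      _ = 8 * (L ^ 6 * (L ^ 36) ^ 2) := by ring
      _ ≤ 8 * ((4 * P) * (8 * (M * N)) ^ 2) := by gcongr
      _ = _ := by rw [hU]; ring
  have k3 : L ^ 16 ≤ 2 * (M * R) := by
    calc L ^ 16 ≤ L ^ 20 := by gcongr; norm_num
      _ = L ^ 12 * L ^ 8 := by ring
      _ ≤ M * (2 * R) := by gcongr
      _ = _ := by ring
  have k4 : R * L ^ 16 ≤ M ^ 2 := by
    calc R * L ^ 16 ≤ L ^ 8 * L ^ 16 := by gcongr
      _ = (L ^ 12) ^ 2 := by ring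
      _ ≤ _ := by gcongr
  have k5 : L ^ 16 ≤ 12 * U := by
    calc L ^ 16 ≤ L ^ 24 := by gcongr; norm_num
      _ = L ^ 6 * L ^ 18 := by ring
      _ ≤ 4 * P * (3 * N) := by gcongr
      _ = _ := by rw [hU]; ring
  have k6 : L ^ 16 ≤ 36864 * H := le_trans (by gcongr; norm_num) h3
  rw [div_pow, ← pow_mul, ← mul_div_assoc, le_div_iff₀ (by positivity)]
  have e1 : H * (13 * U + U ^ 2 / H) * (M * R + R ^ 3 + (M * R) ^ 2 / H) * L ^ (8 * 2) =
      13 * U * (M * R) * (H * L ^ 16) + 13 * U * R ^ 2 * (H * R * L ^ 16) + U ^ 2 * (M * R) * L ^ 16 + U ^ 2 * R ^ 2 * (R * L ^ 16)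
      + 13 * U * (M * R) ^ 2 * L ^ 16 + U ^ 2 * (M * R) ^ 2 / H * L ^ 16 := by
    field_simp; ring
  rw [e1]
  have e2 : U ^ 2 * (M * R) ^ 2 / H * (36864 * H) = 36864 * (U * M * R) ^ 2 := by field_simp
  calc _ ≤ 13 * U * (M * R) * (1536 * (U * M * R)) + 13 * U * R ^ 2 * (2048 * (U * M ^ 2)) + U ^ 2 * (M * R) * (2 * (M * R)) + U ^ 2 * R ^ 2 * M ^ 2
      + 13 * U * (M * R) ^ 2 * (12 * U) + U ^ 2 * (M * R) ^ 2 / H * (36864 * H) := by gcongr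
    _ ≤ _ := by rw [e2]; nlinarith only [sq_nonneg (U * M * R)]

lemma exists_phase (z : ℂ) : ∃ θ : ℂ, ‖θ‖ ≤ 1 ∧ θ * z = ‖z‖ := by
  by_cases h : z = 0
  · exact ⟨0, by simp, by simp [h]⟩
  · refine ⟨(starRingEnd ℂ) z / ‖z‖, ?_, ?_⟩
    · rw [norm_div, RCLike.norm_conj]; simp [h]
    · have : (‖z‖:ℂ) ≠ 0 := by simpa using h
      rw [div_mul_eq_mul_div, Complex.conj_mul']; field_simp

set_option maxHeartbeats 2000000 in
/-- application of the double large sieve -/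
lemma B_dls (c : ℝ) (hc : 2 < c) (hc3 : c < 3) (ε : ℝ) (hε : 0 < ε) : ∃ C > (1:ℝ), ∀ (L x H : ℝ) (M N Q Q' R : ℕ) (β : ℕ → ℕ → ℂ), C ≤ L →
    1 ≤ Q → 1 ≤ Q' → (Q:ℝ) ≤ L ^ 4 → (Q':ℝ) ≤ L ^ 4 → L ^ 6 ≤ 4 * ((Q:ℝ) * Q') → (Q:ℝ) * Q' ≤ L ^ 6 → L ^ 8 ≤ 2 * (R:ℝ) → (R:ℝ) ≤ L ^ 8 →
    x ≠ 0 → H = |x| * ((Q:ℝ) * Q' * (N:ℝ) ^ (c - 2)) * (R * (M:ℝ) ^ (c - 1)) →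
    H * N ≤ 8 * L ^ 52 → L ^ 20 ≤ 36864 * H → L ^ 18 ≤ 3 * (N:ℝ) → L ^ 12 ≤ (M:ℝ) → L ^ 36 ≤ 8 * ((M:ℝ) * N) → (M:ℝ) * N ≤ L ^ 36 → (M:ℝ) ≤ H →
    (∀ r m, ‖β r m‖ ≤ 1) →
    ‖∑ u ∈ Finset.Ico 1 Q ×ˢ Finset.Ico 1 Q' ×ˢ Finset.Ico N (2 * N), ∑ v ∈ Finset.Ico 1 R ×ˢ Finset.Ico M (2 * M),
      β v.1 v.2 * e ((x * Dl [(u.1:ℝ), (u.2.1:ℝ)] (fun t => t ^ c) u.2.2) * (((v.2:ℝ) + v.1) ^ c - (v.2:ℝ) ^ c))‖ ≤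
      C * (L ^ 36) ^ ε * ((Q:ℝ) * Q' * N * M * R / L ^ 8) := by
  classical
  obtain ⟨C1, hC1, hu⟩ := Nu c hc (ε / 4) (by positivity)
  obtain ⟨C2, hC2, hv⟩ := Nv c hc hc3
  obtain ⟨C3, hC3, hlg⟩ := log_bound (ε / 10) (by positivity)
  set K := Real.exp (8 * Real.pi) * 5187 * C1 * C2 * C3 ^ 5 * 100000 with hK
  have hK0 : 0 < K := by positivity
  refine ⟨8 + C2 + √K, by have := Real.sqrt_nonneg K; linarith, ?_⟩
  intro L x H M N Q Q' R β hL hQ hQ' hQ4 hQ'4 hP1 hP2 hR1 hR2 hx hH g1 g2 g3 g4 g5 g6 g7 hβ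
  have hsK := Real.sqrt_nonneg K
  have hL1 : 8 ≤ L := by linarith
  have hLC2 : C2 ≤ L := by linarith
  have hL0 : 0 < L := by linarith
  have hL8 : (8:ℝ) ^ 8 ≤ L ^ 8 := by gcongr
  have hL4 : (8:ℝ) ^ 4 ≤ L ^ 4 := by gcongr
  have hN0 : (0:ℝ) < N := by have : 0 < L ^ 18 := by positivity
                             linarith
  have hM0 : (0:ℝ) < M := by have : 0 < L ^ 12 := by positivity
                             linarith
  have hR0 : (1:ℝ) ≤ R := by linarith
  have hR1n : 1 ≤ R := by exact_mod_cast hR0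
  have hQ0 : (0:ℝ) < Q := by exact_mod_cast hQ
  have hQ0' : (0:ℝ) < Q' := by exact_mod_cast hQ'
  have hx0 : 0 < |x| := abs_pos.mpr hx
  have hH0 : 0 < H := by rw [hH]; positivity
  have hL418 : 3 * (2 * L ^ 4) ≤ L ^ 18 := by
    have : L ^ 18 = L ^ 4 * (L ^ 6 * L ^ 8) := by ring
    have h6 : 1 ≤ L ^ 6 := one_le_pow₀ (by linarith)
    have : (6:ℝ) ≤ L ^ 6 * L ^ 8 := by nlinarith only [h6, hL8]
    rw [‹L ^ 18 = _›]; nlinarith only [this, hL4]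
  have hQN : (Q:ℝ) + Q' ≤ N := by linarith
  have hRM : (R:ℝ) ≤ M := by
    have : L ^ 12 = L ^ 4 * L ^ 8 := by ring
    rw [this] at g4; nlinarith only [g4, hR2, hL4, hL8]
  have hCRM : C2 * R ≤ M := by
    calc C2 * (R:ℝ) ≤ L * L ^ 8 := by gcongr
      _ = L ^ 9 := by ring
      _ ≤ L ^ 12 := by gcongr <;> linarith only [hc, hc3, hC2, hL, hsK]
      _ ≤ _ := g4
  set P := (Q:ℝ) * Q' * (N:ℝ) ^ (c - 2) with hP
  set P' := R * (M:ℝ) ^ (c - 1) with hP'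
  have hP0 : 0 < P := by positivity
  have hP'0 : 0 < P' := by positivity
  set s := Finset.Ico 1 Q ×ˢ Finset.Ico 1 Q' ×ˢ Finset.Ico N (2 * N) with hs
  set t := Finset.Ico 1 R ×ˢ Finset.Ico M (2 * M) with ht
  set A := 24 * (|x| * P) with hA
  set B := 27 * P' with hB
  have key := dls' s t (fun u => x * Dl [(u.1:ℝ), (u.2.1:ℝ)] (fun t => t ^ c) u.2.2) (fun v => ((v.2:ℝ) + v.1) ^ c - (v.2:ℝ) ^ c) A B (by positivity) (by positivity)
    (by
      intro u hu
      simp only [hs, Finset.mem_product, Finset.mem_Ico] at hu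
      obtain ⟨⟨a1, a2⟩, ⟨a3, a4⟩, a5, a6⟩ := hu
      have b1 : (1:ℝ) ≤ u.1 := by exact_mod_cast a1
      have b2 : (u.1:ℝ) ≤ Q := by exact_mod_cast a2.le
      have b3 : (1:ℝ) ≤ u.2.1 := by exact_mod_cast a3
      have b4 : (u.2.1:ℝ) ≤ Q' := by exact_mod_cast a4.le
      have b5 : (N:ℝ) ≤ u.2.2 := by exact_mod_cast a5
      have b6 : (u.2.2:ℝ) ≤ 2 * N := by exact_mod_cast a6.le
      obtain ⟨v, w1, w2, w3⟩ := Dl_bound [(u.1:ℝ), (u.2.1:ℝ)] (by simp; constructor <;> linarith only [a1, a3]) c N u.2.2 hN0 b5 (by simp; linarith only [hc, hc3, hQ4, hQ'4, g3, hL4, hL418, b2, b4, b6])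
      have hlen : (([(u.1:ℝ), (u.2.1:ℝ)]).length : ℝ) = 2 := by norm_num
      rw [hlen] at w1 w2
      have hpr : ([(u.1:ℝ), (u.2.1:ℝ)]).prod = (u.1:ℝ) * u.2.1 := by simp
      rw [hpr] at w1 w2
      have hv0 : 0 ≤ v := le_trans (by positivity) w1
      rw [w3, abs_mul, hA]
      have hcf : cf ([(u.1:ℝ), (u.2.1:ℝ)]).length c = c * (c - 1) := by simp [cf]
      rw [hcf, abs_of_nonneg (mul_nonneg (by nlinarith only [hc] : 0 ≤ c * (c - 1)) hv0)]
      have h4 : (4:ℝ) ^ |c - 2| ≤ 4 := by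
        calc (4:ℝ) ^ |c - 2| ≤ 4 ^ (1:ℝ) := by
              apply Real.rpow_le_rpow_of_exponent_le (by norm_num)
              rw [abs_of_pos (by linarith only [hc])]; linarith only [hc3]
          _ = 4 := Real.rpow_one _
      calc |x| * (c * (c - 1) * v) ≤ |x| * (6 * (4 * (Q * Q' * (N:ℝ) ^ (c - 2)))) := by
            gcongr
            · nlinarith only [hc, hc3]
            · refine w2.trans ?_; gcongr
        _ = _ := by rw [hP]; ring)
    (by
      intro v hv
      simp only [ht, Finset.mem_product, Finset.mem_Ico] at hv
      obtain ⟨⟨a1, a2⟩, a5, a6⟩ := hv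
      have b1 : (1:ℝ) ≤ v.1 := by exact_mod_cast a1
      have b2 : (v.1:ℝ) ≤ R := by exact_mod_cast a2.le
      have b5 : (M:ℝ) ≤ v.2 := by exact_mod_cast a5
      have b6 : (v.2:ℝ) ≤ 2 * M := by exact_mod_cast a6.le
      obtain ⟨ξ, k1, k2, k3⟩ := phi_mvt c v.1 v.2 hc (by linarith only [hc, hc3, b1]) (by linarith only [hc, hc3, hR1, hL8, hRM, b5])
      have hξ0 : 0 < ξ := by linarith only [hc, hc3, hR1, hL8, hRM, b5, k1]
      have hD : ((v.2:ℝ) + v.1) ^ c - (v.2:ℝ) ^ c = c * (v.1 * ξ ^ (c - 1)) := by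
        rw [← k3]; field_simp
      have hup : ξ ^ (c - 1) ≤ 9 * (M:ℝ) ^ (c - 1) := by
        calc ξ ^ (c - 1) ≤ (3 * M) ^ (c - 1) := by gcongr <;> linarith only [hc, hc3, hRM, b2, b6, k2]
          _ = 3 ^ (c - 1) * (M:ℝ) ^ (c - 1) := by rw [Real.mul_rpow (by norm_num) hM0.le]
          _ ≤ 3 ^ (2:ℝ) * (M:ℝ) ^ (c - 1) := by gcongr <;> linarith only [hc, hc3]
          _ = _ := by norm_num
      rw [hD, abs_of_nonneg (by positivity)]
      calc c * (v.1 * ξ ^ (c - 1)) ≤ 3 * (R * (9 * (M:ℝ) ^ (c - 1))) := by gcongr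
        _ = _ := by rw [hB, hP']; ring)
    (fun _ => 1) (fun v => β v.1 v.2) (by simp) (fun v _ => hβ _ _)
  simp only [one_mul] at key
  have n1 := hu Q Q' N (1 / (27 * H)) hQ hQ' (by exact_mod_cast hN0) (by exact_mod_cast hQN) (by positivity) s hs _ rfl
  have n2 := hv R M (1 / (24 * H)) hR1n hCRM (by positivity) (by
    rw [div_mul_eq_mul_div, div_le_one (by positivity)]; linarith only [hc, hc3, hR1, g7, hL8, hRM]) t ht
  rw [← hP] at n1
  rw [← hP'] at n2
  have f1 : 1 / (27 * H) * P = 1 / (|x| * B) := by rw [hH, hB]; field_simp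
  have f2 : 1 / (24 * H) * P' = 1 / A := by rw [hH, hA]; field_simp
  rw [f1] at n1
  rw [f2] at n2
  have hset : ((s ×ˢ s).filter (fun p => |x * Dl [(p.1.1:ℝ), (p.1.2.1:ℝ)] (fun t => t ^ c) p.1.2.2 - x * Dl [(p.2.1:ℝ), (p.2.2.1:ℝ)] (fun t => t ^ c) p.2.2.2| ≤ 1 / B)) =
      ((s ×ˢ s).filter (fun p => |Dl [(p.1.1:ℝ), (p.1.2.1:ℝ)] (fun t => t ^ c) p.1.2.2 - Dl [(p.2.1:ℝ), (p.2.2.1:ℝ)] (fun t => t ^ c) p.2.2.2| ≤ 1 / (|x| * B))) := by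
    apply Finset.filter_congr
    intro p _
    have h1B : 1 / (|x| * B) = 1 / B / |x| := by rw [div_div, mul_comm]
    rw [← mul_sub, abs_mul, h1B, le_div_iff₀ hx0, mul_comm |x|]
  rw [hset] at key
  set U := (Q:ℝ) * Q' * N with hU
  have hU0 : 0 < U := by positivity
  set c1 := (((s ×ˢ s).filter (fun p => |Dl [(p.1.1:ℝ), (p.1.2.1:ℝ)] (fun t => t ^ c) p.1.2.2 - Dl [(p.2.1:ℝ), (p.2.2.1:ℝ)] (fun t => t ^ c) p.2.2.2| ≤ 1 / (|x| * B))).card : ℝ) with hc1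
  set c2 := (((t ×ˢ t).filter (fun p => |(((p.1.2:ℝ) + p.1.1) ^ c - (p.1.2:ℝ) ^ c) - (((p.2.2:ℝ) + p.2.1) ^ c - (p.2.2:ℝ) ^ c)| ≤ 1 / A)).card : ℝ) with hc2
  have m1 : c1 ≤ C1 * U ^ (ε / 4) * (13 * U + U ^ 2 / H) := by
    refine n1.trans (mul_le_mul_of_nonneg_left ?_ (by positivity))
    have h1 : ((Q:ℝ) + Q') ^ 2 ≤ (2 * L ^ 4) ^ 2 := by gcongr; linarith only [hQ4, hQ'4]
    have h2 : U ^ 2 * (((Q:ℝ) + Q') ^ 2 / (N:ℝ) ^ 2) ≤ 12 * U := by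
      rw [← mul_div_assoc, div_le_iff₀ (by positivity)]
      calc U ^ 2 * ((Q:ℝ) + Q') ^ 2 ≤ U ^ 2 * (2 * L ^ 4) ^ 2 := by gcongr
        _ = U * (Q * Q') * N * (4 * L ^ 8) := by rw [hU]; ring
        _ ≤ U * L ^ 6 * N * (4 * L ^ 8) := by gcongr
        _ = 4 * U * N * L ^ 14 := by ring
        _ ≤ 4 * U * N * L ^ 18 := by gcongr <;> linarith only [hc, hc3, hC2, hL, hsK]
        _ ≤ 4 * U * N * (3 * N) := by gcongr
        _ = _ := by ring
    have h3 : U ^ 2 * (1 / (27 * H)) ≤ U ^ 2 / H := by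
      rw [mul_one_div]; gcongr; linarith only [hc, hc3, hR1, g7, hL8, hRM]
    rw [mul_add]; linarith only [h2, h3]
  have m2 : c2 ≤ C2 * (M * R + (R:ℝ) ^ 3 + ((M:ℝ) * R) ^ 2 / H) * (1 + Real.log (8 * M)) ^ 5 := by
    refine n2.trans ?_
    have h1M : (1:ℝ) ≤ M := by linarith only [hc, hc3, hR1, hL8, hRM]
    have := Real.log_nonneg (by linarith only [hc, hc3, hR1, hL8, hRM] : (1:ℝ) ≤ 8 * M)
    gcongr
    rw [mul_one_div]; gcongr; linarith only [hc, hc3, hR1, g7, hL8, hRM]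
  have hXb : 1 ≤ L ^ 36 := one_le_pow₀ (by linarith only [hc, hc3, hC2, hL, hsK])
  have hLM : 1 + Real.log (8 * M) ≤ C3 * (L ^ 36) ^ (ε / 10) := by
    refine (hlg M (by linarith only [hc, hc3, hR1, hL8, hRM])).trans ?_
    gcongr
    refine le_trans ?_ g6
    have : (1:ℝ) ≤ N := by exact_mod_cast (by exact_mod_cast hN0 : 0 < N)
    exact le_mul_of_one_le_right hM0.le this
  have hLM0 : 0 ≤ 1 + Real.log (8 * M) := by
    have := Real.log_nonneg (by linarith only [hc, hc3, hR1, hL8, hRM] : (1:ℝ) ≤ 8 * M)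
    linarith only [hc, hc3, this]
  have hUX : U ^ (ε / 4) ≤ (L ^ 36) ^ (ε / 2) := by
    have : U ≤ (L ^ 36) ^ (2:ℝ) := by
      rw [Real.rpow_ofNat]
      have hN36 : (N:ℝ) ≤ L ^ 36 := by
        refine le_trans ?_ g6
        exact le_mul_of_one_le_left hN0.le (by linarith only [hc, hc3, hR1, hL8, hRM])
      calc U ≤ L ^ 6 * L ^ 36 := by rw [hU]; gcongr
        _ ≤ L ^ 36 * L ^ 36 := by gcongr <;> linarith only [hc, hc3, hC2, hL, hsK]
        _ = _ := by ring
    calc U ^ (ε / 4) ≤ ((L ^ 36) ^ (2:ℝ)) ^ (ε / 4) := by gcongr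
      _ = _ := by rw [← Real.rpow_mul (by positivity)]; congr 1; ring
  have hG : (1 + Real.log (8 * M)) ^ 5 ≤ C3 ^ 5 * (L ^ 36) ^ (ε / 2) := by
    calc (1 + Real.log (8 * M)) ^ 5 ≤ (C3 * (L ^ 36) ^ (ε / 10)) ^ 5 := by gcongr
      _ = C3 ^ 5 * (L ^ 36) ^ (ε / 2) := by
        rw [mul_pow, ← Real.rpow_mul_natCast (by positivity)]; congr 2; push_cast; ring
  have hGG : (L ^ 36) ^ (ε / 2) * (L ^ 36) ^ (ε / 2) = (L ^ 36) ^ ε := by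
    rw [← Real.rpow_add (by positivity)]; congr 1; ring
  have hX1 : 1 ≤ (L ^ 36) ^ ε := Real.one_le_rpow hXb hε.le
  have hAB : 8 * (A * B) + 3 ≤ 5187 * H := by
    have : A * B = 648 * H := by rw [hA, hB, hH]; ring
    have hH1 : 1 ≤ H := by linarith only [hc, hc3, hR1, g7, hL8, hRM]
    rw [this]; linarith only [hc, hc3, hR1, g7, hL8, hRM]
  have hnum := B_num L H N M (Q * Q') R U (by linarith only [hc, hc3, hC2, hL, hsK]) hN0 hM0 hH0 hP1 hR1 hR2 hU g1 g2 g3 g4 g5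
  have hfin : ‖∑ u ∈ s, ∑ v ∈ t,
      β v.1 v.2 * e ((x * Dl [(u.1:ℝ), (u.2.1:ℝ)] (fun t => t ^ c) u.2.2) * (((v.2:ℝ) + v.1) ^ c - (v.2:ℝ) ^ c))‖ ≤ √K * ((L ^ 36) ^ ε * (U * M * R / L ^ 8)) := by
    apply sq_root_bd _ _ _ (norm_nonneg _) (by positivity)
    refine key.trans ?_
    have hc10 : 0 ≤ c1 := by rw [hc1]; positivity
    have hc20 : 0 ≤ c2 := by rw [hc2]; positivity
    calc Real.exp (8 * Real.pi) * (8 * (A * B) + 3) * c1 * c2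
        ≤ Real.exp (8 * Real.pi) * (5187 * H) * (C1 * (L ^ 36) ^ (ε / 2) * (13 * U + U ^ 2 / H)) * (C2 * (M * R + (R:ℝ) ^ 3 + ((M:ℝ) * R) ^ 2 / H) * (C3 ^ 5 * (L ^ 36) ^ (ε / 2))) := by
          refine mul_le_mul (mul_le_mul (by gcongr) (m1.trans (by gcongr)) hc10 (by positivity)) (m2.trans (by gcongr)) hc20 (by positivity)
      _ = Real.exp (8 * Real.pi) * 5187 * C1 * C2 * C3 ^ 5 * ((L ^ 36) ^ (ε / 2) * (L ^ 36) ^ (ε / 2)) * (H * (13 * U + U ^ 2 / H) * (M * R + (R:ℝ) ^ 3 + ((M:ℝ) * R) ^ 2 / H)) := by ring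
      _ ≤ Real.exp (8 * Real.pi) * 5187 * C1 * C2 * C3 ^ 5 * (L ^ 36) ^ ε * (100000 * (U * M * R / L ^ 8) ^ 2) := by
          rw [hGG]; gcongr
      _ = K * ((L ^ 36) ^ ε * (U * M * R / L ^ 8) ^ 2) := by rw [hK]; ring
      _ ≤ K * (((L ^ 36) ^ ε) ^ 2 * (U * M * R / L ^ 8) ^ 2) := by
          gcongr; nlinarith only [hX1]
      _ = _ := by ring
  refine hfin.trans ?_
  rw [mul_assoc (8 + C2 + √K)]
  gcongr
  linarith only [hc, hc3, hC2]

lemma step_num (w P N Q V C G k : ℝ) (hw0 : 0 ≤ w) (hP : 0 ≤ P) (hN : 0 ≤ N) (hQ : 0 < Q) (hC : 0 < C) (hG : 1 ≤ G) (hk : 0 < k)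
    (hkQ : k ^ 2 ≤ 2 * Q) (hw : w ^ 2 ≤ P * (2 * N / Q * (P * N + 2 * V))) (hV : V ≤ C * G * (P * Q * N / k ^ 2)) :
    w ≤ √(4 + 4 * C) * (G * (P * N / k)) := by
  apply sq_root_bd _ _ _ hw0 (by positivity)
  have b : 1 / Q ≤ 2 / k ^ 2 := by rw [div_le_div_iff₀ hQ (by positivity)]; linarith
  calc w ^ 2 ≤ _ := hw
    _ ≤ P * (2 * N / Q * (P * N + 2 * (C * G * (P * Q * N / k ^ 2)))) := by gcongr
    _ = 2 * (P * N) ^ 2 * (1 / Q) + 4 * C * G * (P * N / k) ^ 2 := by field_simp; ring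
    _ ≤ 2 * (P * N) ^ 2 * (2 / k ^ 2) + 4 * C * G * (P * N / k) ^ 2 := by gcongr
    _ = 4 * 1 * (P * N / k) ^ 2 + 4 * C * G * (P * N / k) ^ 2 := by ring
    _ ≤ 4 * G ^ 2 * (P * N / k) ^ 2 + 4 * C * G ^ 2 * (P * N / k) ^ 2 := by gcongr <;> nlinarith only [hG]
    _ = _ := by ring

lemma B_num2 (L H M N F F' W : ℝ) (hL : 400 ≤ L) (hN0 : 0 < N) (hM0 : 0 < M) (hH0 : 0 < H) (hF0 : 0 ≤ F')
    (hH : H * (N ^ 2 * M) = W * F') (hF : F' ≤ F) (hF' : F ≤ 512 * F') (hW : L ^ 14 ≤ 8 * W) (hW' : W ≤ L ^ 14)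
    (h1 : L ^ 6 * N ^ 3 ≤ F) (h2 : F ≤ L ^ 74) (hN : L ^ 18 ≤ 3 * N) (hMN : M * N ≤ L ^ 36) (hMN' : L ^ 36 ≤ 8 * (M * N)) :
    H * N ≤ 8 * L ^ 52 ∧ L ^ 20 ≤ 36864 * H ∧ L ^ 12 ≤ M ∧ M ≤ H := by
  have hL0 : 0 < L := by linarith only [hL]
  have hW0 : 0 < W := by have : 0 < L ^ 14 := by positivity
                         linarith only [this, hW]
  have hHM : L ^ 20 * N ≤ 4096 * (H * M) := by
    refine le_of_mul_le_mul_right (a := N ^ 2) ?_ (by positivity)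
    calc L ^ 20 * N * N ^ 2 = L ^ 14 * (L ^ 6 * N ^ 3) := by ring
      _ ≤ (8 * W) * (512 * F') := mul_le_mul hW (h1.trans hF') (by positivity) (by positivity)
      _ = 4096 * (W * F') := by ring
      _ = _ := by rw [← hH]; ring
  refine ⟨?_, ?_, ?_, ?_⟩
  · refine le_of_mul_le_mul_right (a := L ^ 36) ?_ (by positivity)
    calc H * N * L ^ 36 ≤ H * N * (8 * (M * N)) := by gcongr
      _ = 8 * (W * F') := by rw [← hH]; ring
      _ ≤ 8 * (L ^ 14 * L ^ 74) := by gcongr; exact hF.trans h2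
      _ = _ := by ring
  · refine le_of_mul_le_mul_right (a := L ^ 36) ?_ (by positivity)
    calc L ^ 20 * L ^ 36 = L ^ 20 * (L ^ 18) ^ 2 := by ring
      _ ≤ L ^ 20 * (3 * N) ^ 2 := by gcongr
      _ = 9 * N * (L ^ 20 * N) := by ring
      _ ≤ 9 * N * (4096 * (H * M)) := by gcongr
      _ = 36864 * H * (M * N) := by ring
      _ ≤ _ := by gcongr
  · have hN3 : N ^ 3 ≤ L ^ 68 := by
      refine le_of_mul_le_mul_left (a := L ^ 6) ?_ (by positivity)
      calc _ ≤ _ := h1.trans h2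
        _ = _ := by ring
    refine le_of_pow_le_pow_left₀ (n := 3) (by norm_num) hM0.le ?_
    refine le_of_mul_le_mul_right (a := L ^ 72) ?_ (by positivity)
    have h512 : (512:ℝ) ≤ L ^ 4 := by
      calc (512:ℝ) ≤ 400 ^ 4 := by norm_num
        _ ≤ _ := by gcongr
    calc (L ^ 12) ^ 3 * L ^ 72 = (L ^ 36) ^ 3 := by ring
      _ ≤ (8 * (M * N)) ^ 3 := by gcongr
      _ = M ^ 3 * (512 * N ^ 3) := by ring
      _ ≤ M ^ 3 * (L ^ 4 * L ^ 68) := by gcongr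
      _ = _ := by ring
  · refine le_of_mul_le_mul_right (a := M * N ^ 2 * 4096) ?_ (by positivity)
    have h2' : (27 * 4096:ℝ) ≤ L ^ 2 := by nlinarith only [hL]
    calc M * (M * N ^ 2 * 4096) = 4096 * (M * N) ^ 2 := by ring
      _ ≤ 4096 * (L ^ 36) ^ 2 := by gcongr
      _ = (27 * 4096) * L ^ 72 / 27 := by ring
      _ ≤ L ^ 2 * L ^ 72 / 27 := by gcongr
      _ = L ^ 20 * (L ^ 18 / 3) ^ 3 := by ring
      _ ≤ L ^ 20 * N ^ 3 := by gcongr; linarith only [hN]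
      _ = (L ^ 20 * N) * N ^ 2 := by ring
      _ ≤ (4096 * (H * M)) * N ^ 2 := by gcongr
      _ = _ := by ring

/-- converting a sum of norms to a single norm -/
lemma B_E {ι : Type*} (s : Finset ι) (φ : ι → ℝ) (ψ : ℕ → ℝ) (M R : ℕ) (b : ℕ → ℂ) (hb : ∀ n, ‖b n‖ ≤ 1) (B : ℝ)
    (h : ∀ β : ℕ → ℕ → ℂ, (∀ r m, ‖β r m‖ ≤ 1) → ‖∑ u ∈ s, ∑ v ∈ Finset.Ico 1 R ×ˢ Finset.Ico M (2 * M), β v.1 v.2 * e (φ u * (ψ (v.2 + v.1) - ψ v.2))‖ ≤ B) :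
    ∑ r ∈ Finset.Ico 1 R, ‖∑ u ∈ s, ∑ m ∈ Finset.Ico M (2 * M), (b (m + r) * (starRingEnd ℂ) (b m)) * e (φ u * (ψ (m + r) - ψ m))‖ ≤ B := by
  choose θ hθ1 hθ2 using fun r : ℕ => exists_phase (∑ u ∈ s, ∑ m ∈ Finset.Ico M (2 * M), (b (m + r) * (starRingEnd ℂ) (b m)) * e (φ u * (ψ (m + r) - ψ m)))
  refine le_trans (le_of_eq ?_) (h (fun r m => θ r * (b (m + r) * (starRingEnd ℂ) (b m))) fun r m => ?_)
  · have h1 : ((∑ r ∈ Finset.Ico 1 R, ‖∑ u ∈ s, ∑ m ∈ Finset.Ico M (2 * M), (b (m + r) * (starRingEnd ℂ) (b m)) * e (φ u * (ψ (m + r) - ψ m))‖ : ℝ) : ℂ) =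
        ∑ u ∈ s, ∑ v ∈ Finset.Ico 1 R ×ˢ Finset.Ico M (2 * M), θ v.1 * (b (v.2 + v.1) * (starRingEnd ℂ) (b v.2)) * e (φ u * (ψ (v.2 + v.1) - ψ v.2)) := by
      push_cast
      simp_rw [Finset.sum_product, ← hθ2]
      rw [Finset.sum_comm]
      simp_rw [Finset.mul_sum, mul_assoc]
    rw [← h1, Complex.norm_real, Real.norm_of_nonneg (Finset.sum_nonneg fun _ _ => norm_nonneg _)]
  · rw [norm_mul, norm_mul, RCLike.norm_conj]
    exact mul_le_one₀ (hθ1 r) (by positivity) (mul_le_one₀ (hb _) (norm_nonneg _) (hb _))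

set_option maxHeartbeats 1000000 in
lemma B_V (c : ℝ) (hc : 2 < c) (hc3 : c < 3) (ε : ℝ) (hε : 0 < ε) : ∃ C > (1:ℝ), ∀ (L x : ℝ) (M N Q Q' : ℕ), C ≤ L →
    Q = ⌊L ^ 4⌋₊ → Q' = ⌊L ^ 2⌋₊ → L ^ 6 * (N:ℝ) ^ 3 ≤ |x| * (L ^ 36) ^ c → |x| * (L ^ 36) ^ c ≤ L ^ 74 → L ^ 18 ≤ 3 * (N:ℝ) →
    (M:ℝ) * N ≤ L ^ 36 → L ^ 36 ≤ 8 * ((M:ℝ) * N) →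
    ∑ u ∈ Finset.Ico 1 Q ×ˢ Finset.Ico 1 Q' ×ˢ Finset.Ico N (2 * N), ‖∑ m ∈ Finset.Ico M (2 * M),
      e ((x * Dl [(u.1:ℝ), (u.2.1:ℝ)] (fun t => t ^ c) u.2.2) * (m:ℝ) ^ c)‖ ≤ C * ((L ^ 36) ^ ε * ((Q:ℝ) * Q' * N * M / L ^ 4)) := by
  obtain ⟨C, hC, h⟩ := B_dls c hc hc3 ε hε
  refine ⟨400 + C + √(4 + 4 * C), by have := Real.sqrt_nonneg (4 + 4 * C); linarith, ?_⟩
  intro L x M N Q Q' hL hQ hQ' h1 h2 hN hMN hMN'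
  have hsq := Real.sqrt_nonneg (4 + 4 * C)
  have hL4 : 400 ≤ L := by linarith only [hL, hC, hsq]
  have hLC : C ≤ L := by linarith only [hL, hsq]
  have hL1 : 1 ≤ L := by linarith only [hL4]
  have hL0 : 0 < L := by linarith only [hL4]
  obtain ⟨q1, q2, q3⟩ := floor_half (L ^ 4) (one_le_pow₀ hL1)
  obtain ⟨p1, p2, p3⟩ := floor_half (L ^ 2) (one_le_pow₀ hL1)
  obtain ⟨r1, r2, r3⟩ := floor_half (L ^ 8) (one_le_pow₀ hL1)
  rw [← hQ] at q1 q2 q3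
  rw [← hQ'] at p1 p2 p3
  generalize ⌊L ^ 8⌋₊ = R at r1 r2 r3
  have hQ0 : (0:ℝ) < Q := by exact_mod_cast q1
  have hQ0' : (0:ℝ) < Q' := by exact_mod_cast p1
  have hR0 : (0:ℝ) < R := by exact_mod_cast r1
  have hN0 : (0:ℝ) < N := by have : 0 < L ^ 18 := by positivity
                             linarith only [this, hN]
  have hM0 : (0:ℝ) < M := by
    have : 0 < (M:ℝ) * N := by have : 0 < L ^ 36 := by positivity
                               linarith only [this, hMN']
    exact pos_of_mul_pos_left this hN0.le
  have hx : x ≠ 0 := by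
    rintro rfl
    have : 0 < L ^ 6 * (N:ℝ) ^ 3 := by positivity
    simp at h1; linarith only [this, h1]
  have hPP : L ^ 6 ≤ 4 * ((Q:ℝ) * Q') := by
    calc L ^ 6 = L ^ 4 * L ^ 2 := by ring
      _ ≤ (2 * (Q:ℝ)) * (2 * Q') := by gcongr
      _ = _ := by ring
  have hPP' : (Q:ℝ) * Q' ≤ L ^ 6 := by
    calc (Q:ℝ) * Q' ≤ L ^ 4 * L ^ 2 := by gcongr
      _ = _ := by ring
  have hH0 : 0 < |x| * ((Q:ℝ) * Q' * (N:ℝ) ^ (c - 2)) * (R * (M:ℝ) ^ (c - 1)) := by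
    have := abs_pos.mpr hx; positivity
  obtain ⟨g1, g2, g3, g4⟩ := B_num2 L _ M N _ (|x| * ((M:ℝ) * N) ^ c) ((Q:ℝ) * Q' * R) hL4 hN0 hM0 hH0 (by positivity)
    (by
      rw [Real.rpow_sub hN0, Real.rpow_sub hM0, Real.rpow_one, Real.rpow_ofNat, Real.mul_rpow hM0.le hN0.le]
      field_simp) (by gcongr)
    (by
      calc |x| * (L ^ 36) ^ c ≤ |x| * (8 * ((M:ℝ) * N)) ^ c := by gcongr
        _ = |x| * ((8:ℝ) ^ c * ((M:ℝ) * N) ^ c) := by rw [Real.mul_rpow (by norm_num) (by positivity)]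
        _ ≤ |x| * ((8:ℝ) ^ (3:ℝ) * ((M:ℝ) * N) ^ c) := by gcongr; norm_num
        _ = _ := by norm_num; ring)
    (by
      calc L ^ 14 = L ^ 6 * L ^ 8 := by ring
        _ ≤ (4 * ((Q:ℝ) * Q')) * (2 * R) := by gcongr
        _ = _ := by ring)
    (by
      calc (Q:ℝ) * Q' * R ≤ L ^ 6 * L ^ 8 := by gcongr
        _ = _ := by ring) h1 h2 hN hMN hMN'
  have hRM : R ≤ M := by
    have : (R:ℝ) ≤ M := r2.trans ((pow_le_pow_right₀ hL1 (by norm_num)).trans g3)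
    exact_mod_cast this
  have key := fun β => h L x _ M N Q Q' R β hLC q1 p1 q2 (p2.trans (pow_le_pow_right₀ hL1 (by norm_num))) hPP hPP' r3 r2 hx rfl g1 g2 hN g3 hMN' hMN g4
  clear h g1 g2 g3 g4 hH0 h1 h2 hPP hPP' hMN hMN'
  set s := Finset.Ico 1 Q ×ˢ Finset.Ico 1 Q' ×ˢ Finset.Ico N (2 * N) with hs
  have hcard : (s.card:ℝ) ≤ (Q:ℝ) * Q' * N := by
    have : s.card ≤ Q * (Q' * N) := by
      rw [hs, Finset.card_product, Finset.card_product, Nat.card_Ico, Nat.card_Ico, Nat.card_Ico]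
      gcongr <;> omega
    calc (s.card:ℝ) ≤ ((Q * (Q' * N) : ℕ):ℝ) := by exact_mod_cast this
      _ = _ := by push_cast; ring
  have hv := vdcP s (fun u => x * Dl [(u.1:ℝ), (u.2.1:ℝ)] (fun t => t ^ c) u.2.2) (fun m => (m:ℝ) ^ c)
    (fun n => if n ∈ Finset.Ico M (2 * M) then 1 else 0) M R r1 hRM (fun n => by split_ifs <;> simp) (fun n hn => by
      rw [ne_eq, ite_eq_right_iff, Classical.not_imp, Finset.mem_Ico] at hn; exact hn.1)
  have hE := B_E s (fun u => x * Dl [(u.1:ℝ), (u.2.1:ℝ)] (fun t => t ^ c) u.2.2) (fun m => (m:ℝ) ^ c) M R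
    (fun n => if n ∈ Finset.Ico M (2 * M) then 1 else 0) (fun n => by split_ifs <;> simp) _ (fun β hβ => by
      have := key β hβ
      simpa only [Nat.cast_add] using this)
  refine (step_num _ ((Q:ℝ) * Q' * N) M R _ C ((L ^ 36) ^ ε) (L ^ 4) (Finset.sum_nonneg fun _ _ => norm_nonneg _) (by positivity) hM0.le hR0 (by linarith only [hC])
    (Real.one_le_rpow (one_le_pow₀ hL1) hε.le) (by positivity) (by rw [← pow_mul]; exact r3) ?_ (hE.trans (le_of_eq ?_))).trans ?_
  · refine sq_sum_le_card_mul_sum_sq.trans ?_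
    refine mul_le_mul hcard ?_ (by positivity) (by positivity)
    refine le_trans (le_of_eq ?_) (hv.trans ?_)
    · refine Finset.sum_congr rfl fun u _ => ?_
      congr 2
      refine Finset.sum_congr rfl fun m hm => ?_
      rw [if_pos hm, one_mul]
    · gcongr
  · ring
  · gcongr; linarith only [hC]

set_option maxHeartbeats 1000000 in
lemma caseB (c : ℝ) (hc : 2 < c) (hc3 : c < 3) (ε : ℝ) (hε : 0 < ε) : ∃ C > (1:ℝ), ∀ (L x : ℝ) (M N : ℕ) (a b : ℕ → ℂ), C ≤ L →
    L ^ 6 * (N:ℝ) ^ 3 ≤ |x| * (L ^ 36) ^ c → |x| * (L ^ 36) ^ c ≤ L ^ 74 → L ^ 18 ≤ 3 * (N:ℝ) →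
    (M:ℝ) * N ≤ L ^ 36 → L ^ 36 ≤ 8 * ((M:ℝ) * N) →
    (∀ n, ‖a n‖ ≤ 1) → (∀ n, ‖b n‖ ≤ 1) → (∀ n, b n ≠ 0 → N ≤ n ∧ n < 2 * N) →
    ‖∑ m ∈ Finset.Ico M (2 * M), a m * ∑ n ∈ Finset.Ico N (2 * N), b n * e (x * (m:ℝ) ^ c * (n:ℝ) ^ c)‖ ≤ C * ((L ^ 36) ^ ε * L ^ 35) := by
  obtain ⟨C, hC, h⟩ := B_V c hc hc3 ε hε
  have s1 := Real.sqrt_nonneg (4 + 4 * √(4 + 4 * C))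
  refine ⟨2 + C + √(4 + 4 * √(4 + 4 * C)), by linarith, ?_⟩
  intro L x M N a b hL h1 h2 hN hMN hMN' ha hb hb0
  have hL2 : 2 ≤ L := by linarith only [hL, hC, s1]
  have hLC : C ≤ L := by linarith only [hL, s1]
  have hL1 : 1 ≤ L := by linarith only [hL2]
  have hL0 : 0 < L := by linarith only [hL2]
  obtain ⟨q1, q2, q3⟩ := floor_half (L ^ 4) (one_le_pow₀ hL1)
  obtain ⟨p1, p2, p3⟩ := floor_half (L ^ 2) (one_le_pow₀ hL1)
  have hV := h L x M N _ _ hLC rfl rfl h1 h2 hN hMN hMN'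
  generalize ⌊L ^ 4⌋₊ = Q at q1 q2 q3 hV
  generalize ⌊L ^ 2⌋₊ = Q' at p1 p2 p3 hV
  clear h h1 h2
  have hQ0 : (0:ℝ) < Q := by exact_mod_cast q1
  have hQ0' : (0:ℝ) < Q' := by exact_mod_cast p1
  have hN4 : L ^ 4 ≤ N := by
    have : L ^ 18 = L ^ 4 * L ^ 14 := by ring
    have h14 : (2:ℝ) ^ 14 ≤ L ^ 14 := by gcongr
    have h4 : 0 < L ^ 4 := by positivity
    nlinarith only [this, h14, h4, hN]
  have hN0 : (0:ℝ) < N := lt_of_lt_of_le (by positivity) hN4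
  have hQN : Q ≤ N := by exact_mod_cast q2.trans hN4
  have hQN' : Q' ≤ N := by exact_mod_cast p2.trans ((pow_le_pow_right₀ hL1 (by norm_num)).trans hN4)
  have hG : 1 ≤ (L ^ 36) ^ ε := Real.one_le_rpow (one_le_pow₀ hL1) hε.le
  set b' : ℕ → ℕ → ℂ := fun q n => b (n + q) * (starRingEnd ℂ) (b n) with hb'
  set ψ : ℕ → ℕ → ℝ := fun q n => ((n + q : ℕ):ℝ) ^ c - (n:ℝ) ^ c with hψ
  set T : ℕ → ℂ := fun q => ∑ y ∈ Finset.Ico M (2 * M), ∑ n ∈ Finset.Ico N (2 * N), b' q n * e ((x * (y:ℝ) ^ c) * ψ q n) with hT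
  have hcM : (Finset.Ico M (2 * M)).card = M := by rw [Nat.card_Ico]; omega
  have hTq : ∀ q ∈ Finset.Ico 1 Q', ‖T q‖ ^ 2 ≤ M * (2 * N / Q * (M * N + 2 * ∑ q' ∈ Finset.Ico 1 Q, ∑ n ∈ Finset.Ico N (2 * N),
      ‖∑ m ∈ Finset.Ico M (2 * M), e ((x * Dl [(q':ℝ), (q:ℝ)] (fun t => t ^ c) n) * (m:ℝ) ^ c)‖)) := by
    intro q _
    obtain ⟨k1, k2⟩ := b_shift b N hb hb0 q
    have hcs := cs_card (Finset.Ico M (2 * M)) (fun _ => 1) (fun m => ∑ n ∈ Finset.Ico N (2 * N), b' q n * e ((x * (m:ℝ) ^ c) * ψ q n)) (by simp)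
    have hv := vdcP (Finset.Ico M (2 * M)) (fun m => x * (m:ℝ) ^ c) (ψ q) (b' q) N Q q1 hQN k1 k2
    rw [hcM] at hcs hv
    simp only [one_mul] at hcs
    refine hcs.trans (mul_le_mul_of_nonneg_left (hv.trans ?_) (by positivity))
    gcongr with q' _
    rw [Finset.sum_comm]
    refine (norm_sum_le _ _).trans (Finset.sum_le_sum fun n _ => ?_)
    rw [← Finset.mul_sum, norm_mul]
    refine (mul_le_of_le_one_left (norm_nonneg _) ((b_shift _ N k1 k2 q').1 n)).trans (le_of_eq ?_)
    congr 1
    refine Finset.sum_congr rfl fun m _ => ?_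
    congr 1
    simp only [hψ, Dl]; push_cast; ring
  have hTT : ∑ q ∈ Finset.Ico 1 Q', ‖T q‖ ≤ √(4 + 4 * C) * ((L ^ 36) ^ ε * (Q' * M * N / L ^ 2)) := by
    refine step_num _ ((Q':ℝ) * M) N Q _ C _ (L ^ 2) (Finset.sum_nonneg fun _ _ => norm_nonneg _) (by positivity) hN0.le hQ0 (by linarith only [hC]) hG (by positivity)
      (by rw [← pow_mul]; exact q3) ?_ (hV.trans (le_of_eq (by ring)))
    have hc1 : ((Finset.Ico 1 Q').card:ℝ) ≤ Q' := by rw [Nat.card_Ico]; exact_mod_cast Nat.sub_le _ _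
    refine sq_sum_le_card_mul_sum_sq.trans ?_
    rw [mul_assoc]
    refine mul_le_mul hc1 ((Finset.sum_le_sum hTq).trans ?_) (by positivity) (by positivity)
    simp_rw [← Finset.mul_sum, Finset.sum_add_distrib, ← Finset.mul_sum]
    rw [Finset.sum_product, Finset.sum_comm, Finset.sum_const, nsmul_eq_mul]
    simp_rw [Finset.sum_product]
    gcongr _ * (_ * (?_ + _))
    have e0 : M * (((Finset.Ico 1 Q').card:ℝ) * N) ≤ Q' * M * N := by rw [← mul_assoc, mul_comm (M:ℝ)]; gcongr
    exact e0
  refine (step_num _ M N Q' (∑ q ∈ Finset.Ico 1 Q', ‖T q‖) (√(4 + 4 * C)) _ L (norm_nonneg _) (by positivity) hN0.le hQ0' (by positivity) hG hL0 p3 ?_ (hTT.trans (le_of_eq (by ring)))).trans ?_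
  · have hcs := cs_card (Finset.Ico M (2 * M)) a (fun m => ∑ n ∈ Finset.Ico N (2 * N), b n * e ((x * (m:ℝ) ^ c) * (n:ℝ) ^ c)) (fun i _ => ha i)
    have hv := vdcP (Finset.Ico M (2 * M)) (fun m => x * (m:ℝ) ^ c) (fun n => (n:ℝ) ^ c) b N Q' p1 hQN' hb hb0
    rw [hcM] at hcs hv
    exact hcs.trans (mul_le_mul_of_nonneg_left hv (by positivity))
  · have h35 : (M:ℝ) * N / L ≤ L ^ 35 := by
      rw [div_le_iff₀ hL0]; refine hMN.trans (le_of_eq ?_); ring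
    gcongr
    linarith only [hC]

lemma e_pow (a : ℝ) (k : ℕ) : e (k * a) = e a ^ k := by
  unfold e; rw [← Complex.exp_nat_mul]; congr 1; push_cast; ring

lemma dft_orth (P n j : ℕ) (hn : n < P) (hj : j < P) :
    ∑ k ∈ Finset.range P, e (k * (((j:ℝ) - n) / P)) = if j = n then (P:ℂ) else 0 := by
  have hP : (0:ℝ) < P := by exact_mod_cast (by omega : 0 < P)
  split_ifs with h
  · subst h; simp [e_zero]
  · simp_rw [e_pow]
    have h1 := geom_sum_mul (e (((j:ℝ) - n) / P)) P
    have hz := e_int ((j:ℤ) - n)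
    push_cast at hz
    rw [← e_pow, mul_div_cancel₀ _ hP.ne', hz, sub_self] at h1
    refine (mul_eq_zero.mp h1).resolve_right fun h2 => ?_
    rw [sub_eq_zero] at h2
    unfold e at h2
    rw [Complex.exp_eq_one_iff] at h2
    obtain ⟨r, hr⟩ := h2
    have h3 : ((((j:ℝ) - n) / P : ℝ):ℂ) = r := by
      refine mul_left_cancel₀ Complex.two_pi_I_ne_zero ?_
      rw [hr]; ring
    have h4 : ((j:ℝ) - n) / P = r := by exact_mod_cast h3
    rw [div_eq_iff hP.ne'] at h4
    have h5 : ((j:ℤ) - n : ℤ) = r * P := by exact_mod_cast h4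
    have : r = 0 := by
      by_contra h0
      have hr1 : 1 ≤ |r| := Int.one_le_abs h0
      have : |(j:ℤ) - n| = |r| * P := by rw [h5, abs_mul, Nat.abs_cast]
      have : |(j:ℤ) - n| < P := by rw [abs_lt]; omega
      nlinarith
    rw [this, zero_mul] at h5
    omega

lemma dft_sep (P n A B : ℕ) (hn : n < P) (hB : B ≤ P) : (if A ≤ n ∧ n < B then (1:ℂ) else 0) =
    ∑ k ∈ Finset.range P, ((1 / (P:ℂ)) * ∑ j ∈ Finset.Ico A B, e ((k:ℝ) / P * j)) * e (-((k:ℝ) / P * n)) := by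
  have hP : (P:ℂ) ≠ 0 := by exact_mod_cast (by omega : P ≠ 0)
  have h1 : ∀ k ∈ Finset.range P, ((1 / (P:ℂ)) * ∑ j ∈ Finset.Ico A B, e ((k:ℝ) / P * j)) * e (-((k:ℝ) / P * n)) =
      (1 / (P:ℂ)) * ∑ j ∈ Finset.Ico A B, e (k * (((j:ℝ) - n) / P)) := by
    intro k _
    rw [mul_assoc, Finset.sum_mul]
    congr 1
    refine Finset.sum_congr rfl fun j _ => ?_
    rw [← e_add]; congr 1; ring
  rw [Finset.sum_congr rfl h1, ← Finset.mul_sum, Finset.sum_comm,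
    Finset.sum_congr rfl fun j hj => dft_orth P n j hn ((Finset.mem_Ico.mp hj).2.trans_le hB), Finset.sum_ite_eq']
  simp only [Finset.mem_Ico]
  split_ifs <;> simp [hP]

lemma gk_bound (P A B k : ℕ) (hk : k < P) (hB : B ≤ P) :
    ‖(1 / (P:ℂ)) * ∑ j ∈ Finset.Ico A B, e ((k:ℝ) / P * j)‖ ≤ if k = 0 then 1 else 3 * (1 / (k:ℝ) + 1 / ((P - k : ℕ):ℝ)) := by
  have hP : (0:ℝ) < P := by exact_mod_cast (by omega : 0 < P)
  rw [norm_mul, norm_div, norm_one, Complex.norm_natCast]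
  split_ifs with h0
  · rw [one_div, inv_mul_le_iff₀ hP, mul_one]
    refine (norm_sum_le _ _).trans ?_
    simp only [e_norm, Finset.sum_const, Nat.card_Ico, nsmul_eq_mul, mul_one]
    exact_mod_cast (Nat.sub_le _ _).trans hB
  · have hk0 : (0:ℝ) < k := by exact_mod_cast Nat.pos_of_ne_zero h0
    have hk1 : (0:ℝ) < ((P - k : ℕ):ℝ) := by exact_mod_cast (by omega : 0 < P - k)
    have hc : ((P - k : ℕ):ℝ) = P - k := by rw [Nat.cast_sub hk.le]
    have hθ : ∀ θ : ℝ, θ = 1 / (P * (1 / (k:ℝ) + 1 / ((P - k : ℕ):ℝ))) → 0 < θ ∧ θ ≤ k / P ∧ θ ≤ ((P - k : ℕ):ℝ) / P := by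
      rintro θ rfl
      refine ⟨by positivity, ?_, ?_⟩
      · rw [div_le_div_iff₀ (by positivity) hP, one_mul, mul_left_comm]
        refine le_mul_of_one_le_right hP.le ?_
        rw [mul_add, mul_one_div_cancel hk0.ne']
        have : 0 ≤ (k:ℝ) * (1 / ((P - k : ℕ):ℝ)) := by positivity
        linarith
      · rw [div_le_div_iff₀ (by positivity) hP, one_mul, mul_left_comm]
        refine le_mul_of_one_le_right hP.le ?_
        rw [mul_add, mul_one_div_cancel hk1.ne']
        have : 0 ≤ ((P - k : ℕ):ℝ) * (1 / (k:ℝ)) := by positivity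
        linarith
    obtain ⟨t0, t1, t2⟩ := hθ _ rfl
    have key := kusmin_landau0 (fun j => (k:ℝ) / P * j) A B _ t0 (by intro n _ _; push_cast; linarith)
      (by
        intro n _ _
        have : (k:ℝ) / P * ((n + 1 : ℕ):ℝ) - (k:ℝ) / P * n = k / P := by push_cast; ring
        simp only [this]
        refine ⟨t1, ?_⟩
        have h3 : (k:ℝ) / P = 1 - ((P - k : ℕ):ℝ) / P := by rw [hc]; field_simp; ring
        rw [h3]; linarith)
    rw [one_div, inv_mul_le_iff₀ hP]
    refine key.trans (le_of_eq ?_)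
    rw [div_div_eq_mul_div]; ring

lemma wk_sum (P : ℕ) (hP : 1 ≤ P) : ∑ k ∈ Finset.range P, (if k = 0 then (1:ℝ) else 3 * (1 / (k:ℝ) + 1 / ((P - k : ℕ):ℝ))) ≤ 7 * (1 + Real.log P) := by
  obtain ⟨p, rfl⟩ : ∃ p, P = p + 1 := ⟨P - 1, by omega⟩
  rw [Finset.sum_range_succ', if_pos rfl]
  have h1 : ∑ k ∈ Finset.range p, 1 / ((k + 1 : ℕ):ℝ) ≤ 1 + Real.log ((p + 1 : ℕ):ℝ) := by
    refine le_trans ?_ (sum_inv_le_log (p + 1))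
    rw [Finset.sum_bij_ne_zero (fun k _ _ => k + 1) (t := Finset.Icc 1 p) (g := fun g => 1 / (g:ℝ))]
    · exact Finset.sum_le_sum_of_subset_of_nonneg (Finset.Icc_subset_Icc_right (by omega)) fun _ _ _ => by positivity
    · intro k hk _; simp at hk ⊢; omega
    · intro _ _ _ _ _ _ h; omega
    · intro k hk _; exact ⟨k - 1, by simp at hk ⊢; omega, by positivity, by simp at hk ⊢; omega⟩
    · intro k hk _; rfl
  have h2 : ∑ k ∈ Finset.range p, 1 / ((p + 1 - (k + 1) : ℕ):ℝ) = ∑ k ∈ Finset.range p, 1 / ((k + 1 : ℕ):ℝ) := by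
    rw [← Finset.sum_range_reflect]
    refine Finset.sum_congr rfl fun k hk => ?_
    rw [Finset.mem_range] at hk
    congr 2; omega
  have h3 : ∑ k ∈ Finset.range p, (if k + 1 = 0 then (1:ℝ) else 3 * (1 / ((k + 1 : ℕ):ℝ) + 1 / ((p + 1 - (k + 1) : ℕ):ℝ))) =
      3 * (∑ k ∈ Finset.range p, 1 / ((k + 1 : ℕ):ℝ) + ∑ k ∈ Finset.range p, 1 / ((p + 1 - (k + 1) : ℕ):ℝ)) := by
    rw [← Finset.sum_add_distrib, Finset.mul_sum]
    exact Finset.sum_congr rfl fun k _ => if_neg (by omega)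
  rw [h3, h2]
  have := Real.log_nonneg (by exact_mod_cast hP : (1:ℝ) ≤ ((p + 1 : ℕ):ℝ))
  linarith

/-- separation of variables -/
lemma sep_vars (s t : Finset ℕ) (P : ℕ) (hP : 1 ≤ P) (ht : ∀ n ∈ t, n < P) (E : ℕ → ℕ → ℂ) (T : ℝ)
    (h : ∀ a b : ℕ → ℂ, (∀ n, ‖a n‖ ≤ 1) → (∀ n, ‖b n‖ ≤ 1) → ‖∑ m ∈ s, ∑ n ∈ t, a m * b n * E m n‖ ≤ T)
    (a b : ℕ → ℂ) (ha : ∀ n, ‖a n‖ ≤ 1) (hb : ∀ n, ‖b n‖ ≤ 1) (A B : ℕ → ℕ) :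
    ‖∑ m ∈ s, ∑ n ∈ t, if A m ≤ n ∧ n < B m then a m * b n * E m n else 0‖ ≤ 7 * (1 + Real.log P) * T := by
  set w : ℕ → ℝ := fun k => if k = 0 then (1:ℝ) else 3 * (1 / (k:ℝ) + 1 / ((P - k : ℕ):ℝ)) with hw
  set g : ℕ → ℕ → ℂ := fun k m => (1 / (P:ℂ)) * ∑ j ∈ Finset.Ico (A m) (min (B m) P), e ((k:ℝ) / P * j) with hg
  have hwp : ∀ k < P, 0 < w k := by
    intro k hk
    simp only [hw]
    split_ifs with h0
    · norm_num
    · have hk0 : (0:ℝ) < k := by exact_mod_cast Nat.pos_of_ne_zero h0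
      positivity
  have hT : 0 ≤ T := (norm_nonneg _).trans (h a b ha hb)
  have h1 : ∑ m ∈ s, ∑ n ∈ t, (if A m ≤ n ∧ n < B m then a m * b n * E m n else 0) =
      ∑ k ∈ Finset.range P, (w k : ℂ) * ∑ m ∈ s, ∑ n ∈ t, (a m * (g k m / w k)) * (b n * e (-((k:ℝ) / P * n))) * E m n := by
    simp_rw [Finset.mul_sum]
    conv_rhs => rw [Finset.sum_comm]
    refine Finset.sum_congr rfl fun m _ => ?_
    conv_rhs => rw [Finset.sum_comm]
    refine Finset.sum_congr rfl fun n hn => ?_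
    have h2 := dft_sep P n (A m) (min (B m) P) (ht n hn) (min_le_right _ _)
    have h3 : (if A m ≤ n ∧ n < B m then a m * b n * E m n else 0) = (if A m ≤ n ∧ n < min (B m) P then (1:ℂ) else 0) * (a m * b n * E m n) := by
      have := ht n hn
      rw [ite_mul, one_mul, zero_mul]
      congr 1; simp [this]
    rw [h3, h2, Finset.sum_mul]
    refine Finset.sum_congr rfl fun k hk => ?_
    have : (w k : ℂ) ≠ 0 := by exact_mod_cast (hwp k (Finset.mem_range.mp hk)).ne'
    simp only [hg]
    field_simp
  rw [h1]
  refine (norm_sum_le _ _).trans ?_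
  refine le_trans (Finset.sum_le_sum (g := fun k => w k * T) fun k hk => ?_) (by
    rw [← Finset.sum_mul]; exact mul_le_mul_of_nonneg_right (wk_sum P hP) hT)
  have hk := Finset.mem_range.mp hk
  rw [norm_mul, Complex.norm_real, Real.norm_of_nonneg (hwp k hk).le]
  refine mul_le_mul_of_nonneg_left ?_ (hwp k hk).le
  apply h (fun m => a m * (g k m / w k)) (fun n => b n * e (-((k:ℝ) / P * n)))
  · intro m
    rw [norm_mul, norm_div, Complex.norm_real, Real.norm_of_nonneg (hwp k hk).le]
    refine mul_le_one₀ (ha m) (div_nonneg (norm_nonneg _) (hwp k hk).le) ?_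
    rw [div_le_one (hwp k hk)]
    exact gk_bound P _ _ k hk (min_le_right _ _)
  · intro n; rw [norm_mul, e_norm, mul_one]; exact hb n

lemma boxle (c : ℝ) (hc : 2 < c) (hc3 : c < 3) (ε : ℝ) (hε : 0 < ε) : ∃ C > (1:ℝ), ∀ (L x : ℝ) (M N : ℕ) (a b : ℕ → ℂ), C ≤ L →
    L ^ 35 ≤ |x| * (L ^ 36) ^ c → |x| * (L ^ 36) ^ c ≤ L ^ 74 → L ^ 2 ≤ M → M ≤ N →
    (M:ℝ) * N ≤ L ^ 36 → L ^ 36 ≤ 8 * ((M:ℝ) * N) →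
    (∀ n, ‖a n‖ ≤ 1) → (∀ n, ‖b n‖ ≤ 1) →
    ‖∑ m ∈ Finset.Ico M (2 * M), ∑ n ∈ Finset.Ico N (2 * N), a m * b n * e (x * (m:ℝ) ^ c * (n:ℝ) ^ c)‖ ≤ C * ((L ^ 36) ^ ε * L ^ 35) := by
  obtain ⟨C1, hC1, A⟩ := caseA c hc hc3
  obtain ⟨C2, hC2, B⟩ := caseB c hc hc3 ε hε
  refine ⟨2 + C1 + C2, by linarith, ?_⟩
  intro L x M N a b hL hF1 hF2 hM hMN h1 h2 ha hb
  have hL2 : 2 ≤ L := by linarith only [hL, hC1, hC2]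
  have hLC : C2 ≤ L := by linarith only [hL, hC1]
  have hL0 : 0 < L := by linarith only [hL2]
  have hMN' : (M:ℝ) ≤ N := by exact_mod_cast hMN
  have hN0 : (0:ℝ) ≤ N := by positivity
  have hN3 : L ^ 18 ≤ 3 * (N:ℝ) := by
    refine (sq_le_sq₀ (by positivity) (by positivity)).mp ?_
    have h3 : (M:ℝ) * N ≤ N * N := mul_le_mul_of_nonneg_right hMN' hN0
    have h4 : (L ^ 18) ^ 2 = L ^ 36 := by ring
    rw [h4]
    nlinarith only [h3, h2, hN0]
  have hX1 : 1 ≤ (L ^ 36) ^ ε := Real.one_le_rpow (one_le_pow₀ (by linarith only [hL2])) hε.le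
  have hp : 0 < L ^ 35 := by positivity
  have hp2 : L ^ 35 ≤ (L ^ 36) ^ ε * L ^ 35 := le_mul_of_one_le_left hp.le hX1
  rcases le_total (|x| * (L ^ 36) ^ c) (L ^ 6 * (N:ℝ) ^ 3) with h | h
  · have key := A L (L ^ 36) x N M b (fun m => if m ∈ Finset.Ico M (2 * M) then a m else 0) hL2 rfl hF1 h hN3 hM
      (by rw [mul_comm]; exact h1) (by rw [mul_comm (N:ℝ)]; exact h2) hb
      (by intro n; split_ifs; exacts [ha n, by simp])
      (by intro n hn; split_ifs at hn with h5; exacts [Finset.mem_Ico.mp h5, absurd rfl hn])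
    have : ∑ m ∈ Finset.Ico M (2 * M), ∑ n ∈ Finset.Ico N (2 * N), a m * b n * e (x * (m:ℝ) ^ c * (n:ℝ) ^ c) =
      ∑ m ∈ Finset.Ico N (2 * N), b m * ∑ n ∈ Finset.Ico M (2 * M), (fun m => if m ∈ Finset.Ico M (2 * M) then a m else 0) n * e (x * (m:ℝ) ^ c * (n:ℝ) ^ c) := by
      rw [Finset.sum_comm]
      refine Finset.sum_congr rfl fun m _ => ?_
      rw [Finset.mul_sum]
      refine Finset.sum_congr rfl fun n hn => ?_
      simp only [if_pos hn]
      rw [show x * (m:ℝ) ^ c * (n:ℝ) ^ c = x * (n:ℝ) ^ c * (m:ℝ) ^ c by ring]; ring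
    rw [this]
    refine key.trans ?_
    exact mul_le_mul (by linarith only [hC2]) hp2 hp.le (by linarith only [hC1, hC2])
  · have key := B L x M N a (fun m => if m ∈ Finset.Ico N (2 * N) then b m else 0) hLC h hF2 hN3 h1 h2 ha
      (by intro n; split_ifs; exacts [hb n, by simp])
      (by intro n hn; split_ifs at hn with h5; exacts [Finset.mem_Ico.mp h5, absurd rfl hn])
    have : ∑ m ∈ Finset.Ico M (2 * M), ∑ n ∈ Finset.Ico N (2 * N), a m * b n * e (x * (m:ℝ) ^ c * (n:ℝ) ^ c) =
      ∑ m ∈ Finset.Ico M (2 * M), a m * ∑ n ∈ Finset.Ico N (2 * N), (fun m => if m ∈ Finset.Ico N (2 * N) then b m else 0) n * e (x * (m:ℝ) ^ c * (n:ℝ) ^ c) := by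
      refine Finset.sum_congr rfl fun m _ => ?_
      rw [Finset.mul_sum]
      refine Finset.sum_congr rfl fun n hn => ?_
      simp only [if_pos hn]
      ring
    rw [this]
    refine key.trans ?_
    exact mul_le_mul_of_nonneg_right (by linarith only [hC1]) (hp.le.trans hp2)

lemma boxII (c : ℝ) (hc : 2 < c) (hc3 : c < 3) (ε : ℝ) (hε : 0 < ε) : ∃ C > (1:ℝ), ∀ (L x : ℝ) (M N : ℕ) (a b : ℕ → ℂ), C ≤ L →
    L ^ 35 ≤ |x| * (L ^ 36) ^ c → |x| * (L ^ 36) ^ c ≤ L ^ 74 → L ^ 2 ≤ M → L ^ 2 ≤ N →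
    (M:ℝ) * N ≤ L ^ 36 → L ^ 36 ≤ 8 * ((M:ℝ) * N) →
    (∀ n, ‖a n‖ ≤ 1) → (∀ n, ‖b n‖ ≤ 1) →
    ‖∑ m ∈ Finset.Ico M (2 * M), ∑ n ∈ Finset.Ico N (2 * N), a m * b n * e (x * (m:ℝ) ^ c * (n:ℝ) ^ c)‖ ≤ C * ((L ^ 36) ^ ε * L ^ 35) := by
  obtain ⟨C, hC, h⟩ := boxle c hc hc3 ε hε
  refine ⟨C, hC, ?_⟩
  intro L x M N a b hL hF1 hF2 hM hN h1 h2 ha hb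
  rcases le_total M N with hl | hl
  · exact h L x M N a b hL hF1 hF2 hM hl h1 h2 ha hb
  · have key := h L x N M b a hL hF1 hF2 hN hl (by rw [mul_comm]; exact h1) (by rw [mul_comm (N:ℝ)]; exact h2) hb ha
    rw [Finset.sum_comm]
    refine le_trans (le_of_eq ?_) key
    congr 1
    refine Finset.sum_congr rfl fun m _ => Finset.sum_congr rfl fun n _ => ?_
    rw [show x * (m:ℝ) ^ c * (n:ℝ) ^ c = x * (n:ℝ) ^ c * (m:ℝ) ^ c by ring]; ring

/-- cut box: sum over X/2 < m n ≤ X -/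
lemma cutII (c : ℝ) (hc : 2 < c) (hc3 : c < 3) (ε : ℝ) (hε : 0 < ε) : ∃ C > (1:ℝ), ∀ (L x : ℝ) (M N : ℕ) (a b : ℕ → ℂ), C ≤ L →
    L ^ 35 ≤ |x| * (L ^ 36) ^ c → |x| * (L ^ 36) ^ c ≤ L ^ 74 → L ^ 2 ≤ M → L ^ 2 ≤ N →
    (∀ n, ‖a n‖ ≤ 1) → (∀ n, ‖b n‖ ≤ 1) →
    ‖∑ m ∈ Finset.Ico M (2 * M), ∑ n ∈ Finset.Ico N (2 * N), if L ^ 36 / 2 < (m:ℝ) * n ∧ (m:ℝ) * n ≤ L ^ 36 then a m * b n * e (x * (m:ℝ) ^ c * (n:ℝ) ^ c) else 0‖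
      ≤ C * ((1 + Real.log (8 * L ^ 36)) * ((L ^ 36) ^ ε * L ^ 35)) := by
  obtain ⟨C, hC, h⟩ := boxII c hc hc3 ε hε
  refine ⟨7 * C, by linarith, ?_⟩
  intro L x M N a b hL hF1 hF2 hM hN ha hb
  have hL2 : 1 ≤ L := by linarith only [hL, hC]
  have hL0 : 0 < L := by linarith only [hL2]
  have hLC : C ≤ L := by linarith only [hL, hC]
  have hX1 : 1 ≤ L ^ 36 := one_le_pow₀ hL2
  have hlog := Real.log_nonneg (by linarith only [hX1] : 1 ≤ 8 * L ^ 36)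
  have hM1 : 1 ≤ M := by exact_mod_cast (one_le_pow₀ hL2).trans hM
  have hN1 : 1 ≤ N := by exact_mod_cast (one_le_pow₀ hL2).trans hN
  have hM1' : (1:ℝ) ≤ M := by exact_mod_cast hM1
  have hN1' : (1:ℝ) ≤ N := by exact_mod_cast hN1
  by_cases hb1 : (M:ℝ) * N ≤ L ^ 36 ∧ L ^ 36 ≤ 8 * ((M:ℝ) * N)
  · have key := sep_vars (Finset.Ico M (2 * M)) (Finset.Ico N (2 * N)) (2 * N) (by omega) (fun n hn => (Finset.mem_Ico.mp hn).2)
      (fun m n => e (x * (m:ℝ) ^ c * (n:ℝ) ^ c)) _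
      (fun a b ha hb => h L x M N a b hLC hF1 hF2 hM hN hb1.1 hb1.2 ha hb) a b ha hb
      (fun m => ⌊L ^ 36 / 2 / m⌋₊ + 1) (fun m => ⌊L ^ 36 / m⌋₊ + 1)
    have heq : ∀ m ∈ Finset.Ico M (2 * M), ∀ n ∈ Finset.Ico N (2 * N),
        (if L ^ 36 / 2 < (m:ℝ) * n ∧ (m:ℝ) * n ≤ L ^ 36 then a m * b n * e (x * (m:ℝ) ^ c * (n:ℝ) ^ c) else 0) =
        if ⌊L ^ 36 / 2 / m⌋₊ + 1 ≤ n ∧ n < ⌊L ^ 36 / m⌋₊ + 1 then a m * b n * e (x * (m:ℝ) ^ c * (n:ℝ) ^ c) else 0 := by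
      intro m hm n hn
      have hm0 : (0:ℝ) < m := by exact_mod_cast (hM1.trans (Finset.mem_Ico.mp hm).1)
      refine if_congr (and_congr ?_ ?_) rfl rfl
      · rw [Nat.add_one_le_iff, Nat.floor_lt (by positivity), div_lt_iff₀ hm0, mul_comm]
      · rw [Nat.lt_add_one_iff, Nat.le_floor_iff (by positivity), le_div_iff₀ hm0, mul_comm]
    rw [Finset.sum_congr rfl fun m hm => Finset.sum_congr rfl fun n hn => heq m hm n hn]
    refine key.trans ?_
    have : 7 * C * ((1 + Real.log (8 * L ^ 36)) * ((L ^ 36) ^ ε * L ^ 35)) = 7 * (1 + Real.log (8 * L ^ 36)) * (C * ((L ^ 36) ^ ε * L ^ 35)) := by ring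
    rw [this]
    have hl : Real.log ((2 * N : ℕ):ℝ) ≤ Real.log (8 * L ^ 36) := by
      refine Real.log_le_log (by exact_mod_cast (by omega)) ?_
      push_cast
      nlinarith only [hb1.1, hM1', hN1', hX1]
    refine mul_le_mul_of_nonneg_right (by linarith only [hl]) (by positivity)
  · rw [Finset.sum_congr rfl fun m hm => Finset.sum_congr rfl fun n hn => if_neg ?_]
    · simp only [Finset.sum_const_zero, norm_zero]
      positivity
    · rintro ⟨h3, h4⟩
      refine hb1 ⟨?_, ?_⟩
      · refine le_trans ?_ h4
        exact_mod_cast Nat.mul_le_mul (Finset.mem_Ico.mp hm).1 (Finset.mem_Ico.mp hn).1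
      · have : ((m:ℝ)) * n ≤ (2 * M) * (2 * N) := by
          exact_mod_cast Nat.mul_le_mul (Finset.mem_Ico.mp hm).2.le (Finset.mem_Ico.mp hn).2.le
        linarith only [h3, this]

lemma abel_log (f : ℕ → ℂ) (A B : ℕ) (hA : 1 ≤ A) (hAB : A ≤ B) (T : ℝ) (hT : ∀ b ≤ B, ‖∑ m ∈ Finset.Ico A b, f m‖ ≤ T) :
    ‖∑ m ∈ Finset.Ico A B, (Real.log m : ℂ) * f m‖ ≤ 2 * Real.log B * T := by
  have h1 : ∀ b, A ≤ b → ∑ m ∈ Finset.Ico A b, (Real.log m : ℂ) * f m = (Real.log b : ℂ) * ∑ m ∈ Finset.Ico A b, f m -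
      ∑ m ∈ Finset.Ico A b, ((Real.log ((m + 1 : ℕ):ℝ) - Real.log m : ℝ) : ℂ) * ∑ j ∈ Finset.Ico A (m + 1), f j := by
    intro b hb
    induction b, hb using Nat.le_induction with
    | base => simp
    | succ b hb ih =>
      rw [Finset.sum_Ico_succ_top hb, ih, Finset.sum_Ico_succ_top hb (fun m => ((Real.log ((m + 1 : ℕ):ℝ) - Real.log m : ℝ) : ℂ) * ∑ j ∈ Finset.Ico A (m + 1), f j), Finset.sum_Ico_succ_top hb]
      rw [Complex.ofReal_sub]
      ring
  have hT0 : 0 ≤ T := (norm_nonneg _).trans (hT 0 (by omega))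
  have hl0 : 0 ≤ Real.log A := Real.log_natCast_nonneg A
  have hlB : 0 ≤ Real.log B := Real.log_natCast_nonneg B
  rw [h1 B hAB]
  refine (norm_sub_le _ _).trans ?_
  have e1 : ‖(Real.log B : ℂ) * ∑ m ∈ Finset.Ico A B, f m‖ ≤ Real.log B * T := by
    rw [norm_mul, Complex.norm_real, Real.norm_of_nonneg hlB]
    exact mul_le_mul_of_nonneg_left (hT B le_rfl) hlB
  have e2 : ‖∑ m ∈ Finset.Ico A B, ((Real.log ((m + 1 : ℕ):ℝ) - Real.log m : ℝ) : ℂ) * ∑ j ∈ Finset.Ico A (m + 1), f j‖ ≤ (Real.log B - Real.log A) * T := by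
    refine (norm_sum_le _ _).trans ?_
    rw [← Finset.sum_Ico_sub (fun m : ℕ => Real.log (m:ℝ)) hAB, Finset.sum_mul]
    refine Finset.sum_le_sum fun m hm => ?_
    have hm := Finset.mem_Ico.mp hm
    have hp : 0 ≤ Real.log ((m + 1 : ℕ):ℝ) - Real.log m := by
      rw [sub_nonneg]
      refine Real.log_le_log (by exact_mod_cast (by omega)) (by push_cast; linarith)
    rw [norm_mul, Complex.norm_real, Real.norm_of_nonneg hp]
    exact mul_le_mul_of_nonneg_left (hT (m + 1) (by omega)) hp
  have e3 : 0 ≤ Real.log A * T := mul_nonneg hl0 hT0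
  linarith only [e1, e2, e3]

lemma typeI (c : ℝ) (hc : 2 < c) (hc3 : c < 3) : ∃ C > (0:ℝ), ∀ (L x : ℝ) (k b : ℕ), 2 ≤ L →
    L ^ 35 ≤ |x| * (L ^ 36) ^ c → |x| * (L ^ 36) ^ c ≤ L ^ 74 → 1 ≤ k → (k:ℝ) ≤ L ^ 4 →
    b ≤ ⌊L ^ 36 / k⌋₊ + 1 →
    ‖∑ m ∈ Finset.Ico (⌊L ^ 36 / k / 2⌋₊ + 1) b, e (x * (k:ℝ) ^ c * (m:ℝ) ^ c)‖ ≤ C * (L ^ 35 / k) := by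
  obtain ⟨C, hC, h⟩ := WI c hc hc3 (1 / 8) 1 (by norm_num) (by norm_num)
  refine ⟨C, hC, ?_⟩
  intro L x k b hL hF1 hF2 hk hk4 hb
  have hL0 : 0 < L := by linarith
  have hk0 : (0:ℝ) < k := by exact_mod_cast hk
  set Y := L ^ 36 / k with hY
  have hY1 : L ^ 32 ≤ Y := by
    rw [hY, le_div_iff₀ hk0]
    calc L ^ 32 * k ≤ L ^ 32 * L ^ 4 := mul_le_mul_of_nonneg_left hk4 (by positivity)
      _ = L ^ 36 := by ring
  have hY2 : 2 ≤ Y := by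
    refine le_trans ?_ hY1
    calc (2:ℝ) ≤ 2 ^ 32 := by norm_num
      _ ≤ L ^ 32 := pow_le_pow_left₀ (by norm_num) hL 32
  have hY3 : Y ≤ L ^ 36 := div_le_self (by positivity) (by exact_mod_cast hk)
  have hkY : k * Y = L ^ 36 := mul_div_cancel₀ _ hk0.ne'
  have hA1 : Y / 2 < ((⌊Y / 2⌋₊ + 1 : ℕ):ℝ) := by push_cast; exact Nat.lt_floor_add_one _
  have hA2 : ((⌊Y / 2⌋₊ + 1 : ℕ):ℝ) ≤ Y := by
    push_cast
    have := Nat.floor_le (by linarith : 0 ≤ Y / 2)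
    linarith
  have hb2 : b ≤ 2 * (⌊Y / 2⌋₊ + 1) := by
    have : ⌊Y⌋₊ < 2 * (⌊Y / 2⌋₊ + 1) := by
      rw [Nat.floor_lt (by linarith)]; push_cast at hA1 ⊢; linarith
    omega
  generalize (⌊Y / 2⌋₊ + 1) = A at *
  have hA0 : (0:ℝ) < A := by linarith
  have hy : |x * (k:ℝ) ^ c| * (A:ℝ) ^ c = |x| * (k * A) ^ c := by
    rw [abs_mul, abs_of_pos (Real.rpow_pos_of_pos hk0 c), Real.mul_rpow hk0.le hA0.le]; ring
  have hX0 : 0 < L ^ 36 := by positivity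
  have key := h L (|x| * (L ^ 36) ^ c) (x * (k:ℝ) ^ c) A A b hL hF1 hF2 (by linarith) (by linarith) le_rfl hb2
    (by
      rw [hy]
      have : (1 / 8 : ℝ) * (L ^ 36) ^ c ≤ (k * A) ^ c := by
        calc (1 / 8 : ℝ) * (L ^ 36) ^ c ≤ (1 / 2) ^ c * (L ^ 36) ^ c := by
              refine mul_le_mul_of_nonneg_right ?_ (by positivity)
              calc (1 / 8 : ℝ) = (1 / 2) ^ (3:ℝ) := by norm_num
                _ ≤ _ := Real.rpow_le_rpow_of_exponent_ge (by norm_num) (by norm_num) hc3.le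
          _ = (1 / 2 * L ^ 36) ^ c := by rw [Real.mul_rpow (by norm_num) hX0.le]
          _ ≤ _ := by
              refine Real.rpow_le_rpow (by positivity) ?_ (by linarith)
              rw [← hkY]; nlinarith only [hA1, hk0]
      calc _ = |x| * (1 / 8 * (L ^ 36) ^ c) := by ring
        _ ≤ _ := mul_le_mul_of_nonneg_left this (abs_nonneg _))
    (by
      rw [hy, one_mul]
      refine mul_le_mul_of_nonneg_left (Real.rpow_le_rpow (by positivity) ?_ (by linarith)) (abs_nonneg _)
      rw [← hkY]; exact mul_le_mul_of_nonneg_left hA2 hk0.le)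
  refine key.trans (mul_le_mul_of_nonneg_left ?_ hC.le)
  calc (A:ℝ) / L ≤ Y / L := div_le_div_of_nonneg_right hA2 hL0.le
    _ = L ^ 35 / k := by rw [hY]; field_simp

noncomputable def Gw (X c x : ℝ) (n : ℕ) : ℂ := if X / 2 < (n:ℝ) ∧ (n:ℝ) ≤ X then e (x * (n:ℝ) ^ c) else 0

lemma Gw_mul (X c x : ℝ) (m n : ℕ) : Gw X c x (m * n) =
    if X / 2 < (m:ℝ) * n ∧ (m:ℝ) * n ≤ X then e (x * (m:ℝ) ^ c * (n:ℝ) ^ c) else 0 := by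
  unfold Gw
  rw [Nat.cast_mul, Real.mul_rpow (Nat.cast_nonneg _) (Nat.cast_nonneg _), mul_assoc]

lemma Gw_big (X c x : ℝ) (hX : 0 ≤ X) (n : ℕ) (hn : ⌊X⌋₊ < n) : Gw X c x n = 0 := by
  refine if_neg fun h => ?_
  rw [Nat.floor_lt hX] at hn
  linarith only [hn, h.2]

lemma conv_sum (f h : ArithmeticFunction ℝ) (G : ℕ → ℂ) (N : ℕ) (hG : ∀ n, N < n → G n = 0) :
    ∑ n ∈ Finset.Ioc 0 N, ((f * h) n : ℂ) * G n = ∑ m ∈ Finset.Ioc 0 N, ∑ n ∈ Finset.Ioc 0 N, (f m : ℂ) * (h n : ℂ) * G (m * n) := by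
  rw [← Finset.sum_product']
  have h1 : ∀ n ∈ Finset.Ioc 0 N, ((f * h) n : ℂ) * G n =
      ∑ p ∈ Finset.Ioc 0 N ×ˢ Finset.Ioc 0 N, if p.1 * p.2 = n then (f p.1 : ℂ) * (h p.2 : ℂ) * G (p.1 * p.2) else 0 := by
    intro n hn
    have hn' := Finset.mem_Ioc.mp hn
    rw [ArithmeticFunction.mul_apply, Nat.divisorsAntidiagonal_eq_prod_filter_of_le hn'.1.ne' hn'.2, Complex.ofReal_sum,
      Finset.sum_mul, Finset.sum_filter]
    refine Finset.sum_congr rfl fun p _ => ?_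
    split_ifs with h2
    · rw [h2, Complex.ofReal_mul]
    · rfl
  rw [Finset.sum_congr rfl h1, Finset.sum_comm]
  refine Finset.sum_congr rfl fun p hp => ?_
  rw [Finset.sum_ite_eq]
  split_ifs with h2
  · rfl
  · rw [hG, mul_zero]
    rw [Finset.mem_product, Finset.mem_Ioc, Finset.mem_Ioc] at hp
    rw [Finset.mem_Ioc, not_and_or] at h2
    have := Nat.mul_pos hp.1.1 hp.2.1
    omega

lemma inner_eq (X c x : ℝ) (hX : 0 ≤ X) (k : ℕ) (hk : 1 ≤ k) (w : ℕ → ℂ) :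
    ∑ n ∈ Finset.Ioc 0 ⌊X⌋₊, w n * Gw X c x (k * n) =
    ∑ n ∈ Finset.Ico (⌊X / k / 2⌋₊ + 1) (⌊X / k⌋₊ + 1), w n * e (x * (k:ℝ) ^ c * (n:ℝ) ^ c) := by
  have hk0 : (0:ℝ) < k := by exact_mod_cast hk
  have h1 : Finset.Ico (⌊X / k / 2⌋₊ + 1) (⌊X / k⌋₊ + 1) = (Finset.Ioc 0 ⌊X⌋₊).filter (fun n : ℕ => X / 2 < (k:ℝ) * n ∧ (k:ℝ) * n ≤ X) := by
    ext n
    rw [Finset.mem_Ico, Finset.mem_filter, Finset.mem_Ioc, Nat.add_one_le_iff, Nat.lt_add_one_iff,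
      Nat.floor_lt (by positivity), Nat.le_floor_iff (by positivity), Nat.le_floor_iff hX, le_div_iff₀ hk0, div_right_comm, div_lt_iff₀ hk0,
      mul_comm (n:ℝ)]
    constructor
    · rintro ⟨h2, h3⟩
      have hn : 0 < n := by
        rcases Nat.eq_zero_or_pos n with h | h
        · subst h; simp at h2; linarith
        · exact h
      refine ⟨⟨hn, ?_⟩, h2, h3⟩
      have : (1:ℝ) ≤ k := by exact_mod_cast hk
      have hn0 : (0:ℝ) < n := by exact_mod_cast hn
      nlinarith only [h3, this, hn0]
    · exact fun h => h.2
  rw [h1, Finset.sum_filter]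
  refine Finset.sum_congr rfl fun n _ => ?_
  rw [Gw_mul, mul_ite, mul_zero]

lemma tI_gen (f : ℕ → ℝ) (w G : ℕ → ℂ) (N : ℕ) (D T U : ℝ) (hD : 0 ≤ D) (hT : 0 ≤ T) (hf : ∀ k ∈ Finset.Ioc 0 N, |f k| ≤ D)
    (hf0 : ∀ k, f k ≠ 0 → (k:ℝ) ≤ U)
    (h : ∀ k : ℕ, 1 ≤ k → (k:ℝ) ≤ U → ‖∑ n ∈ Finset.Ioc 0 N, w n * G (k * n)‖ ≤ T / k) :
    ‖∑ m ∈ Finset.Ioc 0 N, ∑ n ∈ Finset.Ioc 0 N, (f m : ℂ) * w n * G (m * n)‖ ≤ D * T * (1 + Real.log N) := by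
  refine (norm_sum_le _ _).trans ?_
  refine le_trans (Finset.sum_le_sum (g := fun m : ℕ => D * T * (1 / (m:ℝ))) fun m hm => ?_) ?_
  · simp_rw [mul_assoc]
    rw [← Finset.mul_sum, norm_mul, Complex.norm_real, Real.norm_eq_abs]
    have e1 : 0 ≤ D * (T * (1 / (m:ℝ))) := by positivity
    by_cases h0 : f m = 0
    · rw [h0, abs_zero, zero_mul]; exact e1
    · rw [mul_one_div]
      exact mul_le_mul (hf m hm) (h m (Finset.mem_Ioc.mp hm).1 (hf0 m h0)) (norm_nonneg _) hD
  · rw [← Finset.mul_sum]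
    exact mul_le_mul_of_nonneg_left (sum_inv_le_log N) (mul_nonneg hD hT)

/-- both type I sums -/
lemma tI_all (c : ℝ) (hc : 2 < c) (hc3 : c < 3) : ∃ C > (0:ℝ), ∀ (L x D : ℝ) (f : ℕ → ℝ), 2 ≤ L →
    L ^ 35 ≤ |x| * (L ^ 36) ^ c → |x| * (L ^ 36) ^ c ≤ L ^ 74 → 0 ≤ D → (∀ k ∈ Finset.Ioc 0 ⌊L ^ 36⌋₊, |f k| ≤ D) →
    (∀ k, f k ≠ 0 → (k:ℝ) ≤ L ^ 4) →
    ‖∑ m ∈ Finset.Ioc 0 ⌊L ^ 36⌋₊, ∑ n ∈ Finset.Ioc 0 ⌊L ^ 36⌋₊, (f m : ℂ) * 1 * Gw (L ^ 36) c x (m * n)‖ ≤ C * (D * (1 + Real.log (8 * L ^ 36)) ^ 2 * L ^ 35) ∧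
    ‖∑ m ∈ Finset.Ioc 0 ⌊L ^ 36⌋₊, ∑ n ∈ Finset.Ioc 0 ⌊L ^ 36⌋₊, (f m : ℂ) * (Real.log n : ℂ) * Gw (L ^ 36) c x (m * n)‖ ≤ C * (D * (1 + Real.log (8 * L ^ 36)) ^ 2 * L ^ 35) := by
  obtain ⟨C, hC, h⟩ := typeI c hc hc3
  refine ⟨2 * C, by positivity, ?_⟩
  intro L x D f hL hF1 hF2 hD hf hf0
  have hX1 : 1 ≤ L ^ 36 := one_le_pow₀ (by linarith only [hL])
  have hp : 0 < L ^ 35 := by positivity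
  have hlog := Real.log_nonneg (by linarith only [hX1] : 1 ≤ 8 * L ^ 36)
  have hN1 : 1 ≤ ⌊L ^ 36⌋₊ := Nat.le_floor (by exact_mod_cast hX1)
  have hlN : Real.log (⌊L ^ 36⌋₊:ℝ) ≤ Real.log (8 * L ^ 36) :=
    Real.log_le_log (by exact_mod_cast hN1) ((Nat.floor_le (by linarith only [hX1])).trans (by linarith only [hX1]))
  have hlN0 : 0 ≤ Real.log (⌊L ^ 36⌋₊:ℝ) := Real.log_natCast_nonneg _
  generalize hℓ : Real.log (8 * L ^ 36) = ℓ at *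
  constructor
  · refine (tI_gen f (fun _ => 1) _ _ D (C * L ^ 35) (L ^ 4) hD (by positivity) hf hf0 ?_).trans ?_
    · intro k hk hk4
      rw [inner_eq _ _ _ (by linarith only [hX1]) k hk]
      simp only [one_mul]
      rw [mul_div_assoc]
      exact h L x k _ hL hF1 hF2 hk hk4 le_rfl
    · calc D * (C * L ^ 35) * (1 + Real.log (⌊L ^ 36⌋₊:ℝ)) ≤ D * (C * L ^ 35) * (2 * (1 + ℓ) ^ 2) := by
            refine mul_le_mul_of_nonneg_left ?_ (by positivity)
            nlinarith only [hlN, hlog]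
        _ = _ := by ring
  · refine (tI_gen f (fun n => (Real.log n : ℂ)) _ _ D (2 * ℓ * (C * L ^ 35)) (L ^ 4) hD (by positivity) hf hf0 ?_).trans ?_
    · intro k hk hk4
      have hk0 : (1:ℝ) ≤ k := by exact_mod_cast hk
      rw [inner_eq _ _ _ (by linarith only [hX1]) k hk]
      have hle : ⌊L ^ 36 / k / 2⌋₊ + 1 ≤ ⌊L ^ 36 / k⌋₊ + 1 := by
        have : ⌊L ^ 36 / k / 2⌋₊ ≤ ⌊L ^ 36 / k⌋₊ := Nat.floor_le_floor (half_le_self (by positivity))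
        omega
      refine (abel_log _ _ _ (by omega) hle (C * (L ^ 35 / k)) fun b hb => h L x k b hL hF1 hF2 hk hk4 hb).trans ?_
      have : Real.log ((⌊L ^ 36 / k⌋₊ + 1 : ℕ):ℝ) ≤ ℓ := by
        rw [← hℓ]
        refine Real.log_le_log (by positivity) ?_
        push_cast
        have e1 : (⌊L ^ 36 / k⌋₊:ℝ) ≤ L ^ 36 / k := Nat.floor_le (by positivity)
        have e2 : L ^ 36 / k ≤ L ^ 36 := div_le_self (by positivity) hk0
        linarith only [e1, e2, hX1]
      calc _ ≤ 2 * ℓ * (C * (L ^ 35 / k)) := by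
            refine mul_le_mul_of_nonneg_right (by linarith only [this]) (by positivity)
        _ = _ := by ring
    · calc D * (2 * ℓ * (C * L ^ 35)) * (1 + Real.log (⌊L ^ 36⌋₊:ℝ)) = D * (C * L ^ 35) * (2 * (ℓ * (1 + Real.log (⌊L ^ 36⌋₊:ℝ)))) := by ring
        _ ≤ D * (C * L ^ 35) * (2 * (1 + ℓ) ^ 2) := by
            refine mul_le_mul_of_nonneg_left ?_ (by positivity)
            have := mul_le_mul_of_nonneg_left hlN hlog
            nlinarith only [this, hlog]
        _ = _ := by ring

lemma dyadic_sum (f : ℕ → ℂ) (W J : ℕ) : ∑ m ∈ Finset.Ico W (W * 2 ^ J), f m = ∑ i ∈ Finset.range J, ∑ m ∈ Finset.Ico (W * 2 ^ i) (2 * (W * 2 ^ i)), f m := by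
  induction J with
  | zero => simp
  | succ J ih =>
    rw [Finset.sum_range_succ, ← ih, show W * 2 ^ (J + 1) = 2 * (W * 2 ^ J) by ring,
      Finset.sum_Ico_consecutive f (Nat.le_mul_of_pos_right W (by positivity)) (by omega)]

lemma sum_supp (f : ℕ → ℂ) (s t : Finset ℕ) (hs : ∀ m, f m ≠ 0 → m ∈ s) (ht : ∀ m, f m ≠ 0 → m ∈ t) : ∑ m ∈ s, f m = ∑ m ∈ t, f m :=
  Finset.sum_congr_of_eq_on_inter (fun m _ h => by by_contra h0; exact h (ht m h0)) (fun m _ h => by by_contra h0; exact h (hs m h0)) (fun _ _ _ => rfl)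

lemma tII_unit (c : ℝ) (hc : 2 < c) (hc3 : c < 3) (ε : ℝ) (hε : 0 < ε) : ∃ C > (1:ℝ), ∀ (L x : ℝ) (a b : ℕ → ℂ), C ≤ L →
    L ^ 35 ≤ |x| * (L ^ 36) ^ c → |x| * (L ^ 36) ^ c ≤ L ^ 74 →
    (∀ n, ‖a n‖ ≤ 1) → (∀ n, ‖b n‖ ≤ 1) → (∀ n, a n ≠ 0 → L ^ 2 < n ∧ n ≤ ⌊L ^ 36⌋₊) → (∀ n, b n ≠ 0 → L ^ 2 < n ∧ n ≤ ⌊L ^ 36⌋₊) →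
    ‖∑ m ∈ Finset.Ioc 0 ⌊L ^ 36⌋₊, ∑ n ∈ Finset.Ioc 0 ⌊L ^ 36⌋₊, a m * b n * Gw (L ^ 36) c x (m * n)‖ ≤
      C * ((1 + Real.log (8 * L ^ 36)) ^ 3 * ((L ^ 36) ^ ε * L ^ 35)) := by
  obtain ⟨C, hC, h⟩ := cutII c hc hc3 ε hε
  refine ⟨4 * C, by linarith, ?_⟩
  intro L x a b hL hF1 hF2 ha hb ha0 hb0
  have hLC : C ≤ L := by linarith only [hL, hC]
  have hL1 : 1 ≤ L := by linarith only [hLC, hC]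
  have hX1 : 1 ≤ L ^ 36 := one_le_pow₀ hL1
  have hlog := Real.log_nonneg (by linarith only [hX1] : 1 ≤ 8 * L ^ 36)
  have hN1 : 1 ≤ ⌊L ^ 36⌋₊ := Nat.le_floor (by exact_mod_cast hX1)
  have hlN : Real.log (⌊L ^ 36⌋₊:ℝ) ≤ Real.log (8 * L ^ 36) :=
    Real.log_le_log (by exact_mod_cast hN1) ((Nat.floor_le (by linarith only [hX1])).trans (by linarith only [hX1]))
  set N := ⌊L ^ 36⌋₊
  set W := ⌊L ^ 2⌋₊ + 1 with hW
  have hW1 : L ^ 2 ≤ W := by rw [hW]; push_cast; exact (Nat.lt_floor_add_one _).le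
  set J := Nat.log 2 N + 1 with hJ
  have hJ1 : N < 2 ^ J := Nat.lt_pow_succ_log_self (by norm_num) N
  have hJ2 : (J:ℝ) ≤ 2 * (1 + Real.log (8 * L ^ 36)) := by
    have e1 : (((2:ℕ) ^ (Nat.log 2 N) : ℕ):ℝ) ≤ N := by exact_mod_cast Nat.pow_log_le_self 2 (by omega)
    have e2 := Real.log_le_log (by positivity) e1
    push_cast at e2
    rw [Real.log_pow] at e2
    have e3 : (1/2:ℝ) ≤ Real.log 2 := by have := Real.log_two_gt_d9; linarith
    have e4 : ((Nat.log 2 N : ℕ):ℝ) * (1/2) ≤ (Nat.log 2 N : ℕ) * Real.log 2 := mul_le_mul_of_nonneg_left e3 (by positivity)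
    rw [hJ]; push_cast
    linarith only [e2, e4, hlN]
  have hmem : ∀ n : ℕ, L ^ 2 < n ∧ n ≤ N → n ∈ Finset.Ico W (W * 2 ^ J) := by
    rintro n ⟨h1, h2⟩
    rw [Finset.mem_Ico, hW, Nat.add_one_le_iff, Nat.floor_lt (by positivity)]
    refine ⟨h1, ?_⟩
    calc n ≤ N := h2
      _ < 2 ^ J := hJ1
      _ ≤ _ := Nat.le_mul_of_pos_left _ (by omega)
  have hmem' : ∀ n : ℕ, L ^ 2 < n ∧ n ≤ N → n ∈ Finset.Ioc 0 N := by
    rintro n ⟨h1, h2⟩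
    rw [Finset.mem_Ioc]
    refine ⟨?_, h2⟩
    have : (0:ℝ) < n := lt_of_le_of_lt (by positivity) h1
    exact_mod_cast this
  have q1 : ∑ m ∈ Finset.Ioc 0 N, ∑ n ∈ Finset.Ioc 0 N, a m * b n * Gw (L ^ 36) c x (m * n) =
      ∑ m ∈ Finset.Ico W (W * 2 ^ J), ∑ n ∈ Finset.Ico W (W * 2 ^ J), a m * b n * Gw (L ^ 36) c x (m * n) := by
    rw [sum_supp _ _ (Finset.Ico W (W * 2 ^ J))]
    · refine Finset.sum_congr rfl fun m _ => sum_supp _ _ _ ?_ ?_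
      · exact fun n hn => hmem' n (hb0 n fun h0 => hn (by rw [h0]; ring))
      · exact fun n hn => hmem n (hb0 n fun h0 => hn (by rw [h0]; ring))
    · exact fun m hm => hmem' m (ha0 m fun h0 => hm (by simp [h0]))
    · exact fun m hm => hmem m (ha0 m fun h0 => hm (by simp [h0]))
  rw [q1, dyadic_sum]
  have hWi : ∀ i : ℕ, L ^ 2 ≤ ((W * 2 ^ i : ℕ):ℝ) := by
    intro i
    refine hW1.trans ?_
    exact_mod_cast Nat.le_mul_of_pos_right W (by positivity)
  set B := C * ((1 + Real.log (8 * L ^ 36)) * ((L ^ 36) ^ ε * L ^ 35)) with hB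
  have hB0 : 0 ≤ B := by positivity
  have q2 : ∀ i ∈ Finset.range J, ‖∑ m ∈ Finset.Ico (W * 2 ^ i) (2 * (W * 2 ^ i)), ∑ n ∈ Finset.Ico W (W * 2 ^ J), a m * b n * Gw (L ^ 36) c x (m * n)‖ ≤ J * B := by
    intro i _
    rw [Finset.sum_congr rfl fun m _ => dyadic_sum _ W J, Finset.sum_comm]
    refine (norm_sum_le _ _).trans ((Finset.sum_le_sum (g := fun _ => B) fun j _ => ?_).trans (by simp))
    refine le_trans (le_of_eq ?_) (h L x (W * 2 ^ i) (W * 2 ^ j) a b hLC hF1 hF2 (hWi i) (hWi j) ha hb)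
    congr 1
    refine Finset.sum_congr rfl fun m _ => Finset.sum_congr rfl fun n _ => ?_
    rw [Gw_mul, mul_ite, mul_zero]
  refine (norm_sum_le _ _).trans ((Finset.sum_le_sum q2).trans ?_)
  rw [Finset.sum_const, Finset.card_range, nsmul_eq_mul]
  have hJ0 : (0:ℝ) ≤ J := by positivity
  calc (J:ℝ) * (J * B) = (J * J) * B := by ring
    _ ≤ (2 * (1 + Real.log (8 * L ^ 36))) * (2 * (1 + Real.log (8 * L ^ 36))) * B :=
        mul_le_mul_of_nonneg_right (mul_le_mul hJ2 hJ2 hJ0 (hJ0.trans hJ2)) hB0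
    _ = _ := by rw [hB]; ring

lemma tII (c : ℝ) (hc : 2 < c) (hc3 : c < 3) (ε : ℝ) (hε : 0 < ε) : ∃ C > (1:ℝ), ∀ (L x D1 D2 : ℝ) (f g : ℕ → ℝ), C ≤ L →
    L ^ 35 ≤ |x| * (L ^ 36) ^ c → |x| * (L ^ 36) ^ c ≤ L ^ 74 → 0 < D1 → 0 < D2 →
    (∀ n ∈ Finset.Ioc 0 ⌊L ^ 36⌋₊, |f n| ≤ D1) → (∀ n ∈ Finset.Ioc 0 ⌊L ^ 36⌋₊, |g n| ≤ D2) →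
    (∀ n, f n ≠ 0 → L ^ 2 < n) → (∀ n, g n ≠ 0 → L ^ 2 < n) →
    ‖∑ m ∈ Finset.Ioc 0 ⌊L ^ 36⌋₊, ∑ n ∈ Finset.Ioc 0 ⌊L ^ 36⌋₊, (f m : ℂ) * (g n : ℂ) * Gw (L ^ 36) c x (m * n)‖ ≤
      C * (D1 * D2 * ((1 + Real.log (8 * L ^ 36)) ^ 3 * ((L ^ 36) ^ ε * L ^ 35))) := by
  obtain ⟨C, hC, h⟩ := tII_unit c hc hc3 ε hε
  refine ⟨C, hC, ?_⟩
  intro L x D1 D2 f g hL hF1 hF2 h1 h2 hf hg hf0 hg0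
  generalize hN : ⌊L ^ 36⌋₊ = N at *
  have A : ∀ (f : ℕ → ℝ) (D : ℝ), 0 < D → (∀ n ∈ Finset.Ioc 0 N, |f n| ≤ D) → (∀ n, f n ≠ 0 → L ^ 2 < n) →
      ∃ a : ℕ → ℂ, (∀ n, ‖a n‖ ≤ 1) ∧ (∀ n, a n ≠ 0 → L ^ 2 < n ∧ n ≤ N) ∧ ∀ n ∈ Finset.Ioc 0 N, (f n : ℂ) = D * a n := by
    intro f D hD hf hf0
    refine ⟨fun n => if n ∈ Finset.Ioc 0 N then ((f n / D : ℝ):ℂ) else 0, ?_, ?_, ?_⟩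
    · intro n
      dsimp only
      split_ifs with hn
      · rw [Complex.norm_real, Real.norm_eq_abs, abs_div, abs_of_pos hD, div_le_one hD]; exact hf n hn
      · simp
    · intro n hn
      dsimp only at hn
      split_ifs at hn with h5
      · exact ⟨hf0 n fun h0 => hn (by simp [h0]), (Finset.mem_Ioc.mp h5).2⟩
      · exact absurd rfl hn
    · intro n hn
      dsimp only
      rw [if_pos hn, ← Complex.ofReal_mul, mul_div_cancel₀ _ hD.ne']
  obtain ⟨a, a1, a2, a3⟩ := A f D1 h1 hf hf0
  obtain ⟨b, b1, b2, b3⟩ := A g D2 h2 hg hg0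
  have key := h L x a b hL hF1 hF2 a1 b1 (by rw [hN]; exact a2) (by rw [hN]; exact b2)
  rw [hN] at key
  have q : ∑ m ∈ Finset.Ioc 0 N, ∑ n ∈ Finset.Ioc 0 N, (f m : ℂ) * (g n : ℂ) * Gw (L ^ 36) c x (m * n) =
      ((D1 * D2 : ℝ) : ℂ) * ∑ m ∈ Finset.Ioc 0 N, ∑ n ∈ Finset.Ioc 0 N, a m * b n * Gw (L ^ 36) c x (m * n) := by
    simp_rw [Finset.mul_sum]
    refine Finset.sum_congr rfl fun m hm => Finset.sum_congr rfl fun n hn => ?_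
    rw [a3 m hm, b3 n hn, Complex.ofReal_mul]; ring
  rw [q, norm_mul, Complex.norm_real, Real.norm_of_nonneg (by positivity)]
  calc _ ≤ D1 * D2 * _ := mul_le_mul_of_nonneg_left key (by positivity)
    _ = _ := by ring

noncomputable def trunc1 (V : ℕ) (f : ArithmeticFunction ℝ) : ArithmeticFunction ℝ := ⟨fun n => if n ≤ V then f n else 0, by simp⟩

lemma trunc1_apply (V : ℕ) (f : ArithmeticFunction ℝ) (n : ℕ) : trunc1 V f n = if n ≤ V then f n else 0 := rfl

noncomputable abbrev muR : ArithmeticFunction ℝ := ((ArithmeticFunction.moebius : ArithmeticFunction ℤ) : ArithmeticFunction ℝ)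
noncomputable abbrev zetaR : ArithmeticFunction ℝ := ((ArithmeticFunction.zeta : ArithmeticFunction ℕ) : ArithmeticFunction ℝ)
noncomputable abbrev LamR : ArithmeticFunction ℝ := ArithmeticFunction.vonMangoldt

lemma zetaR_apply (n : ℕ) (hn : n ≠ 0) : zetaR n = 1 := by
  simp [zetaR, ArithmeticFunction.natCoe_apply, ArithmeticFunction.zeta_apply, hn]

lemma muR_abs (n : ℕ) : |muR n| ≤ 1 := by
  have := ArithmeticFunction.abs_moebius_le_one (n := n)
  simp only [muR, ArithmeticFunction.intCoe_apply]
  exact_mod_cast this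

lemma vaughan (V : ℕ) : LamR = trunc1 V LamR + trunc1 V muR * ArithmeticFunction.log - (trunc1 V muR * trunc1 V LamR) * zetaR
    + ((muR - trunc1 V muR) * zetaR) * (LamR - trunc1 V LamR) := by
  have e1 : muR * zetaR = 1 := ArithmeticFunction.coe_moebius_mul_coe_zeta
  have e2 : zetaR * LamR = ArithmeticFunction.log := ArithmeticFunction.zeta_mul_vonMangoldt
  linear_combination (-(LamR - trunc1 V LamR)) * e1 + trunc1 V muR * e2

lemma af_sub (f g : ArithmeticFunction ℝ) (n : ℕ) : (f - g) n = f n - g n := by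
  rw [sub_eq_add_neg, ArithmeticFunction.add_apply, ArithmeticFunction.neg_apply, sub_eq_add_neg]

lemma trunc1_muR_abs (V n : ℕ) : |trunc1 V muR n| ≤ 1 := by
  rw [trunc1_apply]; split_ifs; exacts [muR_abs n, by simp]

lemma sub_trunc1 (V n : ℕ) (f : ArithmeticFunction ℝ) : (f - trunc1 V f) n = if n ≤ V then 0 else f n := by
  rw [af_sub, trunc1_apply]; split_ifs <;> simp

lemma beta_abs (V n : ℕ) : |(trunc1 V muR * trunc1 V LamR) n| ≤ Real.log n := by
  rw [← ArithmeticFunction.vonMangoldt_sum, ArithmeticFunction.mul_apply]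
  refine (Finset.abs_sum_le_sum_abs _ _).trans ?_
  rw [← Nat.sum_divisorsAntidiagonal' (f := fun _ b => LamR b)]
  refine Finset.sum_le_sum fun p _ => ?_
  rw [abs_mul]
  have h1 : |trunc1 V LamR p.2| ≤ LamR p.2 := by
    have h0 : 0 ≤ LamR p.2 := ArithmeticFunction.vonMangoldt_nonneg
    rw [trunc1_apply]; split_ifs
    · rw [abs_of_nonneg h0]
    · rw [abs_zero]; exact h0
  calc _ ≤ 1 * LamR p.2 := mul_le_mul (trunc1_muR_abs V _) h1 (abs_nonneg _) zero_le_one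
    _ = _ := one_mul _

lemma beta_supp (V n : ℕ) (h : (trunc1 V muR * trunc1 V LamR) n ≠ 0) : n ≤ V * V := by
  rw [ArithmeticFunction.mul_apply] at h
  obtain ⟨p, hp, h1⟩ := Finset.exists_ne_zero_of_sum_ne_zero h
  rw [← (Nat.mem_divisorsAntidiagonal.mp hp).1]
  have h2 := left_ne_zero_of_mul h1
  have h3 := right_ne_zero_of_mul h1
  rw [trunc1_apply] at h2 h3
  exact Nat.mul_le_mul (by by_contra h4; exact h2 (if_neg h4)) (by by_contra h4; exact h3 (if_neg h4))

lemma gamma_abs (V n : ℕ) : |((muR - trunc1 V muR) * zetaR) n| ≤ n.divisors.card := by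
  rw [ArithmeticFunction.mul_apply]
  refine (Finset.abs_sum_le_sum_abs _ _).trans ?_
  have : (n.divisors.card : ℝ) = ∑ p ∈ n.divisorsAntidiagonal, (1:ℝ) := by
    rw [Nat.sum_divisorsAntidiagonal' (f := fun _ _ => (1:ℝ))]; simp
  rw [this]
  refine Finset.sum_le_sum fun p hp => ?_
  have h2 : p.2 ≠ 0 := by
    have := Nat.mem_divisorsAntidiagonal.mp hp
    intro h0; rw [h0] at this; omega
  rw [zetaR_apply _ h2, mul_one, sub_trunc1]
  split_ifs
  · simp
  · exact muR_abs _

lemma gamma_supp (V n : ℕ) (h : ((muR - trunc1 V muR) * zetaR) n ≠ 0) : V < n := by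
  rw [ArithmeticFunction.mul_apply] at h
  obtain ⟨p, hp, h1⟩ := Finset.exists_ne_zero_of_sum_ne_zero h
  have h2 := left_ne_zero_of_mul h1
  have h3 := Nat.mem_divisorsAntidiagonal.mp hp
  rw [sub_trunc1] at h2
  have h4 : V < p.1 := by by_contra h4; exact h2 (if_pos (by omega))
  have h5 : p.1 ≤ n := Nat.le_of_dvd (by omega) ⟨p.2, h3.1.symm⟩
  omega

lemma lam_log (c : ℝ) (hc : 2 < c) (hc3 : c < 3) (ε : ℝ) (hε : 0 < ε) : ∃ C > (1:ℝ), ∀ (L x : ℝ), C ≤ L →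
    L ^ 35 ≤ |x| * (L ^ 36) ^ c → |x| * (L ^ 36) ^ c ≤ L ^ 74 →
    ‖∑ n ∈ Finset.Ioc 0 ⌊L ^ 36⌋₊, (LamR n : ℂ) * Gw (L ^ 36) c x n‖ ≤
      C * ((1 + Real.log (8 * L ^ 36)) ^ 4 * (((L ^ 36) ^ ε) ^ 2 * L ^ 35)) := by
  obtain ⟨C1, hC1, hI⟩ := tI_all c hc hc3
  obtain ⟨C2, hC2, hII⟩ := tII c hc hc3 ε hε
  obtain ⟨Cd, hCd, hd⟩ := divisor_bound ε hε
  have hCd2 : 0 < C2 * Cd := by positivity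
  refine ⟨2 + 2 * C1 + C2 + C2 * Cd, by linarith, ?_⟩
  intro L x hL hF1 hF2
  have hL2 : 2 ≤ L := by linarith only [hL, hC1, hC2, hCd2]
  have hLC : C2 ≤ L := by linarith only [hL, hC1, hC2, hCd2]
  have hX1 : 1 ≤ L ^ 36 := one_le_pow₀ (by linarith only [hL2])
  have hlog := Real.log_nonneg (by linarith only [hX1] : 1 ≤ 8 * L ^ 36)
  have hlogn : ∀ n ∈ Finset.Ioc 0 ⌊L ^ 36⌋₊, Real.log n ≤ 1 + Real.log (8 * L ^ 36) := by
    intro n hn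
    have hn := Finset.mem_Ioc.mp hn
    have h1 : (n:ℝ) ≤ L ^ 36 := (Nat.le_floor_iff (by positivity)).mp hn.2
    have := Real.log_le_log (by exact_mod_cast hn.1) (by linarith only [h1, hX1] : (n:ℝ) ≤ 8 * L ^ 36)
    linarith only [this]
  set V := ⌊L ^ 2⌋₊ with hV
  have hVL : ∀ n : ℕ, n ≤ V ↔ (n:ℝ) ≤ L ^ 2 := fun n => Nat.le_floor_iff (by positivity)
  have hVL' : ∀ n : ℕ, V < n ↔ L ^ 2 < (n:ℝ) := fun n => Nat.floor_lt (by positivity)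
  have hVr : (V:ℝ) ≤ L ^ 2 := (hVL V).mp le_rfl
  have hG : ∀ n, ⌊L ^ 36⌋₊ < n → Gw (L ^ 36) c x n = 0 := Gw_big _ _ _ (by positivity)
  set ℓ := 1 + Real.log (8 * L ^ 36) with hℓ
  have hℓ1 : 1 ≤ ℓ := by linarith only [hlog, hℓ]
  have t1 := (hI L x ℓ (fun n => trunc1 V muR n) hL2 hF1 hF2 (by linarith only [hℓ1]) (fun k _ => (trunc1_muR_abs V k).trans hℓ1) (by
    intro k hk
    have : k ≤ V := by by_contra h4; exact hk (if_neg h4)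
    refine ((hVL k).mp this).trans (pow_le_pow_right₀ (by linarith only [hL2]) (by norm_num)))).2
  have t2 := (hI L x ℓ (fun n => (trunc1 V muR * trunc1 V LamR) n) hL2 hF1 hF2 (by linarith only [hℓ1]) (fun k hk => (beta_abs V k).trans (hlogn k hk)) (by
    intro k hk
    have h1 : (k:ℝ) ≤ V * V := by exact_mod_cast beta_supp V k hk
    calc (k:ℝ) ≤ V * V := h1
      _ ≤ L ^ 2 * L ^ 2 := mul_le_mul hVr hVr (by positivity) (by positivity)
      _ = L ^ 4 := by ring)).1
  have t3 := hII L x (Cd * (L ^ 36) ^ ε) ℓ (fun n => ((muR - trunc1 V muR) * zetaR) n) (fun n => (LamR - trunc1 V LamR) n) hLC hF1 hF2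
    (by positivity) (by linarith only [hℓ1])
    (by
      intro n hn
      have hn' := Finset.mem_Ioc.mp hn
      refine (gamma_abs V n).trans ((hd n hn'.1).trans (mul_le_mul_of_nonneg_left ?_ hCd.le))
      exact Real.rpow_le_rpow (by positivity) ((Nat.le_floor_iff (by positivity)).mp hn'.2) hε.le)
    (by
      intro n hn
      refine le_trans ?_ (hlogn n hn)
      rw [sub_trunc1]
      split_ifs
      · rw [abs_zero]; exact Real.log_natCast_nonneg n
      · rw [abs_of_nonneg ArithmeticFunction.vonMangoldt_nonneg]; exact ArithmeticFunction.vonMangoldt_le_log)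
    (fun n hn => (hVL' n).mp (gamma_supp V n hn))
    (fun n hn => (hVL' n).mp (by
      rw [sub_trunc1] at hn
      by_contra h4; exact hn (if_pos (by omega))))
  rw [← hℓ] at t1 t2 t3
  have hsplit : ∑ n ∈ Finset.Ioc 0 ⌊L ^ 36⌋₊, (LamR n : ℂ) * Gw (L ^ 36) c x n =
      ∑ n ∈ Finset.Ioc 0 ⌊L ^ 36⌋₊, ((trunc1 V muR * ArithmeticFunction.log) n : ℂ) * Gw (L ^ 36) c x n
      - ∑ n ∈ Finset.Ioc 0 ⌊L ^ 36⌋₊, (((trunc1 V muR * trunc1 V LamR) * zetaR) n : ℂ) * Gw (L ^ 36) c x n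
      + ∑ n ∈ Finset.Ioc 0 ⌊L ^ 36⌋₊, ((((muR - trunc1 V muR) * zetaR) * (LamR - trunc1 V LamR)) n : ℂ) * Gw (L ^ 36) c x n := by
    rw [← Finset.sum_sub_distrib, ← Finset.sum_add_distrib]
    refine Finset.sum_congr rfl fun n _ => ?_
    have h0 : (trunc1 V LamR n : ℂ) * Gw (L ^ 36) c x n = 0 := by
      rw [trunc1_apply]
      split_ifs with h1
      · have h2 : Gw (L ^ 36) c x n = 0 := by
          refine if_neg fun h3 => ?_
          have h4 := (hVL n).mp h1
          have h5 : L ^ 36 = L ^ 2 * L ^ 34 := by ring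
          have h6 : (2:ℝ) ≤ L ^ 34 := by
            calc (2:ℝ) ≤ 2 ^ 34 := by norm_num
              _ ≤ L ^ 34 := pow_le_pow_left₀ (by norm_num) hL2 34
          have h7 : 0 < L ^ 2 := by positivity
          have h8 := h3.1
          rw [h5] at h8
          nlinarith only [h8, h4, h6, h7]
        rw [h2, mul_zero]
      · rw [Complex.ofReal_zero, zero_mul]
    have h1 := congrArg (fun f : ArithmeticFunction ℝ => ((f n : ℝ) : ℂ)) (vaughan V)
    simp only [ArithmeticFunction.add_apply, af_sub (trunc1 V LamR + trunc1 V muR * ArithmeticFunction.log)] at h1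
    rw [h1]
    push_cast
    linear_combination h0
  rw [hsplit, conv_sum _ _ _ _ hG, conv_sum _ _ _ _ hG, conv_sum _ _ _ _ hG]
  have hz : ∑ m ∈ Finset.Ioc 0 ⌊L ^ 36⌋₊, ∑ n ∈ Finset.Ioc 0 ⌊L ^ 36⌋₊, ((trunc1 V muR * trunc1 V LamR) m : ℂ) * (zetaR n : ℂ) * Gw (L ^ 36) c x (m * n) =
      ∑ m ∈ Finset.Ioc 0 ⌊L ^ 36⌋₊, ∑ n ∈ Finset.Ioc 0 ⌊L ^ 36⌋₊, ((trunc1 V muR * trunc1 V LamR) m : ℂ) * 1 * Gw (L ^ 36) c x (m * n) := by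
    refine Finset.sum_congr rfl fun m hm => Finset.sum_congr rfl fun n hn => ?_
    rw [zetaR_apply n (Finset.mem_Ioc.mp hn).1.ne', Complex.ofReal_one]
  rw [hz]
  refine (norm_add_le _ _).trans ((add_le_add ((norm_sub_le _ _).trans (add_le_add t1 t2)) t3).trans ?_)
  have hE : 1 ≤ (L ^ 36) ^ ε := Real.one_le_rpow hX1 hε.le
  generalize (L ^ 36) ^ ε = E at *
  have hp : 0 < L ^ 35 := by positivity
  generalize L ^ 35 = P at *
  clear_value ℓ
  have g1 : ℓ * ℓ ^ 2 * P ≤ ℓ ^ 4 * (E ^ 2 * P) := by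
    calc ℓ * ℓ ^ 2 * P = ℓ ^ 3 * (1 * P) := by ring
      _ ≤ ℓ ^ 4 * (E ^ 2 * P) := by
        refine mul_le_mul (pow_le_pow_right₀ hℓ1 (by norm_num)) (mul_le_mul_of_nonneg_right (one_le_pow₀ hE) hp.le) (by positivity) (by positivity)
  have g2 : 0 ≤ ℓ ^ 4 * (E ^ 2 * P) := by positivity
  calc C1 * (ℓ * ℓ ^ 2 * P) + C1 * (ℓ * ℓ ^ 2 * P) + C2 * (Cd * E * ℓ * (ℓ ^ 3 * (E * P)))
      ≤ C1 * (ℓ ^ 4 * (E ^ 2 * P)) + C1 * (ℓ ^ 4 * (E ^ 2 * P)) + C2 * Cd * (ℓ ^ 4 * (E ^ 2 * P)) := by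
        have := mul_le_mul_of_nonneg_left g1 hC1.le
        linarith only [this]
    _ = (2 * C1 + C2 * Cd) * (ℓ ^ 4 * (E ^ 2 * P)) := by ring
    _ ≤ _ := mul_le_mul_of_nonneg_right (by linarith only [hC2]) g2

lemma Gw_norm (X c x : ℝ) (n : ℕ) : ‖Gw X c x n‖ ≤ 1 := by
  unfold Gw; split_ifs
  · rw [e_norm]
  · simp

lemma S_lam (X c x : ℝ) (hX : 1 ≤ X) : ‖S X c x‖ ≤ ‖∑ n ∈ Finset.Ioc 0 ⌊X⌋₊, (LamR n : ℂ) * Gw X c x n‖ + 2 * √X * Real.log X := by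
  have h1 : S X c x = ∑ n ∈ (Finset.Ioc 0 ⌊X⌋₊).filter (fun n => n.Prime), (LamR n : ℂ) * Gw X c x n := by
    unfold S
    rw [Finset.sum_filter, Finset.sum_filter]
    have h2 : Finset.Ioc 0 ⌊X⌋₊ ⊆ Finset.range (⌈X⌉₊ + 1) := by
      intro n hn
      rw [Finset.mem_Ioc] at hn; rw [Finset.mem_range]
      have := Nat.floor_le_ceil X
      omega
    rw [← Finset.sum_subset h2]
    · refine Finset.sum_congr rfl fun n _ => ?_
      by_cases hp : n.Prime
      · rw [if_pos hp, Gw, mul_ite, mul_zero]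
        refine if_congr (by simp [hp]) ?_ rfl
        rw [show LamR n = Real.log n from ArithmeticFunction.vonMangoldt_apply_prime hp, mul_comm x]
      · rw [if_neg hp, if_neg fun h => hp h.1]
    · intro n _ hn
      refine if_neg fun h => hn ?_
      rw [Finset.mem_Ioc, Nat.le_floor_iff (by linarith)]
      exact ⟨h.1.pos, h.2.2⟩
  have h3 := Finset.sum_filter_add_sum_filter_not (Finset.Ioc 0 ⌊X⌋₊) (fun n => n.Prime) (fun n => (LamR n : ℂ) * Gw X c x n)
  have h4 : ‖∑ n ∈ (Finset.Ioc 0 ⌊X⌋₊).filter (fun n => ¬ n.Prime), (LamR n : ℂ) * Gw X c x n‖ ≤ 2 * √X * Real.log X := by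
    refine le_trans ?_ (Chebyshev.psi_sub_theta_le hX)
    rw [Chebyshev.psi_sub_theta_eq_sum_not_prime]
    refine (norm_sum_le _ _).trans (Finset.sum_le_sum fun n _ => ?_)
    have h0 : 0 ≤ LamR n := ArithmeticFunction.vonMangoldt_nonneg
    rw [norm_mul, Complex.norm_real, Real.norm_of_nonneg h0]
    exact mul_le_of_le_one_right h0 (Gw_norm X c x n)
  rw [h1, eq_sub_of_add_eq h3]
  exact (norm_sub_le _ _).trans (add_le_add le_rfl h4)

theorem stmt18 (c : ℝ) (hc1 : 2 < c) (hc2 : c < 37 / 18) :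
    ∃ η₀ > 0, ∀ η : ℝ, 0 < η → η < η₀ → ∀ δ : ℝ, δ = c / 2 - 1 + η →
    ∃ C > 0, ∃ X₀ : ℝ, ∀ X ≥ X₀, ∀ τ K : ℝ,
      τ = X ^ (1 - c - η) → K = (Real.log X) ^ 5 →
      ∀ x : ℝ, τ ≤ |x| → |x| ≤ K → ‖S X c x‖ ≤ C * X ^ (1 - δ) := by
  obtain ⟨ρ, hρ⟩ : ∃ ρ, ρ = 37 / 18 - c := ⟨_, rfl⟩
  have hρ0 : 0 < ρ := by linarith
  refine ⟨ρ / 4, by positivity, ?_⟩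
  intro η hη hη2 δ hδ
  obtain ⟨C, hC, h⟩ := lam_log c hc1 (by linarith) (ρ / 24) (by positivity)
  obtain ⟨Cl, hCl, hl⟩ := log_bound (ρ / 24) (by positivity)
  have ev1 : ∀ᶠ X : ℝ in Filter.atTop, C ≤ X ^ (1 / 36 : ℝ) :=
    (tendsto_rpow_atTop (by norm_num : (0:ℝ) < 1 / 36)).eventually_ge_atTop C
  have ev2 : ∀ᶠ X : ℝ in Filter.atTop, ‖Real.log X ^ (5:ℝ)‖ ≤ 1 * ‖X ^ ρ‖ :=
    (isLittleO_log_rpow_rpow_atTop 5 hρ0).bound one_pos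
  obtain ⟨X₀, hX₀⟩ := Filter.eventually_atTop.mp (ev1.and (ev2.and (Filter.eventually_ge_atTop (1:ℝ))))
  refine ⟨C * Cl ^ 4 + 2 * Cl, by positivity, X₀, ?_⟩
  rintro X hX τ K rfl rfl x hx1 hx2
  obtain ⟨hL, hlg, hX1⟩ := hX₀ X hX
  have hX0 : 0 < X := by linarith only [hX1]
  have hlog0 := Real.log_nonneg hX1
  have hlog5 : Real.log X ^ 5 ≤ X ^ ρ := by
    rw [one_mul, Real.norm_of_nonneg (by positivity), Real.norm_of_nonneg (by positivity)] at hlg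
    have : Real.log X ^ (5:ℝ) = Real.log X ^ 5 := by exact_mod_cast Real.rpow_natCast (Real.log X) 5
    rwa [this] at hlg
  have hpow : ∀ k : ℕ, (X ^ (1 / 36 : ℝ)) ^ k = X ^ ((k:ℝ) / 36) := by
    intro k
    rw [← Real.rpow_natCast, ← Real.rpow_mul hX0.le]; congr 1; ring
  have h36 : (X ^ (1 / 36 : ℝ)) ^ 36 = X := by rw [hpow]; norm_num
  have key := h (X ^ (1 / 36 : ℝ)) x hL
  rw [h36, hpow 35, hpow 74] at key
  have hXc : 0 < X ^ c := Real.rpow_pos_of_pos hX0 c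
  have key := key
    (by
      calc X ^ (((35:ℕ):ℝ) / 36) ≤ X ^ (1 - c - η + c) := Real.rpow_le_rpow_of_exponent_le hX1 (by push_cast; linarith)
        _ = X ^ (1 - c - η) * X ^ c := Real.rpow_add hX0 _ _
        _ ≤ _ := mul_le_mul_of_nonneg_right hx1 hXc.le)
    (by
      calc |x| * X ^ c ≤ X ^ ρ * X ^ c := mul_le_mul_of_nonneg_right (hx2.trans hlog5) hXc.le
        _ = X ^ (ρ + c) := (Real.rpow_add hX0 _ _).symm
        _ ≤ _ := Real.rpow_le_rpow_of_exponent_le hX1 (by push_cast; linarith))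
  have hl1 := hl X hX1
  have hl0 : 0 ≤ 1 + Real.log (8 * X) := by
    have := Real.log_nonneg (by linarith only [hX1] : 1 ≤ 8 * X); linarith only [this]
  have hl2 : Real.log X ≤ Cl * X ^ (ρ / 24) := by
    have := Real.log_le_log hX0 (by linarith only [hX1] : X ≤ 8 * X)
    linarith only [this, hl1]
  refine (S_lam X c x hX1).trans ?_
  rw [add_mul]
  refine add_le_add (key.trans ?_) ?_
  · calc C * ((1 + Real.log (8 * X)) ^ 4 * ((X ^ (ρ / 24)) ^ 2 * X ^ (((35:ℕ):ℝ) / 36)))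
        ≤ C * ((Cl * X ^ (ρ / 24)) ^ 4 * ((X ^ (ρ / 24)) ^ 2 * X ^ (((35:ℕ):ℝ) / 36))) := by
          refine mul_le_mul_of_nonneg_left (mul_le_mul_of_nonneg_right (pow_le_pow_left₀ hl0 hl1 4) (by positivity)) (by positivity)
      _ = C * Cl ^ 4 * ((X ^ (ρ / 24)) ^ 6 * X ^ (((35:ℕ):ℝ) / 36)) := by ring
      _ = C * Cl ^ 4 * X ^ (ρ / 24 * 6 + ((35:ℕ):ℝ) / 36) := by
          rw [Real.rpow_add hX0, Real.rpow_mul hX0.le]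
          congr 2; exact_mod_cast (Real.rpow_natCast (X ^ (ρ / 24)) 6).symm
      _ ≤ _ := by
          refine mul_le_mul_of_nonneg_left (Real.rpow_le_rpow_of_exponent_le hX1 ?_) (by positivity)
          push_cast; linarith
  · calc 2 * √X * Real.log X ≤ 2 * √X * (Cl * X ^ (ρ / 24)) := mul_le_mul_of_nonneg_left hl2 (by positivity)
      _ = 2 * Cl * (X ^ (1 / 2 : ℝ) * X ^ (ρ / 24)) := by rw [Real.sqrt_eq_rpow]; ring
      _ = 2 * Cl * X ^ (1 / 2 + ρ / 24) := by rw [Real.rpow_add hX0]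
      _ ≤ _ := by
          refine mul_le_mul_of_nonneg_left (Real.rpow_le_rpow_of_exponent_le hX1 ?_) (by positivity)
          linarith
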